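/- Let K, L ⊊ H² be proper closed convex sets with nonempty interior such that for all orientation-preserving congruences φ, ψ of H² with int((φK) ∩ (ψL)) ≠ ∅, the set (φK) ∩ (ψL) admits some non-trivial congruence. If both bd K and bd L are connected, then case (A) holds: each of K and L is a circle, a paracircle, a convex domain bounded by a hypercycle, or a half-plane; and if one of K, L is a convex set bounded by a hypercycle or a half-plane, then the other is either a circle or a congruent copy of the first. -/

import Mathlib

open Metric Set Filter

namespace BallChar

/-- `X` is (isometric to) the `d`-dimensional round sphere of radius 1,
with the intrinsic (great-circle) metric. -/
def IsSphereSpace (X : Type*) [MetricSpace X] (d : ℕ) : Prop :=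
  ∃ e : X → EuclideanSpace ℝ (Fin (d + 1)),
    Function.Injective e ∧
    Set.range e = Metric.sphere (0 : EuclideanSpace ℝ (Fin (d + 1))) 1 ∧
    ∀ x y : X, dist x y = Real.arccos (@inner ℝ _ _ (e x) (e y))

/-- `X` is (isometric to) the `d`-dimensional Euclidean space. -/
def IsEuclideanSpaceForm (X : Type*) [MetricSpace X] (d : ℕ) : Prop :=
  Nonempty (X ≃ᵢ EuclideanSpace ℝ (Fin d))

/-- The Minkowski bilinear form on `ℝ^d × ℝ`. -/
noncomputable def mink (d : ℕ) (u v : EuclideanSpace ℝ (Fin d) × ℝ) : ℝ :=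
  @inner ℝ _ _ u.1 v.1 - u.2 * v.2

/-- `X` is (isometric to) the `d`-dimensional hyperbolic space of curvature `-1`
(the hyperboloid model). -/
def IsHyperbolicSpace (X : Type*) [MetricSpace X] (d : ℕ) : Prop :=
  ∃ e : X → EuclideanSpace ℝ (Fin d) × ℝ,
    Function.Injective e ∧
    Set.range e = {u | mink d u u = -1 ∧ 0 < u.2} ∧
    ∀ x y : X, Real.cosh (dist x y) = - mink d (e x) (e y)

/-- `X` is `S^d`, `ℝ^d` or `H^d`. -/
def IsSpaceForm (X : Type*) [MetricSpace X] (d : ℕ) : Prop :=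
  IsSphereSpace X d ∨ IsEuclideanSpaceForm X d ∨ IsHyperbolicSpace X d

variable {X : Type*} [MetricSpace X]

/-- Metric betweenness: `z` lies on a shortest geodesic from `x` to `y`. -/
def Btw (x z y : X) : Prop := dist x z + dist z y = dist x y

/-- `z` is the unique point between `x` and `y` at its distance from `x`. -/
def UniqueBtwPt (x z y : X) : Prop :=
  Btw x z y ∧ ∀ w, Btw x w y → dist x w = dist x z → w = z

/-- Geodesic convexity (for two antipodal points of a sphere no condition is imposed). -/
def GConvex (K : Set X) : Prop :=
  ∀ x ∈ K, ∀ y ∈ K, ∀ z, UniqueBtwPt x z y → z ∈ K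

/-- `p` is a (metric) midpoint of `x` and `y`. -/
def IsMidpoint (p x y : X) : Prop := Btw x p y ∧ dist x p = dist p y

/-- A reflection in a hyperplane: a non-trivial involutive isometry whose
non-fixed locus is disconnected (by the mirror hyperplane). -/
def IsReflection (σ : X ≃ᵢ X) : Prop :=
  σ.trans σ = IsometryEquiv.refl X ∧ σ ≠ IsometryEquiv.refl X ∧
    ¬ IsPreconnected {x : X | σ x ≠ x}

/-- An orientation preserving congruence: a product of an even number of reflections. -/
def OrientationPreserving (f : X ≃ᵢ X) : Prop :=
  ∃ l : List (X ≃ᵢ X), (∀ σ ∈ l, IsReflection σ) ∧ Even l.length ∧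
    f = l.foldr IsometryEquiv.trans (IsometryEquiv.refl X)

/-- Two subsets are congruent if some isometry of the space maps one onto the other. -/
def Congruent (A B : Set X) : Prop := ∃ f : X ≃ᵢ X, ⇑f '' A = B

/-- `S` admits some non-trivial congruence. -/
def AdmitsNontrivialCongruence (S : Set X) : Prop :=
  ∃ f : X ≃ᵢ X, f ≠ IsometryEquiv.refl X ∧ ⇑f '' S = S

/-- `S` is axially symmetric (symmetric with respect to some reflection). -/
def AxiallySymmetric (S : Set X) : Prop :=
  ∃ σ : X ≃ᵢ X, IsReflection σ ∧ ⇑σ '' S = S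

/-- `S` is centrally symmetric: some involutive isometry fixing a point `p`
maps `S` onto itself, `p` being a midpoint of every pair `x`, `σ x` of `S`. -/
def CentrallySymmetric (S : Set X) : Prop :=
  ∃ (σ : X ≃ᵢ X) (p : X), Function.Involutive ⇑σ ∧ σ p = p ∧ ⇑σ '' S = S ∧
    ∀ x ∈ S, IsMidpoint p x (σ x)

/-- `S` is symmetric with respect to the orthogonal bisector hyperplane of
the segment `[a, b]`, i.e. invariant under the reflection interchanging `a` and `b`. -/
def SymmetricWrtPerpBisector (S : Set X) (a b : X) : Prop :=
  ∃ σ : X ≃ᵢ X, IsReflection σ ∧ σ a = b ∧ ⇑σ '' S = S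

/-- A closed half-space: one of the two closed sides of the mirror of a reflection. -/
def IsHalfspace (P : Set X) : Prop :=
  ∃ σ : X ≃ᵢ X, IsReflection σ ∧ IsClosed P ∧
    P ∪ ⇑σ '' P = univ ∧ P ∩ ⇑σ '' P = {x | σ x = x}

/-- A hyperplane: the mirror (fixed point set) of a reflection. -/
def IsHyperplane (B : Set X) : Prop :=
  ∃ σ : X ≃ᵢ X, IsReflection σ ∧ B = {x | σ x = x}

/-- A paraball (horoball): a sublevel set of a Busemann function. -/
def IsParaball (K : Set X) : Prop :=
  ∃ γ : ℝ → X, Isometry γ ∧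
    K = {x | ∃ b ≤ 0, Tendsto (fun t => dist x (γ t) - t) atTop (nhds b)}

/-- A parasphere (horosphere): the boundary of a paraball. -/
def IsParasphere (C : Set X) : Prop := ∃ K : Set X, IsParaball K ∧ C = frontier K

/-- A hypersphere at distance `lam > 0` from its base hyperplane
(degeneration to a hyperplane excluded). -/
def IsHypersphere (C : Set X) (lam : ℝ) : Prop :=
  0 < lam ∧ (∃ P : Set X, IsHalfspace P ∧ C = frontier {x | infDist x P ≤ lam}) ∧
    ¬ IsHyperplane C

/-- The family of connected components of the boundary of `K`. -/
def bdryComponents (K : Set X) : Set (Set X) :=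
  (connectedComponentIn (frontier K)) '' (frontier K)

/-- `closedBall p r` is an inball of `M` (a ball of maximal radius contained in `M`). -/
def IsInball (M : Set X) (p : X) (r : ℝ) : Prop :=
  0 ≤ r ∧ closedBall p r ⊆ M ∧ ∀ (q : X) (s : ℝ), closedBall q s ⊆ M → s ≤ r

/-- `closedBall p r` is the unique inball of `M`. -/
def HasUniqueInball (M : Set X) (p : X) (r : ℝ) : Prop :=
  IsInball M p r ∧ ∀ (q : X) (s : ℝ), IsInball M q s → q = p

/-- The (geodesic) convex hull of a set. -/
def gconvexHull (Y : Set X) : Set X := ⋂₀ {C : Set X | GConvex C ∧ Y ⊆ C}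

/-- `z` lies on the complete geodesic line through `a` and `b`. -/
def OnLine (a b z : X) : Prop := Btw a z b ∨ Btw z a b ∨ Btw a b z

/-- The closed `(d-1)`-ball of radius `ε` centred at `a` in the hyperplane through `a`
orthogonal to the segment `[a, b]`. -/
def perpDisc (a b : X) (ε : ℝ) : Set X :=
  {x | (∀ z, OnLine a b z → dist x a ≤ dist x z) ∧ dist x a ≤ ε}

/-- The set `D(ε)` associated to the segment `D = [a, b]`: the convex hull of the two
`(d-1)`-balls of radius `ε` orthogonal to `D` at its endpoints. -/
def segCyl (a b : X) (ε : ℝ) : Set X :=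
  gconvexHull (perpDisc a b ε ∪ perpDisc b a ε)

/-- `[a, b]` is the unique diametral segment of `M`. -/
def UniqueDiametral (M : Set X) (a b : X) : Prop :=
  a ∈ M ∧ b ∈ M ∧ a ≠ b ∧ dist a b = diam M ∧
    ∀ a' ∈ M, ∀ b' ∈ M, dist a' b' = diam M → (a' = a ∧ b' = b) ∨ (a' = b ∧ b' = a)

/-- Condition (**): at every boundary point, `K` contains a ball having this point
on its boundary. -/
def CondBallInside (K : Set X) : Prop :=
  ∀ x ∈ frontier K, ∃ ε > 0, ∃ p : X, closedBall p ε ⊆ K ∧ x ∈ sphere p ε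

/-- `K` has an extreme point. -/
def HasExtremePoint (K : Set X) : Prop :=
  ∃ x ∈ K, ∀ y ∈ K, ∀ z ∈ K, Btw y x z → x = y ∨ x = z

/-- Condition (***): near every boundary point, `K` is contained in a ball
(resp. in a convex set bounded by a hypersphere, for hyperbolic space) whose boundary
has sectional curvatures bounded below and passes through the given point. -/
def CondCurvBound (d : ℕ) (K : Set X) : Prop :=
  ∀ x ∈ frontier K, ∃ ε > 0, ∃ B : Set X,
    {y | y ∈ K ∧ dist y x ≤ ε} ⊆ B ∧ x ∈ frontier B ∧
    (IsSphereSpace X d → ∃ (q : X) (R : ℝ), 0 < R ∧ R < Real.pi / 2 ∧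
        ε ≤ Real.cos R / Real.sin R ∧ B = closedBall q R) ∧
    (IsEuclideanSpaceForm X d → ∃ (q : X) (R : ℝ), 0 < R ∧ ε ≤ 1 / R ∧ B = closedBall q R) ∧
    (IsHyperbolicSpace X d → ∃ (P : Set X) (lam : ℝ), IsHalfspace P ∧ 0 < lam ∧
        ε ≤ Real.tanh lam ∧ B = {y | infDist y P ≤ lam})

/-- `K` has a supporting sphere at each of its boundary points
(for the sphere, of radius less than `π/2`). -/
def SupportingSpheres (d : ℕ) (K : Set X) : Prop :=
  ∀ x ∈ frontier K, ∃ (p : X) (R : ℝ), 0 < R ∧ K ⊆ closedBall p R ∧ x ∈ sphere p R ∧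
    (IsSphereSpace X d → R < Real.pi / 2)

/-- `K` is `C¹` (smooth): at each boundary point there is a unique supporting half-space. -/
def SmoothBody (K : Set X) : Prop :=
  ∀ x ∈ frontier K, ∃! P : Set X, IsHalfspace P ∧ K ⊆ P ∧ x ∈ frontier P

/-- A complete geodesic (straight line). -/
def IsGeodesicLine (B : Set X) : Prop := ∃ γ : ℝ → X, Isometry γ ∧ B = Set.range γ

/-- A circle (closed disc) of positive radius. -/
def IsDisc (K : Set X) : Prop := ∃ (p : X) (r : ℝ), 0 < r ∧ K = closedBall p r

/-- The parallel domain of `B` at distance `l`. -/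
def parallelDomain (B : Set X) (l : ℝ) : Set X := {x | infDist x B ≤ l}

/-- `K` is the parallel domain of some straight line, at some distance `l > 0`. -/
def IsParallelDomain (K : Set X) : Prop :=
  ∃ (B : Set X) (l : ℝ), IsGeodesicLine B ∧ 0 < l ∧ K = parallelDomain B l

/-- A convex domain bounded by a (proper) hypercycle. -/
def IsHypercycleDomain (K : Set X) : Prop :=
  ∃ (P : Set X) (l : ℝ), IsHalfspace P ∧ 0 < l ∧ K = {x | infDist x P ≤ l}

/-- `C` is a hypercycle or a straight line (a curve at constant distance `l ≥ 0`
from its base line). -/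
def IsHypercycleOrLine (C : Set X) : Prop :=
  ∃ (P : Set X) (l : ℝ), IsHalfspace P ∧ 0 ≤ l ∧ C = frontier {x | infDist x P ≤ l}

/-- `C` is a hypercycle (or straight line) with base line `B`. -/
def HypercycleWithBase (C B : Set X) : Prop :=
  ∃ (P : Set X) (l : ℝ), IsHalfspace P ∧ 0 ≤ l ∧ frontier P = B ∧
    C = frontier {x | infDist x P ≤ l}


/-! Cases (A)-(E) of Theorem 5 (hyperbolic plane). -/

/-- One of the basic bodies of case (A). -/
def CaseABody (K : Set X) : Prop :=
  IsDisc K ∨ IsParaball K ∨ IsHypercycleDomain K ∨ IsHalfspace K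

/-- Case (A) of Theorem 5. -/
def CaseA (K L : Set X) : Prop :=
  CaseABody K ∧ CaseABody L ∧
    ((IsHypercycleDomain K ∨ IsHalfspace K) → IsDisc L ∨ Congruent K L) ∧
    ((IsHypercycleDomain L ∨ IsHalfspace L) → IsDisc K ∨ Congruent L K)

/-- `M` is bounded either by two hypercycles whose base lines coincide, or by a
hypercycle and its base line. -/
def TwoHypSameBase (M : Set X) : Prop :=
  ∃ (B C₁ C₂ : Set X), IsGeodesicLine B ∧ C₁ ≠ C₂ ∧
    HypercycleWithBase C₁ B ∧ HypercycleWithBase C₂ B ∧ frontier M = C₁ ∪ C₂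

/-- Case (B) of Theorem 5. -/
def CaseB (K L : Set X) : Prop :=
  (IsDisc K ∧ TwoHypSameBase L) ∨ (IsDisc L ∧ TwoHypSameBase K)

/-- `M` is bounded by at least two hypercycles or straight lines, with all base lines
different, whose mutual distances are at least `2r`. -/
def MultiHypFarApart (M : Set X) (r : ℝ) : Prop :=
  (∀ x ∈ frontier M, IsHypercycleOrLine (connectedComponentIn (frontier M) x)) ∧
  (∃ x ∈ frontier M, ∃ y ∈ frontier M,
      connectedComponentIn (frontier M) x ≠ connectedComponentIn (frontier M) y) ∧
  (∀ x ∈ frontier M, ∀ y ∈ frontier M,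
      connectedComponentIn (frontier M) x ≠ connectedComponentIn (frontier M) y →
        2 * r ≤ dist x y ∧
        ∀ B₁ B₂ : Set X, HypercycleWithBase (connectedComponentIn (frontier M) x) B₁ →
          HypercycleWithBase (connectedComponentIn (frontier M) y) B₂ → B₁ ≠ B₂)

/-- Case (C) of Theorem 5. -/
def CaseC (K L : Set X) : Prop :=
  (∃ (p : X) (r : ℝ), 0 < r ∧ K = closedBall p r ∧ MultiHypFarApart L r) ∨
  (∃ (p : X) (r : ℝ), 0 < r ∧ L = closedBall p r ∧ MultiHypFarApart K r)

/-- Case (D) of Theorem 5. -/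
def CaseD (K L : Set X) : Prop :=
  (IsParaball K ∧ IsParallelDomain L) ∨ (IsParaball L ∧ IsParallelDomain K)

/-- Case (E) of Theorem 5. -/
def CaseE (K L : Set X) : Prop :=
  Congruent K L ∧ IsParallelDomain K ∧ IsParallelDomain L

/-- All cases of (3) of Theorem 5 together. -/
def Theorem5Cases (K L : Set X) : Prop :=
  CaseA K L ∨ CaseB K L ∨ CaseC K L ∨ CaseD K L ∨ CaseE K L

/-- Condition (1) of Theorem 5: every intersection of congruent copies admits some
non-trivial congruence. -/
def T5Cond1 (K L : Set X) : Prop :=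
  ∀ φ ψ : X ≃ᵢ X, OrientationPreserving φ → OrientationPreserving ψ →
    (interior ((⇑φ '' K) ∩ (⇑ψ '' L))).Nonempty →
    AdmitsNontrivialCongruence ((⇑φ '' K) ∩ (⇑ψ '' L))

/-- Condition (2) of Theorem 5: every intersection of congruent copies is axially
symmetric. -/
def T5Cond2 (K L : Set X) : Prop :=
  ∀ φ ψ : X ≃ᵢ X, OrientationPreserving φ → OrientationPreserving ψ →
    (interior ((⇑φ '' K) ∩ (⇑ψ '' L))).Nonempty →
    AxiallySymmetric ((⇑φ '' K) ∩ (⇑ψ '' L))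

/-- All connected components of the boundary of `K` are hypercycles or straight lines. -/
def BdryHypOrLine (K : Set X) : Prop :=
  ∀ x ∈ frontier K, IsHypercycleOrLine (connectedComponentIn (frontier K) x)

/-- The boundary of `K` has at least two connected components. -/
def AtLeastTwoComponents (K : Set X) : Prop :=
  ∃ x ∈ frontier K, ∃ y ∈ frontier K,
    connectedComponentIn (frontier K) x ≠ connectedComponentIn (frontier K) y

/-- The boundary of `K` is nonempty and has a single connected component. -/
def SingleComponent (K : Set X) : Prop :=
  (frontier K).Nonempty ∧ ∀ x ∈ frontier K, ∀ y ∈ frontier K,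
    connectedComponentIn (frontier K) x = connectedComponentIn (frontier K) y

/-- The associated graph of `K` contains two edges with at least one common endpoint:
`K` has two distinct boundary components which are asymptotic (come arbitrarily close). -/
def TwoAsymptoticComponents (K : Set X) : Prop :=
  ∃ x ∈ frontier K, ∃ y ∈ frontier K,
    connectedComponentIn (frontier K) x ≠ connectedComponentIn (frontier K) y ∧
    ∀ δ > (0 : ℝ), ∃ p ∈ connectedComponentIn (frontier K) x,
      ∃ q ∈ connectedComponentIn (frontier K) y, dist p q < δ

/-- The associated graph of `K` has only pairwise vertex-disjoint edges: distinct
boundary components of `K` stay at positive distance from each other. -/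
def VertexDisjointEdges (K : Set X) : Prop :=
  ∀ x ∈ frontier K, ∀ y ∈ frontier K,
    connectedComponentIn (frontier K) x ≠ connectedComponentIn (frontier K) y →
      ∃ δ > (0 : ℝ), ∀ p ∈ connectedComponentIn (frontier K) x,
        ∀ q ∈ connectedComponentIn (frontier K) y, δ ≤ dist p q

/-! Conditions of Theorem 6. -/

/-- Condition (1) of Theorem 6. -/
def T6Cond1 (K L : Set X) : Prop :=
  ∃ ε > (0 : ℝ), ∀ φ ψ : X ≃ᵢ X, OrientationPreserving φ → OrientationPreserving ψ →
    (interior ((⇑φ '' K) ∩ (⇑ψ '' L))).Nonempty →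
    diam ((⇑φ '' K) ∩ (⇑ψ '' L)) < ε →
    CentrallySymmetric ((⇑φ '' K) ∩ (⇑ψ '' L))

/-- Condition (2) of Theorem 6. -/
def T6Cond2 (K L : Set X) : Prop :=
  ∀ x ∈ frontier K, ∀ y ∈ frontier L, ∃ ε > (0 : ℝ),
    ∀ φ ψ : X ≃ᵢ X, OrientationPreserving φ → OrientationPreserving ψ →
      (interior ((⇑φ '' K) ∩ (⇑ψ '' L))).Nonempty →
      diam ((⇑φ '' K) ∩ (⇑ψ '' L)) < ε →
      ∀ (p : X) (r : ℝ), HasUniqueInball ((⇑φ '' K) ∩ (⇑ψ '' L)) p r →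
        frontier ((⇑φ '' K) ∩ (⇑ψ '' L)) ∩ sphere p r = {φ x, ψ y} →
        φ x ∈ interior (⇑ψ '' L) → ψ y ∈ interior (⇑φ '' K) →
        IsMidpoint p (φ x) (ψ y) →
        CentrallySymmetric ((⇑φ '' K) ∩ (⇑ψ '' L))

/-- Condition (3) of Theorem 6. -/
def T6Cond3 (K L : Set X) : Prop :=
  ∀ x ∈ frontier K, ∀ y ∈ frontier L, ∃ ε > (0 : ℝ),
    ∀ φ ψ : X ≃ᵢ X, OrientationPreserving φ → OrientationPreserving ψ →
      (interior ((⇑φ '' K) ∩ (⇑ψ '' L))).Nonempty →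
      diam ((⇑φ '' K) ∩ (⇑ψ '' L)) < ε →
      ∀ (p : X) (r : ℝ), HasUniqueInball ((⇑φ '' K) ∩ (⇑ψ '' L)) p r →
        frontier ((⇑φ '' K) ∩ (⇑ψ '' L)) ∩ sphere p r = {φ x, ψ y} →
        φ x ∈ interior (⇑ψ '' L) → ψ y ∈ interior (⇑φ '' K) →
        IsMidpoint p (φ x) (ψ y) →
        SymmetricWrtPerpBisector ((⇑φ '' K) ∩ (⇑ψ '' L)) (φ x) (ψ y)

/-- Condition (4) of Theorem 6. -/
def T6Cond4 (d : ℕ) (K L : Set X) : Prop :=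
  (∃ r > (0 : ℝ), (IsSphereSpace X d → r ≤ Real.pi / 2) ∧
      (∀ C ∈ bdryComponents K ∪ bdryComponents L, ∃ p : X, C = sphere p r) ∧
      (∃ p : X, K = closedBall p r) ∧ ∃ q : X, L = closedBall q r) ∨
  ((∀ C ∈ bdryComponents K ∪ bdryComponents L, IsParasphere C) ∧
      IsParaball K ∧ IsParaball L) ∨
  (∃ lam > (0 : ℝ), ∀ C ∈ bdryComponents K ∪ bdryComponents L, IsHypersphere C lam)

/-! Conditions of Theorems 7 and 8. -/

/-- The pair `φ, ψ` is admissible for hypothesis (****): both are orientation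
preserving, and for the sphere `(φ K) ∪ (ψ L)` lies in an open hemisphere. -/
def GoodPair (d : ℕ) (K L : Set X) (φ ψ : X ≃ᵢ X) : Prop :=
  OrientationPreserving φ ∧ OrientationPreserving ψ ∧
    (IsSphereSpace X d → ∃ s : X, (⇑φ '' K) ∪ (⇑ψ '' L) ⊆ ball s (Real.pi / 2))

/-- The convex hull of the union of the two congruent copies. -/
def hullUnion (K L : Set X) (φ ψ : X ≃ᵢ X) : Set X := gconvexHull ((⇑φ '' K) ∪ (⇑ψ '' L))

/-- Condition (A) of (3) of Theorem 7: the diameter of `M` is sufficiently close to `π`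
(sphere), resp. sufficiently large (Euclidean, hyperbolic), as measured by `δ`. -/
def BigDiam (d : ℕ) (X : Type*) [MetricSpace X] (M : Set X) (δ : ℝ) : Prop :=
  (IsSphereSpace X d → Real.pi - δ < diam M) ∧ (¬ IsSphereSpace X d → 1 / δ < diam M)

/-- Condition (1) of Theorem 7. -/
def T7Cond1 (d : ℕ) (K L : Set X) : Prop :=
  ∀ φ ψ : X ≃ᵢ X, GoodPair d K L φ ψ → CentrallySymmetric (hullUnion K L φ ψ)

/-- Condition (2) of Theorem 7. -/
def T7Cond2 (d : ℕ) (K L : Set X) : Prop :=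
  ∀ φ ψ : X ≃ᵢ X, GoodPair d K L φ ψ → ∀ a b : X, UniqueDiametral (hullUnion K L φ ψ) a b →
    SymmetricWrtPerpBisector (hullUnion K L φ ψ) a b

/-- Condition (3) of Theorem 7. -/
def T7Cond3 (d : ℕ) (K L : Set X) : Prop :=
  ∃ δ > (0 : ℝ), ∀ φ ψ : X ≃ᵢ X, GoodPair d K L φ ψ →
    ∀ x ∈ frontier K, ∀ y ∈ frontier L,
      BigDiam d X (hullUnion K L φ ψ) δ →
      UniqueDiametral (hullUnion K L φ ψ) (φ x) (ψ y) →
      CentrallySymmetric (hullUnion K L φ ψ)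

/-- Condition (4) of Theorem 7. -/
def T7Cond4 (d : ℕ) (K L : Set X) : Prop :=
  ∃ δ > (0 : ℝ), ∀ φ ψ : X ≃ᵢ X, GoodPair d K L φ ψ →
    ∀ x ∈ frontier K, ∀ y ∈ frontier L,
      BigDiam d X (hullUnion K L φ ψ) δ →
      UniqueDiametral (hullUnion K L φ ψ) (φ x) (ψ y) →
      SymmetricWrtPerpBisector (hullUnion K L φ ψ) (φ x) (ψ y)

/-- Condition (5) of Theorem 7. -/
def T7Cond5 (d : ℕ) (K L : Set X) : Prop :=
  ∃ δ > (0 : ℝ), ∀ φ ψ : X ≃ᵢ X, GoodPair d K L φ ψ →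
    ∀ x ∈ frontier K, ∀ y ∈ frontier L,
      BigDiam d X (hullUnion K L φ ψ) δ →
      UniqueDiametral (hullUnion K L φ ψ) (φ x) (ψ y) →
      ∃ ε₀ > (0 : ℝ), ∀ ε : ℝ, 0 < ε → ε < ε₀ →
        (IsSphereSpace X d → ∃ s : X, (⇑φ '' K) ∪ (⇑ψ '' L) ⊆ ball s (Real.pi / 2) ∧
            segCyl (φ x) (ψ y) ε ⊆ ball s (Real.pi / 2)) ∧
        CentrallySymmetric (hullUnion K L φ ψ ∩ segCyl (φ x) (ψ y) ε)

/-- Condition (6) of Theorem 7. -/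
def T7Cond6 (d : ℕ) (K L : Set X) : Prop :=
  ∃ δ > (0 : ℝ), ∀ φ ψ : X ≃ᵢ X, GoodPair d K L φ ψ →
    ∀ x ∈ frontier K, ∀ y ∈ frontier L,
      BigDiam d X (hullUnion K L φ ψ) δ →
      UniqueDiametral (hullUnion K L φ ψ) (φ x) (ψ y) →
      ∃ ε₀ > (0 : ℝ), ∀ ε : ℝ, 0 < ε → ε < ε₀ →
        (IsSphereSpace X d → ∃ s : X, (⇑φ '' K) ∪ (⇑ψ '' L) ⊆ ball s (Real.pi / 2) ∧
            segCyl (φ x) (ψ y) ε ⊆ ball s (Real.pi / 2)) ∧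
        SymmetricWrtPerpBisector (hullUnion K L φ ψ ∩ segCyl (φ x) (ψ y) ε) (φ x) (ψ y)

/-- Condition (7) of Theorem 7: `K` and `L` are congruent balls. -/
def T7Cond7 (d : ℕ) (K L : Set X) : Prop :=
  ∃ r > (0 : ℝ), (IsSphereSpace X d → r < Real.pi / 2) ∧
    (∃ p : X, K = closedBall p r) ∧ ∃ q : X, L = closedBall q r

/-- Condition (1) of Theorem 8. -/
def T8Cond1 (K L : Set X) : Prop :=
  ∀ φ ψ : X ≃ᵢ X, GoodPair 2 K L φ ψ → AxiallySymmetric (hullUnion K L φ ψ)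

/-- Condition (2) of Theorem 8. -/
def T8Cond2 (K L : Set X) : Prop :=
  ∀ φ ψ : X ≃ᵢ X, GoodPair 2 K L φ ψ → AdmitsNontrivialCongruence (hullUnion K L φ ψ)

/-- Condition (3) of Theorem 8. -/
def T8Cond3 (K L : Set X) : Prop :=
  ∃ δ > (0 : ℝ), ∀ φ ψ : X ≃ᵢ X, GoodPair 2 K L φ ψ →
    ∀ x ∈ frontier K, ∀ y ∈ frontier L,
      BigDiam 2 X (hullUnion K L φ ψ) δ →
      UniqueDiametral (hullUnion K L φ ψ) (φ x) (ψ y) →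
      AxiallySymmetric (hullUnion K L φ ψ)

/-- Condition (4) of Theorem 8. -/
def T8Cond4 (K L : Set X) : Prop :=
  ∃ δ > (0 : ℝ), ∀ φ ψ : X ≃ᵢ X, GoodPair 2 K L φ ψ →
    ∀ x ∈ frontier K, ∀ y ∈ frontier L,
      BigDiam 2 X (hullUnion K L φ ψ) δ →
      UniqueDiametral (hullUnion K L φ ψ) (φ x) (ψ y) →
      AdmitsNontrivialCongruence (hullUnion K L φ ψ)

/-- Condition (5) of Theorem 8. -/
def T8Cond5 (K L : Set X) : Prop :=
  ∃ δ > (0 : ℝ), ∀ φ ψ : X ≃ᵢ X, GoodPair 2 K L φ ψ →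
    ∀ x ∈ frontier K, ∀ y ∈ frontier L,
      BigDiam 2 X (hullUnion K L φ ψ) δ →
      UniqueDiametral (hullUnion K L φ ψ) (φ x) (ψ y) →
      ∃ ε₀ > (0 : ℝ), ∀ ε : ℝ, 0 < ε → ε < ε₀ →
        (IsSphereSpace X 2 → ∃ s : X, (⇑φ '' K) ∪ (⇑ψ '' L) ⊆ ball s (Real.pi / 2) ∧
            segCyl (φ x) (ψ y) ε ⊆ ball s (Real.pi / 2)) ∧
        AxiallySymmetric (hullUnion K L φ ψ ∩ segCyl (φ x) (ψ y) ε)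

/-- Condition (6) of Theorem 8. -/
def T8Cond6 (K L : Set X) : Prop :=
  ∃ δ > (0 : ℝ), ∀ φ ψ : X ≃ᵢ X, GoodPair 2 K L φ ψ →
    ∀ x ∈ frontier K, ∀ y ∈ frontier L,
      BigDiam 2 X (hullUnion K L φ ψ) δ →
      UniqueDiametral (hullUnion K L φ ψ) (φ x) (ψ y) →
      ∃ ε₀ > (0 : ℝ), ∀ ε : ℝ, 0 < ε → ε < ε₀ →
        (IsSphereSpace X 2 → ∃ s : X, (⇑φ '' K) ∪ (⇑ψ '' L) ⊆ ball s (Real.pi / 2) ∧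
            segCyl (φ x) (ψ y) ε ⊆ ball s (Real.pi / 2)) ∧
        AdmitsNontrivialCongruence (hullUnion K L φ ψ ∩ segCyl (φ x) (ψ y) ε)

/-- Condition (7) of Theorem 8: `K` and `L` are (in general incongruent) circles. -/
def T8Cond7 (K L : Set X) : Prop :=
  ∃ (p q : X) (r s : ℝ), 0 < r ∧ 0 < s ∧
    (IsSphereSpace X 2 → r < Real.pi / 2 ∧ s < Real.pi / 2) ∧
    K = closedBall p r ∧ L = closedBall q s

/-! ### The Lorentz form on `ℝ × ℝ × ℝ` -/

/-- Minkowski three-space. -/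
abbrev Vec : Type := ℝ × ℝ × ℝ

/-- The Lorentz form; the first coordinate is time. -/
def lor (x y : Vec) : ℝ := x.2.1 * y.2.1 + x.2.2 * y.2.2 - x.1 * y.1

/-- The upper sheet of the hyperboloid. -/
def Hyp : Set Vec := {z | lor z z = -1 ∧ 0 < z.1}

/-- The open future cone. -/
def Fut : Set Vec := {v | lor v v < 0 ∧ 0 < v.1}

theorem lor_comm (x y : Vec) : lor x y = lor y x := by simp only [lor]; ring

@[simp] theorem lor_add_left (x y z : Vec) : lor (x + y) z = lor x z + lor y z := by
  simp [lor]; ring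

@[simp] theorem lor_add_right (x y z : Vec) : lor x (y + z) = lor x y + lor x z := by
  simp [lor]; ring

@[simp] theorem lor_sub_left (x y z : Vec) : lor (x - y) z = lor x z - lor y z := by
  simp [lor]; ring

@[simp] theorem lor_sub_right (x y z : Vec) : lor x (y - z) = lor x y - lor x z := by
  simp [lor]; ring

@[simp] theorem lor_smul_left (a : ℝ) (x y : Vec) : lor (a • x) y = a * lor x y := by
  simp [lor]; ring

@[simp] theorem lor_smul_right (a : ℝ) (x y : Vec) : lor x (a • y) = a * lor x y := by
  simp [lor]; ring

@[simp] theorem lor_neg_left (x y : Vec) : lor (-x) y = -lor x y := by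
  simp [lor]; ring

@[simp] theorem lor_neg_right (x y : Vec) : lor x (-y) = -lor x y := by
  simp [lor]; ring

@[simp] theorem lor_zero_left (y : Vec) : lor 0 y = 0 := by simp [lor]

@[simp] theorem lor_zero_right (y : Vec) : lor y 0 = 0 := by simp [lor]

theorem continuous_lor : Continuous fun p : Vec × Vec => lor p.1 p.2 := by
  unfold lor; fun_prop

@[fun_prop]
theorem continuous_lor_comp {Y : Type*} [TopologicalSpace Y] {f g : Y → Vec} (hf : Continuous f)
    (hg : Continuous g) : Continuous fun y => lor (f y) (g y) :=
  continuous_lor.comp (hf.prodMk hg)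

@[fun_prop]
theorem continuousOn_lor_comp {Y : Type*} [TopologicalSpace Y] {f g : Y → Vec} {S : Set Y}
    (hf : ContinuousOn f S) (hg : ContinuousOn g S) :
    ContinuousOn (fun y => lor (f y) (g y)) S :=
  continuous_lor.comp_continuousOn (hf.prodMk hg)

theorem vec_ext {x y : Vec} (h0 : x.1 = y.1) (h1 : x.2.1 = y.2.1) (h2 : x.2.2 = y.2.2) :
    x = y := Prod.ext h0 (Prod.ext h1 h2)

theorem hyp_lor_le {z w : Vec} (hz : z ∈ Hyp) (hw : w ∈ Hyp) : lor z w ≤ -1 := by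
  obtain ⟨hz, hz0⟩ := hz
  obtain ⟨hw, hw0⟩ := hw
  simp only [lor] at *
  have h := abs_le_of_sq_le_sq' (a := 1 + z.2.1 * w.2.1 + z.2.2 * w.2.2) (b := z.1 * w.1) (by
    have h1 : z.1 ^ 2 = 1 + z.2.1 ^ 2 + z.2.2 ^ 2 := by linarith
    have h2 : w.1 ^ 2 = 1 + w.2.1 ^ 2 + w.2.2 ^ 2 := by linarith
    rw [mul_pow, h1, h2]
    nlinarith [sq_nonneg (z.2.1 - w.2.1), sq_nonneg (z.2.2 - w.2.2),
      sq_nonneg (z.2.1 * w.2.2 - z.2.2 * w.2.1)]) (by positivity)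
  linarith [h.2]

theorem hyp_lor_eq {z w : Vec} (hz : z ∈ Hyp) (hw : w ∈ Hyp) (h : lor z w = -1) : z = w := by
  obtain ⟨hz, hz0⟩ := hz
  obtain ⟨hw, hw0⟩ := hw
  simp only [lor] at *
  have h1 : z.1 ^ 2 = 1 + z.2.1 ^ 2 + z.2.2 ^ 2 := by linarith
  have h2 : w.1 ^ 2 = 1 + w.2.1 ^ 2 + w.2.2 ^ 2 := by linarith
  have h3 : z.1 ^ 2 * w.1 ^ 2 = (1 + z.2.1 * w.2.1 + z.2.2 * w.2.2) ^ 2 := by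
    rw [← mul_pow]; congr 1; linarith
  rw [h1, h2] at h3
  have e1 : z.2.1 - w.2.1 = 0 := by
    have : (z.2.1 - w.2.1) ^ 2 = 0 := by
      nlinarith [sq_nonneg (z.2.1 - w.2.1), sq_nonneg (z.2.2 - w.2.2),
        sq_nonneg (z.2.1 * w.2.2 - z.2.2 * w.2.1)]
    exact pow_eq_zero_iff (two_ne_zero) |>.1 this
  have e2 : z.2.2 - w.2.2 = 0 := by
    have : (z.2.2 - w.2.2) ^ 2 = 0 := by
      nlinarith [sq_nonneg (z.2.1 - w.2.1), sq_nonneg (z.2.2 - w.2.2),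
        sq_nonneg (z.2.1 * w.2.2 - z.2.2 * w.2.1)]
    exact pow_eq_zero_iff (two_ne_zero) |>.1 this
  have e1' : z.2.1 = w.2.1 := by linarith
  have e2' : z.2.2 = w.2.2 := by linarith
  refine vec_ext ?_ e1' e2'
  rw [e1', e2'] at h1
  exact (pow_left_inj₀ hz0.le hw0.le two_ne_zero).1 (h1.trans h2.symm)

theorem lor_orth_nonneg {d w : Vec} (hw : w ∈ Hyp) (h : lor d w = 0) : 0 ≤ lor d d := by
  obtain ⟨hw, hw0⟩ := hw
  simp only [lor] at *
  have h1 : (d.1 * w.1) ^ 2 = (d.2.1 * w.2.1 + d.2.2 * w.2.2) ^ 2 := by congr 1; linarith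
  have h2 : w.1 ^ 2 = 1 + w.2.1 ^ 2 + w.2.2 ^ 2 := by linarith
  rw [mul_pow] at h1
  have : 0 ≤ w.1 ^ 2 * (d.2.1 * d.2.1 + d.2.2 * d.2.2 - d.1 * d.1) := by
    have : w.1 ^ 2 * (d.2.1 * d.2.1 + d.2.2 * d.2.2 - d.1 * d.1) =
      (d.2.1 ^ 2 + d.2.2 ^ 2) + (d.2.1 * w.2.2 - d.2.2 * w.2.1) ^ 2 := by
        linear_combination (d.2.1 ^ 2 + d.2.2 ^ 2) * h2 - h1
    rw [this]; positivity
  exact nonneg_of_mul_nonneg_right this (by positivity)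

theorem lor_orth_eq_zero {d w : Vec} (hw : w ∈ Hyp) (h : lor d w = 0) (hd : lor d d = 0) :
    d = 0 := by
  obtain ⟨hw, hw0⟩ := hw
  simp only [lor] at *
  have h1 : (d.1 * w.1) ^ 2 = (d.2.1 * w.2.1 + d.2.2 * w.2.2) ^ 2 := by congr 1; linarith
  have h2 : w.1 ^ 2 = 1 + w.2.1 ^ 2 + w.2.2 ^ 2 := by linarith
  rw [mul_pow] at h1
  have h3 : (d.2.1 ^ 2 + d.2.2 ^ 2) + (d.2.1 * w.2.2 - d.2.2 * w.2.1) ^ 2 = 0 := by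
    linear_combination w.1 ^ 2 * hd + h1 - (d.2.1 ^ 2 + d.2.2 ^ 2) * h2
  have e1 : d.2.1 = 0 := by
    refine pow_eq_zero_iff (two_ne_zero) |>.1 ?_
    nlinarith [sq_nonneg d.2.1, sq_nonneg d.2.2, sq_nonneg (d.2.1 * w.2.2 - d.2.2 * w.2.1)]
  have e2 : d.2.2 = 0 := by
    refine pow_eq_zero_iff (two_ne_zero) |>.1 ?_
    nlinarith [sq_nonneg d.2.1, sq_nonneg d.2.2, sq_nonneg (d.2.1 * w.2.2 - d.2.2 * w.2.1)]
  have e0 : d.1 = 0 := by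
    rw [e1, e2] at hd
    nlinarith
  exact vec_ext e0 e1 e2

theorem lor_orth_pos {d w : Vec} (hw : w ∈ Hyp) (h : lor d w = 0) (hd : d ≠ 0) : 0 < lor d d :=
  lt_of_le_of_ne (lor_orth_nonneg hw h) fun h0 => hd (lor_orth_eq_zero hw h h0.symm)

theorem Hyp_subset_Fut : Hyp ⊆ Fut := fun z hz => ⟨by rw [hz.1]; norm_num, hz.2⟩

theorem isOpen_Fut : IsOpen Fut := by
  refine IsOpen.inter (isOpen_lt (f := fun v : Vec => lor v v) (by fun_prop) continuous_const)
    (isOpen_lt (g := fun v : Vec => v.1) continuous_const (by fun_prop))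

theorem Fut_smul {v : Vec} (hv : v ∈ Fut) {a : ℝ} (ha : 0 < a) : a • v ∈ Fut := by
  refine ⟨?_, ?_⟩
  · simp only [lor_smul_left, lor_smul_right]
    have := hv.1
    nlinarith [mul_pos ha ha]
  · simpa using mul_pos ha hv.2

/-- The radial projection onto the hyperboloid. -/
noncomputable def nrm (v : Vec) : Vec := (Real.sqrt (-lor v v))⁻¹ • v

theorem sqrt_lor_pos {v : Vec} (hv : v ∈ Fut) : 0 < Real.sqrt (-lor v v) :=
  Real.sqrt_pos.2 (by linarith [hv.1])

theorem nrm_mem {v : Vec} (hv : v ∈ Fut) : nrm v ∈ Hyp := by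
  have h := sqrt_lor_pos hv
  refine ⟨?_, ?_⟩
  · simp only [nrm, lor_smul_left, lor_smul_right]
    have h2 := Real.sq_sqrt (show 0 ≤ -lor v v by linarith [hv.1])
    field_simp
    linarith
  · simpa [nrm] using mul_pos (inv_pos.2 h) hv.2

theorem sqrt_smul_nrm {v : Vec} (hv : v ∈ Fut) : Real.sqrt (-lor v v) • nrm v = v := by
  have h := sqrt_lor_pos hv
  simp [nrm, smul_smul, h.ne']

theorem nrm_of_hyp {v : Vec} (hv : v ∈ Hyp) : nrm v = v := by
  simp [nrm, hv.1]

theorem nrm_smul_of_hyp {v : Vec} (hv : v ∈ Hyp) {a : ℝ} (ha : 0 < a) : nrm (a • v) = v := by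
  have : -lor (a • v) (a • v) = a ^ 2 := by
    simp only [lor_smul_left, lor_smul_right, hv.1]; ring
  rw [nrm, this, Real.sqrt_sq ha.le, smul_smul, inv_mul_cancel₀ ha.ne', one_smul]

theorem continuousOn_nrm : ContinuousOn nrm Fut := by
  refine ContinuousOn.smul (f := fun v : Vec => (Real.sqrt (-lor v v))⁻¹) ?_ continuousOn_id
  exact ContinuousOn.inv₀ (f := fun v : Vec => Real.sqrt (-lor v v)) (by fun_prop)
    fun v hv => (sqrt_lor_pos hv).ne'

theorem Fut_lor_neg {v w : Vec} (hv : v ∈ Fut) (hw : w ∈ Fut) : lor v w < 0 := by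
  rw [← sqrt_smul_nrm hv, ← sqrt_smul_nrm hw]
  simp only [lor_smul_left, lor_smul_right]
  have h := hyp_lor_le (nrm_mem hv) (nrm_mem hw)
  have := mul_pos (sqrt_lor_pos hv) (sqrt_lor_pos hw)
  nlinarith

theorem Fut_add {v w : Vec} (hv : v ∈ Fut) (hw : w ∈ Fut) : v + w ∈ Fut := by
  refine ⟨?_, add_pos hv.2 hw.2⟩
  simp only [lor_add_left, lor_add_right, lor_comm w v]
  linarith [hv.1, hw.1, Fut_lor_neg hv hw]

/-- A timelike vector which is negatively paired with a future vector is future. -/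
theorem mem_Fut_of_lor_neg {z w : Vec} (hz : lor z z < 0) (hw : w ∈ Fut) (h : lor z w < 0) :
    z ∈ Fut := by
  refine ⟨hz, ?_⟩
  by_contra hn
  have hz0 : z.1 ≠ 0 := by
    intro h0
    simp only [lor, h0] at hz
    nlinarith [sq_nonneg z.2.1, sq_nonneg z.2.2]
  have : -z ∈ Fut := ⟨by simpa using hz, by
    have := lt_of_le_of_ne (not_lt.1 hn) hz0
    simpa using this⟩
  have := Fut_lor_neg this hw
  simp at this
  linarith

theorem mem_Hyp_of_lor_neg {z w : Vec} (hz : lor z z = -1) (hw : w ∈ Hyp) (h : lor z w < 0) :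
    z ∈ Hyp :=
  ⟨hz, (mem_Fut_of_lor_neg (by rw [hz]; norm_num) (Hyp_subset_Fut hw) h).2⟩

/-! ### Orthonormal frames and linear isometries -/

/-- An orthonormal frame with future timelike first vector. -/
structure OFrame (E e1 e2 : Vec) : Prop where
  hE : E ∈ Hyp
  h11 : lor e1 e1 = 1
  h22 : lor e2 e2 = 1
  h1 : lor E e1 = 0
  h2 : lor E e2 = 0
  h12 : lor e1 e2 = 0

theorem OFrame.expand {E e1 e2 : Vec} (h : OFrame E e1 e2) (v : Vec) :
    v = -lor v E • E + lor v e1 • e1 + lor v e2 • e2 := by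
  obtain ⟨⟨h00, -⟩, h11, h22, h01, h02, h12⟩ := h
  simp only [lor] at *
  let A : Matrix (Fin 3) (Fin 3) ℝ :=
    !![E.1, e1.1, e2.1; E.2.1, e1.2.1, e2.2.1; E.2.2, e1.2.2, e2.2.2]
  let B : Matrix (Fin 3) (Fin 3) ℝ :=
    !![E.1, -E.2.1, -E.2.2; -e1.1, e1.2.1, e1.2.2; -e2.1, e2.2.1, e2.2.2]
  have hBA : B * A = 1 := by
    ext i j
    fin_cases i <;> fin_cases j <;>
      simp [A, B, Matrix.mul_apply, Fin.sum_univ_three] <;> linarith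
  have hAB : A * B = 1 := mul_eq_one_comm.1 hBA
  have g := fun i j => congrFun (congrFun hAB i) j
  have g00 := g 0 0; have g01 := g 0 1; have g02 := g 0 2
  have g10 := g 1 0; have g11 := g 1 1; have g12 := g 1 2
  have g20 := g 2 0; have g21 := g 2 1; have g22 := g 2 2
  simp [A, B, Matrix.mul_apply, Fin.sum_univ_three] at g00 g01 g02 g10 g11 g12 g20 g21 g22
  refine vec_ext ?_ ?_ ?_ <;> simp
  · linear_combination -v.1 * g00 - v.2.1 * g01 - v.2.2 * g02
  · linear_combination -v.1 * g10 - v.2.1 * g11 - v.2.2 * g12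
  · linear_combination -v.1 * g20 - v.2.1 * g21 - v.2.2 * g22

/-- Linear automorphisms preserving the form and the future sheet. -/
structure IsLor (A : Vec ≃ₗ[ℝ] Vec) : Prop where
  lor_map : ∀ x y, lor (A x) (A y) = lor x y
  hyp_map : ∀ z ∈ Hyp, A z ∈ Hyp

theorem IsLor.symm {A : Vec ≃ₗ[ℝ] Vec} (h : IsLor A) : IsLor A.symm := by
  have h1 : ∀ x y, lor (A.symm x) (A.symm y) = lor x y := fun x y => by
    rw [← h.lor_map]; simp
  refine ⟨h1, fun z hz => mem_Hyp_of_lor_neg (w := A.symm (A z)) ?_ (by simpa using hz) ?_⟩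
  · rw [h1]; exact hz.1
  · rw [h1]
    linarith [hyp_lor_le hz (h.hyp_map z hz)]

theorem IsLor.trans {A B : Vec ≃ₗ[ℝ] Vec} (h : IsLor A) (h' : IsLor B) : IsLor (A.trans B) :=
  ⟨fun x y => by simp [h.lor_map, h'.lor_map], fun z hz => h'.hyp_map _ (h.hyp_map z hz)⟩

theorem IsLor.refl : IsLor (LinearEquiv.refl ℝ Vec) := ⟨fun _ _ => rfl, fun _ h => h⟩

theorem IsLor.mem_iff {A : Vec ≃ₗ[ℝ] Vec} (h : IsLor A) {z : Vec} : A z ∈ Hyp ↔ z ∈ Hyp :=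
  ⟨fun hz => by simpa using h.symm.hyp_map _ hz, h.hyp_map z⟩

theorem isLor_of {A : Vec ≃ₗ[ℝ] Vec} (h : ∀ x y, lor (A x) (A y) = lor x y) {P : Vec}
    (hP : P ∈ Hyp) (hAP : A P ∈ Hyp) : IsLor A :=
  ⟨h, fun z hz => mem_Hyp_of_lor_neg (by rw [h]; exact hz.1) hAP (by
    rw [h]; linarith [hyp_lor_le hz hP])⟩

/-- The linear map between two orthonormal frames. -/
theorem OFrame.exists_map {E e1 e2 E' e1' e2' : Vec} (h : OFrame E e1 e2)
    (h' : OFrame E' e1' e2') :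
    ∃ A : Vec ≃ₗ[ℝ] Vec, IsLor A ∧ A E = E' ∧ A e1 = e1' ∧ A e2 = e2' := by
  have key : ∀ {E e1 e2 E' e1' e2' : Vec}, OFrame E e1 e2 → ∀ v : Vec, OFrame E' e1' e2' →
      ∀ w, w = -lor v E • E' + lor v e1 • e1' + lor v e2 • e2' →
      v = -lor w E' • E + lor w e1' • e1 + lor w e2' • e2 := by
    intro E e1 e2 E' e1' e2' h v h' w hw
    rw [hw]
    simp only [lor_add_left, lor_smul_left, h'.hE.1, h'.h11, h'.h22, h'.h1, h'.h2, h'.h12,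
      lor_comm e1' E', lor_comm e2' E', lor_comm e2' e1']
    simpa using h.expand v
  let A : Vec ≃ₗ[ℝ] Vec :=
    { toFun := fun v => -lor v E • E' + lor v e1 • e1' + lor v e2 • e2'
      invFun := fun v => -lor v E' • E + lor v e1' • e1 + lor v e2' • e2
      map_add' := fun x y => by simp only [lor_add_left]; module
      map_smul' := fun a x => by simp only [lor_smul_left, RingHom.id_apply]; module
      left_inv := fun v => (key h v h' _ rfl).symm
      right_inv := fun v => (key h' v h _ rfl).symm }
  have hA : ∀ v, A v = -lor v E • E' + lor v e1 • e1' + lor v e2 • e2' := fun v => rfl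
  have hAE : A E = E' := by simp [hA, h.hE.1, h.h1, h.h2]
  refine ⟨A, isLor_of (fun x y => ?_) h.hE (by rw [hAE]; exact h'.hE), hAE, ?_, ?_⟩
  · rw [hA x, hA y]
    conv_rhs => rw [h.expand x, h.expand y]
    simp only [lor_add_left, lor_add_right, lor_smul_left, lor_smul_right, h'.hE.1, h'.h11,
      h'.h22, h'.h1, h'.h2, h'.h12, lor_comm e1' E', lor_comm e2' E', lor_comm e2' e1', h.hE.1,
      h.h11, h.h22, h.h1, h.h2, h.h12, lor_comm e1 E, lor_comm e2 E, lor_comm e2 e1]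
  · simp [hA, lor_comm e1 E, h.h1, h.h11, h.h12]
  · simp [hA, lor_comm e2 E, lor_comm e2 e1, h.h2, h.h22, h.h12]

/-! ### Chord frames -/

/-- Two points of the sheet, at `cosh`-distance `s`, with a unit normal of their chord. -/
structure CFrame (s : ℝ) (P Q n : Vec) : Prop where
  hP : P ∈ Hyp
  hQ : Q ∈ Hyp
  hPQ : lor P Q = -s
  hs : 1 < s
  hPn : lor P n = 0
  hQn : lor Q n = 0
  hn : lor n n = 1

theorem CFrame.swap {s : ℝ} {P Q n : Vec} (h : CFrame s P Q n) : CFrame s Q P n :=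
  ⟨h.hQ, h.hP, by rw [lor_comm, h.hPQ], h.hs, h.hQn, h.hPn, h.hn⟩

theorem CFrame.neg {s : ℝ} {P Q n : Vec} (h : CFrame s P Q n) : CFrame s P Q (-n) :=
  ⟨h.hP, h.hQ, h.hPQ, h.hs, by simp [h.hPn], by simp [h.hQn], by simp [h.hn]⟩

theorem CFrame.map {s : ℝ} {P Q n : Vec} (h : CFrame s P Q n) {A : Vec ≃ₗ[ℝ] Vec}
    (hA : IsLor A) : CFrame s (A P) (A Q) (A n) :=
  ⟨hA.hyp_map _ h.hP, hA.hyp_map _ h.hQ, by rw [hA.lor_map, h.hPQ], h.hs,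
    by rw [hA.lor_map, h.hPn], by rw [hA.lor_map, h.hQn], by rw [hA.lor_map, h.hn]⟩

theorem CFrame.sq_pos {s : ℝ} {P Q n : Vec} (h : CFrame s P Q n) : 0 < s ^ 2 - 1 := by
  nlinarith [h.hs]

theorem CFrame.oframe {s : ℝ} {P Q n : Vec} (h : CFrame s P Q n) :
    OFrame P ((Real.sqrt (s ^ 2 - 1))⁻¹ • (Q - s • P)) n := by
  have h1 := Real.sqrt_pos.2 h.sq_pos
  have h2 := Real.sq_sqrt h.sq_pos.le
  refine ⟨h.hP, ?_, h.hn, ?_, h.hPn, ?_⟩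
  · simp only [lor_smul_left, lor_smul_right, lor_sub_left, lor_sub_right, h.hP.1, h.hQ.1, h.hPQ,
      lor_comm Q P]
    field_simp
    rw [h2]; ring
  · simp only [lor_smul_right, lor_sub_right, h.hP.1, h.hPQ]; ring
  · simp only [lor_smul_left, lor_sub_left, h.hPn, h.hQn]; ring

/-- Coordinates in a chord frame. -/
theorem CFrame.expand {s : ℝ} {P Q n : Vec} (h : CFrame s P Q n) (z : Vec) :
    ∃ α β γ : ℝ, z = α • P + β • Q + γ • n := by
  have := h.oframe.expand z
  refine ⟨-lor z P - lor z ((Real.sqrt (s ^ 2 - 1))⁻¹ • (Q - s • P)) *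
    (Real.sqrt (s ^ 2 - 1))⁻¹ * s, lor z ((Real.sqrt (s ^ 2 - 1))⁻¹ • (Q - s • P)) *
    (Real.sqrt (s ^ 2 - 1))⁻¹, lor z n, ?_⟩
  refine this.trans ?_
  generalize lor z ((Real.sqrt (s ^ 2 - 1))⁻¹ • (Q - s • P)) = c
  module

section coords

variable {s α β γ α' β' γ' : ℝ} {P Q n : Vec}

theorem CFrame.lor_P (h : CFrame s P Q n) :
    lor (α • P + β • Q + γ • n) P = -(α + β * s) := by
  simp only [lor_add_left, lor_smul_left, h.hP.1, lor_comm Q P, lor_comm n P, h.hPQ, h.hPn]; ring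

theorem CFrame.lor_Q (h : CFrame s P Q n) :
    lor (α • P + β • Q + γ • n) Q = -(α * s + β) := by
  simp only [lor_add_left, lor_smul_left, h.hQ.1, lor_comm n Q, h.hPQ, h.hQn]; ring

theorem CFrame.lor_n (h : CFrame s P Q n) : lor (α • P + β • Q + γ • n) n = γ := by
  simp only [lor_add_left, lor_smul_left, h.hn, h.hPn, h.hQn]; ring

theorem CFrame.lor_lor (h : CFrame s P Q n) :
    lor (α • P + β • Q + γ • n) (α' • P + β' • Q + γ' • n) =
      γ * γ' - α * α' - β * β' - s * (α * β' + β * α') := by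
  simp only [lor_add_right, lor_smul_right, h.lor_P, h.lor_Q, h.lor_n]; ring

theorem CFrame.coord_eq (h : CFrame s P Q n)
    (he : α • P + β • Q + γ • n = α' • P + β' • Q + γ' • n) : α = α' ∧ β = β' ∧ γ = γ' := by
  have h1 := h.lor_P (α := α) (β := β) (γ := γ)
  have h2 := h.lor_Q (α := α) (β := β) (γ := γ)
  have h3 := h.lor_n (α := α) (β := β) (γ := γ)
  rw [he, h.lor_P] at h1
  rw [he, h.lor_Q] at h2
  rw [he, h.lor_n] at h3
  have hs := h.sq_pos
  have e1 : (s ^ 2 - 1) * (α - α') = 0 := by linear_combination s * h2 - h1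
  have e2 : (s ^ 2 - 1) * (β - β') = 0 := by linear_combination s * h1 - h2
  refine ⟨?_, ?_, h3.symm⟩
  · have := (mul_eq_zero.1 e1).resolve_left hs.ne'; linarith
  · have := (mul_eq_zero.1 e2).resolve_left hs.ne'; linarith

theorem CFrame.ext (h : CFrame s P Q n) {x y : Vec} (h1 : lor x P = lor y P)
    (h2 : lor x Q = lor y Q) (h3 : lor x n = lor y n) : x = y := by
  obtain ⟨α, β, γ, rfl⟩ := h.expand x
  obtain ⟨α', β', γ', rfl⟩ := h.expand y
  rw [h.lor_P, h.lor_P] at h1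
  rw [h.lor_Q, h.lor_Q] at h2
  rw [h.lor_n, h.lor_n] at h3
  have hs := h.sq_pos
  have e1 : (s ^ 2 - 1) * (α - α') = 0 := by linear_combination h1 - s * h2
  have e2 : (s ^ 2 - 1) * (β - β') = 0 := by linear_combination h2 - s * h1
  have e1' := (mul_eq_zero.1 e1).resolve_left hs.ne'
  have e2' := (mul_eq_zero.1 e2).resolve_left hs.ne'
  rw [show α = α' by linarith, show β = β' by linarith, h3]

end coords

theorem CFrame.exists_map {s : ℝ} {P Q n P' Q' n' : Vec} (h : CFrame s P Q n)
    (h' : CFrame s P' Q' n') :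
    ∃ A : Vec ≃ₗ[ℝ] Vec, IsLor A ∧ A P = P' ∧ A Q = Q' ∧ A n = n' := by
  obtain ⟨A, hA, h0, h1, h2⟩ := h.oframe.exists_map h'.oframe
  refine ⟨A, hA, h0, ?_, h2⟩
  have hs := (Real.sqrt_pos.2 h.sq_pos)
  rw [map_smul, map_sub, map_smul, h0] at h1
  have := smul_right_injective Vec (inv_ne_zero hs.ne') h1
  simpa using this

theorem CFrame.map_unique {s : ℝ} {P Q n : Vec} (h : CFrame s P Q n) {A B : Vec ≃ₗ[ℝ] Vec}
    (h1 : A P = B P) (h2 : A Q = B Q) (h3 : A n = B n) : A = B := by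
  ext1 z
  obtain ⟨α, β, γ, rfl⟩ := h.expand z
  simp [h1, h2, h3]

/-- Existence of a unit normal. -/
theorem exists_cframe {P Q : Vec} (hP : P ∈ Hyp) (hQ : Q ∈ Hyp) (hne : P ≠ Q) :
    ∃ n, CFrame (-lor P Q) P Q n := by
  have hs : 1 < -lor P Q := by
    have := hyp_lor_le hP hQ
    rcases this.lt_or_eq with h | h
    · linarith
    · exact absurd (hyp_lor_eq hP hQ h) hne
  -- the Lorentz cross product
  set w : Vec := (P.2.1 * Q.2.2 - P.2.2 * Q.2.1, P.1 * Q.2.2 - P.2.2 * Q.1,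
    P.2.1 * Q.1 - P.1 * Q.2.1) with hw
  have hwP : lor w P = 0 := by simp only [lor, hw]; ring
  have hwQ : lor w Q = 0 := by simp only [lor, hw]; ring
  have hww : lor w w = (lor P Q) ^ 2 - lor P P * lor Q Q := by simp only [lor, hw]; ring
  rw [hP.1, hQ.1] at hww
  have hpos : 0 < lor w w := by rw [hww]; nlinarith
  have h1 := Real.sqrt_pos.2 hpos
  have h2 := Real.sq_sqrt hpos.le
  refine ⟨(Real.sqrt (lor w w))⁻¹ • w, hP, hQ, by ring, hs, ?_, ?_, ?_⟩
  · simp [lor_comm P w, hwP]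
  · simp [lor_comm Q w, hwQ]
  · simp only [lor_smul_left, lor_smul_right]
    field_simp
    exact h2.symm

/-! ### Convex cones in the future cone -/

/-- A convex cone with interior points, relatively closed in the future cone. -/
structure IsBody (C : Set Vec) : Prop where
  fut : C ⊆ Fut
  add : ∀ v ∈ C, ∀ w ∈ C, v + w ∈ C
  smul : ∀ a : ℝ, 0 < a → ∀ v ∈ C, a • v ∈ C
  closed : ∀ v ∈ Fut, v ∈ closure C → v ∈ C
  int : (interior C).Nonempty

/-- The boundary points on the hyperboloid. -/
def Bd (C : Set Vec) : Set Vec := {z | z ∈ Hyp ∧ z ∈ C ∧ z ∉ interior C}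

namespace IsBody

variable {C D : Set Vec}

theorem convex (h : IsBody C) : Convex ℝ C := by
  intro x hx y hy a b ha hb hab
  rcases ha.eq_or_lt with rfl | ha
  · simp_all
  rcases hb.eq_or_lt with rfl | hb
  · simp_all
  exact h.add _ (h.smul a ha _ hx) _ (h.smul b hb _ hy)

theorem smul_int (h : IsBody C) {a : ℝ} (ha : 0 < a) {v : Vec} (hv : v ∈ interior C) :
    a • v ∈ interior C := by
  have h1 : (fun x => a • x) '' interior C ⊆ interior C := by
    refine interior_maximal ?_ (isOpenMap_smul₀ ha.ne' _ isOpen_interior)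
    rintro _ ⟨w, hw, rfl⟩
    exact h.smul a ha _ (interior_subset hw)
  exact h1 ⟨v, hv, rfl⟩

theorem smul_int_iff (h : IsBody C) {a : ℝ} (ha : 0 < a) {v : Vec} :
    a • v ∈ interior C ↔ v ∈ interior C := by
  refine ⟨fun hv => ?_, h.smul_int ha⟩
  have := h.smul_int (inv_pos.2 ha) hv
  rwa [smul_smul, inv_mul_cancel₀ ha.ne', one_smul] at this

theorem smul_iff (h : IsBody C) {a : ℝ} (ha : 0 < a) {v : Vec} : a • v ∈ C ↔ v ∈ C := by
  refine ⟨fun hv => ?_, h.smul _ ha v⟩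
  have := h.smul _ (inv_pos.2 ha) _ hv
  rwa [smul_smul, inv_mul_cancel₀ ha.ne', one_smul] at this

theorem int_add (h : IsBody C) {v w : Vec} (hv : v ∈ interior C) (hw : w ∈ C) :
    v + w ∈ interior C := by
  have h1 : (fun x => x + w) '' interior C ⊆ interior C := by
    refine interior_maximal ?_ ((Homeomorph.addRight w).isOpenMap _ isOpen_interior)
    rintro _ ⟨x, hx, rfl⟩
    exact h.add _ (interior_subset hx) _ hw
  exact h1 ⟨v, hv, rfl⟩

theorem add_int (h : IsBody C) {v w : Vec} (hv : v ∈ C) (hw : w ∈ interior C) :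
    v + w ∈ interior C := by rw [add_comm]; exact h.int_add hw hv

/-- Nonnegative combinations with a positive multiple of an interior point. -/
theorem comb_int (h : IsBody C) {a b c : ℝ} {x y w : Vec} (ha : 0 ≤ a) (hb : 0 ≤ b) (hc : 0 < c)
    (hx : x ∈ C) (hy : y ∈ C) (hw : w ∈ interior C) : a • x + b • y + c • w ∈ interior C := by
  have hw' := h.smul_int hc hw
  have h1 : b • y + c • w ∈ interior C := by
    rcases hb.eq_or_lt with rfl | hb
    · simpa using hw'
    · exact h.add_int (h.smul b hb _ hy) hw'
  rw [add_assoc]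
  rcases ha.eq_or_lt with rfl | ha
  · simpa using h1
  · exact h.add_int (h.smul a ha _ hx) h1

theorem image (h : IsBody C) {A : Vec ≃ₗ[ℝ] Vec} (hA : IsLor A) : IsBody (A '' C) := by
  have hfut : ∀ v, v ∈ Fut → A v ∈ Fut := fun v hv => by
    rw [← sqrt_smul_nrm hv, map_smul]
    exact Fut_smul (Hyp_subset_Fut (hA.hyp_map _ (nrm_mem hv))) (sqrt_lor_pos hv)
  have hfut' : ∀ v, v ∈ Fut → A.symm v ∈ Fut := fun v hv => by
    rw [← sqrt_smul_nrm hv, map_smul]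
    exact Fut_smul (Hyp_subset_Fut (hA.symm.hyp_map _ (nrm_mem hv))) (sqrt_lor_pos hv)
  refine ⟨?_, ?_, ?_, ?_, ?_⟩
  · rintro _ ⟨v, hv, rfl⟩
    exact hfut v (h.fut hv)
  · rintro _ ⟨v, hv, rfl⟩ _ ⟨w, hw, rfl⟩
    exact ⟨v + w, h.add _ hv _ hw, map_add _ _ _⟩
  · rintro a ha _ ⟨v, hv, rfl⟩
    exact ⟨a • v, h.smul a ha v hv, map_smul _ _ _⟩
  · intro v hv hvc
    have : A '' closure C = closure (A '' C) :=
      A.toContinuousLinearEquiv.toHomeomorph.image_closure C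
    rw [← this] at hvc
    obtain ⟨w, hw, rfl⟩ := hvc
    exact ⟨w, h.closed w (by simpa using hfut' _ hv) hw, rfl⟩
  · have : A '' interior C = interior (A '' C) :=
      A.toContinuousLinearEquiv.toHomeomorph.image_interior C
    rw [← this]
    exact h.int.image _

end IsBody

theorem image_interior_lin (A : Vec ≃ₗ[ℝ] Vec) (C : Set Vec) :
    A '' interior C = interior (A '' C) :=
  A.toContinuousLinearEquiv.toHomeomorph.image_interior C

theorem mem_interior_image {A : Vec ≃ₗ[ℝ] Vec} {C : Set Vec} {z : Vec} :
    A z ∈ interior (A '' C) ↔ z ∈ interior C := by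
  rw [← image_interior_lin, A.injective.mem_set_image]

theorem mem_Bd_image {A : Vec ≃ₗ[ℝ] Vec} (hA : IsLor A) {C : Set Vec} {z : Vec} :
    A z ∈ Bd (A '' C) ↔ z ∈ Bd C := by
  simp only [Bd, mem_ofPred_eq, mem_interior_image, hA.mem_iff, A.injective.mem_set_image]

/-! ### Caps and their intersections -/

/-- The part of `C` above the chord lies in the cone spanned by `P`, `Q`, `xP + yQ + kn`. -/
def Outer (C : Set Vec) (P Q n : Vec) (x y k : ℝ) : Prop :=
  ∀ α β γ : ℝ, α • P + β • Q + γ • n ∈ C → 0 < γ → x * γ ≤ k * α ∧ y * γ ≤ k * β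

theorem Outer.mem_int {C D : Set Vec} {s : ℝ} {P Q n z : Vec} {x y k : ℝ} (h : CFrame s P Q n)
    (hD : IsBody D) (hP : P ∈ D) (hQ : Q ∈ D) (hk : 0 < k)
    (hapex : x • P + y • Q + k • n ∈ interior D)
    (ho : Outer C P Q n x y k) (hz : z ∈ C) (hzn : 0 < lor z n) : z ∈ interior D := by
  obtain ⟨α, β, γ, rfl⟩ := h.expand z
  rw [h.lor_n] at hzn
  obtain ⟨h1, h2⟩ := ho α β γ hz hzn
  have := hD.comb_int (a := α - γ / k * x) (b := β - γ / k * y) (c := γ / k)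
    (by rw [sub_nonneg]; field_simp; linarith) (by rw [sub_nonneg]; field_simp; linarith)
    (by positivity) hP hQ hapex
  convert this using 1
  have hk' : γ / k * k = γ := by field_simp
  conv_lhs => rw [← hk']
  module

/-- On a chord crossed by the body, only the segment between the end points lies in the body. -/
theorem nonneg_of_crossing {C : Set Vec} {s : ℝ} {P Q n : Vec} (h : CFrame s P Q n)
    (hC : IsBody C) (hP : P ∈ Bd C) (hQ : Q ∈ Bd C) {y y' : Vec} (hy : y ∈ C)
    (hyn : 0 < lor y n) (hy' : y' ∈ interior C) (hy'n : lor y' n < 0) {α β : ℝ}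
    (hz : α • P + β • Q ∈ C) : 0 ≤ α ∧ 0 ≤ β := by
  have key : ∀ {P Q n : Vec}, CFrame s P Q n → P ∈ Bd C → Q ∈ Bd C → 0 < lor y n →
      lor y' n < 0 → ∀ α β : ℝ, α • P + β • Q ∈ C → 0 ≤ β := by
    intro P Q n h hP hQ hyn hy'n α β hz
    by_contra hβ
    push Not at hβ
    have hq : (-lor y' n) • y + (lor y n) • y' ∈ interior C :=
      hC.add_int (hC.smul _ (by linarith) _ hy) (hC.smul_int hyn hy')
    have hqn : lor ((-lor y' n) • y + (lor y n) • y') n = 0 := by simp; ring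
    generalize (-lor y' n) • y + (lor y n) • y' = q at hq hqn
    obtain ⟨a, b, c, rfl⟩ := h.expand q
    rw [h.lor_n] at hqn
    subst hqn
    simp only [zero_smul, add_zero] at hq
    have hPF := Hyp_subset_Fut h.hP
    have hQF := Hyp_subset_Fut h.hQ
    have e1 := h.lor_P (α := α) (β := β) (γ := 0)
    have e2 := Fut_lor_neg (hC.fut hz) hPF
    simp only [zero_smul, add_zero] at e1
    have f1 := h.lor_P (α := a) (β := b) (γ := 0)
    have f2 := Fut_lor_neg (hC.fut (interior_subset hq)) hPF
    simp only [zero_smul, add_zero] at f1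
    have f3 := h.lor_Q (α := a) (β := b) (γ := 0)
    have f4 := Fut_lor_neg (hC.fut (interior_subset hq)) hQF
    simp only [zero_smul, add_zero] at f3
    have hs := h.hs
    have hα : 0 < α := by nlinarith
    rcases le_or_gt b 0 with hb | hb
    · have ha : 0 < a := by nlinarith
      have := hC.comb_int (le_refl 0) (neg_nonneg.2 hb) one_pos hQ.2.1 hQ.2.1 hq
      rw [show (0 : ℝ) • Q + -b • Q + (1 : ℝ) • (a • P + b • Q) = a • P by module,
        hC.smul_int_iff ha] at this
      exact hP.2.2 this
    · rcases le_or_gt a 0 with ha | ha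
      · have := hC.comb_int (le_refl 0) (neg_nonneg.2 ha) one_pos hP.2.1 hP.2.1 hq
        rw [show (0 : ℝ) • P + -a • P + (1 : ℝ) • (a • P + b • Q) = b • Q by module,
          hC.smul_int_iff hb] at this
        exact hQ.2.2 this
      · have := hC.comb_int (le_refl 0) hb.le (neg_pos.2 hβ) hP.2.1 hz hq
        rw [show (0 : ℝ) • P + b • (α • P + β • Q) + -β • (a • P + b • Q)
          = (α * b - β * a) • P by module, hC.smul_int_iff (by nlinarith)] at this
        exact hP.2.2 this
  refine ⟨?_, key h hP hQ hyn hy'n α β hz⟩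
  exact key h.swap hQ hP hyn hy'n β α (by rwa [add_comm])

/-- The distances to the chord end points of the boundary points above the chord. -/
def Prof (C : Set Vec) (P Q n : Vec) : Set (ℝ × ℝ) :=
  {p | ∃ z ∈ Bd C, 0 < lor z n ∧ p = (-lor z P, -lor z Q)}

theorem Prof_swap (C : Set Vec) (P Q n : Vec) : Prof C Q P n = Prod.swap '' Prof C P Q n := by
  ext ⟨a, b⟩
  constructor
  · rintro ⟨z, hz, h1, h2⟩
    obtain ⟨rfl, rfl⟩ := Prod.mk.inj h2
    exact ⟨_, ⟨z, hz, h1, rfl⟩, rfl⟩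
  · rintro ⟨_, ⟨z, hz, h1, rfl⟩, h2⟩
    obtain ⟨rfl, rfl⟩ := Prod.mk.inj h2
    exact ⟨z, hz, h1, rfl⟩

theorem Prof_image {A : Vec ≃ₗ[ℝ] Vec} (hA : IsLor A) (C : Set Vec) (P Q n : Vec) :
    Prof (A '' C) (A P) (A Q) (A n) = Prof C P Q n := by
  ext p
  constructor
  · rintro ⟨z, hz, h1, rfl⟩
    obtain ⟨w, rfl⟩ := A.surjective z
    rw [mem_Bd_image hA] at hz
    rw [hA.lor_map] at h1
    exact ⟨w, hz, h1, by simp [hA.lor_map]⟩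
  · rintro ⟨z, hz, h1, rfl⟩
    exact ⟨A z, (mem_Bd_image hA).2 hz, by rwa [hA.lor_map], by simp [hA.lor_map]⟩

/-- The dichotomy for the profiles of two chords. -/
def ProfDich (p q : Set (ℝ × ℝ)) : Prop :=
  p = q ∨ p = Prod.swap '' q ∨ (p = Prod.swap '' p ∧ q = Prod.swap '' q)

section Lens

variable {C D : Set Vec} {s δ : ℝ} {P Q n : Vec}

theorem Prof_eq_of_inter (h : CFrame s P Q n) (hD : IsBody D) (hP : P ∈ D) (hQ : Q ∈ D)
    (hδ : 0 < δ) (hapex : P + Q + δ • n ∈ interior D) (ho : Outer C P Q n 1 1 δ) :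
    Prof (C ∩ D) P Q n = Prof C P Q n := by
  have hm : ∀ z, z ∈ C → 0 < lor z n → z ∈ interior D := fun z hz hzn =>
    ho.mem_int h hD hP hQ hδ (by simpa using hapex) hz hzn
  ext p
  constructor
  · rintro ⟨z, ⟨h0, h1, h2⟩, h3, rfl⟩
    refine ⟨z, ⟨h0, h1.1, fun h4 => h2 ?_⟩, h3, rfl⟩
    rw [interior_inter]
    exact ⟨h4, hm z h1.1 h3⟩
  · rintro ⟨z, ⟨h0, h1, h2⟩, h3, rfl⟩
    refine ⟨z, ⟨h0, ⟨h1, interior_subset (hm z h1 h3)⟩, fun h4 => h2 ?_⟩, h3, rfl⟩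
    rw [interior_inter] at h4
    exact h4.1

theorem CFrame.image_normal (h : CFrame s P Q n) {v : Vec} (h1 : lor v P = 0) (h2 : lor v Q = 0)
    (h3 : lor v v = 1) : v = n ∨ v = -n := by
  have e : v = (lor v n) • n := by
    refine h.ext ?_ ?_ ?_
    · simp [h1, lor_comm n P, h.hPn]
    · simp [h2, lor_comm n Q, h.hQn]
    · simp [h.hn]
  have h4 : (lor v n) ^ 2 = 1 := by
    rw [e] at h3
    simp only [lor_smul_left, lor_smul_right, h.hn] at h3
    simp only [mul_one] at h3
    nlinarith
  rcases mul_self_eq_one_iff.1 ((sq _).symm.trans h4) with h5 | h5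
  · left; rw [e, h5, one_smul]
  · right; rw [e, h5, neg_one_smul]

/-- Points of a lens are at most as far apart as its vertices. -/
theorem lens_dist_le (h : CFrame s P Q n) (hδ : 0 < δ) (hδs : δ ^ 2 < 2 * (s - 1))
    {α β γ α' β' γ' : ℝ} (h1 : 0 ≤ α) (h2 : 0 ≤ β) (h3 : |γ| ≤ δ * α) (h4 : |γ| ≤ δ * β)
    (h1' : 0 ≤ α') (h2' : 0 ≤ β') (h3' : |γ'| ≤ δ * α') (h4' : |γ'| ≤ δ * β')
    (hz : lor (α • P + β • Q + γ • n) (α • P + β • Q + γ • n) = -1)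
    (hz' : lor (α' • P + β' • Q + γ' • n) (α' • P + β' • Q + γ' • n) = -1)
    (hd : lor (α • P + β • Q + γ • n) (α' • P + β' • Q + γ' • n) ≤ -s) :
    (α = 1 ∧ β = 0 ∧ γ = 0) ∨ (α = 0 ∧ β = 1 ∧ γ = 0) := by
  rw [h.lor_lor] at hz hz' hd
  have hs := h.hs
  have q : ∀ {α β γ : ℝ}, 0 ≤ α → 0 ≤ β → |γ| ≤ δ * α → |γ| ≤ δ * β →
      γ * γ - α * α - β * β - s * (α * β + β * α) = -1 → γ * γ ≤ δ ^ 2 * (α * β) ∧ α + β ≤ 1 := by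
    intro α β γ h1 h2 h3 h4 hz
    have hg : γ * γ ≤ δ ^ 2 * (α * β) := by
      rw [← abs_mul_abs_self γ]
      nlinarith [mul_le_mul h3 h4 (abs_nonneg _) (by positivity)]
    refine ⟨hg, ?_⟩
    have : (α + β) ^ 2 ≤ 1 := by nlinarith [mul_nonneg h1 h2]
    nlinarith
  obtain ⟨hg, ht⟩ := q h1 h2 h3 h4 hz
  obtain ⟨hg', ht'⟩ := q h1' h2' h3' h4' hz'
  have hgg : -(γ * γ') ≤ δ ^ 2 / 2 * (α * α' + β * β') := by
    have e1 : -(γ * γ') ≤ |γ| * |γ'| := by rw [← abs_mul]; exact neg_le_abs _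
    have e2 : |γ| * |γ'| ≤ δ * α * (δ * α') := mul_le_mul h3 h3' (abs_nonneg _) (by positivity)
    have e3 : |γ| * |γ'| ≤ δ * β * (δ * β') := mul_le_mul h4 h4' (abs_nonneg _) (by positivity)
    nlinarith
  have htt : (α + β) * (α' + β') ≤ 1 := by nlinarith
  have hA : 0 ≤ α * α' := mul_nonneg h1 h1'
  have hB : 0 ≤ β * β' := mul_nonneg h2 h2'
  have hsum : α * α' + β * β' = 0 := by
    by_contra hne
    have hpos : 0 < α * α' + β * β' := lt_of_le_of_ne (by positivity) (Ne.symm hne)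
    nlinarith
  have hA0 : α * α' = 0 := by linarith
  have hB0 : β * β' = 0 := by linarith
  have hc : 1 ≤ α * β' + β * α' := by nlinarith
  have ht1 : α + β = 1 := by nlinarith
  rcases mul_eq_zero.1 hA0 with h0 | h0
  · right
    refine ⟨h0, by linarith, ?_⟩
    rw [h0] at h3
    simpa using h3
  · left
    have h0' : β' ≠ 0 := by rintro h0'; rw [h0, h0'] at hc; norm_num at hc
    have hb : β = 0 := (mul_eq_zero.1 hB0).resolve_right h0'
    refine ⟨by linarith, hb, ?_⟩
    rw [hb] at h4
    simpa using h4

/-- The profiles of two caps whose union admits a symmetry. -/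
theorem lens_dich (h : CFrame s P Q n) (hC : IsBody C) (hD : IsBody D)
    (hPC : P ∈ Bd C) (hQC : Q ∈ Bd C) (hPD : P ∈ Bd D) (hQD : Q ∈ Bd D)
    (hδ : 0 < δ) (hδs : δ ^ 2 < 2 * (s - 1))
    (hoC : Outer C P Q n 1 1 δ) (hoD : Outer D P Q (-n) 1 1 δ)
    (hiC : P + Q + δ • (-n) ∈ interior C) (hiD : P + Q + δ • n ∈ interior D)
    {A : Vec ≃ₗ[ℝ] Vec} (hA : IsLor A) (hA1 : A ≠ LinearEquiv.refl ℝ Vec)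
    (hAM : A '' (C ∩ D) = C ∩ D) :
    ProfDich (Prof C P Q n) (Prof D P Q (-n)) := by
  have hPC' := Prof_eq_of_inter h hD hPD.2.1 hQD.2.1 hδ hiD hoC
  have hPD' := Prof_eq_of_inter h.neg hC hPC.2.1 hQC.2.1 hδ hiC hoD
  rw [inter_comm] at hPD'
  by_cases hflat : (∀ z ∈ C, lor z n ≤ 0) ∧ ∀ z ∈ D, 0 ≤ lor z n
  · left
    rw [show Prof C P Q n = ∅ from ?_, show Prof D P Q (-n) = ∅ from ?_]
    · refine eq_empty_of_forall_notMem ?_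
      rintro _ ⟨z, hz, h1, -⟩
      have := hflat.2 z hz.2.1
      simp at h1; linarith
    · refine eq_empty_of_forall_notMem ?_
      rintro _ ⟨z, hz, h1, -⟩
      have := hflat.1 z hz.2.1
      linarith
  have hiCn : lor (P + Q + δ • (-n)) n < 0 := by simp [h.hPn, h.hQn, h.hn, hδ]
  have hiDn : 0 < lor (P + Q + δ • n) n := by simp [h.hPn, h.hQn, h.hn, hδ]
  have hnn : ∀ α β : ℝ, α • P + β • Q ∈ C ∩ D → 0 ≤ α ∧ 0 ≤ β := by
    intro α β hz
    by_cases hf : ∀ z ∈ C, lor z n ≤ 0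
    · have : ¬ ∀ z ∈ D, 0 ≤ lor z n := fun h' => hflat ⟨hf, h'⟩
      push Not at this
      obtain ⟨y, hy, hyn⟩ := this
      exact nonneg_of_crossing h.neg hD hPD hQD hy (by simpa using hyn) hiD
        (by rw [lor_neg_right]; linarith) hz.2
    · push Not at hf
      obtain ⟨y, hy, hyn⟩ := hf
      exact nonneg_of_crossing h hC hPC hQC hy hyn hiC hiCn hz.1
  have hco : ∀ α β γ : ℝ, α • P + β • Q + γ • n ∈ C ∩ D →
      0 ≤ α ∧ 0 ≤ β ∧ |γ| ≤ δ * α ∧ |γ| ≤ δ * β := by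
    intro α β γ hz
    rcases lt_trichotomy γ 0 with hg | hg | hg
    · obtain ⟨h1, h2⟩ := hoD α β (-γ) (by simpa using hz.2) (by linarith)
      rw [abs_of_neg hg]
      refine ⟨?_, ?_, by linarith, by linarith⟩
      · by_contra; nlinarith
      · by_contra; nlinarith
    · subst hg
      rw [zero_smul, add_zero] at hz
      obtain ⟨h1, h2⟩ := hnn α β hz
      simp only [abs_zero]
      exact ⟨h1, h2, by positivity, by positivity⟩
    · obtain ⟨h1, h2⟩ := hoC α β γ hz.1 hg
      rw [abs_of_pos hg]
      refine ⟨?_, ?_, by linarith, by linarith⟩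
      · by_contra; nlinarith
      · by_contra; nlinarith
  have hAmem : ∀ z, z ∈ C ∩ D → A z ∈ C ∩ D := fun z hz => by
    rw [← hAM]; exact mem_image_of_mem _ hz
  have hvert : ∀ z w : Vec, z ∈ C ∩ D → w ∈ C ∩ D → z ∈ Hyp → w ∈ Hyp → lor z w = -s →
      z = P ∨ z = Q := by
    intro z w hz hw hzH hwH hzw
    obtain ⟨α, β, γ, rfl⟩ := h.expand z
    obtain ⟨α', β', γ', rfl⟩ := h.expand w
    obtain ⟨a1, a2, a3, a4⟩ := hco _ _ _ hz
    obtain ⟨b1, b2, b3, b4⟩ := hco _ _ _ hw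
    rcases lens_dist_le h hδ hδs a1 a2 a3 a4 b1 b2 b3 b4 hzH.1 hwH.1 hzw.le with
      ⟨rfl, rfl, rfl⟩ | ⟨rfl, rfl, rfl⟩
    · left; simp
    · right; simp
  have hAP : A P = P ∨ A P = Q := hvert (A P) (A Q) (hAmem _ ⟨hPC.2.1, hPD.2.1⟩)
    (hAmem _ ⟨hQC.2.1, hQD.2.1⟩) (hA.hyp_map _ h.hP) (hA.hyp_map _ h.hQ)
    (by rw [hA.lor_map, h.hPQ])
  have hAQ : A Q = P ∨ A Q = Q := hvert (A Q) (A P) (hAmem _ ⟨hQC.2.1, hQD.2.1⟩)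
    (hAmem _ ⟨hPC.2.1, hPD.2.1⟩) (hA.hyp_map _ h.hQ) (hA.hyp_map _ h.hP)
    (by rw [hA.lor_map, lor_comm, h.hPQ])
  have hne : P ≠ Q := by
    intro he
    have := h.hPQ
    rw [← he, h.hP.1] at this
    linarith [h.hs]
  have hpq : (A P = P ∧ A Q = Q) ∨ (A P = Q ∧ A Q = P) := by
    rcases hAP with e1 | e1 <;> rcases hAQ with e2 | e2
    · exact absurd (A.injective (e1.trans e2.symm)) hne
    · exact Or.inl ⟨e1, e2⟩
    · exact Or.inr ⟨e1, e2⟩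
    · exact absurd (A.injective (e1.trans e2.symm)) hne
  have hn' : A n = n ∨ A n = -n := by
    refine h.image_normal ?_ ?_ (by rw [hA.lor_map, h.hn])
    · rcases hpq with ⟨e1, e2⟩ | ⟨e1, e2⟩
      · rw [← e1, hA.lor_map, lor_comm, h.hPn, ]
      · rw [← e2, hA.lor_map, lor_comm, h.hQn, ]
    · rcases hpq with ⟨e1, e2⟩ | ⟨e1, e2⟩
      · rw [← e2, hA.lor_map, lor_comm, h.hQn, ]
      · rw [← e1, hA.lor_map, lor_comm, h.hPn, ]
  have h1 := Prof_image hA (C ∩ D) P Q n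
  have h2 := Prof_image hA (C ∩ D) P Q (-n)
  rw [hAM] at h1 h2
  rw [map_neg] at h2
  rcases hpq with ⟨e1, e2⟩ | ⟨e1, e2⟩ <;> rcases hn' with e3 | e3 <;> rw [e1, e2, e3] at h1 h2
  · refine absurd (h.map_unique (B := LinearEquiv.refl ℝ Vec) ?_ ?_ ?_) hA1 <;> simpa
  · left
    rw [← hPC', ← hPD', h1]
  · right; right
    rw [Prof_swap, hPC'] at h1
    rw [Prof_swap, hPD'] at h2
    exact ⟨h1.symm, h2.symm⟩
  · right; left
    rw [Prof_swap, hPD', hPC'] at h1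
    exact h1.symm

end Lens

/-! ### The boundary of a body as a graph -/

/-- The affine chart `E + u e₁ + v e₂`. -/
def chart (E e1 e2 : Vec) (u v : ℝ) : Vec := E + u • e1 + v • e2

section chart

variable {E e1 e2 : Vec}

theorem continuous_chart : Continuous fun p : ℝ × ℝ => chart E e1 e2 p.1 p.2 := by
  unfold chart; fun_prop

theorem OFrame.lor_chart (h : OFrame E e1 e2) (u v u' v' : ℝ) :
    lor (chart E e1 e2 u v) (chart E e1 e2 u' v') = u * u' + v * v' - 1 := by
  simp only [chart, lor_add_left, lor_add_right, lor_smul_left, lor_smul_right, h.hE.1, h.h11,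
    h.h22, h.h1, h.h2, h.h12, lor_comm e1 E, lor_comm e2 E, lor_comm e2 e1]
  ring

theorem OFrame.lor_chart_E (h : OFrame E e1 e2) (u v : ℝ) :
    lor (chart E e1 e2 u v) E = -1 := by
  simp only [chart, lor_add_left, lor_smul_left, h.hE.1, lor_comm e1 E, lor_comm e2 E, h.h1, h.h2]
  ring

theorem OFrame.chart_mem_Fut (h : OFrame E e1 e2) {u v : ℝ} :
    chart E e1 e2 u v ∈ Fut ↔ u ^ 2 + v ^ 2 < 1 := by
  constructor
  · intro h1
    have := h1.1
    rw [h.lor_chart] at this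
    linarith
  · intro h1
    refine mem_Fut_of_lor_neg ?_ (Hyp_subset_Fut h.hE) ?_
    · rw [h.lor_chart]; linarith
    · rw [h.lor_chart_E]; norm_num

theorem OFrame.exists_chart (h : OFrame E e1 e2) {z : Vec} (hz : z ∈ Fut) :
    ∃ c u v : ℝ, 0 < c ∧ z = c • chart E e1 e2 u v := by
  have hc := Fut_lor_neg hz (Hyp_subset_Fut h.hE)
  refine ⟨-lor z E, lor z e1 / (-lor z E), lor z e2 / (-lor z E), by linarith, ?_⟩
  conv_lhs => rw [h.expand z]
  have hne : -lor z E ≠ 0 := by linarith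
  generalize -lor z E = c at *
  simp only [chart, smul_add, smul_smul]
  rw [mul_div_cancel₀ _ hne, mul_div_cancel₀ _ hne]

/-- The body `C` is, near its boundary point `E`, the epigraph of the convex function `φ`. -/
structure Chart (C : Set Vec) (E e1 e2 : Vec) (r M b : ℝ) (φ : ℝ → ℝ) : Prop where
  frame : OFrame E e1 e2
  r_pos : 0 < r
  M_pos : 0 < M
  b_pos : 0 < b
  zero : φ 0 = 0
  conv : ConvexOn ℝ (Icc (-r) r) φ
  bound : ∀ u ∈ Icc (-r) r, |φ u| ≤ M * |u|
  mem : ∀ u ∈ Icc (-r) r, ∀ v, φ u ≤ v → v ≤ b → chart E e1 e2 u v ∈ C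
  int : ∀ u ∈ Icc (-r) r, ∀ v, φ u < v → v ≤ b → chart E e1 e2 u v ∈ interior C
  lower : ∀ u ∈ Icc (-r) r, ∀ v, chart E e1 e2 u v ∈ C → φ u ≤ v

theorem OFrame.neg (h : OFrame E e1 e2) : OFrame E (-e1) e2 :=
  ⟨h.hE, by simp [h.h11], h.h22, by simp [h.h1], h.h2, by simp [h.h12]⟩

theorem chart_neg (u v : ℝ) : chart E (-e1) e2 u v = chart E e1 e2 (-u) v := by
  simp [chart]

theorem Chart.neg {C : Set Vec} {r M b : ℝ} {φ : ℝ → ℝ} (h : Chart C E e1 e2 r M b φ) :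
    Chart C E (-e1) e2 r M b (fun u => φ (-u)) := by
  have hm : ∀ u ∈ Icc (-r) r, -u ∈ Icc (-r) r := fun u hu =>
    ⟨by linarith [hu.2], by linarith [hu.1]⟩
  refine ⟨h.frame.neg, h.r_pos, h.M_pos, h.b_pos, by simpa using h.zero, ?_, ?_, ?_, ?_, ?_⟩
  · refine ⟨convex_Icc _ _, fun x hx y hy a b ha hb hab => ?_⟩
    have := h.conv.2 (hm x hx) (hm y hy) ha hb hab
    simp only [smul_eq_mul] at *
    rw [show -(a * x + b * y) = a * -x + b * -y by ring]
    exact this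
  · intro u hu
    have := h.bound _ (hm u hu)
    rwa [abs_neg] at this
  · intro u hu v h1 h2
    rw [chart_neg]; exact h.mem _ (hm u hu) v h1 h2
  · intro u hu v h1 h2
    rw [chart_neg]; exact h.int _ (hm u hu) v h1 h2
  · intro u hu v h1
    rw [chart_neg] at h1; exact h.lower _ (hm u hu) v h1

theorem exists_frame_int {C : Set Vec} (hC : IsBody C) (hE : E ∈ Bd C) :
    ∃ e1 e2 b, OFrame E e1 e2 ∧ 0 < b ∧ chart E e1 e2 0 b ∈ interior C := by
  obtain ⟨x, hx⟩ := hC.int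
  have hxF := hC.fut (interior_subset hx)
  have hc := Fut_lor_neg hxF (Hyp_subset_Fut hE.1)
  -- the scaled component orthogonal to `E`
  set y : Vec := (-lor x E)⁻¹ • x - E with hy
  have hyE : lor y E = 0 := by
    rw [hy]
    simp only [lor_sub_left, lor_smul_left, hE.1.1]
    rw [inv_neg, neg_mul, inv_mul_cancel₀ hc.ne]
    norm_num
  have hEy : E + y ∈ interior C := by
    rw [hy, add_sub_cancel]
    exact hC.smul_int (inv_pos.2 (by linarith)) hx
  have hy0 : y ≠ 0 := by
    intro h0
    rw [h0, add_zero] at hEy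
    exact hE.2.2 hEy
  have hyy := lor_orth_pos hE.1 hyE hy0
  have hb := Real.sqrt_pos.2 hyy
  have hb2 := Real.sq_sqrt hyy.le
  set b := Real.sqrt (lor y y)
  have hyeq : b • (b⁻¹ • y) = y := by rw [smul_smul, mul_inv_cancel₀ hb.ne', one_smul]
  have h22 : lor (b⁻¹ • y) (b⁻¹ • y) = 1 := by
    simp only [lor_smul_left, lor_smul_right]
    rw [← hb2]; field_simp
  have h2 : lor E (b⁻¹ • y) = 0 := by rw [lor_smul_right, lor_comm, hyE, mul_zero]
  obtain ⟨w, hw⟩ : ∃ w : Vec, lor E w = 0 ∧ lor w (b⁻¹ • y) = 0 ∧ lor w w = 1 := by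
    generalize b⁻¹ • y = f at h22 h2
    have h00 := hE.1.1
    refine ⟨(E.2.1 * f.2.2 - E.2.2 * f.2.1, E.1 * f.2.2 - E.2.2 * f.1,
      E.2.1 * f.1 - E.1 * f.2.1), ?_, ?_, ?_⟩
    · simp only [lor]; ring
    · simp only [lor]; ring
    · have : lor (E.2.1 * f.2.2 - E.2.2 * f.2.1, E.1 * f.2.2 - E.2.2 * f.1,
        E.2.1 * f.1 - E.1 * f.2.1) (E.2.1 * f.2.2 - E.2.2 * f.2.1, E.1 * f.2.2 - E.2.2 * f.1,
        E.2.1 * f.1 - E.1 * f.2.1) = (lor E f) ^ 2 - lor E E * lor f f := by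
        simp only [lor]; ring
      rw [this, h2, h00, h22]; norm_num
  refine ⟨w, b⁻¹ • y, b, ⟨hE.1, hw.2.2, h22, hw.1, h2, hw.2.1⟩, hb, ?_⟩
  simp only [chart, zero_smul, add_zero, hyeq]
  exact hEy

theorem exists_Chart {C : Set Vec} (hC : IsBody C) (hE : E ∈ Bd C) :
    ∃ e1 e2 r M b φ, Chart C E e1 e2 r M b φ := by
  obtain ⟨e1, e2, b, hf, hb, h_inner⟩ := exists_frame_int hC hE
  obtain ⟨r1, hr1, hr⟩ : ∃ r1 > 0, ∀ u : ℝ, |u| ≤ r1 → chart E e1 e2 u b ∈ interior C := by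
    have hcont : Continuous fun u : ℝ => chart E e1 e2 u b :=
      continuous_chart.comp (by fun_prop : Continuous fun u : ℝ => (u, b))
    have := (isOpen_interior.preimage hcont).mem_nhds (show (0 : ℝ) ∈ _ from h_inner)
    obtain ⟨ε, hε, h1⟩ := Metric.mem_nhds_iff.1 this
    refine ⟨ε / 2, by positivity, fun u hu => h1 ?_⟩
    rw [mem_ball_zero_iff, Real.norm_eq_abs]
    linarith
  set M := b / r1 with hM
  have hMpos : 0 < M := by positivity
  have hMr : M * r1 = b := by rw [hM]; field_simp
  have hlow : ∀ u v : ℝ, |u| ≤ r1 → chart E e1 e2 u v ∈ C → -(M * |u|) ≤ v := by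
    intro u v hu hv
    by_contra hlt
    push Not at hlt
    have hbb := hr 0 (by simpa using hr1.le)
    rcases eq_or_ne u 0 with rfl | hu0
    · simp at hlt
      have := hC.add_int (hC.smul b hb _ hv) (hC.smul_int (neg_pos.2 hlt) hbb)
      rw [show b • chart E e1 e2 0 v + -v • chart E e1 e2 0 b = (b - v) • E by
        simp only [chart]; module, hC.smul_int_iff (by linarith)] at this
      exact hE.2.2 this
    · have hup := abs_pos.2 hu0
      set t := r1 / |u| with ht
      have htp : 0 < t := by positivity
      have htu : t * |u| = r1 := by rw [ht]; field_simp
      have h1 := hr (-(t * u)) (by rw [abs_neg, abs_mul, abs_of_pos htp, htu])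
      have h2 := hC.add_int (hC.smul t htp _ hv) h1
      have hneg : t * v + b < 0 := by nlinarith
      have := hC.add_int (hC.smul b hb _ (interior_subset h2))
        (hC.smul_int (neg_pos.2 hneg) hbb)
      rw [show b • (t • chart E e1 e2 u v + chart E e1 e2 (-(t * u)) b) +
        -(t * v + b) • chart E e1 e2 0 b = (b * t - t * v) • E by
        simp only [chart]; module, hC.smul_int_iff (by nlinarith)] at this
      exact hE.2.2 this
  have hupm : ∀ u : ℝ, |u| ≤ r1 → chart E e1 e2 u (M * |u|) ∈ C := by
    intro u hu
    rcases eq_or_ne u 0 with rfl | hu0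
    · simpa [chart] using hE.2.1
    have hup := abs_pos.2 hu0
    set c := |u| / r1 with hc
    have hcp : 0 < c := by positivity
    have hc1 : c ≤ 1 := by rw [hc, div_le_one hr1]; exact hu
    have h1 := hr (u / c) (by
      rw [abs_div, abs_of_pos hcp, hc]; field_simp; exact le_rfl)
    have := hC.convex hE.2.1 (interior_subset h1) (sub_nonneg.2 hc1) hcp.le (by ring)
    convert this using 1
    have e1' : c * (u / c) = u := by field_simp
    have e2' : c * b = M * |u| := by rw [hc, ← hMr]; field_simp
    simp only [chart]
    rw [← e2']
    nth_rewrite 1 [← e1']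
    module
  obtain ⟨r, hr0, hrr1, hrM, hrb⟩ : ∃ r > 0, r ≤ r1 ∧ r ^ 2 * (1 + M ^ 2) < 1 ∧ M * r < b := by
    refine ⟨min (r1 / 2) (1 / (2 * (1 + M ^ 2))), by positivity, ?_, ?_, ?_⟩
    · exact (min_le_left _ _).trans (by linarith)
    · have h1 := min_le_right (r1 / 2) (1 / (2 * (1 + M ^ 2)))
      have h0 : 0 < min (r1 / 2) (1 / (2 * (1 + M ^ 2))) := by positivity
      set r := min (r1 / 2) (1 / (2 * (1 + M ^ 2)))
      have h2 : r * (1 + M ^ 2) ≤ 1 / 2 := by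
        calc r * (1 + M ^ 2) ≤ 1 / (2 * (1 + M ^ 2)) * (1 + M ^ 2) := by gcongr
          _ = 1 / 2 := by field_simp
      have h3 : r ≤ 1 / 2 := by nlinarith [sq_nonneg M]
      nlinarith
    · have h1 := min_le_left (r1 / 2) (1 / (2 * (1 + M ^ 2)))
      nlinarith
  have habs : ∀ u ∈ Icc (-r) r, |u| ≤ r := fun u hu => abs_le.2 hu
  let S : ℝ → Set ℝ := fun u => {v | chart E e1 e2 u v ∈ C}
  have hbdd : ∀ u ∈ Icc (-r) r, BddBelow (S u) := fun u hu =>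
    ⟨-(M * |u|), fun v hv => hlow u v ((habs u hu).trans hrr1) hv⟩
  have hne : ∀ u ∈ Icc (-r) r, M * |u| ∈ S u := fun u hu => hupm u ((habs u hu).trans hrr1)
  have hφb : ∀ u ∈ Icc (-r) r, |sInf (S u)| ≤ M * |u| := fun u hu => by
    rw [abs_le]
    exact ⟨le_csInf ⟨_, hne u hu⟩ fun v hv => hlow u v ((habs u hu).trans hrr1) hv,
      csInf_le (hbdd u hu) (hne u hu)⟩
  have hatt : ∀ u ∈ Icc (-r) r, chart E e1 e2 u (sInf (S u)) ∈ C := by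
    intro u hu
    have h1 := csInf_mem_closure ⟨_, hne u hu⟩ (hbdd u hu)
    have hcont : Continuous fun v : ℝ => chart E e1 e2 u v :=
      continuous_chart.comp (by fun_prop : Continuous fun v : ℝ => (u, v))
    refine hC.closed _ ?_ (map_mem_closure hcont h1 fun v hv => hv)
    rw [hf.chart_mem_Fut]
    have h2 := hφb u hu
    have h3 : (sInf (S u)) ^ 2 ≤ (M * |u|) ^ 2 := by
      rw [← sq_abs (sInf (S u))]; gcongr
    rw [mul_pow, sq_abs] at h3
    have h4 : u ^ 2 ≤ r ^ 2 := by rw [← sq_abs u]; gcongr; exact habs u hu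
    nlinarith [sq_nonneg M]
  have hlt : ∀ u ∈ Icc (-r) r, sInf (S u) < b := fun u hu => by
    have h1 := (abs_le.1 (hφb u hu)).2
    have h2 := habs u hu
    nlinarith
  have hcomb : ∀ u v c : ℝ, c • chart E e1 e2 u b + (1 - c) • chart E e1 e2 u v =
      chart E e1 e2 u (c * b + (1 - c) * v) := fun u v c => by simp only [chart]; module
  refine ⟨e1, e2, r, M, b, fun u => sInf (S u), hf, hr0, hMpos, hb, ?_, ?_, hφb, ?_, ?_, ?_⟩
  · have := hφb 0 ⟨by linarith, hr0.le⟩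
    simpa using this
  · refine ⟨convex_Icc _ _, fun x hx y hy a c ha hc hac => ?_⟩
    refine csInf_le (hbdd _ (convex_Icc _ _ hx hy ha hc hac)) ?_
    have := hC.convex (hatt x hx) (hatt y hy) ha hc hac
    show chart E e1 e2 _ _ ∈ C
    convert this using 1
    simp only [chart, smul_eq_mul]
    have : E = (a + c) • E := by rw [hac, one_smul]
    nth_rewrite 1 [this]
    module
  · intro u hu v h1 h2
    have h3 := hlt u hu
    set w := sInf (S u) with hw
    have := hC.convex (interior_subset (hr u ((habs u hu).trans hrr1))) (hatt u hu)
      (a := (v - w) / (b - w)) (b := 1 - (v - w) / (b - w))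
      (div_nonneg (by linarith) (by linarith))
      (by rw [sub_nonneg, div_le_one (by linarith)]; linarith) (by ring)
    rw [hcomb] at this
    convert this using 2
    rw [← hw]
    have : b - w ≠ 0 := by linarith
    field_simp
    ring
  · intro u hu v h1 h2
    have h3 := hlt u hu
    set w := sInf (S u) with hw
    have h4 : 0 < (v - w) / (b - w) := div_pos (by linarith) (by linarith)
    have := hC.comb_int (a := 1 - (v - w) / (b - w)) (b := 0) (c := (v - w) / (b - w))
      (by rw [sub_nonneg, div_le_one (by linarith)]; linarith) le_rfl h4
      (hatt u hu) (hatt u hu) (hr u ((habs u hu).trans hrr1))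
    rw [zero_smul, add_zero, add_comm, hcomb] at this
    convert this using 2
    rw [← hw]
    have : b - w ≠ 0 := by linarith
    field_simp
    ring
  · intro u hu v hv
    exact csInf_le (hbdd u hu) hv

/-- A convex function has almost constant difference quotients on one side of a point. -/
theorem Chart.slopes {C : Set Vec} {r M b : ℝ} {φ : ℝ → ℝ} (h : Chart C E e1 e2 r M b φ)
    {ε : ℝ} (hε : 0 < ε) : ∃ m : ℝ, ∃ r' > 0, r' ≤ r ∧ |m| ≤ M ∧
      ∀ u v : ℝ, 0 ≤ u → u ≤ v → v ≤ r' →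
        m * (v - u) ≤ φ v - φ u ∧ φ v - φ u ≤ (m + ε) * (v - u) := by
  have hI : ∀ u, 0 ≤ u → u ≤ r → u ∈ Icc (-r) r := fun u h1 h2 => ⟨by linarith, h2⟩
  set T : Set ℝ := (fun u => φ u / u) '' Ioc 0 r with hT
  have hlb : ∀ t ∈ T, -M ≤ t := by
    rintro _ ⟨u, hu, rfl⟩
    have := (abs_le.1 (h.bound u (hI u hu.1.le hu.2))).1
    rw [abs_of_pos hu.1] at this
    rw [le_div_iff₀ hu.1]; linarith
  have hne : T.Nonempty := ⟨_, r, ⟨h.r_pos, le_rfl⟩, rfl⟩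
  have hbb : BddBelow T := ⟨-M, hlb⟩
  have hmu : ∀ u, 0 ≤ u → u ≤ r → sInf T * u ≤ φ u := by
    intro u h1 h2
    rcases h1.eq_or_lt with rfl | h1
    · simp [h.zero]
    · have := csInf_le hbb ⟨u, ⟨h1, h2⟩, rfl⟩
      rwa [le_div_iff₀ h1] at this
  have hub : sInf T ≤ M := by
    refine (csInf_le hbb ⟨r, ⟨h.r_pos, le_rfl⟩, rfl⟩).trans ?_
    have := (abs_le.1 (h.bound r (hI r h.r_pos.le le_rfl))).2
    rw [abs_of_pos h.r_pos] at this
    show φ r / r ≤ M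
    rw [div_le_iff₀ h.r_pos]; linarith
  obtain ⟨_, ⟨w, hw, rfl⟩, hw2⟩ := exists_lt_of_csInf_lt hne
    (show sInf T < sInf T + ε / 2 by linarith)
  replace hw2 : φ w < (sInf T + ε / 2) * w := by rwa [div_lt_iff₀ hw.1] at hw2
  refine ⟨sInf T, w / 2, by have := hw.1; positivity, by linarith [hw.1, hw.2],
    abs_le.2 ⟨le_csInf hne hlb, hub⟩, ?_⟩
  intro u v hu huv hv
  have hw0 := hw.1
  have hwr := hw.2
  rcases huv.eq_or_lt with rfl | huv
  · simp
  have h0v := hmu v (by linarith) (by linarith)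
  constructor
  · rcases hu.eq_or_lt with rfl | hu
    · rw [h.zero]; simpa using h0v
    · have := h.conv.slope_mono_adjacent (hI 0 le_rfl h.r_pos.le) (hI v (by linarith)
        (by linarith)) hu huv
      rw [h.zero, sub_zero, sub_zero] at this
      have h1 := hmu u hu.le (by linarith)
      have h2 : sInf T ≤ φ u / u := by rwa [le_div_iff₀ hu]
      have h3 := h2.trans this
      rwa [le_div_iff₀ (by linarith)] at h3
  · have := h.conv.slope_mono_adjacent (hI u hu (by linarith)) (hI w hw0.le hwr) huv
      (by linarith : v < w)
    have h2 : (φ w - φ v) / (w - v) ≤ sInf T + ε := by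
      rw [div_le_iff₀ (by linarith)]
      nlinarith
    have h3 := this.trans h2
    rwa [div_le_iff₀ (by linarith)] at h3

end chart

/-! ### Chords in a chart -/

section chords

variable {E e1 e2 : Vec}

/-- The normal of the line `v = m u + k` of the chart, pointing downwards. -/
def lineVec (E e1 e2 : Vec) (m k : ℝ) : Vec := -k • E + m • e1 - e2

/-- Its length. -/
noncomputable def lineLen (m k : ℝ) : ℝ := Real.sqrt (1 + m ^ 2 - k ^ 2)

/-- The unit normal of the line `v = m u + k` of the chart, pointing downwards. -/
noncomputable def lineNormal (E e1 e2 : Vec) (m k : ℝ) : Vec :=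
  (lineLen m k)⁻¹ • lineVec E e1 e2 m k

/-- The height of the light cone normalisation. -/
noncomputable def hgt (u v : ℝ) : ℝ := Real.sqrt (1 - u ^ 2 - v ^ 2)

theorem OFrame.lor_chart_lineVec (h : OFrame E e1 e2) (m k u v : ℝ) :
    lor (chart E e1 e2 u v) (lineVec E e1 e2 m k) = m * u + k - v := by
  simp only [chart, lineVec, lor_add_left, lor_add_right, lor_sub_right, lor_smul_left,
    lor_smul_right, h.hE.1, h.h11, h.h22, h.h1, h.h2, h.h12, lor_comm e1 E, lor_comm e2 E,
    lor_comm e2 e1]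
  ring

theorem OFrame.lor_lineVec (h : OFrame E e1 e2) (m k : ℝ) :
    lor (lineVec E e1 e2 m k) (lineVec E e1 e2 m k) = 1 + m ^ 2 - k ^ 2 := by
  simp only [lineVec, lor_add_left, lor_add_right, lor_sub_right, lor_sub_left, lor_smul_left,
    lor_smul_right, h.hE.1, h.h11, h.h22, h.h1, h.h2, h.h12, lor_comm e1 E, lor_comm e2 E,
    lor_comm e2 e1]
  ring

theorem OFrame.nrm_chart (h : OFrame E e1 e2) (u v : ℝ) :
    nrm (chart E e1 e2 u v) = (hgt u v)⁻¹ • chart E e1 e2 u v := by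
  rw [nrm, h.lor_chart, hgt]
  congr 3
  ring

theorem hgt_pos {u v : ℝ} (h : u ^ 2 + v ^ 2 < 1) : 0 < hgt u v :=
  Real.sqrt_pos.2 (by linarith)

theorem hgt_sq {u v : ℝ} (h : u ^ 2 + v ^ 2 < 1) : hgt u v ^ 2 = 1 - u ^ 2 - v ^ 2 :=
  Real.sq_sqrt (by linarith)

theorem hgt_le_one (u v : ℝ) : hgt u v ≤ 1 :=
  Real.sqrt_le_one.2 (by nlinarith [sq_nonneg u, sq_nonneg v])

theorem OFrame.smul_nrm_chart (h : OFrame E e1 e2) {u v : ℝ} (hu : u ^ 2 + v ^ 2 < 1) :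
    hgt u v • nrm (chart E e1 e2 u v) = chart E e1 e2 u v := by
  rw [h.nrm_chart, smul_smul, mul_inv_cancel₀ (hgt_pos hu).ne', one_smul]

variable {u1 v1 u2 v2 m k : ℝ}

theorem OFrame.lineLen_sq_pos (h : OFrame E e1 e2) (hX : u1 ^ 2 + v1 ^ 2 < 1)
    (h1 : v1 = m * u1 + k) : 0 < 1 + m ^ 2 - k ^ 2 := by
  rw [← h.lor_lineVec]
  refine lor_orth_pos (w := nrm (chart E e1 e2 u1 v1)) (nrm_mem (h.chart_mem_Fut.2 hX)) ?_ ?_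
  · rw [lor_comm, h.nrm_chart, lor_smul_left, h.lor_chart_lineVec, h1]; ring
  · intro h0
    have : lor (lineVec E e1 e2 m k) e2 = -1 := by
      simp only [lineVec, lor_add_left, lor_sub_left, lor_smul_left, h.h2, h.h12, h.h22]; ring
    rw [h0] at this
    simp at this

theorem OFrame.lineLen_pos (h : OFrame E e1 e2) (hX : u1 ^ 2 + v1 ^ 2 < 1)
    (h1 : v1 = m * u1 + k) : 0 < lineLen m k :=
  Real.sqrt_pos.2 (h.lineLen_sq_pos hX h1)

theorem OFrame.lineLen_sq (h : OFrame E e1 e2) (hX : u1 ^ 2 + v1 ^ 2 < 1)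
    (h1 : v1 = m * u1 + k) : lineLen m k ^ 2 = 1 + m ^ 2 - k ^ 2 :=
  Real.sq_sqrt (h.lineLen_sq_pos hX h1).le

theorem OFrame.lor_chart_lineNormal (h : OFrame E e1 e2) (m k u v : ℝ) :
    lor (chart E e1 e2 u v) (lineNormal E e1 e2 m k) = (m * u + k - v) / lineLen m k := by
  rw [lineNormal, lor_smul_right, h.lor_chart_lineVec]; ring

theorem OFrame.nrm_chart_ne (h : OFrame E e1 e2)
    (hX2 : u2 ^ 2 + v2 ^ 2 < 1) (hne : u1 ≠ u2) :
    nrm (chart E e1 e2 u1 v1) ≠ nrm (chart E e1 e2 u2 v2) := by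
  intro he
  have e1' := congrArg (fun z => lor z E) he
  have e2' := congrArg (fun z => lor z e1) he
  simp only [h.nrm_chart, lor_smul_left, h.lor_chart_E] at e1' e2'
  have f : ∀ u v, lor (chart E e1 e2 u v) e1 = u := fun u v => by
    simp only [chart, lor_add_left, lor_smul_left, h.h1, h.h11, lor_comm e2 e1, h.h12]; ring
  rw [f, f] at e2'
  have e3 : (hgt u1 v1)⁻¹ = (hgt u2 v2)⁻¹ := by linarith
  rw [e3] at e2'
  exact hne (mul_left_cancel₀ (inv_pos.2 (hgt_pos hX2)).ne' e2')

theorem OFrame.cframe (h : OFrame E e1 e2) (hX1 : u1 ^ 2 + v1 ^ 2 < 1)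
    (hX2 : u2 ^ 2 + v2 ^ 2 < 1) (hne : u1 ≠ u2) (h1 : v1 = m * u1 + k) (h2 : v2 = m * u2 + k) :
    CFrame (-lor (nrm (chart E e1 e2 u1 v1)) (nrm (chart E e1 e2 u2 v2)))
      (nrm (chart E e1 e2 u1 v1)) (nrm (chart E e1 e2 u2 v2)) (lineNormal E e1 e2 m k) := by
  have hP := nrm_mem (h.chart_mem_Fut.2 hX1)
  have hQ := nrm_mem (h.chart_mem_Fut.2 hX2)
  have hW := h.lineLen_pos hX1 h1
  refine ⟨hP, hQ, by ring, ?_, ?_, ?_, ?_⟩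
  · rcases (hyp_lor_le hP hQ).lt_or_eq with h3 | h3
    · linarith
    · exact absurd (hyp_lor_eq hP hQ h3) (h.nrm_chart_ne hX2 hne)
  · rw [h.nrm_chart, lor_smul_left, h.lor_chart_lineNormal, h1]; ring
  · rw [h.nrm_chart, lor_smul_left, h.lor_chart_lineNormal, h2]; ring
  · rw [lineNormal, lor_smul_left, lor_smul_right, h.lor_lineVec, ← h.lineLen_sq hX1 h1]
    field_simp

theorem OFrame.lor_nrm_nrm (h : OFrame E e1 e2) :
    -lor (nrm (chart E e1 e2 u1 v1)) (nrm (chart E e1 e2 u2 v2)) =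
      (1 - u1 * u2 - v1 * v2) / (hgt u1 v1 * hgt u2 v2) := by
  rw [h.nrm_chart, h.nrm_chart, lor_smul_left, lor_smul_right, h.lor_chart]
  field_simp
  ring

theorem OFrame.sqrt_dist (h : OFrame E e1 e2) (hX1 : u1 ^ 2 + v1 ^ 2 < 1)
    (hX2 : u2 ^ 2 + v2 ^ 2 < 1) (hlt : u1 < u2) (h1 : v1 = m * u1 + k) (h2 : v2 = m * u2 + k) :
    Real.sqrt ((-lor (nrm (chart E e1 e2 u1 v1)) (nrm (chart E e1 e2 u2 v2))) ^ 2 - 1) =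
      (u2 - u1) * lineLen m k / (hgt u1 v1 * hgt u2 v2) := by
  have ha := hgt_pos hX1
  have hb := hgt_pos hX2
  have hW := h.lineLen_pos hX1 h1
  rw [h.lor_nrm_nrm]
  have : ((1 - u1 * u2 - v1 * v2) / (hgt u1 v1 * hgt u2 v2)) ^ 2 - 1 =
      ((u2 - u1) * lineLen m k / (hgt u1 v1 * hgt u2 v2)) ^ 2 := by
    rw [div_pow, div_pow, mul_pow, mul_pow, h.lineLen_sq hX1 h1, hgt_sq hX1, hgt_sq hX2]
    have e1' : 1 - u1 ^ 2 - v1 ^ 2 ≠ 0 := by linarith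
    have e2' : 1 - u2 ^ 2 - v2 ^ 2 ≠ 0 := by linarith
    field_simp
    rw [h1, h2]
    ring
  rw [this, Real.sqrt_sq]
  have : 0 < u2 - u1 := by linarith
  positivity

theorem OFrame.chart_decomp (h : OFrame E e1 e2) (hX1 : u1 ^ 2 + v1 ^ 2 < 1)
    (hX2 : u2 ^ 2 + v2 ^ 2 < 1) (hlt : u1 < u2) (h1 : v1 = m * u1 + k) (h2 : v2 = m * u2 + k)
    {u v d l μ : ℝ} (hd : d = m * u + k - v)
    (hl : l = (u2 - u + d / lineLen m k ^ 2 * (m + k * u2)) / (u2 - u1))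
    (hμ : μ = (u - u1 - d / lineLen m k ^ 2 * (m + k * u1)) / (u2 - u1)) :
    chart E e1 e2 u v = (l * hgt u1 v1) • nrm (chart E e1 e2 u1 v1) +
      (μ * hgt u2 v2) • nrm (chart E e1 e2 u2 v2) +
      (d / lineLen m k) • lineNormal E e1 e2 m k := by
  have hW := h.lineLen_pos hX1 h1
  have hW2 := h.lineLen_sq hX1 h1
  rw [mul_smul, mul_smul, h.smul_nrm_chart hX1, h.smul_nrm_chart hX2, lineNormal, smul_smul]
  have e0 : d / lineLen m k * (lineLen m k)⁻¹ = d / lineLen m k ^ 2 := by field_simp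
  rw [e0]
  set t := d / lineLen m k ^ 2 with ht
  have hD : u2 - u1 ≠ 0 := by linarith
  have htW : t * (1 + m ^ 2 - k ^ 2) = d := by rw [ht, ← hW2]; field_simp
  have hlm : l + μ - k * t = 1 := by rw [hl, hμ]; field_simp; ring
  have hlu : l * u1 + μ * u2 + t * m = u := by rw [hl, hμ]; field_simp; ring
  have hlv : l * v1 + μ * v2 - t = v := by
    have : l * v1 + μ * v2 - t = m * (l * u1 + μ * u2) + (l + μ) * k - t := by
      rw [h1, h2]; ring
    rw [this]
    linear_combination m * hlu + k * hlm - htW - hd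
  have : l • chart E e1 e2 u1 v1 + μ • chart E e1 e2 u2 v2 + t • lineVec E e1 e2 m k =
      (l + μ - k * t) • E + (l * u1 + μ * u2 + t * m) • e1 + (l * v1 + μ * v2 - t) • e2 := by
    simp only [chart, lineVec]; module
  rw [this, hlm, hlu, hlv, one_smul, chart]

/-- The apex of the inner triangle in the chart. -/
theorem OFrame.inner_apex (h : OFrame E e1 e2) (hX1 : u1 ^ 2 + v1 ^ 2 < 1)
    (hX2 : u2 ^ 2 + v2 ^ 2 < 1) (hlt : u1 < u2) (h1 : v1 = m * u1 + k) (h2 : v2 = m * u2 + k)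
    {x y t L : ℝ} (hL : L = x * hgt u2 v2 + y * hgt u1 v1 + t * (u2 - u1) * k) (hL0 : L ≠ 0) :
    x • nrm (chart E e1 e2 u1 v1) + y • nrm (chart E e1 e2 u2 v2) +
      (t * Real.sqrt ((-lor (nrm (chart E e1 e2 u1 v1)) (nrm (chart E e1 e2 u2 v2))) ^ 2 - 1)) •
        (-lineNormal E e1 e2 m k) = (L / (hgt u1 v1 * hgt u2 v2)) •
      chart E e1 e2 ((x * hgt u2 v2 * u1 + y * hgt u1 v1 * u2 - t * (u2 - u1) * m) / L)
        ((x * hgt u2 v2 * v1 + y * hgt u1 v1 * v2 + t * (u2 - u1)) / L) := by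
  have ha := hgt_pos hX1
  have hb := hgt_pos hX2
  have hW := h.lineLen_pos hX1 h1
  rw [h.sqrt_dist hX1 hX2 hlt h1 h2, h.nrm_chart, h.nrm_chart, lineNormal, ← smul_neg]
  set a := hgt u1 v1
  set b := hgt u2 v2
  simp only [smul_smul]
  have e1' : t * ((u2 - u1) * lineLen m k / (a * b)) * (lineLen m k)⁻¹ =
      (a * b)⁻¹ * (t * (u2 - u1)) := by field_simp
  have e2' : x * a⁻¹ = (a * b)⁻¹ * (x * b) := by field_simp
  have e3' : y * b⁻¹ = (a * b)⁻¹ * (y * a) := by field_simp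
  have e4' : L / (a * b) = (a * b)⁻¹ * L := by field_simp
  rw [e1', e2', e3', e4']
  generalize (a * b)⁻¹ = c
  simp only [chart, smul_add, lineVec, smul_smul, smul_neg, mul_assoc c]
  rw [mul_div_cancel₀ _ hL0, mul_div_cancel₀ _ hL0, hL]
  subst h1 h2
  module

end chords

section bodychords

variable {C : Set Vec} {E e1 e2 : Vec} {r M b : ℝ} {φ : ℝ → ℝ}

/-- The boundary point of a body over the parameter `u` of a chart. -/
noncomputable def bpt (E e1 e2 : Vec) (φ : ℝ → ℝ) (u : ℝ) : Vec := nrm (chart E e1 e2 u (φ u))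

/-- A short chord of a body in a chart, on the line `v = m u + k`. -/
structure Chord (C : Set Vec) (E e1 e2 : Vec) (r M b : ℝ) (φ : ℝ → ℝ) (B ρ u1 u2 m k : ℝ) :
    Prop where
  body : IsBody C
  chart : Chart C E e1 e2 r M b φ
  lt : u1 < u2
  abs1 : |u1| ≤ ρ
  abs2 : |u2| ≤ ρ
  ρr : ρ ≤ r
  MB : M ≤ B
  ρb : ρ * (4 * B + 4) ≤ b
  ρs : ρ * (4 * B + 4) ≤ 1 / 10
  v1 : φ u1 = m * u1 + k
  v2 : φ u2 = m * u2 + k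
  abs_m : |m| ≤ B

theorem Chart.abs_bound (h : Chart C E e1 e2 r M b φ) {B ρ u : ℝ} (hB : M ≤ B) (hρr : ρ ≤ r)
    (hu : |u| ≤ ρ) : |φ u| ≤ B * ρ := by
  have := h.bound u (abs_le.1 (hu.trans hρr))
  have h0 := abs_nonneg u
  have h1 := h.M_pos
  calc |φ u| ≤ M * |u| := this
    _ ≤ B * |u| := mul_le_mul_of_nonneg_right hB h0
    _ ≤ B * ρ := mul_le_mul_of_nonneg_left hu (by linarith)

theorem Chart.small (h : Chart C E e1 e2 r M b φ) {B ρ u : ℝ} (hB : M ≤ B) (hρr : ρ ≤ r)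
    (hρs : ρ * (4 * B + 4) ≤ 1 / 10) (hu : |u| ≤ ρ) : u ^ 2 + φ u ^ 2 ≤ 1 / 100 := by
  have h1 := h.abs_bound hB hρr hu
  have h2 := h.M_pos
  have h3 := (abs_nonneg u).trans hu
  have h4 : 0 ≤ B * ρ := mul_nonneg (by linarith) h3
  have h5 : |u| ≤ 1 / 40 := by nlinarith
  have h6 : |φ u| ≤ 1 / 40 := by nlinarith
  rw [← sq_abs u, ← sq_abs (φ u)]
  nlinarith [abs_nonneg u, abs_nonneg (φ u)]

/-- Points of the body below the line of a chord lie over the chord. -/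
theorem Chart.below (hC : IsBody C) (h : Chart C E e1 e2 r M b φ) {u1 u2 m k u v : ℝ}
    (hlt : u1 < u2) (h1 : u1 ∈ Icc (-r) r) (h2 : u2 ∈ Icc (-r) r)
    (hb1 : φ u1 ≤ b) (hb2 : φ u2 ≤ b)
    (hv1 : φ u1 = m * u1 + k) (hv2 : φ u2 = m * u2 + k)
    (hz : BallChar.chart E e1 e2 u v ∈ C) (hd : v < m * u + k) :
    u ∈ Ioo u1 u2 ∧ φ u ≤ v := by
  have p1 := h.mem u1 h1 (φ u1) le_rfl hb1
  have p2 := h.mem u2 h2 (φ u2) le_rfl hb2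
  have comb : ∀ (x y : ℝ), BallChar.chart E e1 e2 x y ∈ C → ∀ t, 0 ≤ t → t ≤ 1 →
      BallChar.chart E e1 e2 (t * x + (1 - t) * u) (t * y + (1 - t) * v) ∈ C := by
    intro x y hxy t ht0 ht1
    have := hC.convex hxy hz ht0 (by linarith : 0 ≤ 1 - t) (by ring)
    convert this using 1
    simp only [BallChar.chart]
    module
  have hu2 : u < u2 := by
    by_contra hcon
    push Not at hcon
    have hD : 0 < u - u1 := by linarith
    have := comb u1 (φ u1) p1 ((u - u2) / (u - u1)) (by apply div_nonneg <;> linarith)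
      (by rw [div_le_one hD]; linarith)
    have e : (u - u2) / (u - u1) * u1 + (1 - (u - u2) / (u - u1)) * u = u2 := by
      field_simp; ring
    rw [e] at this
    have h5 := h.lower u2 h2 _ this
    rw [hv1, hv2] at h5
    have h6 : (u - u2) / (u - u1) * (m * u1 + k) + (1 - (u - u2) / (u - u1)) * (m * u + k) =
      m * u2 + k := by linear_combination m * e
    have h7 : 0 < 1 - (u - u2) / (u - u1) := by
      rw [sub_pos, div_lt_one hD]; linarith
    nlinarith
  have hu1 : u1 < u := by
    by_contra hcon
    push Not at hcon
    have hD : 0 < u2 - u := by linarith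
    have := comb u2 (φ u2) p2 ((u1 - u) / (u2 - u)) (by apply div_nonneg <;> linarith)
      (by rw [div_le_one hD]; linarith)
    have e : (u1 - u) / (u2 - u) * u2 + (1 - (u1 - u) / (u2 - u)) * u = u1 := by
      field_simp; ring
    rw [e] at this
    have h5 := h.lower u1 h1 _ this
    rw [hv1, hv2] at h5
    have h6 : (u1 - u) / (u2 - u) * (m * u2 + k) + (1 - (u1 - u) / (u2 - u)) * (m * u + k) =
      m * u1 + k := by linear_combination m * e
    have h7 : 0 < 1 - (u1 - u) / (u2 - u) := by
      rw [sub_pos, div_lt_one hD]; linarith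
    nlinarith
  exact ⟨⟨hu1, hu2⟩, h.lower u ⟨by linarith [h1.1], by linarith [h2.2]⟩ v hz⟩

theorem Chart.bpt_mem_Bd (hC : IsBody C) (h : Chart C E e1 e2 r M b φ) {u : ℝ}
    (hu : u ∈ Icc (-r) r) (hb : φ u ≤ b) : bpt E e1 e2 φ u ∈ Bd C := by
  have p := h.mem u hu (φ u) le_rfl hb
  have hF := hC.fut p
  refine ⟨nrm_mem hF, ?_, ?_⟩
  · exact hC.smul _ (inv_pos.2 (sqrt_lor_pos hF)) _ p
  · intro hi
    rw [bpt, nrm, hC.smul_int_iff (inv_pos.2 (sqrt_lor_pos hF))] at hi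
    have hc : Continuous fun y : ℝ => BallChar.chart E e1 e2 u (φ u - y) := by
      unfold BallChar.chart; fun_prop
    have : ∀ᶠ y in nhds (0:ℝ), BallChar.chart E e1 e2 u (φ u - y) ∈ interior C :=
      hc.continuousAt.eventually (isOpen_interior.mem_nhds (by simpa using hi))
    obtain ⟨η, hη, hb⟩ := Metric.eventually_nhds_iff.1 this
    have h1 := hb (y := η / 2) (by rw [Real.dist_eq]; rw [abs_of_pos] <;> linarith)
    have := h.lower u hu _ (interior_subset h1)
    linarith

namespace Chord

variable {B ρ u1 u2 m k : ℝ}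

theorem mem1 (h : Chord C E e1 e2 r M b φ B ρ u1 u2 m k) : u1 ∈ Icc (-r) r :=
  abs_le.1 (h.abs1.trans h.ρr)

theorem mem2 (h : Chord C E e1 e2 r M b φ B ρ u1 u2 m k) : u2 ∈ Icc (-r) r :=
  abs_le.1 (h.abs2.trans h.ρr)

theorem absφ1 (h : Chord C E e1 e2 r M b φ B ρ u1 u2 m k) : |φ u1| ≤ B * ρ :=
  h.chart.abs_bound h.MB h.ρr h.abs1

theorem absφ2 (h : Chord C E e1 e2 r M b φ B ρ u1 u2 m k) : |φ u2| ≤ B * ρ :=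
  h.chart.abs_bound h.MB h.ρr h.abs2

theorem ρ_pos (h : Chord C E e1 e2 r M b φ B ρ u1 u2 m k) : 0 < ρ := by
  have := (abs_le.1 h.abs1).1
  have := (abs_le.1 h.abs2).2
  linarith [h.lt]

theorem B_pos (h : Chord C E e1 e2 r M b φ B ρ u1 u2 m k) : 0 < B := h.chart.M_pos.trans_le h.MB

theorem Bρ (h : Chord C E e1 e2 r M b φ B ρ u1 u2 m k) : 4 * (B * ρ) ≤ b ∧ B * ρ ≤ 1 / 40 ∧
    ρ ≤ 1 / 40 := by
  have h1 := h.ρb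
  have h2 := h.ρs
  have h3 := h.ρ_pos
  have h4 := mul_pos h.B_pos h3
  refine ⟨by nlinarith, by nlinarith, by nlinarith⟩

theorem phi_le1 (h : Chord C E e1 e2 r M b φ B ρ u1 u2 m k) : φ u1 ≤ b := by
  have h1 := (abs_le.1 h.absφ1).2
  have := mul_pos h.B_pos h.ρ_pos
  linarith [h.Bρ.1]

theorem phi_le2 (h : Chord C E e1 e2 r M b φ B ρ u1 u2 m k) : φ u2 ≤ b := by
  have h1 := (abs_le.1 h.absφ2).2
  have := mul_pos h.B_pos h.ρ_pos
  linarith [h.Bρ.1]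

theorem abs_k (h : Chord C E e1 e2 r M b φ B ρ u1 u2 m k) : |k| ≤ 1 / 20 := by
  have h1 := h.absφ1
  have h2 : |m * u1| ≤ B * ρ := by
    rw [abs_mul]
    exact mul_le_mul h.abs_m h.abs1 (abs_nonneg _) h.B_pos.le
  have h3 : k = φ u1 - m * u1 := by rw [h.v1]; ring
  rw [h3]
  have := abs_sub (φ u1) (m * u1)
  linarith [h.Bρ.2.1]

theorem lt1 (h : Chord C E e1 e2 r M b φ B ρ u1 u2 m k) : u1 ^ 2 + φ u1 ^ 2 < 1 := by
  linarith [h.chart.small h.MB h.ρr h.ρs h.abs1]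

theorem lt2 (h : Chord C E e1 e2 r M b φ B ρ u1 u2 m k) : u2 ^ 2 + φ u2 ^ 2 < 1 := by
  linarith [h.chart.small h.MB h.ρr h.ρs h.abs2]

theorem cframe (h : Chord C E e1 e2 r M b φ B ρ u1 u2 m k) :
    CFrame (-lor (bpt E e1 e2 φ u1) (bpt E e1 e2 φ u2)) (bpt E e1 e2 φ u1) (bpt E e1 e2 φ u2)
      (lineNormal E e1 e2 m k) :=
  h.chart.frame.cframe h.lt1 h.lt2 h.lt.ne h.v1 h.v2

theorem W_sq (h : Chord C E e1 e2 r M b φ B ρ u1 u2 m k) :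
    lineLen m k ^ 2 = 1 + m ^ 2 - k ^ 2 := h.chart.frame.lineLen_sq h.lt1 h.v1

theorem W_pos (h : Chord C E e1 e2 r M b φ B ρ u1 u2 m k) :
    0 < lineLen m k := h.chart.frame.lineLen_pos h.lt1 h.v1

theorem W_ge (h : Chord C E e1 e2 r M b φ B ρ u1 u2 m k) : 99 / 100 ≤ lineLen m k ^ 2 := by
  rw [h.W_sq]
  have := h.abs_k
  have : k ^ 2 ≤ (1 / 20) ^ 2 := sq_le_sq' (by linarith [(abs_le.1 this).1]) (abs_le.1 this).2
  nlinarith [sq_nonneg m]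

theorem hgt_ge {u v : ℝ} (h : u ^ 2 + v ^ 2 ≤ 1 / 100) : 99 / 100 ≤ hgt u v :=
  Real.le_sqrt_of_sq_le (by norm_num; linarith)

theorem hgt1 (h : Chord C E e1 e2 r M b φ B ρ u1 u2 m k) : 99 / 100 ≤ hgt u1 (φ u1) :=
  hgt_ge (h.chart.small h.MB h.ρr h.ρs h.abs1)

theorem hgt2 (h : Chord C E e1 e2 r M b φ B ρ u1 u2 m k) : 99 / 100 ≤ hgt u2 (φ u2) :=
  hgt_ge (h.chart.small h.MB h.ρr h.ρs h.abs2)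

theorem lt3 (h : Chord C E e1 e2 r M b φ B ρ u1 u2 m k) :
    -lor (bpt E e1 e2 φ u1) (bpt E e1 e2 φ u2) < 3 := by
  rw [bpt, bpt, h.chart.frame.lor_nrm_nrm]
  have h1 := h.hgt1
  have h2 := h.hgt2
  rw [div_lt_iff₀ (by positivity)]
  have h3 := h.chart.small h.MB h.ρr h.ρs h.abs1
  have h4 := h.chart.small h.MB h.ρr h.ρs h.abs2
  nlinarith [sq_nonneg (u1 + u2), sq_nonneg (φ u1 + φ u2)]

theorem sqrt_dist (h : Chord C E e1 e2 r M b φ B ρ u1 u2 m k) :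
    Real.sqrt ((-lor (bpt E e1 e2 φ u1) (bpt E e1 e2 φ u2)) ^ 2 - 1) =
      (u2 - u1) * lineLen m k / (hgt u1 (φ u1) * hgt u2 (φ u2)) :=
  h.chart.frame.sqrt_dist h.lt1 h.lt2 h.lt h.v1 h.v2

/-- The coefficient of a point below the line with respect to the left end point. -/
theorem abs_mk {u : ℝ} (h : Chord C E e1 e2 r M b φ B ρ u1 u2 m k) (hu : |u| ≤ ρ) :
    |m + k * u| ≤ B + 1 := by
  have h1 := h.abs_k
  have h2 : |k * u| ≤ 1 := by
    rw [abs_mul]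
    have := h.Bρ.2.2
    nlinarith [abs_nonneg k, abs_nonneg u]
  have := abs_add_le m (k * u)
  linarith [h.abs_m]

theorem expand (h : Chord C E e1 e2 r M b φ B ρ u1 u2 m k) {u v d l μ : ℝ}
    (hd : d = m * u + k - v)
    (hl : l = (u2 - u + d / lineLen m k ^ 2 * (m + k * u2)) / (u2 - u1))
    (hμ : μ = (u - u1 - d / lineLen m k ^ 2 * (m + k * u1)) / (u2 - u1)) :
    BallChar.chart E e1 e2 u v = (l * hgt u1 (φ u1)) • bpt E e1 e2 φ u1 +
      (μ * hgt u2 (φ u2)) • bpt E e1 e2 φ u2 +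
      (d / lineLen m k) • lineNormal E e1 e2 m k :=
  h.chart.frame.chart_decomp h.lt1 h.lt2 h.lt h.v1 h.v2 hd hl hμ

theorem expand_smul (h : Chord C E e1 e2 r M b φ B ρ u1 u2 m k) {u v c α β γ : ℝ}
    (he : α • bpt E e1 e2 φ u1 + β • bpt E e1 e2 φ u2 + γ • lineNormal E e1 e2 m k =
      c • BallChar.chart E e1 e2 u v) :
    α = c * ((u2 - u + (m * u + k - v) / lineLen m k ^ 2 * (m + k * u2)) / (u2 - u1) *
      hgt u1 (φ u1)) ∧
    β = c * ((u - u1 - (m * u + k - v) / lineLen m k ^ 2 * (m + k * u1)) / (u2 - u1) *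
      hgt u2 (φ u2)) ∧ γ = c * ((m * u + k - v) / lineLen m k) := by
  rw [h.expand rfl rfl rfl, smul_add, smul_add, smul_smul, smul_smul, smul_smul] at he
  exact h.cframe.coord_eq he

/-- A point below the line of a chord lies in a flat triangle over it. -/
theorem flat_coords (h : Chord C E e1 e2 r M b φ B ρ u1 u2 m k) {κ ε : ℝ} (hκ : 0 < κ)
    (hκB : κ * (B + 1) ≤ 1 / 2) (hεκ : ε ≤ κ / 2) {u v c α β γ : ℝ}
    (hc : 0 < c) (hu : u ∈ Icc u1 u2) (he : α • bpt E e1 e2 φ u1 + β • bpt E e1 e2 φ u2 +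
      γ • lineNormal E e1 e2 m k = c • BallChar.chart E e1 e2 u v)
    (hd0 : 0 ≤ m * u + k - v)
    (hd1 : m * u + k - v ≤ ε * (u2 - u)) (hd2 : m * u + k - v ≤ ε * (u - u1)) :
    0 ≤ γ ∧
    γ ≤ κ * Real.sqrt ((-lor (bpt E e1 e2 φ u1) (bpt E e1 e2 φ u2)) ^ 2 - 1) * α ∧
    γ ≤ κ * Real.sqrt ((-lor (bpt E e1 e2 φ u1) (bpt E e1 e2 φ u2)) ^ 2 - 1) * β := by
  obtain ⟨rfl, rfl, rfl⟩ := h.expand_smul he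
  rw [h.sqrt_dist]
  have hW := h.W_pos
  have hW2 := h.W_ge
  have ha := h.hgt1
  have hb := h.hgt2
  have ha1 := hgt_le_one u1 (φ u1)
  have hb1 := hgt_le_one u2 (φ u2)
  have hD : 0 < u2 - u1 := by linarith [h.lt]
  have m1 := abs_le.1 (h.abs_mk h.abs1)
  have m2 := abs_le.1 (h.abs_mk h.abs2)
  have hB := h.B_pos
  set W := lineLen m k
  set a := hgt u1 (φ u1)
  set a' := hgt u2 (φ u2)
  set d := m * u + k - v
  have ht : d / W ^ 2 * W ^ 2 = d := by field_simp
  have ht0 : 0 ≤ d / W ^ 2 := by positivity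
  have hWd : d / W = d / W ^ 2 * W := by field_simp
  rw [hWd]
  set t := d / W ^ 2
  have ha0 : 0 < a := by linarith
  have ha'0 : 0 < a' := by linarith
  have key : ∀ x y : ℝ, 0 ≤ y → d ≤ ε * y → -(B + 1) ≤ x → t ≤ κ * (y + t * x) := by
    intro x y hy hdy hx
    have h1 : t * (99 / 100) ≤ ε * y := by nlinarith
    have h2 : ε * y ≤ κ / 2 * y := mul_le_mul_of_nonneg_right hεκ hy
    have h3 : -(1 / 2) ≤ κ * x := by nlinarith
    nlinarith [mul_le_mul_of_nonneg_left h3 ht0, mul_nonneg hκ.le hy]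
  have hy2 : 0 ≤ u2 - u := by linarith [hu.2]
  have hy1 : 0 ≤ u - u1 := by linarith [hu.1]
  refine ⟨by positivity, ?_, ?_⟩
  · have h1 := key (m + k * u2) (u2 - u) hy2 hd1 m2.1
    have e : κ * ((u2 - u1) * W / (a * a')) * (c * ((u2 - u + t * (m + k * u2)) / (u2 - u1) * a))
        = c * (W * (κ * (u2 - u + t * (m + k * u2))) / a') := by field_simp
    rw [e]
    refine mul_le_mul_of_nonneg_left ?_ hc.le
    rw [le_div_iff₀ ha'0]
    calc t * W * a' ≤ t * W * 1 := mul_le_mul_of_nonneg_left hb1 (by positivity)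
      _ = W * t := by ring
      _ ≤ _ := mul_le_mul_of_nonneg_left h1 hW.le
  · have h1 := key (-(m + k * u1)) (u - u1) hy1 hd2 (by linarith [m1.2])
    have e : κ * ((u2 - u1) * W / (a * a')) * (c * ((u - u1 - t * (m + k * u1)) / (u2 - u1) * a'))
        = c * (W * (κ * (u - u1 + t * -(m + k * u1))) / a) := by field_simp; ring
    rw [e]
    refine mul_le_mul_of_nonneg_left ?_ hc.le
    rw [le_div_iff₀ ha0]
    calc t * W * a ≤ t * W * 1 := mul_le_mul_of_nonneg_left ha1 (by positivity)
      _ = W * t := by ring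
      _ ≤ _ := mul_le_mul_of_nonneg_left h1 hW.le

end Chord

end bodychords

section arcs

variable {C : Set Vec} {E e1 e2 : Vec} {r M b : ℝ} {φ : ℝ → ℝ}

/-- All difference quotients of `φ` on `[a, c]` are between `lo` and `hi`. -/
def Slopes (φ : ℝ → ℝ) (a c lo hi : ℝ) : Prop :=
  ∀ u v, a ≤ u → u ≤ v → v ≤ c → lo * (v - u) ≤ φ v - φ u ∧ φ v - φ u ≤ hi * (v - u)

theorem Slopes.mono {a c lo hi a' c' : ℝ} (h : Slopes φ a c lo hi) (ha : a ≤ a') (hc : c' ≤ c) :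
    Slopes φ a' c' lo hi := fun u v h1 h2 h3 => h u v (ha.trans h1) h2 (h3.trans hc)

theorem Slopes.weaken {a c lo hi lo' hi' : ℝ} (h : Slopes φ a c lo hi) (h1 : lo' ≤ lo)
    (h2 : hi ≤ hi') : Slopes φ a c lo' hi' := fun u v h3 h4 h5 => by
  have := h u v h3 h4 h5
  have h6 : 0 ≤ v - u := by linarith
  exact ⟨by nlinarith, by nlinarith⟩

theorem Slopes.join {a c d lo hi : ℝ} (h : Slopes φ a c lo hi) (h' : Slopes φ c d lo hi) :
    Slopes φ a d lo hi := by
  intro u v h1 h2 h3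
  rcases le_total v c with h4 | h4
  · exact h u v h1 h2 h4
  rcases le_total c u with h5 | h5
  · exact h' u v h5 h2 h3
  have p := h u c h1 h5 le_rfl
  have q := h' c v le_rfl h4 h3
  exact ⟨by nlinarith, by nlinarith⟩

/-- The slope of a chord. -/
noncomputable def slp (φ : ℝ → ℝ) (u1 u2 : ℝ) : ℝ := (φ u2 - φ u1) / (u2 - u1)

/-- The intercept of a chord. -/
noncomputable def icp (φ : ℝ → ℝ) (u1 u2 : ℝ) : ℝ := φ u1 - slp φ u1 u2 * u1

theorem slp_eq1 {u1 u2 : ℝ} : φ u1 = slp φ u1 u2 * u1 + icp φ u1 u2 := by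
  rw [icp]; ring

theorem slp_eq2 {u1 u2 : ℝ} (h : u1 < u2) : φ u2 = slp φ u1 u2 * u2 + icp φ u1 u2 := by
  have : u2 - u1 ≠ 0 := by linarith
  rw [icp, slp]; field_simp; ring

theorem Slopes.slp_mem {a c lo hi u1 u2 : ℝ} (h : Slopes φ a c lo hi) (ha : a ≤ u1)
    (hlt : u1 < u2) (hc : u2 ≤ c) : slp φ u1 u2 ∈ Icc lo hi := by
  have := h u1 u2 ha hlt.le hc
  have h1 : 0 < u2 - u1 := by linarith
  exact ⟨by rw [slp, le_div_iff₀ h1]; exact this.1, by rw [slp, div_le_iff₀ h1]; exact this.2⟩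

theorem Chart.mkChord (hC : IsBody C) (h : Chart C E e1 e2 r M b φ) {B ρ u1 u2 lo hi : ℝ}
    (hlt : u1 < u2) (abs1 : |u1| ≤ ρ) (abs2 : |u2| ≤ ρ) (ρr : ρ ≤ r) (MB : M ≤ B)
    (ρb : ρ * (4 * B + 4) ≤ b) (ρs : ρ * (4 * B + 4) ≤ 1 / 10) (hs : Slopes φ u1 u2 lo hi)
    (hlo : -B ≤ lo) (hhi : hi ≤ B) :
    Chord C E e1 e2 r M b φ B ρ u1 u2 (slp φ u1 u2) (icp φ u1 u2) := by
  have := hs.slp_mem le_rfl hlt le_rfl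
  exact ⟨hC, h, hlt, abs1, abs2, ρr, MB, ρb, ρs, slp_eq1, slp_eq2 hlt,
    abs_le.2 ⟨hlo.trans this.1, this.2.trans hhi⟩⟩

namespace Chord

variable {B ρ u1 u2 m k : ℝ}

theorem slope_mem (h : Chord C E e1 e2 r M b φ B ρ u1 u2 m k) {lo hi : ℝ}
    (hs : Slopes φ u1 u2 lo hi) : lo ≤ m ∧ m ≤ hi := by
  have := hs u1 u2 le_rfl h.lt.le le_rfl
  have h1 : 0 < u2 - u1 := by linarith [h.lt]
  rw [h.v1, h.v2] at this
  exact ⟨by nlinarith, by nlinarith⟩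

theorem line_sub_le (h : Chord C E e1 e2 r M b φ B ρ u1 u2 m k) {lo hi u : ℝ}
    (hs : Slopes φ u1 u2 lo hi) (hu : u ∈ Icc u1 u2) :
    m * u + k - φ u ≤ (hi - lo) * (u2 - u) ∧ m * u + k - φ u ≤ (hi - lo) * (u - u1) := by
  have p := hs u1 u le_rfl hu.1 hu.2
  have q := hs u u2 hu.1 hu.2 le_rfl
  have hm := h.slope_mem hs
  have h1 : 0 ≤ u - u1 := by linarith [hu.1]
  have h2 : 0 ≤ u2 - u := by linarith [hu.2]
  rw [h.v1] at p
  rw [h.v2] at q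
  exact ⟨by nlinarith, by nlinarith⟩

theorem le_line (h : Chord C E e1 e2 r M b φ B ρ u1 u2 m k) {u : ℝ}
    (hu : u ∈ Icc u1 u2) : φ u ≤ m * u + k := by
  have h1 : 0 < u2 - u1 := by linarith [h.lt]
  have cv := h.chart.conv.2
  have := cv h.mem1 h.mem2 (a := (u2 - u) / (u2 - u1)) (b := (u - u1) / (u2 - u1))
    (by apply div_nonneg <;> linarith [hu.2]) (by apply div_nonneg <;> linarith [hu.1])
    (by field_simp; ring)
  simp only [smul_eq_mul] at this
  have e : (u2 - u) / (u2 - u1) * u1 + (u - u1) / (u2 - u1) * u2 = u := by field_simp; ring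
  have e' : (u2 - u) / (u2 - u1) + (u - u1) / (u2 - u1) = 1 := by field_simp; ring
  rw [e, h.v1, h.v2] at this
  linear_combination this + m * e + k * e'

theorem lt_line (h : Chord C E e1 e2 r M b φ B ρ u1 u2 m k) {u v : ℝ}
    (hu : u ∈ Ioo u1 u2) (hv : v ∈ Ioo u1 u2) (hlt : φ u < m * u + k) : φ v < m * v + k := by
  have hI : ∀ w ∈ Ioo u1 u2, w ∈ Icc (-r) r := fun w hw =>
    ⟨h.mem1.1.trans hw.1.le, hw.2.le.trans h.mem2.2⟩
  rcases lt_trichotomy u v with h0 | rfl | h0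
  · have h1 : 0 < u2 - u := by linarith [hu.2]
    have cv := h.chart.conv.2
    have := cv (hI u hu) h.mem2 (a := (u2 - v) / (u2 - u)) (b := (v - u) / (u2 - u))
      (by apply div_nonneg <;> linarith [hv.2]) (by apply div_nonneg <;> linarith [hu.1])
      (by field_simp; ring)
    simp only [smul_eq_mul] at this
    have e : (u2 - v) / (u2 - u) * u + (v - u) / (u2 - u) * u2 = v := by field_simp; ring
    have e' : (u2 - v) / (u2 - u) + (v - u) / (u2 - u) = 1 := by field_simp; ring
    have e2' : 0 < (u2 - v) / (u2 - u) := by apply div_pos <;> linarith [hv.2]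
    rw [e, h.v2] at this
    have := mul_lt_mul_of_pos_left hlt e2'
    linear_combination (exp := 1) ‹φ v ≤ _› + this + m * e + k * e'
  · exact hlt
  · have h1 : 0 < u - u1 := by linarith [hu.1]
    have cv := h.chart.conv.2
    have := cv (hI u hu) h.mem1 (a := (v - u1) / (u - u1)) (b := (u - v) / (u - u1))
      (by apply div_nonneg <;> linarith [hv.1]) (by apply div_nonneg <;> linarith [hu.1])
      (by field_simp; ring)
    simp only [smul_eq_mul] at this
    have e : (v - u1) / (u - u1) * u + (u - v) / (u - u1) * u1 = v := by field_simp; ring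
    have e' : (v - u1) / (u - u1) + (u - v) / (u - u1) = 1 := by field_simp; ring
    have e2' : 0 < (v - u1) / (u - u1) := by apply div_pos <;> linarith [hv.1]
    rw [e, h.v1] at this
    have := mul_lt_mul_of_pos_left hlt e2'
    linear_combination (exp := 1) ‹φ v ≤ _› + this + m * e + k * e'

theorem lor_bpt_normal {u : ℝ} (h : Chord C E e1 e2 r M b φ B ρ u1 u2 m k) :
    lor (bpt E e1 e2 φ u) (lineNormal E e1 e2 m k) =
      (hgt u (φ u))⁻¹ * ((m * u + k - φ u) / lineLen m k) := by
  rw [bpt, h.chart.frame.nrm_chart, lor_smul_left, h.chart.frame.lor_chart_lineNormal]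

/-- Points of the body strictly beyond the chord. -/
theorem beyond (h : Chord C E e1 e2 r M b φ B ρ u1 u2 m k) {z : Vec} (hz : z ∈ C)
    (hzn : 0 < lor z (lineNormal E e1 e2 m k)) : ∃ c u v : ℝ, 0 < c ∧
      z = c • BallChar.chart E e1 e2 u v ∧ u ∈ Ioo u1 u2 ∧ φ u ≤ v ∧ v < m * u + k := by
  obtain ⟨c, u, v, hc, rfl⟩ := h.chart.frame.exists_chart (h.body.fut hz)
  rw [lor_smul_left, h.chart.frame.lor_chart_lineNormal] at hzn
  have h1 := (pos_iff_pos_of_mul_pos hzn).1 hc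
  have h2 : 0 < m * u + k - v := by
    have h3 := mul_pos h1 h.W_pos
    rwa [div_mul_cancel₀ _ h.W_pos.ne'] at h3
  have h3 := h.chart.below h.body h.lt h.mem1 h.mem2 h.phi_le1 h.phi_le2 h.v1 h.v2
    ((h.body.smul_iff hc).1 hz) (by linarith)
  exact ⟨c, u, v, hc, rfl, h3.1, h3.2, by linarith⟩

theorem outer (h : Chord C E e1 e2 r M b φ B ρ u1 u2 m k) {κ lo hi : ℝ} (hκ : 0 < κ)
    (hκB : κ * (B + 1) ≤ 1 / 2) (hs : Slopes φ u1 u2 lo hi) (hε : hi - lo ≤ κ / 2) :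
    Outer C (bpt E e1 e2 φ u1) (bpt E e1 e2 φ u2) (lineNormal E e1 e2 m k) 1 1
      (κ * Real.sqrt ((-lor (bpt E e1 e2 φ u1) (bpt E e1 e2 φ u2)) ^ 2 - 1)) := by
  intro α β γ hz hγ
  obtain ⟨c, u, v, hc, he, hu, h1, h2⟩ := h.beyond hz (by rwa [h.cframe.lor_n])
  have h3 := h.line_sub_le hs (Ioo_subset_Icc_self hu)
  have := h.flat_coords hκ hκB hε hc (Ioo_subset_Icc_self hu) he (by linarith) (by linarith)
    (by linarith)
  simpa using this.2

theorem outer_gen (h : Chord C E e1 e2 r M b φ B ρ u1 u2 m k) {d0 l0 μ0 : ℝ}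
    (hs : Slopes φ u1 u2 (-B) B) (hd0 : d0 = B * (u2 - u1))
    (hl : l0 = (u2 - (u1 + u2) / 2 + d0 / lineLen m k ^ 2 * (m + k * u2)) / (u2 - u1))
    (hμ : μ0 = ((u1 + u2) / 2 - u1 - d0 / lineLen m k ^ 2 * (m + k * u1)) / (u2 - u1)) :
    Outer C (bpt E e1 e2 φ u1) (bpt E e1 e2 φ u2) (lineNormal E e1 e2 m k)
      (l0 * hgt u1 (φ u1)) (μ0 * hgt u2 (φ u2)) (d0 / lineLen m k) := by
  intro α β γ hz hγ
  obtain ⟨c, u, v, hc, he, hu, h1, h2⟩ := h.beyond hz (by rwa [h.cframe.lor_n])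
  have h3 := h.line_sub_le hs (Ioo_subset_Icc_self hu)
  obtain ⟨rfl, rfl, rfl⟩ := h.expand_smul he
  have hD : 0 < u2 - u1 := by linarith [h.lt]
  have hW := h.W_pos
  have ha : 0 < hgt u1 (φ u1) := by linarith [h.hgt1]
  have hb : 0 < hgt u2 (φ u2) := by linarith [h.hgt2]
  set W := lineLen m k
  set a := hgt u1 (φ u1)
  set a' := hgt u2 (φ u2)
  set d := m * u + k - v
  subst hl hμ hd0
  constructor
  · have e : B * (u2 - u1) / W * (c * ((u2 - u + d / W ^ 2 * (m + k * u2)) / (u2 - u1) * a)) -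
        (u2 - (u1 + u2) / 2 + B * (u2 - u1) / W ^ 2 * (m + k * u2)) / (u2 - u1) * a *
          (c * (d / W)) = c * a / W / 2 * (2 * B * (u2 - u) - d) := by
      field_simp; ring
    have : 0 ≤ c * a / W / 2 * (2 * B * (u2 - u) - d) := by
      have : 0 ≤ 2 * B * (u2 - u) - d := by linarith [h3.1]
      positivity
    linarith
  · have e : B * (u2 - u1) / W * (c * ((u - u1 - d / W ^ 2 * (m + k * u1)) / (u2 - u1) * a')) -
        ((u1 + u2) / 2 - u1 - B * (u2 - u1) / W ^ 2 * (m + k * u1)) / (u2 - u1) * a' *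
          (c * (d / W)) = c * a' / W / 2 * (2 * B * (u - u1) - d) := by
      field_simp; ring
    have : 0 ≤ c * a' / W / 2 * (2 * B * (u - u1) - d) := by
      have : 0 ≤ 2 * B * (u - u1) - d := by linarith [h3.2]
      positivity
    linarith

theorem inner_gen (h : Chord C E e1 e2 r M b φ B ρ u1 u2 m k) {x y t L u : ℝ}
    (hL : L = x * hgt u2 (φ u2) + y * hgt u1 (φ u1) + t * (u2 - u1) * k) (hL0 : 0 < L)
    (hu : u = (x * hgt u2 (φ u2) * u1 + y * hgt u1 (φ u1) * u2 - t * (u2 - u1) * m) / L)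
    (hur : u ∈ Icc (-r) r) (hφ : φ u < m * u + k + t * (u2 - u1) * lineLen m k ^ 2 / L)
    (hub : m * u + k + t * (u2 - u1) * lineLen m k ^ 2 / L ≤ b) :
    x • bpt E e1 e2 φ u1 + y • bpt E e1 e2 φ u2 +
      (t * Real.sqrt ((-lor (bpt E e1 e2 φ u1) (bpt E e1 e2 φ u2)) ^ 2 - 1)) •
        (-lineNormal E e1 e2 m k) ∈ interior C := by
  have e := h.chart.frame.inner_apex h.lt1 h.lt2 h.lt h.v1 h.v2 hL hL0.ne'
  have ha : 0 < hgt u1 (φ u1) := by linarith [h.hgt1]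
  have hb : 0 < hgt u2 (φ u2) := by linarith [h.hgt2]
  rw [bpt, bpt, e, h.body.smul_int_iff (by positivity), ← hu]
  convert h.chart.int u hur _ hφ hub using 2
  rw [hu, h.W_sq]
  generalize hgt u1 (φ u1) = a at *
  generalize hgt u2 (φ u2) = a' at *
  rw [h.v1, h.v2]
  field_simp
  rw [hL]
  ring

theorem inner (h : Chord C E e1 e2 r M b φ B ρ u1 u2 m k) {κ : ℝ} (hκ : 0 < κ)
    (hκB : κ * (B + 1) ≤ 1 / 2) :
    bpt E e1 e2 φ u1 + bpt E e1 e2 φ u2 +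
      (κ * Real.sqrt ((-lor (bpt E e1 e2 φ u1) (bpt E e1 e2 φ u2)) ^ 2 - 1)) •
        (-lineNormal E e1 e2 m k) ∈ interior C := by
  have ha := h.hgt1
  have hb := h.hgt2
  have hB := h.B_pos
  have hρ := h.ρ_pos
  have hD : 0 < u2 - u1 := by linarith [h.lt]
  have hD2 : u2 - u1 ≤ 2 * ρ := by linarith [(abs_le.1 h.abs1).1, (abs_le.1 h.abs2).2]
  have hBρ := h.Bρ
  have hk := abs_le.1 h.abs_k
  have hm := abs_le.1 h.abs_m
  have m1 := abs_le.1 (h.abs_mk h.abs1)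
  have m2 := abs_le.1 (h.abs_mk h.abs2)
  have hW2 := h.W_sq
  have hW := h.W_pos
  have hκ2 : κ ≤ 1 / 2 := by nlinarith
  have hκD : κ * (u2 - u1) ≤ 1 / 2 := by nlinarith
  have hκD0 : 0 < κ * (u2 - u1) := by positivity
  obtain ⟨L, hL⟩ : ∃ L, L = 1 * hgt u2 (φ u2) + 1 * hgt u1 (φ u1) + κ * (u2 - u1) * k := ⟨_, rfl⟩
  have hL1 : 1 ≤ L := by nlinarith
  have hL0 : 0 < L := by linarith
  obtain ⟨u, hu⟩ : ∃ u, u = (1 * hgt u2 (φ u2) * u1 + 1 * hgt u1 (φ u1) * u2 -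
    κ * (u2 - u1) * m) / L := ⟨_, rfl⟩
  have g1 : u - u1 = (u2 - u1) * (hgt u1 (φ u1) - κ * (m + k * u1)) / L := by
    rw [hu]; field_simp; rw [hL]; ring
  have g2 : u2 - u = (u2 - u1) * (hgt u2 (φ u2) + κ * (m + k * u2)) / L := by
    rw [hu]; field_simp; rw [hL]; ring
  have f1 : 0 ≤ hgt u1 (φ u1) - κ * (m + k * u1) := by nlinarith
  have f2 : 0 ≤ hgt u2 (φ u2) + κ * (m + k * u2) := by nlinarith
  have hu1 : u1 ≤ u := by
    have : 0 ≤ u - u1 := by rw [g1]; positivity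
    linarith
  have hu2 : u ≤ u2 := by
    have : 0 ≤ u2 - u := by rw [g2]; positivity
    linarith
  have hpos : 0 < κ * (u2 - u1) * lineLen m k ^ 2 / L := by positivity
  have hle := h.le_line ⟨hu1, hu2⟩
  have := h.inner_gen (x := 1) (y := 1) (t := κ) hL hL0 hu
    ⟨h.mem1.1.trans hu1, hu2.trans h.mem2.2⟩ (by linarith) ?_
  · simpa using this
  · have p1 : κ * (u2 - u1) * lineLen m k ^ 2 / L ≤ κ * (u2 - u1) * lineLen m k ^ 2 :=
      div_le_self (by positivity) hL1
    have p2 : κ * lineLen m k ^ 2 ≤ 1 / 2 + B / 2 := by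
      rw [hW2]
      have : m ^ 2 ≤ B ^ 2 := sq_le_sq' hm.1 hm.2
      nlinarith [sq_nonneg k]
    have p3 : κ * (u2 - u1) * lineLen m k ^ 2 ≤ (2 * ρ) * (1 / 2 + B / 2) := by
      calc κ * (u2 - u1) * lineLen m k ^ 2 = (u2 - u1) * (κ * lineLen m k ^ 2) := by ring
        _ ≤ (2 * ρ) * (1 / 2 + B / 2) := mul_le_mul hD2 p2 (by positivity) (by positivity)
    have q1 := (abs_le.1 h.absφ1).2
    have q2 := (abs_le.1 h.absφ2).2
    have q3 : m * u + k ≤ B * ρ := by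
      have : m * u + k = φ u1 * ((u2 - u) / (u2 - u1)) + φ u2 * ((u - u1) / (u2 - u1)) := by
        rw [h.v1, h.v2]; field_simp; ring
      have e' : (u2 - u) / (u2 - u1) + (u - u1) / (u2 - u1) = 1 := by field_simp; ring
      have n1 : 0 ≤ (u2 - u) / (u2 - u1) := by apply div_nonneg <;> linarith
      have n2 : 0 ≤ (u - u1) / (u2 - u1) := by apply div_nonneg <;> linarith
      rw [this]
      calc _ ≤ B * ρ * ((u2 - u) / (u2 - u1)) + B * ρ * ((u - u1) / (u2 - u1)) :=
            add_le_add (mul_le_mul_of_nonneg_right q1 n1) (mul_le_mul_of_nonneg_right q2 n2)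
        _ = B * ρ := by rw [← mul_add, e', mul_one]
    have := h.ρb
    have e3 : ρ * (4 * B + 4) = 4 * (B * ρ) + 4 * ρ := by ring
    have e4 : 2 * ρ * (1 / 2 + B / 2) = ρ + B * ρ := by ring
    have e5 : 0 < B * ρ := mul_pos hB hρ
    linarith

end Chord

end arcs

/-- The hyperbolic cosine of the distance between two points of a curve. -/
def cd (z : ℝ → Vec) (u v : ℝ) : ℝ := -lor (z u) (z v)

theorem cd_comm (z : ℝ → Vec) (u v : ℝ) : cd z u v = cd z v u := by rw [cd, cd, lor_comm]

/-- A short boundary arc `z` of a body, with the outer normals `N` of its chords, such that the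
caps of the chords are flat. -/
structure ArcOn (C : Set Vec) (ρ : ℝ) (z : ℝ → Vec) (N : ℝ → ℝ → Vec) (κ : ℝ) : Prop where
  body : IsBody C
  ρ_pos : 0 < ρ
  κ_pos : 0 < κ
  κ_le : κ ≤ 1 / 2
  cont : ContinuousOn z (Icc 0 ρ)
  bd : ∀ u ∈ Icc 0 ρ, z u ∈ Bd C
  frame : ∀ a b, 0 ≤ a → a < b → b ≤ ρ → CFrame (cd z a b) (z a) (z b) (N a b)
  lt3 : ∀ a b, 0 ≤ a → a < b → b ≤ ρ → cd z a b < 3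
  coords : ∀ a b, 0 ≤ a → a < b → b ≤ ρ → ∀ u ∈ Icc a b, ∃ α β γ : ℝ,
    z u = α • z a + β • z b + γ • N a b ∧ 0 ≤ γ ∧
      γ ≤ κ * Real.sqrt (cd z a b ^ 2 - 1) * α ∧ γ ≤ κ * Real.sqrt (cd z a b ^ 2 - 1) * β
  outer : ∀ a b, 0 ≤ a → a < b → b ≤ ρ →
    Outer C (z a) (z b) (N a b) 1 1 (κ * Real.sqrt (cd z a b ^ 2 - 1))
  inner : ∀ a b, 0 ≤ a → a < b → b ≤ ρ →
    z a + z b + (κ * Real.sqrt (cd z a b ^ 2 - 1)) • (-N a b) ∈ interior C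
  exhaust : ∀ a b, 0 ≤ a → a < b → b ≤ ρ → ∀ y ∈ Bd C, 0 < lor y (N a b) → ∃ u ∈ Ioo a b, y = z u
  nonflat : ∀ a b, 0 ≤ a → a < b → b ≤ ρ → ∀ u ∈ Ioo a b, 0 < lor (z u) (N a b) →
    ∀ v ∈ Ioo a b, 0 < lor (z v) (N a b)

section

variable {C : Set Vec} {E e1 e2 : Vec} {r M b : ℝ} {φ : ℝ → ℝ}

theorem Chord.exhaust {B ρ u1 u2 m k : ℝ} (h : Chord C E e1 e2 r M b φ B ρ u1 u2 m k) {y : Vec}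
    (hy : y ∈ Bd C) (hyn : 0 < lor y (lineNormal E e1 e2 m k)) :
    ∃ u ∈ Ioo u1 u2, y = bpt E e1 e2 φ u := by
  obtain ⟨c, u, v, hc, rfl, hu, h1, h2⟩ := h.beyond hy.2.1 hyn
  refine ⟨u, hu, ?_⟩
  have hur : u ∈ Icc (-r) r := ⟨h.mem1.1.trans hu.1.le, hu.2.le.trans h.mem2.2⟩
  have hv : v ≤ b := by
    have hD : 0 < u2 - u1 := by linarith [h.lt]
    have n1 : 0 ≤ (u2 - u) / (u2 - u1) := by apply div_nonneg <;> linarith [hu.2]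
    have n2 : 0 ≤ (u - u1) / (u2 - u1) := by apply div_nonneg <;> linarith [hu.1]
    have e' : (u2 - u) / (u2 - u1) + (u - u1) / (u2 - u1) = 1 := by field_simp; ring
    have : m * u + k = φ u1 * ((u2 - u) / (u2 - u1)) + φ u2 * ((u - u1) / (u2 - u1)) := by
      rw [h.v1, h.v2]; field_simp; ring
    refine h2.le.trans ?_
    rw [this]
    calc _ ≤ b * ((u2 - u) / (u2 - u1)) + b * ((u - u1) / (u2 - u1)) :=
          add_le_add (mul_le_mul_of_nonneg_right h.phi_le1 n1) (mul_le_mul_of_nonneg_right h.phi_le2 n2)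
      _ = b := by rw [← mul_add, e', mul_one]
  rcases h1.lt_or_eq with h3 | h3
  · exact absurd ((h.body.smul_int_iff hc).2 (h.chart.int u hur v h3 hv)) hy.2.2
  · have hF : BallChar.chart E e1 e2 u v ∈ Fut := h.body.fut ((h.body.smul_iff hc).1 hy.2.1)
    rw [bpt, h3]
    have hs := sqrt_smul_nrm hF
    conv_lhs => rw [← nrm_of_hyp hy.1, ← hs, smul_smul]
    rw [nrm_smul_of_hyp (nrm_mem hF) (mul_pos hc (sqrt_lor_pos hF))]

theorem Chart.continuousOn_bpt (h : Chart C E e1 e2 r M b φ) {s : Set ℝ}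
    (hs : ∀ u ∈ s, u ∈ Ioo (-r) r) (hF : ∀ u ∈ s, u ^ 2 + φ u ^ 2 < 1) :
    ContinuousOn (bpt E e1 e2 φ) s := by
  have hc : ContinuousOn φ (Ioo (-r) r) :=
    (h.conv.subset Ioo_subset_Icc_self (convex_Ioo _ _)).continuousOn isOpen_Ioo
  have hc' : ContinuousOn φ s := hc.mono hs
  refine continuousOn_nrm.comp (t := Fut) ?_ (fun u hu => h.frame.chart_mem_Fut.2 (hF u hu))
  exact continuous_chart.comp_continuousOn (continuousOn_id.prodMk hc')

theorem Chart.arcOn (hC : IsBody C) (h : Chart C E e1 e2 r M b φ) {κ B ρ lo hi : ℝ}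
    (hκ : 0 < κ) (hκB : κ * (B + 1) ≤ 1 / 2) (MB : M ≤ B) (hρ : 0 < ρ) (ρr : ρ < r)
    (ρb : ρ * (4 * B + 4) ≤ b) (ρs : ρ * (4 * B + 4) ≤ 1 / 10) (hs : Slopes φ 0 ρ lo hi)
    (hlo : -B ≤ lo) (hhi : hi ≤ B) (hε : hi - lo ≤ κ / 2) :
    ArcOn C ρ (bpt E e1 e2 φ) (fun a c => lineNormal E e1 e2 (slp φ a c) (icp φ a c)) κ := by
  have hab : ∀ {u}, 0 ≤ u → u ≤ ρ → |u| ≤ ρ := fun h1 h2 => by rwa [abs_of_nonneg h1]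
  have hch : ∀ a c, 0 ≤ a → a < c → c ≤ ρ →
      Chord C E e1 e2 r M b φ B ρ a c (slp φ a c) (icp φ a c) := fun a c ha hac hc =>
    h.mkChord hC hac (hab ha (hac.le.trans hc)) (hab (ha.trans hac.le) hc) ρr.le MB ρb ρs
      (hs.mono ha hc) hlo hhi
  have hB := h.M_pos.trans_le MB
  have hlt1 : ∀ u ∈ Icc 0 ρ, u ^ 2 + φ u ^ 2 < 1 := fun u hu => by
    linarith [h.small MB ρr.le ρs (hab hu.1 hu.2)]
  have hBρ : 0 < B * ρ := mul_pos hB hρ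
  refine ⟨hC, hρ, hκ, by nlinarith, ?_, ?_, ?_, ?_, ?_, ?_, ?_, ?_, ?_⟩
  · exact h.continuousOn_bpt (fun u hu => ⟨by linarith [hu.1], by linarith [hu.2]⟩) hlt1
  · intro u hu
    refine h.bpt_mem_Bd hC ⟨by linarith [hu.1], by linarith [hu.2]⟩ ?_
    have := (abs_le.1 (h.abs_bound MB ρr.le (hab hu.1 hu.2))).2
    nlinarith
  · exact fun a c ha hac hc => (hch a c ha hac hc).cframe
  · exact fun a c ha hac hc => (hch a c ha hac hc).lt3
  · intro a c ha hac hc u hu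
    have hc' := hch a c ha hac hc
    obtain ⟨α, β, γ, he⟩ := hc'.cframe.expand (bpt E e1 e2 φ u)
    refine ⟨α, β, γ, he, ?_⟩
    have hu0 := hlt1 u ⟨ha.trans hu.1, hu.2.trans hc⟩
    have h3 := hc'.line_sub_le (hs.mono ha hc) hu
    have hD1 : 0 ≤ c - u := by linarith [hu.2]
    have hD2 : 0 ≤ u - a := by linarith [hu.1]
    refine hc'.flat_coords hκ hκB hε (inv_pos.2 (hgt_pos hu0)) hu (v := φ u) ?_ ?_ h3.1 h3.2
    · rw [← he, bpt, h.frame.nrm_chart]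
    · linarith [hc'.le_line hu]
  · exact fun a c ha hac hc => (hch a c ha hac hc).outer hκ hκB (hs.mono ha hc) hε
  · exact fun a c ha hac hc => (hch a c ha hac hc).inner hκ hκB
  · exact fun a c ha hac hc y hy hyn => (hch a c ha hac hc).exhaust hy hyn
  · intro a c ha hac hc u hu hun v hv
    have hc' := hch a c ha hac hc
    have hI : ∀ w ∈ Ioo a c, w ^ 2 + φ w ^ 2 < 1 := fun w hw =>
      hlt1 w ⟨ha.trans hw.1.le, hw.2.le.trans hc⟩
    have hW := hc'.W_pos
    simp only [hc'.lor_bpt_normal] at hun ⊢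
    have p1 := inv_pos.2 (hgt_pos (hI u hu))
    have p2 := hgt_pos (hI v hv)
    have p3 := (pos_iff_pos_of_mul_pos hun).1 p1
    have p4 : 0 < slp φ a c * u + icp φ a c - φ u := by
      have := mul_pos p3 hW
      rwa [div_mul_cancel₀ _ hW.ne'] at this
    have p5 := hc'.lt_line hu hv (by linarith)
    have : 0 < slp φ a c * v + icp φ a c - φ v := by linarith
    positivity

end

/-- Every boundary point of a body is the end point of arcs with flat caps. -/
theorem Chart.exists_arc {C : Set Vec} {E e1 e2 : Vec} {r M b : ℝ} {φ : ℝ → ℝ} (hC : IsBody C)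
    (h : Chart C E e1 e2 r M b φ) : ∃ κ₀ > 0, ∀ κ, 0 < κ → κ ≤ κ₀ → ∃ ρ₀ > 0, ∀ ρ, 0 < ρ →
      ρ ≤ ρ₀ → ArcOn C ρ (bpt E e1 e2 φ)
        (fun a c => lineNormal E e1 e2 (slp φ a c) (icp φ a c)) κ := by
  have hM := h.M_pos
  refine ⟨1 / (2 * (M + 2)), by positivity, fun κ hκ hκ0 => ?_⟩
  rw [le_div_iff₀ (by positivity)] at hκ0
  obtain ⟨m, r', hr', hr'r, hm, hs⟩ := h.slopes (ε := κ / 2) (by positivity)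
  have hm' := abs_le.1 hm
  have hκ1 : κ ≤ 1 := by nlinarith
  have hbp : 0 < b / (4 * (M + 1) + 4) := div_pos h.b_pos (by positivity)
  refine ⟨min (r' / 2) (min (b / (4 * (M + 1) + 4)) (1 / 10 / (4 * (M + 1) + 4))), ?_,
    fun ρ hρ hρ0 => ?_⟩
  · have : 0 < 1 / 10 / (4 * (M + 1) + 4) := by positivity
    exact lt_min (by positivity) (lt_min hbp this)
  · have h1 := hρ0.trans (min_le_left _ _)
    have h2 := hρ0.trans ((min_le_right _ _).trans (min_le_left _ _))
    have h3 := hρ0.trans ((min_le_right _ _).trans (min_le_right _ _))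
    rw [le_div_iff₀ (by positivity)] at h2 h3
    have hs' : Slopes φ 0 ρ m (m + κ / 2) := fun u v hu huv hv => hs u v hu huv (by linarith)
    exact h.arcOn hC hκ (B := M + 1) (by nlinarith) (by linarith) hρ (by linarith) h2 h3 hs'
      (by linarith [hm'.1]) (by linarith [hm'.2]) (by linarith)

/-- Points beyond a chord are determined by their distances to its end points. -/
theorem CFrame.coords_unique {s s' : ℝ} {P Q n P' Q' n' x x' : Vec} (h : CFrame s P Q n)
    (h' : CFrame s' P' Q' n') (hss : s = s') {α β γ α' β' γ' : ℝ} (hx : x ∈ Hyp) (hx' : x' ∈ Hyp)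
    (he : x = α • P + β • Q + γ • n) (he' : x' = α' • P' + β' • Q' + γ' • n')
    (hγ : 0 ≤ γ) (hγ' : 0 ≤ γ') (h1 : lor x P = lor x' P') (h2 : lor x Q = lor x' Q') :
    α = α' ∧ β = β' ∧ γ = γ' := by
  subst hss
  have k1 := hx.1
  have k2 := hx'.1
  rw [he, h.lor_lor] at k1
  rw [he', h'.lor_lor] at k2
  rw [he, he', h.lor_P, h'.lor_P] at h1
  rw [he, he', h.lor_Q, h'.lor_Q] at h2
  have hs := h.sq_pos
  have e1 : (s ^ 2 - 1) * (α - α') = 0 := by linear_combination s * -h2 - -h1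
  have e2 : (s ^ 2 - 1) * (β - β') = 0 := by linear_combination s * -h1 - -h2
  have a1 : α = α' := by have := (mul_eq_zero.1 e1).resolve_left hs.ne'; linarith
  have a2 : β = β' := by have := (mul_eq_zero.1 e2).resolve_left hs.ne'; linarith
  refine ⟨a1, a2, ?_⟩
  subst a1 a2
  have : γ ^ 2 = γ' ^ 2 := by linarith
  exact (pow_left_inj₀ hγ hγ' two_ne_zero).1 this

/-- A curve with the metric properties of a flat arc. -/
structure MetArc (z : ℝ → Vec) (r : ℝ) : Prop where
  r_pos : 0 < r
  cont : ContinuousOn z (Icc 0 r)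
  hyp : ∀ u ∈ Icc 0 r, z u ∈ Hyp
  mono : ∀ a u v b, 0 ≤ a → a ≤ u → u ≤ v → v ≤ b → b ≤ r → (a < u ∨ v < b) →
    cd z u v < cd z a b
  pair : ∀ a b a' b', 0 ≤ a → a < b → b ≤ r → 0 ≤ a' → a' < b' → b' ≤ r → cd z a b = cd z a' b' →
    ∀ u ∈ Icc a b, ∀ v ∈ Icc a b, ∀ u' ∈ Icc a' b', ∀ v' ∈ Icc a' b',
    cd z a u = cd z a' u' → cd z u b = cd z u' b' → cd z a v = cd z a' v' → cd z v b = cd z v' b' →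
    cd z u v = cd z u' v'
  pair_swap : ∀ a b a' b', 0 ≤ a → a < b → b ≤ r → 0 ≤ a' → a' < b' → b' ≤ r →
    cd z a b = cd z a' b' →
    ∀ u ∈ Icc a b, ∀ v ∈ Icc a b, ∀ u' ∈ Icc a' b', ∀ v' ∈ Icc a' b',
    cd z a u = cd z u' b' → cd z u b = cd z a' u' → cd z a v = cd z v' b' → cd z v b = cd z a' v' →
    cd z u v = cd z u' v'
  trap : ∀ a u v b, 0 ≤ a → a < u → u < v → v < b → b ≤ r → cd z a u = cd z v b →
    cd z a v = cd z u b → ∃ τ : ℝ, |τ| < 1 ∧ z v - z u = τ • (z b - z a)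

namespace ArcOn

variable {C : Set Vec} {ρ κ : ℝ} {z : ℝ → Vec} {N : ℝ → ℝ → Vec}

theorem hyp (h : ArcOn C ρ z N κ) {u : ℝ} (hu : u ∈ Icc 0 ρ) : z u ∈ Hyp := (h.bd u hu).1

theorem cd_self (h : ArcOn C ρ z N κ) {u : ℝ} (hu : u ∈ Icc 0 ρ) : cd z u u = 1 := by
  rw [cd, (h.hyp hu).1]; norm_num

theorem inj (h : ArcOn C ρ z N κ) {u v : ℝ} (hu : 0 ≤ u) (huv : u < v) (hv : v ≤ ρ) :
    z u ≠ z v := by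
  intro he
  have := (h.frame u v hu huv hv).hs
  rw [cd, ← he, (h.hyp ⟨hu, huv.le.trans hv⟩).1] at this
  norm_num at this

theorem δ_pos (h : ArcOn C ρ z N κ) {a b : ℝ} (ha : 0 ≤ a) (hab : a < b) (hb : b ≤ ρ) :
    0 < κ * Real.sqrt (cd z a b ^ 2 - 1) :=
  mul_pos h.κ_pos (Real.sqrt_pos.2 (h.frame a b ha hab hb).sq_pos)

theorem δ_sq (h : ArcOn C ρ z N κ) {a b : ℝ} (ha : 0 ≤ a) (hab : a < b) (hb : b ≤ ρ) :
    (κ * Real.sqrt (cd z a b ^ 2 - 1)) ^ 2 < 2 * (cd z a b - 1) := by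
  have hf := h.frame a b ha hab hb
  rw [mul_pow, Real.sq_sqrt hf.sq_pos.le]
  have h1 : κ ^ 2 ≤ 1 / 4 := by nlinarith [h.κ_pos, h.κ_le]
  have h2 := h.lt3 a b ha hab hb
  have h3 := hf.hs
  have h4 := hf.sq_pos
  nlinarith

theorem coords_nonneg (h : ArcOn C ρ z N κ) {a b : ℝ} (ha : 0 ≤ a) (hab : a < b) (hb : b ≤ ρ)
    {u : ℝ} (hu : u ∈ Icc a b) : ∃ α β γ : ℝ,
    z u = α • z a + β • z b + γ • N a b ∧ 0 ≤ α ∧ 0 ≤ β ∧ 0 ≤ γ ∧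
      γ ≤ κ * Real.sqrt (cd z a b ^ 2 - 1) * α ∧ γ ≤ κ * Real.sqrt (cd z a b ^ 2 - 1) * β := by
  obtain ⟨α, β, γ, he, h0, h1, h2⟩ := h.coords a b ha hab hb u hu
  have := h.δ_pos ha hab hb
  exact ⟨α, β, γ, he, nonneg_of_mul_nonneg_right (h0.trans h1) this,
    nonneg_of_mul_nonneg_right (h0.trans h2) this, h0, h1, h2⟩

theorem mono (h : ArcOn C ρ z N κ) {a u v b : ℝ} (ha : 0 ≤ a) (hau : a ≤ u) (huv : u ≤ v)
    (hvb : v ≤ b) (hb : b ≤ ρ) (hne : a < u ∨ v < b) : cd z u v < cd z a b := by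
  have hab : a < b := by rcases hne with h1 | h1 <;> linarith
  have hf := h.frame a b ha hab hb
  by_contra hcon
  push Not at hcon
  obtain ⟨α, β, γ, he, p1, p2, p0, p3, p4⟩ := h.coords_nonneg ha hab hb (u := u) ⟨hau, huv.trans hvb⟩
  obtain ⟨α', β', γ', he', p1', p2', p0', p3', p4'⟩ :=
    h.coords_nonneg ha hab hb (u := v) ⟨hau.trans huv, hvb⟩
  have hu := h.hyp (u := u) ⟨by linarith, by linarith⟩
  have hv := h.hyp (u := v) ⟨by linarith, by linarith⟩
  have d1 := h.δ_pos ha hab hb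
  have d2 := h.δ_sq ha hab hb
  have hd : lor (z u) (z v) ≤ -cd z a b := by rw [cd] at hcon ⊢; rw [cd] at hcon; linarith
  have hd' : lor (z v) (z u) ≤ -cd z a b := by rwa [lor_comm]
  have k1 := hu.1
  have k2 := hv.1
  rw [he] at k1
  rw [he'] at k2
  rw [he, he'] at hd
  rw [he, he'] at hd'
  have c1 := lens_dist_le hf d1 d2 p1 p2 (by rwa [abs_of_nonneg p0]) (by rwa [abs_of_nonneg p0])
    p1' p2' (by rwa [abs_of_nonneg p0']) (by rwa [abs_of_nonneg p0']) k1 k2 hd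
  have c2 := lens_dist_le hf d1 d2 p1' p2' (by rwa [abs_of_nonneg p0'])
    (by rwa [abs_of_nonneg p0']) p1 p2 (by rwa [abs_of_nonneg p0]) (by rwa [abs_of_nonneg p0])
    k2 k1 hd'
  have ends : ∀ w, a ≤ w → w ≤ b → ∀ x y t : ℝ, z w = x • z a + y • z b + t • N a b →
      ((x = 1 ∧ y = 0 ∧ t = 0) ∨ (x = 0 ∧ y = 1 ∧ t = 0)) → w = a ∨ w = b := by
    rintro w hw1 hw2 x y t hw (⟨rfl, rfl, rfl⟩ | ⟨rfl, rfl, rfl⟩)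
    · left
      by_contra hc
      refine h.inj ha (lt_of_le_of_ne hw1 (Ne.symm hc)) (by linarith) ?_
      rw [hw]; module
    · right
      by_contra hc
      refine h.inj (by linarith) (lt_of_le_of_ne hw2 hc) hb ?_
      rw [hw]; module
  have hs := hf.hs
  rcases ends u hau (by linarith) _ _ _ he c1 with rfl | rfl
  · rcases ends v (by linarith) hvb _ _ _ he' c2 with rfl | rfl
    · rw [h.cd_self ⟨ha, by linarith⟩] at hcon; linarith
    · rcases hne with h1 | h1 <;> linarith
  · have : v = u := le_antisymm hvb huv
    subst this
    rw [h.cd_self ⟨by linarith, hb⟩] at hcon; linarith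

theorem pair (h : ArcOn C ρ z N κ) (a b a' b' : ℝ) (ha : 0 ≤ a) (hab : a < b) (hb : b ≤ ρ)
    (ha' : 0 ≤ a') (hab' : a' < b') (hb' : b' ≤ ρ) (hs : cd z a b = cd z a' b')
    (u : ℝ) (hu : u ∈ Icc a b) (v : ℝ) (hv : v ∈ Icc a b) (u' : ℝ) (hu' : u' ∈ Icc a' b')
    (v' : ℝ) (hv' : v' ∈ Icc a' b')
    (h1 : cd z a u = cd z a' u') (h2 : cd z u b = cd z u' b')
    (h3 : cd z a v = cd z a' v') (h4 : cd z v b = cd z v' b') : cd z u v = cd z u' v' := by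
  have I : ∀ {w}, w ∈ Icc a b → w ∈ Icc 0 ρ := fun hw => ⟨ha.trans hw.1, hw.2.trans hb⟩
  have I' : ∀ {w}, w ∈ Icc a' b' → w ∈ Icc 0 ρ := fun hw => ⟨ha'.trans hw.1, hw.2.trans hb'⟩
  have f := h.frame a b ha hab hb
  have f' := h.frame a' b' ha' hab' hb'
  obtain ⟨α, β, γ, he, -, -, p0, -, -⟩ := h.coords_nonneg ha hab hb hu
  obtain ⟨α1, β1, γ1, he1, -, -, p1, -, -⟩ := h.coords_nonneg ha hab hb hv
  obtain ⟨α', β', γ', he', -, -, p0', -, -⟩ := h.coords_nonneg ha' hab' hb' hu'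
  obtain ⟨α1', β1', γ1', he1', -, -, p1', -, -⟩ := h.coords_nonneg ha' hab' hb' hv'
  obtain ⟨rfl, rfl, rfl⟩ := f.coords_unique f' hs (h.hyp (I hu)) (h.hyp (I' hu')) he he' p0 p0'
    (by rw [cd_comm, cd_comm z a'] at h1; simp only [cd] at h1; linarith)
    (by simp only [cd] at h2; linarith)
  obtain ⟨rfl, rfl, rfl⟩ := f.coords_unique f' hs (h.hyp (I hv)) (h.hyp (I' hv')) he1 he1' p1 p1'
    (by rw [cd_comm, cd_comm z a'] at h3; simp only [cd] at h3; linarith)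
    (by simp only [cd] at h4; linarith)
  rw [cd, cd, he, he1, he', he1', f.lor_lor, f'.lor_lor, hs]

theorem pair_swap (h : ArcOn C ρ z N κ) (a b a' b' : ℝ) (ha : 0 ≤ a) (hab : a < b) (hb : b ≤ ρ)
    (ha' : 0 ≤ a') (hab' : a' < b') (hb' : b' ≤ ρ) (hs : cd z a b = cd z a' b')
    (u : ℝ) (hu : u ∈ Icc a b) (v : ℝ) (hv : v ∈ Icc a b) (u' : ℝ) (hu' : u' ∈ Icc a' b')
    (v' : ℝ) (hv' : v' ∈ Icc a' b')
    (h1 : cd z a u = cd z u' b') (h2 : cd z u b = cd z a' u')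
    (h3 : cd z a v = cd z v' b') (h4 : cd z v b = cd z a' v') : cd z u v = cd z u' v' := by
  have I : ∀ {w}, w ∈ Icc a b → w ∈ Icc 0 ρ := fun hw => ⟨ha.trans hw.1, hw.2.trans hb⟩
  have I' : ∀ {w}, w ∈ Icc a' b' → w ∈ Icc 0 ρ := fun hw => ⟨ha'.trans hw.1, hw.2.trans hb'⟩
  have f := h.frame a b ha hab hb
  have f' := (h.frame a' b' ha' hab' hb').swap
  obtain ⟨α, β, γ, he, -, -, p0, -, -⟩ := h.coords_nonneg ha hab hb hu
  obtain ⟨α1, β1, γ1, he1, -, -, p1, -, -⟩ := h.coords_nonneg ha hab hb hv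
  obtain ⟨α', β', γ', he', -, -, p0', -, -⟩ := h.coords_nonneg ha' hab' hb' hu'
  obtain ⟨α1', β1', γ1', he1', -, -, p1', -, -⟩ := h.coords_nonneg ha' hab' hb' hv'
  rw [add_comm (α' • _)] at he'
  rw [add_comm (α1' • _)] at he1'
  obtain ⟨rfl, rfl, rfl⟩ := f.coords_unique f' hs (h.hyp (I hu)) (h.hyp (I' hu')) he he' p0 p0'
    (by rw [cd_comm] at h1; simp only [cd] at h1; linarith)
    (by rw [cd_comm z a'] at h2; simp only [cd] at h2; linarith)
  obtain ⟨rfl, rfl, rfl⟩ := f.coords_unique f' hs (h.hyp (I hv)) (h.hyp (I' hv')) he1 he1' p1 p1'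
    (by rw [cd_comm] at h3; simp only [cd] at h3; linarith)
    (by rw [cd_comm z a'] at h4; simp only [cd] at h4; linarith)
  rw [cd, cd, he, he1, he', he1', f.lor_lor, f'.lor_lor, hs]

theorem trap (h : ArcOn C ρ z N κ) (a u v b : ℝ) (ha : 0 ≤ a) (hau : a < u) (huv : u < v)
    (hvb : v < b) (hb : b ≤ ρ) (h1 : cd z a u = cd z v b) (h2 : cd z a v = cd z u b) :
    ∃ τ : ℝ, |τ| < 1 ∧ z v - z u = τ • (z b - z a) := by
  have hab : a < b := by linarith
  have f := h.frame a b ha hab hb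
  have hu : u ∈ Icc a b := ⟨hau.le, by linarith⟩
  have hv : v ∈ Icc a b := ⟨by linarith, hvb.le⟩
  have I : ∀ {w}, w ∈ Icc a b → w ∈ Icc 0 ρ := fun hw => ⟨ha.trans hw.1, hw.2.trans hb⟩
  obtain ⟨α, β, γ, he, q1, q2, p0, q3, q4⟩ := h.coords_nonneg ha hab hb hu
  obtain ⟨α1, β1, γ1, he1, -, -, p1, -, -⟩ := h.coords_nonneg ha hab hb hv
  rw [add_comm (α1 • _)] at he1
  obtain ⟨rfl, rfl, rfl⟩ := f.coords_unique f.swap rfl (h.hyp (I hu)) (h.hyp (I hv)) he he1 p0 p1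
    (by rw [cd_comm] at h1; simp only [cd] at h1; linarith)
    (by rw [cd_comm z a] at h2; simp only [cd] at h2; linarith)
  refine ⟨α - β, ?_, ?_⟩
  · have hz := (h.hyp (I hu)).1
    rw [he, f.lor_lor] at hz
    have d1 := h.δ_pos ha hab hb
    have d2 := h.δ_sq ha hab hb
    have hs := f.hs
    set δ := κ * Real.sqrt (cd z a b ^ 2 - 1)
    have hγ : γ * γ ≤ δ ^ 2 * (α * β) := by
      calc γ * γ ≤ (δ * α) * (δ * β) := mul_le_mul q3 q4 p0 (by positivity)
        _ = _ := by ring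
    have hαβ := mul_nonneg q1 q2
    have hle : (α + β) ^ 2 ≤ 1 := by nlinarith
    have hne : α ≠ 0 ∧ β ≠ 0 := by
      constructor
      · rintro rfl
        have : γ = 0 := by linarith
        subst this
        have : β = 1 := by nlinarith
        subst this
        exact h.inj (by linarith) (by linarith : u < b) hb (by rw [he]; module)
      · rintro rfl
        have : γ = 0 := by linarith
        subst this
        have : α = 1 := by nlinarith
        subst this
        exact h.inj ha hau (by linarith) (by rw [he]; module)
    have hα := lt_of_le_of_ne q1 (Ne.symm hne.1)
    have hβ := lt_of_le_of_ne q2 (Ne.symm hne.2)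
    have h5 : α + β ≤ 1 := by nlinarith
    exact abs_lt.2 ⟨by linarith, by linarith⟩
  · rw [he, he1]; module

theorem metArc (h : ArcOn C ρ z N κ) : MetArc z ρ :=
  ⟨h.ρ_pos, h.cont, fun _ hu => h.hyp hu, fun _ _ _ _ h1 h2 h3 h4 h5 h6 => h.mono h1 h2 h3 h4 h5 h6,
    h.pair, h.pair_swap, h.trap⟩

end ArcOn

/-! ### Profiles of arcs -/

/-- A convex cone near a chord. -/
structure Lens (C : Set Vec) (s : ℝ) (P Q n : Vec) (δ : ℝ) : Prop where
  body : IsBody C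
  frame : CFrame s P Q n
  bdP : P ∈ Bd C
  bdQ : Q ∈ Bd C
  outer : Outer C P Q n 1 1 δ
  inner : P + Q + δ • (-n) ∈ interior C

/-- Profile of a straight segment of length `s`. -/
def Seg (s : ℝ) : Set (ℝ × ℝ) :=
  {p | ∃ α β : ℝ, 0 < α ∧ 0 < β ∧ α ^ 2 + β ^ 2 + 2 * s * α * β = 1 ∧ p = (α + s * β, s * α + β)}

/-- Replace an empty profile by that of a segment. -/
def fill (s : ℝ) (p : Set (ℝ × ℝ)) : Set (ℝ × ℝ) := {x | x ∈ p ∨ (p = ∅ ∧ x ∈ Seg s)}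

theorem Seg_swap {s : ℝ} {x : ℝ × ℝ} (h : x ∈ Seg s) : x.swap ∈ Seg s := by
  obtain ⟨α, β, h1, h2, h3, rfl⟩ := h
  exact ⟨β, α, h2, h1, by linarith, by ext <;> simp <;> ring⟩

theorem fill_swap (s : ℝ) (p : Set (ℝ × ℝ)) : fill s (Prod.swap '' p) = Prod.swap '' fill s p := by
  ext x
  constructor
  · rintro (⟨y, hy, rfl⟩ | ⟨h1, h2⟩)
    · exact ⟨y, Or.inl hy, rfl⟩
    · exact ⟨x.swap, Or.inr ⟨image_eq_empty.1 h1, Seg_swap h2⟩, Prod.swap_swap x⟩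
  · rintro ⟨y, hy | ⟨h1, h2⟩, rfl⟩
    · exact Or.inl ⟨y, hy, rfl⟩
    · exact Or.inr ⟨by rw [h1, image_empty], Seg_swap h2⟩

theorem ProfDich.fill {p q : Set (ℝ × ℝ)} (h : ProfDich p q) (s : ℝ) :
    ProfDich (fill s p) (fill s q) := by
  rcases h with rfl | h | ⟨h1, h2⟩
  · exact Or.inl rfl
  · exact Or.inr (Or.inl (by rw [h, fill_swap]))
  · exact Or.inr (Or.inr ⟨by rw [← fill_swap, ← h1], by rw [← fill_swap, ← h2]⟩)

theorem ProfDich.swap_right {p q : Set (ℝ × ℝ)} (h : ProfDich p (Prod.swap '' q)) :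
    ProfDich p q := by
  have hs : Prod.swap '' (Prod.swap '' q) = q := by
    rw [← image_comp, Prod.swap_swap_eq, image_id]
  rcases h with h | h | ⟨h1, h2⟩
  · exact Or.inr (Or.inl h)
  · exact Or.inl (by rw [h, hs])
  · exact Or.inr (Or.inr ⟨h1, by rw [hs] at h2; exact h2.symm⟩)

namespace Lens

variable {C D : Set Vec} {s δ : ℝ} {P Q n P' Q' n' : Vec}

theorem swap (h : Lens C s P Q n δ) : Lens C s Q P n δ :=
  ⟨h.body, h.frame.swap, h.bdQ, h.bdP, fun α β γ hm hg => (h.outer β α γ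
    (by rwa [add_comm (β • P)]) hg).symm, by rw [add_comm Q]; exact h.inner⟩

theorem image (h : Lens C s P Q n δ) {A : Vec ≃ₗ[ℝ] Vec} (hA : IsLor A) :
    Lens (A '' C) s (A P) (A Q) (A n) δ := by
  refine ⟨h.body.image hA, h.frame.map hA, (mem_Bd_image hA).2 h.bdP, (mem_Bd_image hA).2 h.bdQ,
    fun α β γ hm hg => h.outer α β γ ?_ hg, ?_⟩
  · rw [← map_smul, ← map_smul, ← map_smul, ← map_add, ← map_add] at hm
    exact A.injective.mem_set_image.1 hm
  · rw [← map_neg, ← map_smul, ← map_add, ← map_add, mem_interior_image]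
    exact h.inner

theorem sum_mem_int (h : Lens C s P Q n δ) (hδ : 0 < δ) {z : Vec} (hz : z ∈ C)
    (hzn : 0 < lor z n) : P + Q ∈ interior C := by
  obtain ⟨α, β, γ, rfl⟩ := h.frame.expand z
  rw [h.frame.lor_n] at hzn
  obtain ⟨h1, h2⟩ := h.outer α β γ hz hzn
  rw [one_mul] at h1 h2
  have hα : 0 < α := (mul_pos_iff_of_pos_left hδ).1 (hzn.trans_le h1)
  have hβ : 0 < β := (mul_pos_iff_of_pos_left hδ).1 (hzn.trans_le h2)
  have hT : 0 < γ + δ * α + δ * β := by positivity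
  set T := γ + δ * α + δ * β
  have e : P + Q = (γ / T) • (P + Q + δ • (-n)) + ((δ / T) • (α • P + β • Q + γ • n) +
      ((δ * β / T) • P + (δ * α / T) • Q)) := by
    have hP : γ / T + δ / T * α + δ * β / T = 1 := by
      simp only [T] at hT ⊢; field_simp
    have hQ : γ / T + δ / T * β + δ * α / T = 1 := by
      simp only [T] at hT ⊢; field_simp; ring
    have hn : γ / T * δ = δ / T * γ := by ring
    calc P + Q = (γ / T + δ / T * α + δ * β / T) • P + (γ / T + δ / T * β + δ * α / T) • Q +
          (δ / T * γ - γ / T * δ) • n := by rw [hP, hQ, hn, sub_self]; module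
      _ = _ := by module
  rw [e]
  have hb := h.body
  refine hb.int_add (hb.smul_int (by positivity) h.inner) (hb.add _ (hb.smul _ (by positivity) _ hz) _
    (hb.add _ (hb.smul _ (by positivity) _ h.bdP.2.1) _ (hb.smul _ (by positivity) _ h.bdQ.2.1)))

theorem inter_nonempty (h : Lens C s P Q n δ) (h' : Lens D s P Q (-n) δ) (hδ : 0 < δ) {z : Vec}
    (hz : z ∈ C) (hzn : 0 < lor z n) : (interior (C ∩ D)).Nonempty := by
  have h1 := h.sum_mem_int hδ hz hzn
  have h2 := h'.inner
  set w := P + Q + δ • (- -n) with hw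
  have hc : Tendsto (fun t : ℝ => P + Q + t • w) (nhdsWithin 0 (Ioi 0)) (nhds (P + Q + (0:ℝ) • w)) := by
    apply Tendsto.mono_left _ nhdsWithin_le_nhds
    exact (by fun_prop : Continuous fun t : ℝ => P + Q + t • w).tendsto 0
  rw [zero_smul, add_zero] at hc
  obtain ⟨t, ht, ht0⟩ := ((hc.eventually (isOpen_interior.mem_nhds h1)).and
    self_mem_nhdsWithin).exists
  refine ⟨P + Q + t • w, ?_⟩
  rw [interior_inter]
  exact ⟨ht, h'.body.add_int (h'.body.add _ h'.bdP.2.1 _ h'.bdQ.2.1) (h'.body.smul_int ht0 h2)⟩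

theorem dich (h : Lens C s P Q n δ) (h' : Lens D s P Q (-n) δ) (hδ : 0 < δ)
    (hδs : δ ^ 2 < 2 * (s - 1)) (hsym : (interior (C ∩ D)).Nonempty →
      ∃ A : Vec ≃ₗ[ℝ] Vec, IsLor A ∧ A ≠ LinearEquiv.refl ℝ Vec ∧ A '' (C ∩ D) = C ∩ D) :
    ProfDich (Prof C P Q n) (Prof D P Q (-n)) := by
  by_cases hne : (interior (C ∩ D)).Nonempty
  · obtain ⟨A, hA, hA1, hAM⟩ := hsym hne
    have hi := h'.inner
    rw [neg_neg] at hi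
    exact lens_dich h.frame h.body h'.body h.bdP h.bdQ h'.bdP h'.bdQ hδ hδs h.outer h'.outer
      h.inner hi hA hA1 hAM
  · left
    rw [show Prof C P Q n = ∅ from ?_, show Prof D P Q (-n) = ∅ from ?_]
    · refine eq_empty_of_forall_notMem ?_
      rintro _ ⟨z, hz, h1, -⟩
      refine hne ?_
      rw [inter_comm]
      exact h'.inter_nonempty (by rwa [neg_neg]) hδ hz.2.1 h1
    · refine eq_empty_of_forall_notMem ?_
      rintro _ ⟨z, hz, h1, -⟩
      exact hne (h.inter_nonempty h' hδ hz.2.1 h1)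

end Lens

/-- The symmetry condition in the linear model. -/
def LinCond (C D : Set Vec) : Prop :=
  ∀ (s : ℝ) (P Q n P' Q' n' : Vec), CFrame s P Q n → CFrame s P' Q' n' →
    ∃ G : Vec ≃ₗ[ℝ] Vec, IsLor G ∧ G n' = -n ∧ ((G P' = P ∧ G Q' = Q) ∨ (G P' = Q ∧ G Q' = P)) ∧
      ((interior (C ∩ G '' D)).Nonempty → ∃ A : Vec ≃ₗ[ℝ] Vec, IsLor A ∧
        A ≠ LinearEquiv.refl ℝ Vec ∧ A '' (C ∩ G '' D) = C ∩ G '' D)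

theorem LinCond.dich {C D : Set Vec} {s δ : ℝ} {P Q n P' Q' n' : Vec} (hcd : LinCond C D)
    (h : Lens C s P Q n δ) (h' : Lens D s P' Q' n' δ) (hδ : 0 < δ)
    (hδs : δ ^ 2 < 2 * (s - 1)) : ProfDich (Prof C P Q n) (Prof D P' Q' n') := by
  obtain ⟨G, hG, hn, hPQ, hsym⟩ := hcd s P Q n P' Q' n' h.frame h'.frame
  rcases hPQ with ⟨hP, hQ⟩ | ⟨hP, hQ⟩
  · have h2 := h'.image hG
    have h3 := Prof_image hG D P' Q' n'
    rw [hP, hQ, hn] at h2 h3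
    rw [← h3]
    exact h.dich h2 hδ hδs hsym
  · have h2 := h'.swap.image hG
    have h3 := Prof_image hG D Q' P' n'
    rw [hP, hQ, hn] at h2 h3
    have := h.dich h2 hδ hδs hsym
    rw [h3, Prof_swap D] at this
    exact this.swap_right

/-- The pairs of distances from the inner points of an arc to its end points. -/
def prof (z : ℝ → Vec) (a b : ℝ) : Set (ℝ × ℝ) := {p | ∃ u ∈ Ioo a b, p = (cd z a u, cd z u b)}

namespace MetArc

variable {z : ℝ → Vec} {r : ℝ}

theorem cd_self (h : MetArc z r) {u : ℝ} (hu : u ∈ Icc 0 r) : cd z u u = 1 := by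
  rw [cd, (h.hyp u hu).1]; norm_num

theorem restrict (h : MetArc z r) {r' : ℝ} (h0 : 0 < r') (h1 : r' ≤ r) : MetArc z r' where
  r_pos := h0
  cont := h.cont.mono (Icc_subset_Icc_right h1)
  hyp u hu := h.hyp u ⟨hu.1, hu.2.trans h1⟩
  mono a u v b k1 k2 k3 k4 k5 := h.mono a u v b k1 k2 k3 k4 (k5.trans h1)
  pair a b a' b' k1 k2 k3 k4 k5 k6 := h.pair a b a' b' k1 k2 (k3.trans h1) k4 k5 (k6.trans h1)
  pair_swap a b a' b' k1 k2 k3 k4 k5 k6 :=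
    h.pair_swap a b a' b' k1 k2 (k3.trans h1) k4 k5 (k6.trans h1)
  trap a u v b k1 k2 k3 k4 k5 := h.trap a u v b k1 k2 k3 k4 (k5.trans h1)

theorem one_lt (h : MetArc z r) {a b : ℝ} (ha : 0 ≤ a) (hab : a < b) (hb : b ≤ r) :
    1 < cd z a b := by
  have := h.mono a a a b ha le_rfl le_rfl hab.le hb (Or.inr hab)
  rwa [h.cd_self ⟨ha, hab.le.trans hb⟩] at this

theorem cont_cd (h : MetArc z r) {a b : ℝ} {f g : ℝ → ℝ} (hf : ContinuousOn f (Icc a b))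
    (hg : ContinuousOn g (Icc a b)) (hf' : MapsTo f (Icc a b) (Icc 0 r))
    (hg' : MapsTo g (Icc a b) (Icc 0 r)) : ContinuousOn (fun u => cd z (f u) (g u)) (Icc a b) :=
  (continuousOn_lor_comp (h.cont.comp hf hf') (h.cont.comp hg hg')).neg

theorem exists_right (h : MetArc z r) {a b t : ℝ} (ha : 0 ≤ a) (hab : a < b) (hb : b ≤ r)
    (h1 : 1 < t) (h2 : t < cd z a b) : ∃ u ∈ Ioo a b, cd z a u = t := by
  have hc : ContinuousOn (fun u => cd z a u) (Icc a b) :=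
    h.cont_cd continuousOn_const continuousOn_id (fun x hx => ⟨ha, hab.le.trans hb⟩)
      (fun x hx => ⟨ha.trans hx.1, hx.2.trans hb⟩)
  obtain ⟨u, hu, he⟩ := intermediate_value_Ioo hab.le hc
    (show t ∈ Ioo (cd z a a) (cd z a b) from ⟨by rwa [h.cd_self ⟨ha, hab.le.trans hb⟩], h2⟩)
  exact ⟨u, hu, he⟩

theorem exists_mid (h : MetArc z r) {a b : ℝ} (ha : 0 ≤ a) (hab : a < b) (hb : b ≤ r) :
    ∃ u ∈ Ioo a b, cd z a u = cd z u b := by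
  have i1 : MapsTo (fun _ : ℝ => a) (Icc a b) (Icc 0 r) := fun x hx => ⟨ha, hab.le.trans hb⟩
  have i2 : MapsTo (fun _ : ℝ => b) (Icc a b) (Icc 0 r) := fun x hx => ⟨ha.trans hab.le, hb⟩
  have i3 : MapsTo (fun u : ℝ => u) (Icc a b) (Icc 0 r) :=
    fun x hx => ⟨ha.trans hx.1, hx.2.trans hb⟩
  have hc := (h.cont_cd continuousOn_const continuousOn_id i1 i3).sub
    (h.cont_cd continuousOn_id continuousOn_const i3 i2)
  have h1 := h.one_lt ha hab hb
  obtain ⟨u, hu, he⟩ := intermediate_value_Ioo hab.le hc (show (0:ℝ) ∈ Ioo _ _ from ⟨by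
    simp only [Pi.sub_apply, id]; rw [h.cd_self ⟨ha, hab.le.trans hb⟩]; linarith, by
    simp only [Pi.sub_apply, id]; rw [h.cd_self ⟨ha.trans hab.le, hb⟩]; linarith⟩)
  exact ⟨u, hu, by simpa [sub_eq_zero] using he⟩

theorem right_lt (h : MetArc z r) {a u v : ℝ} (ha : 0 ≤ a) (hu : a ≤ u) (hv : v ≤ r)
    (huv : u < v) : cd z a u < cd z a v :=
  h.mono a a u v ha le_rfl hu huv.le hv (Or.inr huv)

theorem left_lt (h : MetArc z r) {a u v : ℝ} (ha : 0 ≤ a) (hu : u ≤ v) (hv : v ≤ r)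
    (hau : a < u) : cd z u v < cd z a v :=
  h.mono a u v v ha hau.le hu le_rfl hv (Or.inl hau)

theorem right_inj (h : MetArc z r) {a u v : ℝ} (ha : 0 ≤ a) (hu : u ∈ Icc a r) (hv : v ∈ Icc a r)
    (he : cd z a u = cd z a v) : u = v := by
  rcases lt_trichotomy u v with hh | hh | hh
  · exact absurd he (h.right_lt ha hu.1 hv.2 hh).ne
  · exact hh
  · exact absurd he (h.right_lt ha hv.1 hu.2 hh).ne'

theorem left_inj (h : MetArc z r) {u v b : ℝ} (hb : b ≤ r) (hu : u ∈ Icc 0 b) (hv : v ∈ Icc 0 b)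
    (he : cd z u b = cd z v b) : u = v := by
  rcases lt_trichotomy u v with hh | hh | hh
  · exact absurd he (h.left_lt hu.1 hv.2 hb hh).ne'
  · exact hh
  · exact absurd he (h.left_lt hv.1 hu.2 hb hh).ne

end MetArc

namespace ArcOn

variable {C D : Set Vec} {ρ κ ρ' : ℝ} {z z' : ℝ → Vec} {N N' : ℝ → ℝ → Vec}

theorem lens (h : ArcOn C ρ z N κ) {a b : ℝ} (ha : 0 ≤ a) (hab : a < b) (hb : b ≤ ρ) :
    Lens C (cd z a b) (z a) (z b) (N a b) (κ * Real.sqrt (cd z a b ^ 2 - 1)) :=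
  ⟨h.body, h.frame a b ha hab hb, h.bd a ⟨ha, hab.le.trans hb⟩, h.bd b ⟨ha.trans hab.le, hb⟩,
    h.outer a b ha hab hb, h.inner a b ha hab hb⟩

theorem prof_eq (h : ArcOn C ρ z N κ) {a b : ℝ} (ha : 0 ≤ a) (hab : a < b) (hb : b ≤ ρ) :
    prof z a b = fill (cd z a b) (Prof C (z a) (z b) (N a b)) := by
  have hf := h.frame a b ha hab hb
  have hI : ∀ {u}, u ∈ Ioo a b → u ∈ Icc 0 ρ := fun hu =>
    ⟨ha.trans hu.1.le, hu.2.le.trans hb⟩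
  have hpr : ∀ u v, cd z u v = cd z v u := fun u v => cd_comm ..
  -- in the flat case all points are nonnegative combinations of the end points
  have hflat : Prof C (z a) (z b) (N a b) = ∅ → ∀ u ∈ Ioo a b, ∃ α β : ℝ, 0 < α ∧ 0 < β ∧
      α ^ 2 + β ^ 2 + 2 * cd z a b * α * β = 1 ∧ cd z a u = α + cd z a b * β ∧
      cd z u b = cd z a b * α + β := by
    intro he u hu
    obtain ⟨α, β, γ, e, p1, p2, p0, p3, p4⟩ :=
      h.coords_nonneg ha hab hb (u := u) ⟨hu.1.le, hu.2.le⟩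
    have hγ : γ = 0 := by
      by_contra hne
      have hpos : 0 < lor (z u) (N a b) := by
        rw [e, hf.lor_n]; exact lt_of_le_of_ne p0 (Ne.symm hne)
      have : ((-lor (z u) (z a), -lor (z u) (z b)) : ℝ × ℝ) ∈ Prof C (z a) (z b) (N a b) :=
        ⟨z u, h.bd u (hI hu), hpos, rfl⟩
      rw [he] at this
      exact this
    subst hγ
    have hh := (h.hyp (hI hu)).1
    rw [e, hf.lor_lor] at hh
    have c1 : cd z a u = α + cd z a b * β := by
      rw [hpr a u, show cd z u a = -lor (z u) (z a) from rfl, e, hf.lor_P]; ring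
    have c2 : cd z u b = cd z a b * α + β := by
      rw [show cd z u b = -lor (z u) (z b) from rfl, e, hf.lor_Q]; ring
    have hs := hf.hs
    have m := h.metArc
    have l1 := m.right_lt ha hu.1.le hb hu.2
    have l2 := m.left_lt ha hu.2.le hb hu.1
    refine ⟨α, β, lt_of_le_of_ne p1 ?_, lt_of_le_of_ne p2 ?_, by nlinarith, c1, c2⟩
    · rintro rfl
      have : β = 1 := by nlinarith
      rw [c1, this] at l1; linarith
    · rintro rfl
      have : α = 1 := by nlinarith
      rw [c2, this] at l2; linarith
  ext p
  constructor
  · rintro ⟨u, hu, rfl⟩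
    by_cases he : Prof C (z a) (z b) (N a b) = ∅
    · obtain ⟨α, β, h1, h2, h3, h4, h5⟩ := hflat he u hu
      exact Or.inr ⟨he, α, β, h1, h2, h3, by rw [h4, h5]⟩
    · obtain ⟨_, y, hy, hyn, -⟩ := nonempty_iff_ne_empty.2 he
      obtain ⟨v, hv, rfl⟩ := h.exhaust a b ha hab hb y hy hyn
      refine Or.inl ⟨z u, h.bd u (hI hu), h.nonflat a b ha hab hb v hv hyn u hu, ?_⟩
      rw [hpr a u]; rfl
  · rintro (⟨y, hy, hyn, rfl⟩ | ⟨he, α, β, h1, h2, h3, rfl⟩)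
    · obtain ⟨v, hv, rfl⟩ := h.exhaust a b ha hab hb y hy hyn
      exact ⟨v, hv, by rw [hpr a v]; rfl⟩
    · have hs := hf.hs
      set s := cd z a b with hsd
      have q : (α + s * β) ^ 2 = 1 + (s ^ 2 - 1) * β ^ 2 := by nlinarith
      have pβ : 0 < β ^ 2 := by positivity
      have lβ : β ^ 2 < 1 := by
        have : 0 < s * α * β := by positivity
        nlinarith
      have pT : 0 < α + s * β := by positivity
      have t1 : 1 < α + s * β := by
        have := mul_pos hf.sq_pos pβ
        nlinarith
      have t2 : α + s * β < s := by
        have := mul_lt_mul_of_pos_left lβ hf.sq_pos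
        nlinarith
      obtain ⟨u, hu, hut⟩ := h.metArc.exists_right ha hab hb t1 t2
      obtain ⟨α', β', k1, k2, k3, k4, k5⟩ := hflat he u hu
      have q' : (α' + s * β') ^ 2 = 1 + (s ^ 2 - 1) * β' ^ 2 := by nlinarith
      rw [← k4, hut, q] at q'
      have eβ : β ^ 2 = β' ^ 2 := by
        have := hf.sq_pos
        have e : (s ^ 2 - 1) * β ^ 2 = (s ^ 2 - 1) * β' ^ 2 := by linarith
        exact mul_left_cancel₀ this.ne' e
      have eβ' : β = β' := (pow_left_inj₀ h2.le k2.le two_ne_zero).1 eβ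
      subst eβ'
      have : α = α' := by linarith
      subst this
      exact ⟨u, hu, by rw [k4, k5]⟩

theorem dich (h : ArcOn C ρ z N κ) (h' : ArcOn D ρ' z' N' κ) (hcd : LinCond C D) {a b a' b' : ℝ}
    (ha : 0 ≤ a) (hab : a < b) (hb : b ≤ ρ) (ha' : 0 ≤ a') (hab' : a' < b') (hb' : b' ≤ ρ')
    (hs : cd z a b = cd z' a' b') : ProfDich (prof z a b) (prof z' a' b') := by
  rw [h.prof_eq ha hab hb, h'.prof_eq ha' hab' hb']
  have l' := h'.lens ha' hab' hb'
  rw [← hs] at l' ⊢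
  exact (hcd.dich (h.lens ha hab hb) l' (h.δ_pos ha hab hb) (h.δ_sq ha hab hb)).fill _

end ArcOn

/-! ### Arcs with symmetric or congruent chords -/

/-- All chords have symmetric profiles. -/
def SymArc (z : ℝ → Vec) (r : ℝ) : Prop :=
  ∀ a b, 0 ≤ a → a < b → b ≤ r → prof z a b = Prod.swap '' prof z a b

/-- Distances along the arc determine the third side of a triangle. -/
def HomArc (z : ℝ → Vec) (r : ℝ) : Prop :=
  ∀ a u v a₂ u₂ v₂, 0 ≤ a → a < u → u < v → v ≤ r → 0 ≤ a₂ → a₂ < u₂ → u₂ < v₂ → v₂ ≤ r →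
    cd z a u = cd z a₂ u₂ → cd z a v = cd z a₂ v₂ → cd z u v = cd z u₂ v₂

/-- Subdivision of an isosceles triangle. -/
def MidArc (z : ℝ → Vec) (r : ℝ) : Prop :=
  ∀ P m R, 0 ≤ P → P < m → m < R → R ≤ r → cd z P m = cd z m R → ∃ m1 ∈ Ioo P m, ∃ m2 ∈ Ioo m R,
    cd z P m1 = cd z m1 m ∧ cd z m1 m = cd z m m2 ∧ cd z m m2 = cd z m2 R ∧
      cd z P m = cd z m1 m2

namespace MetArc

variable {z : ℝ → Vec} {r : ℝ}

theorem exists_left (h : MetArc z r) {a b t : ℝ} (ha : 0 ≤ a) (hab : a < b) (hb : b ≤ r)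
    (h1 : 1 < t) (h2 : t < cd z a b) : ∃ u ∈ Ioo a b, cd z u b = t := by
  have hc : ContinuousOn (fun u => cd z u b) (Icc a b) :=
    h.cont_cd continuousOn_id continuousOn_const (fun x hx => ⟨ha.trans hx.1, hx.2.trans hb⟩)
      (fun x hx => ⟨ha.trans hab.le, hb⟩)
  obtain ⟨u, hu, he⟩ := intermediate_value_Ioo' hab.le hc
    (show t ∈ Ioo (cd z b b) (cd z a b) from ⟨by rwa [h.cd_self ⟨ha.trans hab.le, hb⟩], h2⟩)
  exact ⟨u, hu, he⟩

theorem midArc_of_sym (h : MetArc z r) (hs : SymArc z r) : MidArc z r := by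
  intro P m R hP hPm hmR hR he
  obtain ⟨m1, hm1, e1⟩ := h.exists_mid hP hPm (hmR.le.trans hR)
  have hPR := hPm.trans hmR
  have mir : ∀ a b, 0 ≤ a → a < b → b ≤ r → ∀ u ∈ Ioo a b, ∃ w ∈ Ioo a b,
      cd z a w = cd z u b ∧ cd z w b = cd z a u := by
    intro a b ha hab hb u hu
    have : (cd z u b, cd z a u) ∈ prof z a b := by
      rw [hs a b ha hab hb]
      exact ⟨(cd z a u, cd z u b), ⟨u, hu, rfl⟩, rfl⟩
    obtain ⟨w, hw, hp⟩ := this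
    obtain ⟨p1, p2⟩ := Prod.mk.inj hp
    exact ⟨w, hw, p1.symm, p2.symm⟩
  have hm1R : m1 ∈ Ioo P R := ⟨hm1.1, hm1.2.trans hmR⟩
  obtain ⟨m2, hm2, f1, f2⟩ := mir P R hP hPR hR m1 hm1R
  have hmm2 : m < m2 := by
    by_contra hcon
    push Not at hcon
    have k1 : cd z P m2 ≤ cd z P m := by
      rcases hcon.eq_or_lt with rfl | hlt
      · exact le_rfl
      · exact (h.right_lt hP hm2.1.le (hmR.le.trans hR) hlt).le
    have k2 : cd z m R < cd z m1 R := h.left_lt (hP.trans hm1.1.le) hmR.le hR hm1.2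
    linarith
  have g := h.pair_swap P R P R hP hPR hR hP hPR hR rfl m1 ⟨hm1R.1.le, hm1R.2.le⟩ m
    ⟨hPm.le, hmR.le⟩ m2 ⟨hm2.1.le, hm2.2.le⟩ m ⟨hPm.le, hmR.le⟩ f2.symm f1.symm he he.symm
  have g' : cd z m1 m = cd z m m2 := by rw [g]; exact cd_comm ..
  obtain ⟨w, hw, w1, w2⟩ := mir P m2 hP hm2.1 (hm2.2.le.trans hR) m1 ⟨hm1.1, hm1.2.trans hmm2⟩
  have hwm : w = m := by
    refine h.left_inj (hm2.2.le.trans hR) ⟨hP.trans hw.1.le, hw.2.le⟩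
      ⟨hP.trans hPm.le, hmm2.le⟩ ?_
    rw [w2, e1, g']
  subst hwm
  exact ⟨m1, hm1, m2, ⟨hmm2, hm2.2⟩, e1, g', by rw [← g', f2, e1], w1⟩

theorem midArc_of_hom (h : MetArc z r) (hs : HomArc z r) : MidArc z r := by
  have hsas : ∀ a u v a' u' v', 0 ≤ a → a < u → u < v → v ≤ r → 0 ≤ a' → a' < u' → u' < v' →
      v' ≤ r → cd z a u = cd z a' u' → cd z u v = cd z u' v' → cd z a v ≤ cd z a' v' →
      cd z a v = cd z a' v' := by
    intro a u v a' u' v' h1 h2 h3 h4 h5 h6 h7 h8 k1 k2 k3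
    rcases k3.eq_or_lt with k3 | k3
    · exact k3
    obtain ⟨w, hw, hwe⟩ := h.exists_right h5 (h6.trans h7) h8 (h.one_lt h1 (h2.trans h3) h4) k3
    have huw : u' < w := by
      by_contra hcon
      push Not at hcon
      have k4 : cd z a' w ≤ cd z a' u' := by
        rcases hcon.eq_or_lt with rfl | hlt
        · exact le_rfl
        · exact (h.right_lt h5 hw.1.le (h7.le.trans h8) hlt).le
      have := h.right_lt h1 h2.le h4 h3
      linarith
    have := hs a u v a' u' w h1 h2 h3 h4 h5 h6 huw (hw.2.le.trans h8) k1 hwe.symm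
    rw [k2] at this
    have hwv := h.right_inj (h5.trans h6.le) ⟨h7.le, h8⟩ ⟨huw.le, hw.2.le.trans h8⟩ this
    exact absurd hwv hw.2.ne'
  have hsas' : ∀ a u v a' u' v', 0 ≤ a → a < u → u < v → v ≤ r → 0 ≤ a' → a' < u' → u' < v' →
      v' ≤ r → cd z a u = cd z a' u' → cd z u v = cd z u' v' → cd z a v = cd z a' v' := by
    intro a u v a' u' v' h1 h2 h3 h4 h5 h6 h7 h8 k1 k2
    rcases le_total (cd z a v) (cd z a' v') with k | k
    · exact hsas a u v a' u' v' h1 h2 h3 h4 h5 h6 h7 h8 k1 k2 k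
    · exact (hsas a' u' v' a u v h5 h6 h7 h8 h1 h2 h3 h4 k1.symm k2.symm k).symm
  intro P m R hP hPm hmR hR he
  have hmr := hmR.le.trans hR
  obtain ⟨m1, hm1, e1⟩ := h.exists_mid hP hPm hmr
  have t1 := h.one_lt hP hm1.1 (hm1.2.le.trans hmr)
  have t2 : cd z P m1 < cd z m R := by
    rw [← he]; exact h.right_lt hP hm1.1.le hmr hm1.2
  obtain ⟨m2, hm2, e2⟩ := h.exists_right (hP.trans hPm.le) hmR hR t1 t2
  have e3 := hs P m1 m m m2 R hP hm1.1 hm1.2 hmr (hP.trans hPm.le) hm2.1 hm2.2 hR e2.symm he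
  exact ⟨m1, hm1, m2, hm2, e1, by rw [e2, e1], by rw [← e3, e2, e1],
    hsas' P m1 m m1 m m2 hP hm1.1 hm1.2 hmr (hP.trans hm1.1.le) hm1.2 hm2.1 (hm2.2.le.trans hR) e1
      (by rw [e2, e1])⟩

theorem restrict_lt (h : MetArc z r) {t : ℝ} (ht : 1 < t) :
    ∃ r' > 0, r' ≤ r ∧ cd z 0 r' ≤ t := by
  by_cases hc : cd z 0 r ≤ t
  · exact ⟨r, h.r_pos, le_rfl, hc⟩
  · push Not at hc
    obtain ⟨u, hu, he⟩ := h.exists_right le_rfl h.r_pos le_rfl ht hc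
    exact ⟨u, hu.1, hu.2.le, he.le⟩

theorem exists_right_le (h : MetArc z r) {a b t : ℝ} (ha : 0 ≤ a) (hab : a < b) (hb : b ≤ r)
    (h1 : 1 < t) (h2 : t ≤ cd z a b) : ∃ u, a < u ∧ u ≤ b ∧ cd z a u = t := by
  rcases h2.eq_or_lt with h2 | h2
  · exact ⟨b, hab, le_rfl, h2.symm⟩
  · obtain ⟨u, hu, he⟩ := h.exists_right ha hab hb h1 h2
    exact ⟨u, hu.1, hu.2.le, he⟩

theorem le_of_subset (h : MetArc z r) {a b c d : ℝ} (ha : 0 ≤ a) (hac : a ≤ c) (hcd : c ≤ d)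
    (hdb : d ≤ b) (hb : b ≤ r) : cd z c d ≤ cd z a b := by
  by_cases hne : a < c ∨ d < b
  · exact (h.mono a c d b ha hac hcd hdb hb hne).le
  · push Not at hne
    rw [le_antisymm hac hne.1, le_antisymm hdb hne.2]

/-- The starting points of the chords carrying a point with prescribed distances. -/
theorem isClosed_profile (h : MetArc z r) (w s p q : ℝ) (hw : w ≤ r) :
    IsClosed {a : ℝ | ∃ u b, 0 ≤ a ∧ a ≤ w ∧ a ≤ u ∧ u ≤ b ∧ b ≤ r ∧ cd z a b = s ∧ cd z a u = p ∧
      cd z u b = q} := by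
  set I : Set (ℝ × ℝ × ℝ) := {x | 0 ≤ x.1 ∧ x.1 ≤ w ∧ x.1 ≤ x.2.1 ∧ x.2.1 ≤ x.2.2 ∧ x.2.2 ≤ r}
  have hI : IsClosed I := by
    have i1 : IsClosed {x : ℝ × ℝ × ℝ | 0 ≤ x.1} := isClosed_le (by fun_prop) (by fun_prop)
    have i2 : IsClosed {x : ℝ × ℝ × ℝ | x.1 ≤ w} := isClosed_le (by fun_prop) (by fun_prop)
    have i3 : IsClosed {x : ℝ × ℝ × ℝ | x.1 ≤ x.2.1} := isClosed_le (by fun_prop) (by fun_prop)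
    have i4 : IsClosed {x : ℝ × ℝ × ℝ | x.2.1 ≤ x.2.2} := isClosed_le (by fun_prop) (by fun_prop)
    have i5 : IsClosed {x : ℝ × ℝ × ℝ | x.2.2 ≤ r} := isClosed_le (by fun_prop) (by fun_prop)
    exact i1.inter (i2.inter (i3.inter (i4.inter i5)))
  have hIc : IsCompact I := by
    refine (isCompact_Icc (a := ((0:ℝ), (0:ℝ), (0:ℝ))) (b := (r, r, r))).of_isClosed_subset hI ?_
    rintro ⟨a, u, b⟩ ⟨h1, h2, h3, h4, h5⟩
    simp only at h1 h2 h3 h4 h5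
    refine ⟨⟨h1, ?_, ?_⟩, ⟨?_, ?_, ?_⟩⟩ <;> simp only <;> linarith
  have m1 : MapsTo (fun x : ℝ × ℝ × ℝ => x.1) I (Icc 0 r) := by
    rintro ⟨a, u, b⟩ ⟨h1, h2, h3, h4, h5⟩
    simp only at h1 h2 h3 h4 h5
    constructor <;> simp only <;> linarith
  have m2 : MapsTo (fun x : ℝ × ℝ × ℝ => x.2.1) I (Icc 0 r) := by
    rintro ⟨a, u, b⟩ ⟨h1, h2, h3, h4, h5⟩
    simp only at h1 h2 h3 h4 h5
    constructor <;> simp only <;> linarith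
  have m3 : MapsTo (fun x : ℝ × ℝ × ℝ => x.2.2) I (Icc 0 r) := by
    rintro ⟨a, u, b⟩ ⟨h1, h2, h3, h4, h5⟩
    simp only at h1 h2 h3 h4 h5
    constructor <;> simp only <;> linarith
  have c1 := h.cont.comp (continuous_fst.continuousOn) m1
  have c2 := h.cont.comp (f := fun x : ℝ × ℝ × ℝ => x.2.1)
    ((continuous_fst.comp continuous_snd).continuousOn) m2
  have c3 := h.cont.comp (f := fun x : ℝ × ℝ × ℝ => x.2.2)
    ((continuous_snd.comp continuous_snd).continuousOn) m3
  have hf : ContinuousOn (fun x : ℝ × ℝ × ℝ => ((cd z x.1 x.2.2, cd z x.1 x.2.1, cd z x.2.1 x.2.2)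
      : ℝ × ℝ × ℝ)) I :=
    ((continuousOn_lor_comp c1 c3).neg).prodMk
      (((continuousOn_lor_comp c1 c2).neg).prodMk ((continuousOn_lor_comp c2 c3).neg))
  have hK := hIc.of_isClosed_subset (hf.preimage_isClosed_of_isClosed hI
    (isClosed_singleton (x := ((s, p, q) : ℝ × ℝ × ℝ)))) inter_subset_left
  convert (hK.image continuous_fst).isClosed using 1
  ext a
  constructor
  · rintro ⟨u, b, h1, h2, h3, h4, h5, h6, h7, h8⟩
    exact ⟨(a, u, b), ⟨⟨h1, h2, h3, h4, h5⟩, by simp [h6, h7, h8]⟩, rfl⟩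
  · rintro ⟨⟨a, u, b⟩, ⟨⟨h1, h2, h3, h4, h5⟩, h6⟩, rfl⟩
    simp only [mem_preimage, mem_singleton_iff, Prod.mk.injEq] at h6
    exact ⟨u, b, h1, h2, h3, h4, h5, h6.1, h6.2.1, h6.2.2⟩

theorem hom_of_prof_const (h : MetArc z r) {w s : ℝ} {p : Set (ℝ × ℝ)} (hw0 : 0 < w) (hw : w ≤ r)
    (hs : 1 < s) (hb : ∀ a, 0 ≤ a → a ≤ w → ∃ b, a < b ∧ b ≤ r ∧ cd z a b = s ∧ prof z a b = p) :
    ∃ r' > 0, r' ≤ w ∧ HomArc z r' := by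
  obtain ⟨r', hr0, hrw, hr⟩ := (h.restrict hw0 hw).restrict_lt (t := (1 + s) / 2) (by linarith)
  refine ⟨r', hr0, hrw, ?_⟩
  intro a u v a' u' v' h1 h2 h3 h4 h5 h6 h7 h8 k1 k2
  obtain ⟨b, b1, b2, b3, b4⟩ := hb a h1 (by linarith)
  obtain ⟨b', b1', b2', b3', b4'⟩ := hb a' h5 (by linarith)
  have hvb : ∀ a v b, 0 ≤ a → a ≤ b → a ≤ v → v ≤ r' → cd z a b = s → v < b := by
    intro a v b ha hab hav hv hs
    by_contra hcon
    push Not at hcon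
    have := h.le_of_subset le_rfl ha hab (hcon.trans hv) (hrw.trans hw)
    linarith
  have l := hvb a v b h1 b1.le (h2.trans h3).le h4 b3
  have l' := hvb a' v' b' h5 b1'.le (h6.trans h7).le h8 b3'
  have tr : ∀ x x', a < x → x < b → a' < x' → x' < b' → cd z a x = cd z a' x' →
      cd z x b = cd z x' b' := by
    intro x x' x1 x2 x3 x4 xe
    have : (cd z a x, cd z x b) ∈ prof z a' b' := by
      rw [b4', ← b4]; exact ⟨x, ⟨x1, x2⟩, rfl⟩
    obtain ⟨y, hy, hp⟩ := this
    obtain ⟨p1, p2⟩ := Prod.mk.inj hp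
    have : y = x' := h.right_inj h5 ⟨hy.1.le, hy.2.le.trans b2'⟩ ⟨x3.le, x4.le.trans b2'⟩
      (by rw [← p1, xe])
    rw [p2, this]
  exact h.pair a b a' b' h1 b1 b2 h5 b1' b2' (by rw [b3, b3']) u ⟨h2.le, (h3.trans l).le⟩ v
    ⟨(h2.trans h3).le, l.le⟩ u' ⟨h6.le, (h7.trans l').le⟩ v' ⟨(h6.trans h7).le, l'.le⟩ k1
    (tr u u' h2 (h3.trans l) h6 (h7.trans l') k1) k2 (tr v v' (h2.trans h3) l (h6.trans h7) l' k2)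

end MetArc

theorem ArcOn.sym_or_hom {C D : Set Vec} {ρ κ ρ' : ℝ} {z z' : ℝ → Vec} {N N' : ℝ → ℝ → Vec}
    (h : ArcOn C ρ z N κ) (h' : ArcOn D ρ' z' N' κ) (hcd : LinCond C D) :
    ∃ r > 0, r ≤ ρ ∧ (SymArc z r ∨ HomArc z r) := by
  have M' := h'.metArc
  obtain ⟨ρ1, h10, h1ρ, h11⟩ := h.metArc.restrict_lt (M'.one_lt le_rfl h'.ρ_pos le_rfl)
  have M := h.metArc.restrict h10 h1ρ
  by_cases hS : SymArc z (ρ1 / 2)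
  · exact ⟨ρ1 / 2, by positivity, by linarith, Or.inl hS⟩
  rw [SymArc] at hS
  push Not at hS
  obtain ⟨a0, b0, ha0, hab0, hb0, hne⟩ := hS
  set Q := prof z a0 b0
  set s := cd z a0 b0 with hs
  have hb0' : b0 ≤ ρ1 := by linarith
  have hs1 : 1 < s := M.one_lt ha0 hab0 hb0'
  obtain ⟨v, hv0, hvρ, hv⟩ := M'.exists_right_le le_rfl h'.ρ_pos le_rfl hs1
    ((M.le_of_subset le_rfl ha0 hab0.le hb0' le_rfl).trans h11)
  have hss : ∀ q : Set (ℝ × ℝ), Prod.swap '' (Prod.swap '' q) = q := fun q => by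
    rw [← image_comp, Prod.swap_swap_eq, image_id]
  have hall : ∀ a b, 0 ≤ a → a < b → b ≤ ρ1 → cd z a b = s →
      prof z a b = Q ∨ prof z a b = Prod.swap '' Q := by
    intro a b ha hab hb he
    have d0 := h.dich h' hcd ha0 hab0 (hb0'.trans h1ρ) le_rfl hv0 hvρ hv.symm
    have d1 := h.dich h' hcd ha hab (hb.trans h1ρ) le_rfl hv0 hvρ (he.trans hv.symm)
    have d0' : Q = prof z' 0 v ∨ Q = Prod.swap '' prof z' 0 v := by
      rcases d0 with d0 | d0 | ⟨d0, -⟩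
      · exact Or.inl d0
      · exact Or.inr d0
      · exact absurd d0 hne
    have hq : prof z' 0 v ≠ Prod.swap '' prof z' 0 v := by
      intro hq
      rcases d0' with d | d
      · rw [d] at hne; exact hne hq
      · rw [d, hss] at hne; exact hne hq.symm
    rcases d1 with d1 | d1 | ⟨-, d1⟩
    · rcases d0' with d | d
      · exact Or.inl (by rw [d1, d])
      · exact Or.inr (by rw [d1, d, hss])
    · rcases d0' with d | d
      · exact Or.inr (by rw [d1, d])
      · exact Or.inl (by rw [d1, d])
    · exact absurd d1 hq
  obtain ⟨p, q, hpq, hqp⟩ : ∃ p q, (p, q) ∈ Q ∧ (q, p) ∉ Q := by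
    by_contra hcon
    push Not at hcon
    refine hne (Subset.antisymm ?_ ?_)
    · rintro ⟨x, y⟩ hx
      exact ⟨(y, x), hcon _ _ hx, rfl⟩
    · rintro _ ⟨⟨x, y⟩, hx, rfl⟩
      exact hcon _ _ hx
  have hp1 : 1 < p ∧ 1 < q := by
    obtain ⟨u, hu, hup⟩ := hpq
    obtain ⟨rfl, rfl⟩ := Prod.mk.inj hup
    exact ⟨M.one_lt ha0 hu.1 (hu.2.le.trans hb0'), M.one_lt (ha0.trans hu.1.le) hu.2 hb0'⟩
  obtain ⟨w, hw, hws⟩ := M.exists_left le_rfl h10 le_rfl hs1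
    (M.mono 0 a0 b0 ρ1 le_rfl ha0 hab0.le hb0' le_rfl (Or.inr (by linarith)))
  have hbex : ∀ a, 0 ≤ a → a ≤ w → ∃ b, a < b ∧ b ≤ ρ1 ∧ cd z a b = s := by
    intro a ha haw
    refine M.exists_right_le ha (haw.trans_lt hw.2) le_rfl hs1 ?_
    rw [← hws]
    exact M.le_of_subset ha haw hw.2.le le_rfl le_rfl
  have hprof : ∀ p q, 1 < p → 1 < q → ∀ a u b, 0 ≤ a → a ≤ u → u ≤ b → b ≤ ρ1 → cd z a u = p →
      cd z u b = q → (p, q) ∈ prof z a b := by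
    intro p q hp hq a u b ha hau hub hb h1 h2
    refine ⟨u, ⟨lt_of_le_of_ne hau ?_, lt_of_le_of_ne hub ?_⟩, by rw [h1, h2]⟩
    · rintro rfl; rw [M.cd_self ⟨ha, hub.trans hb⟩] at h1; linarith
    · rintro rfl; rw [M.cd_self ⟨ha.trans hau, hb⟩] at h2; linarith
  have hconst : (∀ a, 0 ≤ a → a ≤ w → ∃ b, a < b ∧ b ≤ ρ1 ∧ cd z a b = s ∧ prof z a b = Q) ∨
      (∀ a, 0 ≤ a → a ≤ w → ∃ b, a < b ∧ b ≤ ρ1 ∧ cd z a b = s ∧ prof z a b = Prod.swap '' Q) := by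
    by_contra hcon
    push Not at hcon
    obtain ⟨⟨a1, ha1, ha1w, k1⟩, ⟨a2, ha2, ha2w, k2⟩⟩ := hcon
    have hz1 := M.isClosed_profile w s p q hw.2.le
    have hz2 := M.isClosed_profile w s q p hw.2.le
    have hQ : ∀ a b, prof z a b = Q → ∃ u, a ≤ u ∧ u ≤ b ∧ cd z a u = p ∧ cd z u b = q := by
      intro a b hpr
      rw [← hpr] at hpq
      obtain ⟨u, hu, hup⟩ := hpq
      obtain ⟨e1, e2⟩ := Prod.mk.inj hup
      exact ⟨u, hu.1.le, hu.2.le, e1.symm, e2.symm⟩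
    have hQ' : ∀ a b, prof z a b = Prod.swap '' Q →
        ∃ u, a ≤ u ∧ u ≤ b ∧ cd z a u = q ∧ cd z u b = p := by
      intro a b hpr
      have : (q, p) ∈ prof z a b := by rw [hpr]; exact ⟨(p, q), hpq, rfl⟩
      obtain ⟨u, hu, hup⟩ := this
      obtain ⟨e1, e2⟩ := Prod.mk.inj hup
      exact ⟨u, hu.1.le, hu.2.le, e1.symm, e2.symm⟩
    have hcov : ∀ a ∈ Icc 0 w, ∃ b, a < b ∧ b ≤ ρ1 ∧ cd z a b = s ∧
        (prof z a b = Q ∨ prof z a b = Prod.swap '' Q) := by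
      intro a ha
      obtain ⟨b, h1, h2, h3⟩ := hbex a ha.1 ha.2
      exact ⟨b, h1, h2, h3, hall a b ha.1 h1 h2 h3⟩
    obtain ⟨a, ha, ⟨u, b, f1, f2, f3, f4, f5, f6, f7, f8⟩, ⟨u', b', g1, g2, g3, g4, g5, g6, g7, g8⟩⟩ :=
      isPreconnected_closed_iff.1 (isPreconnected_Icc (a := (0:ℝ)) (b := w)) _ _ hz1 hz2 (by
        intro a ha
        obtain ⟨b, h1, h2, h3, h4 | h4⟩ := hcov a ha
        · obtain ⟨u, l1, l2, l3, l4⟩ := hQ a b h4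
          exact Or.inl ⟨u, b, ha.1, ha.2, l1, l2, h2, h3, l3, l4⟩
        · obtain ⟨u, l1, l2, l3, l4⟩ := hQ' a b h4
          exact Or.inr ⟨u, b, ha.1, ha.2, l1, l2, h2, h3, l3, l4⟩) (by
        refine ⟨a2, ⟨ha2, ha2w⟩, ?_⟩
        obtain ⟨b, h1, h2, h3, h4⟩ := hcov a2 ⟨ha2, ha2w⟩
        obtain ⟨u, l1, l2, l3, l4⟩ := hQ a2 b (h4.resolve_right (k2 b h1 h2 h3))
        exact ⟨u, b, ha2, ha2w, l1, l2, h2, h3, l3, l4⟩) (by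
        refine ⟨a1, ⟨ha1, ha1w⟩, ?_⟩
        obtain ⟨b, h1, h2, h3, h4⟩ := hcov a1 ⟨ha1, ha1w⟩
        obtain ⟨u, l1, l2, l3, l4⟩ := hQ' a1 b (h4.resolve_left (k1 b h1 h2 h3))
        exact ⟨u, b, ha1, ha1w, l1, l2, h2, h3, l3, l4⟩)
    have hbb : b' = b := M.right_inj f1 ⟨g3.trans g4, g5⟩ ⟨f3.trans f4, f5⟩ (g6.trans f6.symm)
    subst hbb
    have m1 := hprof p q hp1.1 hp1.2 a u b' f1 f3 f4 f5 f7 f8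
    have m2 := hprof q p hp1.2 hp1.1 a u' b' g1 g3 g4 g5 g7 g8
    have hab : a < b' := by
      refine lt_of_le_of_ne (f3.trans f4) ?_
      rintro rfl
      rw [M.cd_self ⟨f1, f5⟩] at f6; linarith
    rcases hall a b' f1 hab f5 f6 with e | e
    · rw [e] at m2; exact hqp m2
    · rw [e] at m1
      obtain ⟨⟨x, y⟩, hx, hxe⟩ := m1
      obtain ⟨rfl, rfl⟩ := Prod.mk.inj hxe
      exact hqp hx
  rcases hconst with hc | hc
  · obtain ⟨r', k1, k2, k3⟩ := M.hom_of_prof_const hw.1 hw.2.le hs1 hc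
    exact ⟨r', k1, (k2.trans hw.2.le).trans h1ρ, Or.inr k3⟩
  · obtain ⟨r', k1, k2, k3⟩ := M.hom_of_prof_const hw.1 hw.2.le hs1 hc
    exact ⟨r', k1, (k2.trans hw.2.le).trans h1ρ, Or.inr k3⟩

/-! ### Planarity -/

theorem exists_plane (x y w : Vec) : ∃ (v : Vec) (t : ℝ), (v ≠ 0 ∨ t ≠ 0) ∧ lor x v = t ∧
    lor y v = t ∧ lor w v = t := by
  let f : (Vec × ℝ) →ₗ[ℝ] (ℝ × ℝ × ℝ) :=
    { toFun := fun p => (lor x p.1 - p.2, lor y p.1 - p.2, lor w p.1 - p.2)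
      map_add' := fun p q => by
        ext <;> simp <;> ring
      map_smul' := fun c p => by
        ext <;> simp <;> ring }
  have hk : LinearMap.ker f ≠ ⊥ := LinearMap.ker_ne_bot_of_finrank_lt (by simp [Vec])
  obtain ⟨⟨v, t⟩, hp, hne⟩ := (Submodule.ne_bot_iff _).1 hk
  rw [LinearMap.mem_ker] at hp
  obtain ⟨e1, e2⟩ := Prod.mk.inj hp
  obtain ⟨e2, e3⟩ := Prod.mk.inj e2
  refine ⟨v, t, ?_, sub_eq_zero.1 e1, sub_eq_zero.1 e2, sub_eq_zero.1 e3⟩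
  by_contra hcon
  push Not at hcon
  exact hne (by rw [hcon.1, hcon.2]; rfl)

theorem MetArc.planar {z : ℝ → Vec} {r : ℝ} (h : MetArc z r) (hm : MidArc z r) :
    ∃ (v : Vec) (t : ℝ), v ≠ 0 ∧ ∀ u ∈ Icc 0 r, lor (z u) v = t := by
  obtain ⟨c, hc, hce⟩ := h.exists_mid le_rfl h.r_pos le_rfl
  obtain ⟨v, t, hvt, e1, e2, e3⟩ := exists_plane (z 0) (z c) (z r)
  have hv : v ≠ 0 := by
    rintro rfl
    refine hvt.elim (fun k => k rfl) fun k => k ?_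
    rw [← e1]; simp
  refine ⟨v, t, hv, ?_⟩
  intro u0 hu0
  by_contra hne
  have step : ∀ P m R, 0 ≤ P → P < m → m < R → R ≤ r → cd z P m = cd z m R → lor (z P) v = t →
      lor (z m) v = t → lor (z R) v = t → ∃ m1 ∈ Ioo P m, ∃ m2 ∈ Ioo m R, cd z P m1 = cd z m1 m ∧
      cd z m m2 = cd z m2 R ∧ lor (z m1) v = t ∧ lor (z m2) v = t := by
    intro P m R h1 h2 h3 h4 h5 k1 k2 k3
    obtain ⟨m1, hm1, m2, hm2, f1, f2, f3, f4⟩ := hm P m R h1 h2 h3 h4 h5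
    obtain ⟨τ, hτ, te⟩ := h.trap P m1 m m2 h1 hm1.1 hm1.2 hm2.1 (hm2.2.le.trans h4)
      (by rw [f1, f2]) f4
    obtain ⟨τ', hτ', te'⟩ := h.trap m1 m m2 R (h1.trans hm1.1.le) hm1.2 hm2.1 hm2.2 h4
      (by rw [f2, f3]) (by rw [← f4, h5])
    have g1 := congrArg (fun x => lor x v) te
    have g2 := congrArg (fun x => lor x v) te'
    simp only [lor_sub_left, lor_smul_left, k1, k2, k3] at g1 g2
    rw [abs_lt] at hτ hτ'
    have q : (lor (z m1) v - t) * (1 - τ * τ') = 0 := by linear_combination -g1 - τ * g2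
    have q' : 1 - τ * τ' ≠ 0 := by nlinarith
    have q1 : lor (z m1) v = t := by
      have := (mul_eq_zero.1 q).resolve_right q'
      linarith
    rw [q1] at g2
    exact ⟨m1, hm1, m2, hm2, f1, f3, q1, by linarith⟩
  set I : Set (ℝ × ℝ × ℝ) := {x | 0 ≤ x.1 ∧ x.1 ≤ x.2.1 ∧ x.2.1 ≤ x.2.2 ∧ x.2.2 ≤ r ∧ x.1 ≤ u0 ∧
    u0 ≤ x.2.2}
  have hI : IsClosed I := by
    have i1 : IsClosed {x : ℝ × ℝ × ℝ | 0 ≤ x.1} := isClosed_le (by fun_prop) (by fun_prop)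
    have i2 : IsClosed {x : ℝ × ℝ × ℝ | x.1 ≤ x.2.1} := isClosed_le (by fun_prop) (by fun_prop)
    have i3 : IsClosed {x : ℝ × ℝ × ℝ | x.2.1 ≤ x.2.2} := isClosed_le (by fun_prop) (by fun_prop)
    have i4 : IsClosed {x : ℝ × ℝ × ℝ | x.2.2 ≤ r} := isClosed_le (by fun_prop) (by fun_prop)
    have i5 : IsClosed {x : ℝ × ℝ × ℝ | x.1 ≤ u0} := isClosed_le (by fun_prop) (by fun_prop)
    have i6 : IsClosed {x : ℝ × ℝ × ℝ | u0 ≤ x.2.2} := isClosed_le (by fun_prop) (by fun_prop)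
    exact i1.inter (i2.inter (i3.inter (i4.inter (i5.inter i6))))
  have hIc : IsCompact I := by
    refine (isCompact_Icc (a := ((0:ℝ), (0:ℝ), (0:ℝ))) (b := (r, r, r))).of_isClosed_subset hI ?_
    rintro ⟨a, u, b⟩ ⟨h1, h2, h3, h4, h5⟩
    simp only at h1 h2 h3 h4 h5
    refine ⟨⟨h1, ?_, ?_⟩, ⟨?_, ?_, ?_⟩⟩ <;> simp only <;> linarith
  have m1 : MapsTo (fun x : ℝ × ℝ × ℝ => x.1) I (Icc 0 r) := by
    rintro ⟨a, u, b⟩ ⟨h1, h2, h3, h4, h5⟩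
    simp only at h1 h2 h3 h4 h5
    constructor <;> simp only <;> linarith
  have m2 : MapsTo (fun x : ℝ × ℝ × ℝ => x.2.1) I (Icc 0 r) := by
    rintro ⟨a, u, b⟩ ⟨h1, h2, h3, h4, h5⟩
    simp only at h1 h2 h3 h4 h5
    constructor <;> simp only <;> linarith
  have m3 : MapsTo (fun x : ℝ × ℝ × ℝ => x.2.2) I (Icc 0 r) := by
    rintro ⟨a, u, b⟩ ⟨h1, h2, h3, h4, h5⟩
    simp only at h1 h2 h3 h4 h5
    constructor <;> simp only <;> linarith
  have c1 := h.cont.comp (continuous_fst.continuousOn) m1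
  have c2 := h.cont.comp (f := fun x : ℝ × ℝ × ℝ => x.2.1)
    ((continuous_fst.comp continuous_snd).continuousOn) m2
  have c3 := h.cont.comp (f := fun x : ℝ × ℝ × ℝ => x.2.2)
    ((continuous_snd.comp continuous_snd).continuousOn) m3
  have hcv : ContinuousOn (fun _ : ℝ × ℝ × ℝ => v) I := continuousOn_const
  have hf : ContinuousOn (fun x : ℝ × ℝ × ℝ => ((cd z x.1 x.2.1 - cd z x.2.1 x.2.2, lor (z x.1) v,
      lor (z x.2.1) v, lor (z x.2.2) v) : ℝ × ℝ × ℝ × ℝ)) I :=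
    (((continuousOn_lor_comp c1 c2).neg).sub ((continuousOn_lor_comp c2 c3).neg)).prodMk
      ((continuousOn_lor_comp c1 hcv).prodMk
        ((continuousOn_lor_comp c2 hcv).prodMk (continuousOn_lor_comp c3 hcv)))
  have hK := hIc.of_isClosed_subset (hf.preimage_isClosed_of_isClosed hI
    (isClosed_singleton (x := ((0, t, t, t) : ℝ × ℝ × ℝ × ℝ)))) inter_subset_left
  obtain ⟨⟨a, m, b⟩, ⟨⟨h1, h2, h3, h4, h5, h6⟩, h7⟩, hmin⟩ := hK.exists_isMinOn
    ⟨(0, c, r), ⟨le_rfl, hc.1.le, hc.2.le, le_rfl, hu0.1, hu0.2⟩, by simp [hce, e1, e2, e3]⟩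
    (f := fun x : ℝ × ℝ × ℝ => x.2.2 - x.1) (by fun_prop)
  simp only [mem_preimage, mem_singleton_iff, Prod.mk.injEq] at h7
  simp only at h1 h2 h3 h4 h5 h6
  obtain ⟨k1, k2, k3, k4⟩ := h7
  have hua : u0 ≠ a := by rintro rfl; exact hne k2
  have hum : u0 ≠ m := by rintro rfl; exact hne k3
  have hub : u0 ≠ b := by rintro rfl; exact hne k4
  have h5' := lt_of_le_of_ne h5 hua.symm
  have h6' := lt_of_le_of_ne h6 hub
  have ham : a < m := by
    refine lt_of_le_of_ne h2 ?_
    rintro rfl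
    rw [h.cd_self ⟨h1, by linarith⟩] at k1
    have := h.one_lt h1 (h5'.trans h6') h4
    linarith
  have hmb : m < b := by
    refine lt_of_le_of_ne h3 ?_
    rintro rfl
    rw [h.cd_self ⟨by linarith, h4⟩] at k1
    have := h.one_lt h1 ham h4
    linarith
  obtain ⟨n1, hn1, n2, hn2, f1, f2, f3, f4⟩ := step a m b h1 ham hmb h4 (by linarith) k2 k3 k4
  rcases lt_or_gt_of_ne hum with hlt | hlt
  · have := hmin (show (a, n1, m) ∈ _ from ⟨⟨h1, hn1.1.le, hn1.2.le, hmb.le.trans h4, h5, hlt.le⟩, by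
      simp [f1, f3, k2, k3]⟩)
    simp only [mem_ofPred_eq] at this
    linarith
  · have := hmin (show (m, n2, b) ∈ _ from ⟨⟨h1.trans ham.le, hn2.1.le, hn2.2.le, h4, hlt.le, h6⟩, by
      simp [f2, f4, k4, k3]⟩)
    simp only [mem_ofPred_eq] at this
    linarith

theorem Chart.exists_planar {C D : Set Vec} {E e1 e2 : Vec} {r M b : ℝ} {φ : ℝ → ℝ}
    (h : Chart C E e1 e2 r M b φ) (hC : IsBody C) (hD : IsBody D) (hDn : (Bd D).Nonempty)
    (hcd : LinCond C D) : ∃ r' > 0, r' ≤ r ∧ ∃ (v : Vec) (t : ℝ), v ≠ 0 ∧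
      ∀ u ∈ Icc 0 r', lor (bpt E e1 e2 φ u) v = t := by
  obtain ⟨E', hE'⟩ := hDn
  obtain ⟨e1', e2', r2, M', b', φ', h'⟩ := exists_Chart hD hE'
  obtain ⟨κ₀, hκ₀, H⟩ := h.exists_arc hC
  obtain ⟨κ₁, hκ₁, H'⟩ := h'.exists_arc hD
  obtain ⟨ρ₀, hρ₀, H⟩ := H (min κ₀ κ₁) (lt_min hκ₀ hκ₁) (min_le_left _ _)
  obtain ⟨ρ₁, hρ₁, H'⟩ := H' (min κ₀ κ₁) (lt_min hκ₀ hκ₁) (min_le_right _ _)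
  have A := H (min ρ₀ r) (lt_min hρ₀ h.r_pos) (min_le_left _ _)
  obtain ⟨r', h1, h2, h3⟩ := A.sym_or_hom (H' ρ₁ hρ₁ le_rfl) hcd
  have M := A.metArc.restrict h1 h2
  obtain ⟨v, t, hv, hvt⟩ := M.planar (h3.elim M.midArc_of_sym M.midArc_of_hom)
  exact ⟨r', h1, h2.trans (min_le_right _ _), v, t, hv, hvt⟩

/-! ### Regular boundary points -/

theorem lor_lin_ext {v w : Vec} (h : ∀ z, lor z v = lor z w) : v = w := by
  have h1 := h (1, 0, 0)
  have h2 := h (0, 1, 0)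
  have h3 := h (0, 0, 1)
  simp only [lor] at h1 h2 h3
  refine Prod.ext (by linarith) (Prod.ext (by linarith) (by linarith))

/-- The linear form `lor · v`. -/
def lorForm (v : Vec) : Vec →ₗ[ℝ] ℝ where
  toFun z := lor z v
  map_add' x y := lor_add_left x y v
  map_smul' c x := lor_smul_left c x v

theorem lorForm_apply (v z : Vec) : lorForm v z = lor z v := rfl

theorem lorForm_ne {v : Vec} (h : v ≠ 0) : lorForm v ≠ 0 := fun h0 => h (lor_lin_ext fun z => by
  have := LinearMap.congr_fun h0 z
  rw [lorForm_apply] at this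
  rw [this]; simp)

theorem hyp_sub_pos {x y : Vec} (hx : x ∈ Hyp) (hy : y ∈ Hyp) (hne : x ≠ y) :
    0 < lor (y - x) (y - x) := by
  have h1 := hyp_lor_le hx hy
  have h2 : lor x y ≠ -1 := fun h => hne (hyp_lor_eq hx hy h)
  have h3 : lor x y < -1 := lt_of_le_of_ne h1 h2
  rw [lor_sub_left, lor_sub_right, lor_sub_right, lor_comm y x, hx.1, hy.1]
  linarith

theorem hyp_indep {x y w : Vec} (hx : x ∈ Hyp) (hy : y ∈ Hyp) (hw : w ∈ Hyp) (hxy : x ≠ y)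
    (hyw : y ≠ w) (hxw : x ≠ w) : LinearIndependent ℝ ![y - x, w - x] := by
  rw [LinearIndependent.pair_iff' (sub_ne_zero.2 hxy.symm)]
  intro a ha
  have h0 := hyp_sub_pos hx hy hxy
  have hw' : w = x + a • (y - x) := by rw [ha]; abel
  have h1 := hw.1
  rw [hw'] at h1
  set d := y - x with hd
  have hxd : 2 * lor x d = - lor d d := by
    have : y = x + d := by rw [hd]; abel
    have h2 := hy.1
    rw [this, lor_add_left, lor_add_right, lor_add_right, hx.1, lor_comm d x] at h2
    linarith
  rw [lor_add_left, lor_add_right, lor_add_right, hx.1, lor_smul_left, lor_smul_right,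
    lor_smul_right, lor_smul_left, lor_comm d x] at h1
  have h2 : (a * (a - 1)) * lor d d = 0 := by linear_combination h1 - a * hxd
  rcases mul_eq_zero.1 ((mul_eq_zero.1 h2).resolve_right h0.ne') with h3 | h3
  · rw [h3, zero_smul, add_zero] at hw'
    exact hxw hw'.symm
  · rw [sub_eq_zero.1 h3, one_smul, hd] at hw'
    exact hyw (by rw [hw']; abel)

/-- Three points of the hyperboloid determine their plane. -/
theorem plane_unique {x y w v v' : Vec} {t t' : ℝ} (hx : x ∈ Hyp) (hy : y ∈ Hyp) (hw : w ∈ Hyp)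
    (hxy : x ≠ y) (hyw : y ≠ w) (hxw : x ≠ w) (hv : v ≠ 0) (h1 : lor x v = t) (h2 : lor y v = t)
    (h3 : lor w v = t) (h1' : lor x v' = t') (h2' : lor y v' = t') (h3' : lor w v' = t') :
    ∃ c : ℝ, v' = c • v ∧ t' = c * t := by
  have hli := hyp_indep hx hy hw hxy hyw hxw
  set S := Submodule.span ℝ (range ![y - x, w - x]) with hS
  have hfr : Module.finrank ℝ S = 2 := by
    rw [finrank_span_eq_card hli]; simp
  have hle : ∀ (u : Vec) (τ : ℝ), lor x u = τ → lor y u = τ → lor w u = τ →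
      S ≤ LinearMap.ker (lorForm u) := by
    intro u τ e1 e2 e3
    rw [hS, Submodule.span_le]
    rintro _ ⟨i, rfl⟩
    fin_cases i <;> simp [lorForm_apply, e1, e2, e3]
  have hker : Module.finrank ℝ (LinearMap.ker (lorForm v)) = 2 := by
    have := Module.Dual.finrank_ker_add_one_of_ne_zero (lorForm_ne hv)
    have h3 : Module.finrank ℝ Vec = 3 := by simp [Vec]
    omega
  have heq := Submodule.eq_of_le_of_finrank_eq (hle v t h1 h2 h3) (by rw [hfr, hker])
  have hk' : LinearMap.ker (lorForm v) ≤ LinearMap.ker (lorForm v') :=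
    heq ▸ hle v' t' h1' h2' h3'
  obtain ⟨z0, hz0⟩ : ∃ z, lorForm v z ≠ 0 := by
    by_contra hcon
    push Not at hcon
    exact lorForm_ne hv (LinearMap.ext hcon)
  have key : ∀ z, lor z v' = (lor z0 v' / lor z0 v) * lor z v := by
    intro z
    have hm : z - (lor z v / lor z0 v) • z0 ∈ LinearMap.ker (lorForm v) := by
      rw [LinearMap.mem_ker, lorForm_apply, lor_sub_left, lor_smul_left]
      rw [lorForm_apply] at hz0
      field_simp
      ring
    have := hk' hm
    rw [LinearMap.mem_ker, lorForm_apply, lor_sub_left, lor_smul_left] at this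
    linear_combination this
  refine ⟨lor z0 v' / lor z0 v, lor_lin_ext fun z => ?_, ?_⟩
  · rw [lor_smul_right, key]
  · rw [← h1', ← h1, key]

/-- Near `z` the boundary is contained in a plane section. -/
def Regular (C : Set Vec) (z : Vec) : Prop :=
  ∃ U ∈ nhds z, ∃ (v : Vec) (t : ℝ), v ≠ 0 ∧ ∀ y ∈ U, y ∈ Bd C → lor y v = t

theorem Regular.image {C : Set Vec} {z : Vec} (h : Regular C z) {A : Vec ≃ₗ[ℝ] Vec} (hA : IsLor A) :
    Regular (A '' C) (A z) := by
  obtain ⟨U, hU, v, t, hv, hUv⟩ := h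
  refine ⟨A '' U, A.toContinuousLinearEquiv.toHomeomorph.isOpenMap.image_mem_nhds hU, A v, t,
    by simpa using hv, ?_⟩
  rintro _ ⟨y, hy, rfl⟩ hyB
  rw [hA.lor_map]
  exact hUv y hy ((mem_Bd_image hA).1 hyB)

theorem Bd_inter_iff {C D : Set Vec} {z : Vec} (hz : z ∈ interior D) :
    z ∈ Bd (C ∩ D) ↔ z ∈ Bd C := by
  have := interior_subset hz
  simp only [Bd, mem_ofPred_eq, interior_inter, mem_inter_iff]
  tauto

theorem Regular_inter_iff {C D : Set Vec} {z : Vec} (hz : z ∈ interior D) :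
    Regular (C ∩ D) z ↔ Regular C z := by
  have hD := isOpen_interior.mem_nhds hz
  constructor <;> rintro ⟨U, hU, v, t, hv, h⟩ <;>
    refine ⟨U ∩ interior D, inter_mem hU hD, v, t, hv, fun y hy hyB => h y hy.1 ?_⟩
  · exact (Bd_inter_iff hy.2).2 hyB
  · exact (Bd_inter_iff hy.2).1 hyB

/-- Points of `S` in the plane `lor · v = t` accumulate at `p`. -/
def Meets (v : Vec) (t : ℝ) (S : Set Vec) (p : Vec) : Prop :=
  ∀ U ∈ nhds p, ∃ x ∈ U ∩ S, ∃ y ∈ U ∩ S, ∃ w ∈ U ∩ S, x ≠ y ∧ y ≠ w ∧ x ≠ w ∧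
    lor x v = t ∧ lor y v = t ∧ lor w v = t

theorem Regular.parallel {C : Set Vec} {z v v' : Vec} {t t' : ℝ} (h : Regular C z) (hv : v ≠ 0)
    (hv' : v' ≠ 0) (h1 : Meets v t (Bd C) z) (h2 : Meets v' t' (Bd C) z) :
    ∃ c : ℝ, c ≠ 0 ∧ v' = c • v ∧ t' = c * t := by
  obtain ⟨U, hU, v0, t0, hv0, hUv⟩ := h
  have key : ∀ {v : Vec} {t : ℝ}, v ≠ 0 → Meets v t (Bd C) z → ∃ c : ℝ, v = c • v0 ∧ t = c * t0 := by
    intro v t hv h1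
    obtain ⟨x, hx, y, hy, w, hw, n1, n2, n3, e1, e2, e3⟩ := h1 U hU
    exact plane_unique hx.2.1 hy.2.1 hw.2.1 n1 n2 n3 hv0 (hUv x hx.1 hx.2) (hUv y hy.1 hy.2)
      (hUv w hw.1 hw.2) e1 e2 e3
  obtain ⟨c, hc, hc'⟩ := key hv h1
  obtain ⟨d, hd, hd'⟩ := key hv' h2
  have hc0 : c ≠ 0 := by rintro rfl; simp at hc; exact hv hc
  have hd0 : d ≠ 0 := by rintro rfl; simp at hd; exact hv' hd
  refine ⟨d / c, div_ne_zero hd0 hc0, ?_, ?_⟩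
  · rw [hc, smul_smul, div_mul_cancel₀ _ hc0, hd]
  · rw [hc', hd']; field_simp

theorem Meets.of_right {v : Vec} {t u0 c : ℝ} {S : Set Vec} {z : ℝ → Vec} (hc : u0 < c)
    (hz : ContinuousWithinAt z (Ioi u0) u0) (hinj : InjOn z (Ioo u0 c))
    (hS : ∀ u ∈ Ioo u0 c, z u ∈ S) (ht : ∀ u ∈ Ioo u0 c, lor (z u) v = t) :
    Meets v t S (z u0) := by
  intro U hU
  have h1 := hz hU
  obtain ⟨d, hd, hdU⟩ := (mem_nhdsGT_iff_exists_Ioo_subset.1 h1)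
  set e := min c d with he
  have he0 : u0 < e := lt_min hc hd
  have hec : e ≤ c := min_le_left _ _
  have hed : e ≤ d := min_le_right _ _
  have hm : ∀ τ : ℝ, 0 < τ → τ < 1 → u0 + τ * (e - u0) ∈ Ioo u0 c ∧ u0 + τ * (e - u0) ∈ Ioo u0 d := by
    intro τ h1 h2
    refine ⟨⟨?_, ?_⟩, ?_, ?_⟩ <;> nlinarith
  obtain ⟨a1, a2⟩ := hm (1 / 4) (by norm_num) (by norm_num)
  obtain ⟨b1, b2⟩ := hm (1 / 2) (by norm_num) (by norm_num)
  obtain ⟨c1, c2⟩ := hm (3 / 4) (by norm_num) (by norm_num)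
  refine ⟨_, ⟨hdU a2, hS _ a1⟩, _, ⟨hdU b2, hS _ b1⟩, _, ⟨hdU c2, hS _ c1⟩, fun h => ?_, fun h => ?_,
    fun h => ?_, ht _ a1, ht _ b1, ht _ c1⟩
  · have := hinj a1 b1 h; linarith
  · have := hinj b1 c1 h; linarith
  · have := hinj a1 c1 h; linarith

theorem Meets.of_left {v : Vec} {t u0 c : ℝ} {S : Set Vec} {z : ℝ → Vec} (hc : c < u0)
    (hz : ContinuousWithinAt z (Iio u0) u0) (hinj : InjOn z (Ioo c u0))
    (hS : ∀ u ∈ Ioo c u0, z u ∈ S) (ht : ∀ u ∈ Ioo c u0, lor (z u) v = t) :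
    Meets v t S (z u0) := by
  have hm : ∀ u, u ∈ Ioo (-u0) (-c) → -u ∈ Ioo c u0 := fun u hu =>
    ⟨by linarith [hu.2], by linarith [hu.1]⟩
  have := Meets.of_right (v := v) (t := t) (u0 := -u0) (c := -c) (S := S) (z := fun u => z (-u))
    (by linarith) ?_ (fun x hx y hy hxy => ?_) (fun u hu => hS _ (hm u hu))
    (fun u hu => ht _ (hm u hu))
  · simpa using this
  · refine ContinuousWithinAt.comp (t := Iio u0) (by simpa using hz) continuous_neg.continuousWithinAt
      (fun x hx => ?_)
    simp only [mem_Ioi, mem_Iio] at hx ⊢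
    linarith
  · exact neg_injective (hinj (hm x hx) (hm y hy) hxy)

/-- An intersection with exactly three irregular boundary points at distinct distances is
rigid. -/
theorem triangle_rigid {C D : Set Vec} {s x y k κ : ℝ} {P Q n E : Vec} (hC : IsBody C)
    (hD : IsBody D) (h : CFrame s P Q n) (hPC : P ∈ Bd C) (hQC : Q ∈ Bd C) (hPD : P ∈ Bd D)
    (hQD : Q ∈ Bd D) (hk : 0 < k) (ho : Outer C P Q n x y k)
    (hapex : x • P + y • Q + k • n ∈ interior D) (hκ : 0 < κ) (ho' : Outer D P Q (-n) 1 1 κ)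
    (hin : P + Q + κ • (-n) ∈ interior C) (hE : E ∈ Bd C) (hEn : 0 < lor E n)
    (hd1 : lor E P ≠ lor E Q) (hd2 : lor E P ≠ lor P Q) (hd3 : lor E Q ≠ lor P Q)
    (hreg : ∀ z ∈ Bd C, 0 < lor z n → z = E ∨ Regular C z)
    (hreg' : ∀ z ∈ Bd D, lor z n < 0 → Regular D z)
    (hreg0 : ∀ α β : ℝ, 0 < α → 0 < β → α • P + β • Q ∈ Bd D → Regular D (α • P + β • Q))
    (hirE : ¬ Regular C E) (hirP : ¬ Regular (C ∩ D) P) (hirQ : ¬ Regular (C ∩ D) Q)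
    {A : Vec ≃ₗ[ℝ] Vec} (hA : IsLor A) (hAM : A '' (C ∩ D) = C ∩ D) :
    A = LinearEquiv.refl ℝ Vec := by
  have hup : ∀ z ∈ C, 0 < lor z n → z ∈ interior D := fun z hz hzn =>
    ho.mem_int h hD hPD.2.1 hQD.2.1 hk hapex hz hzn
  have hEP : E ≠ P := fun e => by rw [e, h.hPn] at hEn; exact lt_irrefl _ hEn
  have hEQ : E ≠ Q := fun e => by rw [e, h.hQn] at hEn; exact lt_irrefl _ hEn
  have hPQ : P ≠ Q := fun e => hd1 (by rw [e])
  have hnE : ∀ {a b : Vec}, a ∈ Hyp → b ∈ Hyp → a ≠ b → lor a b ≠ -1 := fun ha hb hab e =>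
    hab (hyp_lor_eq ha hb e)
  -- the part of the chord
  obtain ⟨a, b, c, hEe⟩ := h.expand E
  have hc : 0 < c := by rw [hEe, h.lor_n] at hEn; exact hEn
  have hw : (κ * a + c) • P + (κ * b + c) • Q ∈ interior C := by
    have := hC.add_int (hC.smul κ hκ E hE.2.1) (hC.smul_int hc hin)
    convert this using 1
    rw [hEe]; module
  have hcr : ∀ α β : ℝ, α • P + β • Q ∈ C → 0 ≤ α ∧ 0 ≤ β := fun α β hz =>
    nonneg_of_crossing h hC hPC hQC hE.2.1 hEn hin (by
      simp [h.hPn, h.hQn, h.hn]; exact hκ) hz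
  have hwnn := hcr _ _ (interior_subset hw)
  have hseg : ∀ α β : ℝ, 0 < α → 0 < β → α • P + β • Q ∈ interior C := by
    intro α β hα hβ
    set a' := κ * a + c
    set b' := κ * b + c
    have hT : 0 < 1 + a' + b' := by linarith [hwnn.1, hwnn.2]
    set ε := min α β / (1 + a' + b')
    have hm : 0 < min α β := lt_min hα hβ
    have hε : 0 < ε := by positivity
    have h1 : ε * (1 + a' + b') = min α β := by simp only [ε]; field_simp
    have h2 : min α β ≤ α := min_le_left _ _
    have h3 : min α β ≤ β := min_le_right _ _
    have := hC.comb_int (a := α - ε * a') (b := β - ε * b') (c := ε) (by nlinarith [hwnn.1, hwnn.2])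
      (by nlinarith [hwnn.1, hwnn.2]) hε hPC.2.1 hQC.2.1 hw
    convert this using 1
    module
  have hirr : ∀ z, z ∈ Bd (C ∩ D) → ¬ Regular (C ∩ D) z → z = E ∨ z = P ∨ z = Q := by
    intro z hz hzr
    rcases lt_trichotomy (lor z n) 0 with hzn | hzn | hzn
    · exfalso
      have hzC : z ∈ interior C := by
        refine ho'.mem_int h.neg hC hPC.2.1 hQC.2.1 hκ (by simpa using hin) hz.2.1.2
          (by rw [lor_neg_right]; linarith)
      rw [inter_comm] at hz hzr
      exact hzr ((Regular_inter_iff hzC).2 (hreg' z ((Bd_inter_iff hzC).1 hz) hzn))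
    · obtain ⟨α, β, γ, rfl⟩ := h.expand z
      rw [h.lor_n] at hzn
      subst hzn
      rw [zero_smul, add_zero] at hz hzr ⊢
      obtain ⟨hα, hβ⟩ := hcr α β hz.2.1.1
      have hq := hz.1.1
      simp only [lor_add_left, lor_add_right, lor_smul_left, lor_smul_right, h.hP.1, h.hQ.1,
        lor_comm Q P] at hq
      rcases hα.eq_or_lt with rfl | hα
      · have : β = 1 := by nlinarith
        right; right; simp [this]
      rcases hβ.eq_or_lt with rfl | hβ
      · have : α = 1 := by nlinarith
        right; left; simp [this]
      exfalso
      have hzC := hseg α β hα hβ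
      rw [inter_comm] at hz hzr
      exact hzr ((Regular_inter_iff hzC).2 (hreg0 α β hα hβ ((Bd_inter_iff hzC).1 hz)))
    · left
      have hzD := hup z hz.2.1.1 hzn
      refine (hreg z ((Bd_inter_iff hzD).1 hz) hzn).resolve_right fun hr => ?_
      exact hzr ((Regular_inter_iff hzD).2 hr)
  have hED := hup E hE.2.1 hEn
  have hirE' : ¬ Regular (C ∩ D) E := fun hr => hirE ((Regular_inter_iff hED).1 hr)
  have hEM : E ∈ Bd (C ∩ D) := (Bd_inter_iff hED).2 hE
  have hvM : ∀ {z}, z ∈ Bd C → z ∈ D → z ∈ Bd (C ∩ D) := fun hz hzD =>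
    ⟨hz.1, ⟨hz.2.1, hzD⟩, fun hi => hz.2.2 (interior_mono inter_subset_left hi)⟩
  have hAi : ∀ z, z ∈ Bd (C ∩ D) → ¬ Regular (C ∩ D) z → A z = E ∨ A z = P ∨ A z = Q := by
    intro z hz hzr
    refine hirr _ ?_ fun hr => hzr ?_
    · rw [← hAM]; exact (mem_Bd_image hA).2 hz
    · have := hr.image hA.symm
      have e : A.symm '' (C ∩ D) = C ∩ D := by
        conv_lhs => rw [← hAM]
        rw [← image_comp]; simp
      rwa [e, A.symm_apply_apply] at this
  have hEH := hE.1
  have n1 := hnE hEH h.hP hEP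
  have n2 := hnE hEH h.hQ hEQ
  have n3 := hnE h.hP h.hQ hPQ
  have m1 := hA.lor_map E P
  have m2 := hA.lor_map E Q
  have m3 := hA.lor_map P Q
  have key : A E = E ∧ A P = P ∧ A Q = Q := by
    rcases hAi E hEM hirE' with e1 | e1 | e1 <;>
    rcases hAi P (hvM hPC hPD.2.1) hirP with e2 | e2 | e2 <;>
    rcases hAi Q (hvM hQC hQD.2.1) hirQ with e3 | e3 | e3 <;>
    first
    | exact ⟨e1, e2, e3⟩
    | (exfalso
       rw [e1, e2] at m1
       rw [e1, e3] at m2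
       rw [e2, e3] at m3
       simp only [lor_comm P E, lor_comm Q E, lor_comm Q P, hEH.1, h.hP.1, h.hQ.1] at m1 m2 m3
       first
       | exact n1 m1.symm
       | exact n2 m2.symm
       | exact n3 m3.symm
       | exact hd1 m1
       | exact hd1 m1.symm
       | exact hd2 m1
       | exact hd2 m1.symm
       | exact hd1 m2
       | exact hd1 m2.symm
       | exact hd3 m2
       | exact hd3 m2.symm)
  have hAn : A n = n := by
    have h1 := key.1
    rw [hEe] at h1
    simp only [map_add, map_smul, key.2.1, key.2.2] at h1
    have := add_left_cancel h1
    exact smul_right_injective _ hc.ne' this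
  exact h.map_unique (by simpa using key.2.1) (by simpa using key.2.2) (by simpa using hAn)

/-- The intersection in `triangle_rigid` has interior points. -/
theorem inter_int_nonempty {C D : Set Vec} {z : Vec} (hC : IsBody C) (hz : z ∈ C)
    (hzD : z ∈ interior D) : (interior (C ∩ D)).Nonempty := by
  obtain ⟨w, hw⟩ := hC.int
  have hc : Tendsto (fun t : ℝ => z + t • w) (nhdsWithin 0 (Ioi 0)) (nhds (z + (0:ℝ) • w)) :=
    Tendsto.mono_left ((by fun_prop : Continuous fun t : ℝ => z + t • w).tendsto 0)
      nhdsWithin_le_nhds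
  rw [zero_smul, add_zero] at hc
  obtain ⟨t, ht, ht0⟩ := ((hc.eventually (isOpen_interior.mem_nhds hzD)).and
    self_mem_nhdsWithin).exists
  refine ⟨z + t • w, ?_⟩
  rw [interior_inter]
  exact ⟨hC.add_int hz (hC.smul_int ht0 hw), ht⟩

/-! ### Boundary points in a chart -/

section

variable {C : Set Vec} {E e1 e2 : Vec} {r M b : ℝ} {φ : ℝ → ℝ}

theorem Chart.eq_bpt (hC : IsBody C) (h : Chart C E e1 e2 r M b φ) {c u v : ℝ} (hc : 0 < c)
    (hu : u ∈ Icc (-r) r) (hv : v ≤ b) (hy : c • chart E e1 e2 u v ∈ Bd C) :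
    c • chart E e1 e2 u v = bpt E e1 e2 φ u := by
  have h1 := h.lower u hu v ((hC.smul_iff hc).1 hy.2.1)
  rcases h1.lt_or_eq with h3 | h3
  · exact absurd ((hC.smul_int_iff hc).2 (h.int u hu v h3 hv)) hy.2.2
  · have hF : BallChar.chart E e1 e2 u v ∈ Fut := hC.fut ((hC.smul_iff hc).1 hy.2.1)
    rw [bpt, h3]
    have hs := sqrt_smul_nrm hF
    conv_lhs => rw [← nrm_of_hyp hy.1, ← hs, smul_smul]
    rw [nrm_smul_of_hyp (nrm_mem hF) (mul_pos hc (sqrt_lor_pos hF))]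

theorem OFrame.lor_smul_chart (h : OFrame E e1 e2) (c u v : ℝ) :
    lor (c • chart E e1 e2 u v) E = -c ∧ lor (c • chart E e1 e2 u v) e1 = c * u ∧
      lor (c • chart E e1 e2 u v) e2 = c * v := by
  refine ⟨by rw [lor_smul_left, h.lor_chart_E]; ring, ?_, ?_⟩ <;>
    simp only [chart, lor_add_left, lor_smul_left, h.h11, h.h22, h.h1, h.h2, h.h12,
      lor_comm e2 e1] <;> ring

theorem OFrame.chart_coords (h : OFrame E e1 e2) {c u v : ℝ} (hc : 0 < c) :
    lor (c • chart E e1 e2 u v) e1 / -lor (c • chart E e1 e2 u v) E = u ∧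
      lor (c • chart E e1 e2 u v) e2 / -lor (c • chart E e1 e2 u v) E = v := by
  obtain ⟨h1, h2, h3⟩ := h.lor_smul_chart c u v
  rw [h1, h2, h3]
  constructor <;> field_simp

theorem OFrame.bpt_coords (h : OFrame E e1 e2) {u : ℝ} (hu : u ^ 2 + φ u ^ 2 < 1) :
    lor (bpt E e1 e2 φ u) e1 / -lor (bpt E e1 e2 φ u) E = u ∧
      lor (bpt E e1 e2 φ u) e2 / -lor (bpt E e1 e2 φ u) E = φ u := by
  rw [bpt, h.nrm_chart]
  exact h.chart_coords (inv_pos.2 (hgt_pos hu))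

theorem OFrame.bpt_inj (h : OFrame E e1 e2) {u u' : ℝ} (hu : u ^ 2 + φ u ^ 2 < 1)
    (hu' : u' ^ 2 + φ u' ^ 2 < 1) (he : bpt E e1 e2 φ u = bpt E e1 e2 φ u') : u = u' := by
  rw [← (h.bpt_coords hu).1, ← (h.bpt_coords hu').1, he]

/-- Boundary points near a boundary point of the chart. -/
theorem Chart.near (hC : IsBody C) (h : Chart C E e1 e2 r M b φ) {a c u0 : ℝ} (ha : -r ≤ a)
    (hc : c ≤ r) (h1 : a < u0) (h2 : u0 < c) (hb : φ u0 < b) (hu : u0 ^ 2 + φ u0 ^ 2 < 1) :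
    ∃ U ∈ nhds (bpt E e1 e2 φ u0), ∀ y ∈ U, y ∈ Bd C → ∃ u ∈ Ioo a c, y = bpt E e1 e2 φ u := by
  have hF := h.frame
  have hne : -lor (bpt E e1 e2 φ u0) E ≠ 0 := by
    rw [bpt, hF.nrm_chart, (hF.lor_smul_chart _ _ _).1, neg_neg]
    exact (inv_pos.2 (hgt_pos hu)).ne'
  obtain ⟨q1, q2⟩ := hF.bpt_coords hu
  have cl : ∀ w : Vec, ContinuousAt (fun y : Vec => lor y w) (bpt E e1 e2 φ u0) := fun w =>
    (by unfold lor; fun_prop : Continuous fun y : Vec => lor y w).continuousAt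
  have c1 : ContinuousAt (fun y : Vec => lor y e1 / -lor y E) (bpt E e1 e2 φ u0) :=
    (cl e1).div (cl E).neg hne
  have c2 : ContinuousAt (fun y : Vec => lor y e2 / -lor y E) (bpt E e1 e2 φ u0) :=
    (cl e2).div (cl E).neg hne
  have d1 := c1.preimage_mem_nhds (t := Ioo a c) (by rw [q1]; exact Ioo_mem_nhds h1 h2)
  have d2 := c2.preimage_mem_nhds (t := Iio b) (by rw [q2]; exact Iio_mem_nhds hb)
  refine ⟨_, inter_mem d1 d2, fun y hy hyB => ?_⟩
  obtain ⟨γ, u, v, hγ, rfl⟩ := hF.exists_chart (hC.fut hyB.2.1)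
  obtain ⟨p1, p2⟩ := hF.chart_coords (u := u) (v := v) hγ
  simp only [mem_inter_iff, mem_preimage, p1, p2] at hy
  exact ⟨u, hy.1, h.eq_bpt hC hγ ⟨by linarith [hy.1.1], by linarith [hy.1.2]⟩ (le_of_lt hy.2) hyB⟩

theorem Chart.regular (hC : IsBody C) (h : Chart C E e1 e2 r M b φ) {a c u0 t : ℝ} {w : Vec}
    (ha : -r ≤ a) (hc : c ≤ r) (h1 : a < u0) (h2 : u0 < c) (hb : φ u0 < b)
    (hu : u0 ^ 2 + φ u0 ^ 2 < 1) (hw : w ≠ 0) (hp : ∀ u ∈ Ioo a c, lor (bpt E e1 e2 φ u) w = t) :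
    Regular C (bpt E e1 e2 φ u0) := by
  obtain ⟨U, hU, hy⟩ := h.near hC ha hc h1 h2 hb hu
  refine ⟨U, hU, w, t, hw, fun y hyU hyB => ?_⟩
  obtain ⟨u, hu, rfl⟩ := hy y hyU hyB
  exact hp u hu

namespace Chord

variable {B ρ u1 u2 m k : ℝ}

/-- Boundary points on the chord belong to the arc. -/
theorem on_chord (h : Chord C E e1 e2 r M b φ B ρ u1 u2 m k) {α β : ℝ} (hα : 0 < α) (hβ : 0 < β)
    (hy : α • bpt E e1 e2 φ u1 + β • bpt E e1 e2 φ u2 ∈ Bd C) :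
    ∃ u ∈ Ioo u1 u2, α • bpt E e1 e2 φ u1 + β • bpt E e1 e2 φ u2 = bpt E e1 e2 φ u := by
  have h1 := hgt_pos h.lt1
  have h2 := hgt_pos h.lt2
  have hlt := h.lt
  have hm1 := h.mem1
  have hm2 := h.mem2
  have hb1 := h.phi_le1
  have hb2 := h.phi_le2
  set a := α * (hgt u1 (φ u1))⁻¹
  set a' := β * (hgt u2 (φ u2))⁻¹
  have ha : 0 < a := by positivity
  have ha' : 0 < a' := by positivity
  have he : α • bpt E e1 e2 φ u1 + β • bpt E e1 e2 φ u2 =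
      (a + a') • BallChar.chart E e1 e2 ((a * u1 + a' * u2) / (a + a'))
        ((a * φ u1 + a' * φ u2) / (a + a')) := by
    rw [bpt, bpt, h.chart.frame.nrm_chart, h.chart.frame.nrm_chart, smul_smul, smul_smul]
    simp only [BallChar.chart, smul_add, smul_smul]
    rw [mul_div_cancel₀ _ (by positivity), mul_div_cancel₀ _ (by positivity)]
    module
  have hu : (a * u1 + a' * u2) / (a + a') ∈ Ioo u1 u2 := by
    constructor
    · rw [lt_div_iff₀ (by positivity)]; nlinarith
    · rw [div_lt_iff₀ (by positivity)]; nlinarith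
  rw [he] at hy ⊢
  refine ⟨_, hu, h.chart.eq_bpt h.body (by positivity) ⟨by linarith [hu.1, hm1.1], by
    linarith [hu.2, hm2.2]⟩ ?_ hy⟩
  rw [div_le_iff₀ (by positivity)]
  nlinarith

theorem hgt_near (h : Chord C E e1 e2 r M b φ B ρ u1 u2 m k) {u : ℝ} (hu : |u| ≤ ρ) :
    1 - (1 + B ^ 2) * ρ ^ 2 ≤ hgt u (φ u) := by
  have h1 := h.chart.abs_bound h.MB h.ρr hu
  have h2 : u ^ 2 ≤ ρ ^ 2 := by rw [← sq_abs]; gcongr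
  have h3 : φ u ^ 2 ≤ (B * ρ) ^ 2 := by rw [← sq_abs]; gcongr
  have h4 := h.chart.small h.MB h.ρr h.ρs hu
  have h5 := hgt_sq (u := u) (v := φ u) (by linarith)
  have h6 := hgt_le_one u (φ u)
  have h7 := hgt_pos (u := u) (v := φ u) (by linarith)
  nlinarith

/-- The cap of a chord lies in a triangle of controlled shape. -/
theorem outer_shape (h : Chord C E e1 e2 r M b φ B ρ u1 u2 m k) (hs : Slopes φ u1 u2 (-B) B)
    (hρ : 4 * ((1 + 2 * B * (B + 1)) * ((1 + B ^ 2) * ρ ^ 2)) ≤ 1 / 4) :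
    ∃ x y t : ℝ, |x| ≤ 1 + 2 * B * (B + 1) ∧ |y| ≤ 1 + 2 * B * (B + 1) ∧ |x + y - 1| ≤ 1 / 4 ∧
      B / (2 * (1 + B ^ 2)) ≤ t ∧ t ≤ 2 * B ∧
      Outer C (bpt E e1 e2 φ u1) (bpt E e1 e2 φ u2) (lineNormal E e1 e2 m k) x y
        (t * Real.sqrt ((-lor (bpt E e1 e2 φ u1) (bpt E e1 e2 φ u2)) ^ 2 - 1)) := by
  have ho := h.outer_gen hs rfl rfl rfl
  have hB := h.B_pos
  have hρ0 := h.ρ_pos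
  have hW := h.W_pos
  have hW2 := h.W_ge
  have hW3 : lineLen m k ^ 2 ≤ 1 + B ^ 2 := by
    rw [h.W_sq]
    have : m ^ 2 ≤ B ^ 2 := by rw [← sq_abs]; exact pow_le_pow_left₀ (abs_nonneg _) h.abs_m 2
    nlinarith [sq_nonneg k]
  have ha := h.hgt1
  have ha' := h.hgt2
  have hb := hgt_le_one u1 (φ u1)
  have hb' := hgt_le_one u2 (φ u2)
  have hc := h.hgt_near h.abs1
  have hc' := h.hgt_near h.abs2
  have hD : 0 < u2 - u1 := by linarith [h.lt]
  have hm1 := h.abs_mk h.abs1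
  have hm2 := h.abs_mk h.abs2
  have hk := h.abs_k
  have hBρ := h.Bρ
  have hD2 : u2 - u1 ≤ 2 * ρ := by linarith [(abs_le.1 h.abs1).1, (abs_le.1 h.abs2).2]
  have hsd := h.sqrt_dist
  set W := lineLen m k
  set g := hgt u1 (φ u1)
  set g' := hgt u2 (φ u2)
  clear_value W g g'
  set F := B / W ^ 2 with hF
  have hF0 : 0 < F := by positivity
  have hF1 : F ≤ 101 / 99 * B := by
    rw [hF, div_le_iff₀ (by positivity)]
    have := mul_le_mul_of_nonneg_left hW2 hB.le
    linarith
  have el : (u2 - (u1 + u2) / 2 + B * (u2 - u1) / W ^ 2 * (m + k * u2)) / (u2 - u1) =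
      1 / 2 + F * (m + k * u2) := by
    rw [hF]; field_simp; ring
  have em : ((u1 + u2) / 2 - u1 - B * (u2 - u1) / W ^ 2 * (m + k * u1)) / (u2 - u1) =
      1 / 2 - F * (m + k * u1) := by
    rw [hF]; field_simp; ring
  rw [el, em] at ho
  set l := 1 / 2 + F * (m + k * u2) with hl
  set μ := 1 / 2 - F * (m + k * u1) with hμ
  clear_value l μ
  have hFB : F * (B + 1) ≤ 101 / 99 * B * (B + 1) := by gcongr
  have hBB : 0 < B * (B + 1) := by positivity
  have hla : |l| ≤ 1 + 2 * B * (B + 1) := by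
    have : |F * (m + k * u2)| ≤ F * (B + 1) := by
      rw [abs_mul, abs_of_pos hF0]; gcongr
    have := abs_le.1 this
    rw [abs_le]; constructor <;> linarith
  have hμa : |μ| ≤ 1 + 2 * B * (B + 1) := by
    have : |F * (m + k * u1)| ≤ F * (B + 1) := by
      rw [abs_mul, abs_of_pos hF0]; gcongr
    have := abs_le.1 this
    rw [abs_le]; constructor <;> linarith
  have hsum : |l + μ - 1| ≤ 1 / 8 := by
    have e : l + μ - 1 = F * (k * (u2 - u1)) := by rw [hl, hμ]; ring
    rw [e, abs_mul, abs_mul, abs_of_pos hF0, abs_of_pos hD]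
    have h1 : |k| * (u2 - u1) ≤ 1 / 20 * (2 * ρ) := by gcongr
    have h2 : F * (|k| * (u2 - u1)) ≤ (101 / 99 * B) * (1 / 20 * (2 * ρ)) := by gcongr
    linarith [hBρ.2.1]
  set K := 1 + 2 * B * (B + 1) with hK
  set θ := (1 + B ^ 2) * ρ ^ 2 with hθ
  have hθ0 : 0 < θ := by positivity
  have hK0 : 0 ≤ K := by positivity
  clear_value θ K F
  have hs1 : |l * g - l| ≤ K * θ := by
    have e : l * g - l = l * (g - 1) := by ring
    rw [e, abs_mul]
    have : |g - 1| ≤ θ := by rw [abs_le]; constructor <;> linarith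
    gcongr
  have hs2 : |μ * g' - μ| ≤ K * θ := by
    have e : μ * g' - μ = μ * (g' - 1) := by ring
    rw [e, abs_mul]
    have : |g' - 1| ≤ θ := by rw [abs_le]; constructor <;> linarith
    gcongr
  refine ⟨l * g, μ * g', F * (g * g'), ?_, ?_, ?_, ?_, ?_, ?_⟩
  · rw [abs_mul, abs_of_pos (by linarith : 0 < g)]
    exact (mul_le_of_le_one_right (abs_nonneg l) hb).trans hla
  · rw [abs_mul, abs_of_pos (by linarith : 0 < g')]
    exact (mul_le_of_le_one_right (abs_nonneg μ) hb').trans hμa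
  · have := abs_le.1 hsum
    have := abs_le.1 hs1
    have := abs_le.1 hs2
    rw [abs_le]; constructor <;> linarith
  · have h1 : B / (1 + B ^ 2) ≤ F := by rw [hF]; gcongr
    have h2 : 99 / 100 * (99 / 100) ≤ g * g' := by gcongr
    have h2 : 1 / 2 ≤ g * g' := by linarith
    calc B / (2 * (1 + B ^ 2)) = B / (1 + B ^ 2) * (1 / 2) := by field_simp
      _ ≤ F * (g * g') := by gcongr
  · have h2 : g * g' ≤ 1 := mul_le_one₀ hb (by linarith) hb'
    have := mul_le_of_le_one_right hF0.le h2
    linarith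
  · have hg : 0 < g := by linarith
    have hg' : 0 < g' := by linarith
    have e : B * (u2 - u1) / W = F * (g * g') * ((u2 - u1) * W / (g * g')) := by
      rw [hF]; field_simp
    rw [hsd]
    rw [e] at ho
    exact ho

end Chord

end

section

variable {C : Set Vec} {E e1 e2 : Vec} {r M b : ℝ} {φ : ℝ → ℝ}

set_option maxHeartbeats 800000 in
/-- If the slopes of the boundary vary little compared with the height of a triangle over a short
chord, then the apex of the triangle is an interior point. -/
theorem Chord.apex_int {B ρ u1 u2 m k : ℝ} (h : Chord C E e1 e2 r M b φ B ρ u1 u2 m k)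
    {x y t R T t0 ε K lo c1 c2 : ℝ} (hx : |x| ≤ R) (hy : |y| ≤ R) (hxy : |x + y - 1| ≤ 1 / 4)
    (ht0 : 0 < t0) (ht : t0 ≤ t) (htT : t ≤ T) (hRρ : R * ((1 + B ^ 2) * ρ ^ 2) ≤ 1 / 16)
    (hTρ : T * ρ ≤ 1) (hK : K = 2 * (R + T * (B + 1))) (hs : Slopes φ c1 c2 lo (lo + ε))
    (hε0 : 0 ≤ ε) (hε : ε * K ≤ t0 / 2) (hc1 : c1 ≤ u1 - K * (u2 - u1))
    (hc2 : u1 + K * (u2 - u1) ≤ c2) (h2 : u2 ≤ c2) (hr1 : -r ≤ c1) (hr2 : c2 ≤ r)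
    (hb : (B * K + 2 * T * (1 + B ^ 2)) * (u2 - u1) ≤ b / 2) :
    x • bpt E e1 e2 φ u1 + y • bpt E e1 e2 φ u2 +
      (t * Real.sqrt ((-lor (bpt E e1 e2 φ u1) (bpt E e1 e2 φ u2)) ^ 2 - 1)) •
        (-lineNormal E e1 e2 m k) ∈ interior C := by
  have hB := h.B_pos
  have hρ0 := h.ρ_pos
  have hW2 := h.W_ge
  have hW3 : lineLen m k ^ 2 ≤ 1 + B ^ 2 := by
    rw [h.W_sq]
    have : m ^ 2 ≤ B ^ 2 := by rw [← sq_abs]; exact pow_le_pow_left₀ (abs_nonneg _) h.abs_m 2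
    nlinarith [sq_nonneg k]
  have ha := h.hgt1
  have ha' := h.hgt2
  have hb1 := hgt_le_one u1 (φ u1)
  have hb1' := hgt_le_one u2 (φ u2)
  have hc := h.hgt_near h.abs1
  have hc' := h.hgt_near h.abs2
  have hD : 0 < u2 - u1 := by linarith [h.lt]
  have hm1 := h.abs_mk h.abs1
  have hk := h.abs_k
  have hBρ := h.Bρ
  have hD2 : u2 - u1 ≤ 2 * ρ := by linarith [(abs_le.1 h.abs1).1, (abs_le.1 h.abs2).2]
  have hR : 0 ≤ R := (abs_nonneg x).trans hx
  have ht' : 0 < t := by linarith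
  have hT : 0 < T := by linarith
  have hK0 : 0 < K := by rw [hK]; positivity
  have hKD : 0 < K * (u2 - u1) := by positivity
  have hm := h.slope_mem (hs.mono (by linarith) h2)
  have hv1 := h.v1
  have hφb : φ u1 ≤ b / 4 := by
    have := abs_le.1 (h.chart.abs_bound h.MB h.ρr h.abs1)
    linarith [this.2]
  have hmB := abs_le.1 h.abs_m
  obtain ⟨L, hL⟩ : ∃ L, L = x * hgt u2 (φ u2) + y * hgt u1 (φ u1) + t * (u2 - u1) * k := ⟨_, rfl⟩
  obtain ⟨u, hu⟩ : ∃ u, u = (x * hgt u2 (φ u2) * u1 + y * hgt u1 (φ u1) * u2 -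
    t * (u2 - u1) * m) / L := ⟨_, rfl⟩
  have key := fun h1 => h.inner_gen hL h1 hu
  revert key
  generalize hgt u1 (φ u1) = g at *
  generalize hgt u2 (φ u2) = g' at *
  generalize lineLen m k = W at *
  intro key
  have d1 : |x * (g' - 1)| ≤ 1 / 16 := by
    rw [abs_mul]
    have : |g' - 1| ≤ (1 + B ^ 2) * ρ ^ 2 := by rw [abs_le]; constructor <;> linarith
    calc _ ≤ R * ((1 + B ^ 2) * ρ ^ 2) := by gcongr
      _ ≤ _ := hRρ
  have d2 : |y * (g - 1)| ≤ 1 / 16 := by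
    rw [abs_mul]
    have : |g - 1| ≤ (1 + B ^ 2) * ρ ^ 2 := by rw [abs_le]; constructor <;> linarith
    calc _ ≤ R * ((1 + B ^ 2) * ρ ^ 2) := by gcongr
      _ ≤ _ := hRρ
  have d3 : |t * (u2 - u1) * k| ≤ 1 / 10 := by
    rw [abs_mul, abs_of_pos (by positivity)]
    calc t * (u2 - u1) * |k| ≤ T * (2 * ρ) * (1 / 20) := by gcongr
      _ ≤ 1 / 10 := by linarith
  have hL1 : 1 / 2 ≤ L ∧ L ≤ 3 / 2 := by
    have := abs_le.1 d1
    have := abs_le.1 d2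
    have := abs_le.1 d3
    have := abs_le.1 hxy
    constructor <;> linarith
  have hL0 : 0 < L := by linarith
  have hdu : |u - u1| ≤ K * (u2 - u1) := by
    have e : u - u1 = (y * g - t * (m + k * u1)) * (u2 - u1) / L := by
      rw [hu, eq_div_iff hL0.ne', sub_mul, div_mul_cancel₀ _ hL0.ne']
      rw [hL]; ring
    have e1 : |y * g - t * (m + k * u1)| ≤ R + T * (B + 1) := by
      refine (abs_sub _ _).trans ?_
      rw [abs_mul, abs_mul, abs_of_pos ht', abs_of_pos (by linarith : 0 < g)]
      calc _ ≤ R * 1 + T * (B + 1) := by gcongr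
        _ = _ := by ring
    rw [e, abs_div, abs_mul, abs_of_pos hD, abs_of_pos hL0, div_le_iff₀ hL0]
    calc _ ≤ (R + T * (B + 1)) * (u2 - u1) := by gcongr
      _ = K * (u2 - u1) * (1 / 2) := by rw [hK]; ring
      _ ≤ K * (u2 - u1) * L := by gcongr; exact hL1.1
  have hud := abs_le.1 hdu
  have hur : u ∈ Icc c1 c2 := ⟨by linarith, by linarith⟩
  have hsl : φ u ≤ m * u + k + ε * (K * (u2 - u1)) := by
    rcases le_total u1 u with h1 | h1
    · have h3 := (hs u1 u (by linarith) h1 hur.2).2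
      have h4 := mul_le_mul_of_nonneg_right hm.1 (sub_nonneg.2 h1)
      have h5 : ε * (u - u1) ≤ ε * (K * (u2 - u1)) := by gcongr; exact hud.2
      linarith
    · have h3 := (hs u u1 hur.1 h1 (by linarith [h.lt])).1
      have h4 := mul_le_mul_of_nonneg_right hm.2 (sub_nonneg.2 h1)
      have h5 : ε * (u1 - u) ≤ ε * (K * (u2 - u1)) := by gcongr; linarith
      linarith
  have hg1 : ε * (K * (u2 - u1)) < t * (u2 - u1) * W ^ 2 / L := by
    rw [lt_div_iff₀ hL0]
    calc ε * (K * (u2 - u1)) * L = ε * K * (u2 - u1) * L := by ring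
      _ ≤ t0 / 2 * (u2 - u1) * (3 / 2) := by gcongr; exact hL1.2
      _ < t0 * (u2 - u1) * (99 / 100) := by linarith [mul_pos ht0 hD]
      _ ≤ t * (u2 - u1) * W ^ 2 := by gcongr
  have hg2 : t * (u2 - u1) * W ^ 2 / L ≤ 2 * T * (1 + B ^ 2) * (u2 - u1) := by
    rw [div_le_iff₀ hL0]
    calc t * (u2 - u1) * W ^ 2 ≤ T * (u2 - u1) * (1 + B ^ 2) := by gcongr
      _ = 2 * T * (1 + B ^ 2) * (u2 - u1) * (1 / 2) := by ring
      _ ≤ _ := by gcongr; exact hL1.1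
  refine key hL0 ⟨hr1.trans hur.1, hur.2.trans hr2⟩ (by linarith) ?_
  have h6 : m * (u - u1) ≤ B * (K * (u2 - u1)) := by
    refine (le_abs_self _).trans ?_
    rw [abs_mul]
    have := h.abs_m
    gcongr
  have := h.chart.b_pos
  linarith

end

/-- The part of the boundary of a body beyond the chord with normal `n`, as an arc. -/
structure Cap (C : Set Vec) (w : ℝ → Vec) (a c : ℝ) (n : Vec) : Prop where
  body : IsBody C
  lt : a < c
  cont : ContinuousOn w (Icc a c)
  inj : InjOn w (Icc a c)
  bd : ∀ u ∈ Icc a c, w u ∈ Bd C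
  frame : CFrame (-lor (w a) (w c)) (w a) (w c) n
  exhaust : ∀ y ∈ Bd C, 0 < lor y n → ∃ u ∈ Ioo a c, y = w u

namespace Cap

variable {C : Set Vec} {w : ℝ → Vec} {a c : ℝ} {n : Vec}

theorem image (h : Cap C w a c n) {A : Vec ≃ₗ[ℝ] Vec} (hA : IsLor A) :
    Cap (A '' C) (fun u => A (w u)) a c (A n) where
  body := h.body.image hA
  lt := h.lt
  cont := A.toContinuousLinearEquiv.continuous.comp_continuousOn h.cont
  inj := fun x hx y hy hxy => h.inj hx hy (A.injective hxy)
  bd := fun u hu => (mem_Bd_image hA).2 (h.bd u hu)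
  frame := by
    have := h.frame.map hA
    rwa [← hA.lor_map (w a)] at this
  exhaust := fun y hy hyn => by
    obtain ⟨y', hy', rfl⟩ := hy.2.1
    rw [hA.lor_map] at hyn
    obtain ⟨u, hu, rfl⟩ := h.exhaust y' ((mem_Bd_image hA).1 hy) hyn
    exact ⟨u, hu, rfl⟩

theorem rev (h : Cap C w a c n) : Cap C (fun u => w (-u)) (-c) (-a) n where
  body := h.body
  lt := neg_lt_neg h.lt
  cont := h.cont.comp continuous_neg.continuousOn fun u hu =>
    ⟨by linarith [hu.2], by linarith [hu.1]⟩
  inj := fun x hx y hy hxy => neg_injective (h.inj ⟨by linarith [hx.2], by linarith [hx.1]⟩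
    ⟨by linarith [hy.2], by linarith [hy.1]⟩ hxy)
  bd := fun u hu => h.bd _ ⟨by linarith [hu.2], by linarith [hu.1]⟩
  frame := by
    have := h.frame.swap
    simp only [neg_neg]
    rwa [lor_comm] at this
  exhaust := fun y hy hyn => by
    obtain ⟨u, hu, rfl⟩ := h.exhaust y hy hyn
    exact ⟨-u, ⟨by linarith [hu.2], by linarith [hu.1]⟩, by rw [neg_neg]⟩

end Cap

section

variable {C : Set Vec} {E e1 e2 : Vec} {r M b : ℝ} {φ : ℝ → ℝ}

theorem Chord.cap {B ρ u1 u2 m k : ℝ} (h : Chord C E e1 e2 r M b φ B ρ u1 u2 m k) (hρ : ρ < r) :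
    Cap C (bpt E e1 e2 φ) u1 u2 (lineNormal E e1 e2 m k) := by
  have h1 := abs_le.1 h.abs1
  have h2 := abs_le.1 h.abs2
  have ha : ∀ u ∈ Icc u1 u2, |u| ≤ ρ := fun u hu =>
    abs_le.2 ⟨h1.1.trans hu.1, hu.2.trans h2.2⟩
  have hs : ∀ u ∈ Icc u1 u2, u ^ 2 + φ u ^ 2 < 1 := fun u hu => by
    linarith [h.chart.small h.MB h.ρr h.ρs (ha u hu)]
  refine ⟨h.body, h.lt, h.chart.continuousOn_bpt (fun u hu => ?_) hs, fun u hu v hv he =>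
    h.chart.frame.bpt_inj (hs u hu) (hs v hv) he, fun u hu => ?_, h.cframe,
    fun y hy hn => h.exhaust hy hn⟩
  · have := abs_le.1 (ha u hu)
    exact ⟨by linarith [this.1], by linarith [this.2]⟩
  · refine h.chart.bpt_mem_Bd h.body (abs_le.1 ((ha u hu).trans h.ρr)) ?_
    have := abs_le.1 (h.chart.abs_bound h.MB h.ρr (ha u hu))
    linarith [h.Bρ.1, h.chart.b_pos]

theorem Chord.arc_coords {B ρ u1 u2 m k κ : ℝ} (h : Chord C E e1 e2 r M b φ B ρ u1 u2 m k)
    (hρ : ρ < r) (hκ : 0 < κ)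
    (ho : Outer C (bpt E e1 e2 φ u1) (bpt E e1 e2 φ u2) (lineNormal E e1 e2 m k) 1 1 κ) {u : ℝ}
    (hu : u ∈ Ioo u1 u2) : ∃ α β γ : ℝ, bpt E e1 e2 φ u = α • bpt E e1 e2 φ u1 +
      β • bpt E e1 e2 φ u2 + γ • lineNormal E e1 e2 m k ∧ 0 < α ∧ 0 < β ∧ 0 ≤ γ ∧ γ ≤ κ * α ∧
      γ ≤ κ * β := by
  have hbd := (h.cap hρ).bd u (Ioo_subset_Icc_self hu)
  have h1 := hgt_pos h.lt1
  have h2 := hgt_pos h.lt2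
  have hW := h.W_pos
  have hs : u ^ 2 + φ u ^ 2 < 1 := by
    rw [← h.chart.frame.chart_mem_Fut]
    refine h.body.fut (h.chart.mem u ⟨h.mem1.1.trans hu.1.le, hu.2.le.trans h.mem2.2⟩ _ le_rfl ?_)
    have : |u| ≤ ρ := abs_le.2 ⟨(abs_le.1 h.abs1).1.trans hu.1.le,
      hu.2.le.trans (abs_le.1 h.abs2).2⟩
    have := abs_le.1 (h.chart.abs_bound h.MB h.ρr this)
    linarith [h.Bρ.1, h.chart.b_pos]
  have hg := inv_pos.2 (hgt_pos hs)
  have hD : 0 < u2 - u1 := by linarith [h.lt]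
  obtain ⟨d, hd⟩ : ∃ d, d = m * u + k - φ u := ⟨_, rfl⟩
  have hd0 : 0 ≤ d := by
    have := h.le_line (Ioo_subset_Icc_self hu); linarith
  have he := h.expand (v := φ u) hd rfl rfl
  have he' : bpt E e1 e2 φ u = (hgt u (φ u))⁻¹ • BallChar.chart E e1 e2 u (φ u) := by
    rw [bpt, h.chart.frame.nrm_chart]
  rw [he, smul_add, smul_add, smul_smul, smul_smul, smul_smul] at he'
  refine ⟨_, _, _, he', ?_⟩
  have hγ : 0 ≤ (hgt u (φ u))⁻¹ * (d / lineLen m k) := by positivity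
  rcases hd0.eq_or_lt with h0 | h0
  · rw [← h0]
    have : 0 < u2 - u := by linarith [hu.2]
    have : 0 < u - u1 := by linarith [hu.1]
    simp only [zero_div, zero_mul, add_zero, sub_zero, mul_zero, le_refl, true_and]
    exact ⟨by positivity, by positivity, by positivity, by positivity⟩
  · have hγ' : 0 < (hgt u (φ u))⁻¹ * (d / lineLen m k) := by positivity
    have := hbd.2.1
    rw [he'] at this
    obtain ⟨q1, q2⟩ := ho _ _ _ this hγ'
    rw [one_mul] at q1 q2
    exact ⟨pos_of_mul_pos_right (hγ'.trans_le q1) hκ.le,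
      pos_of_mul_pos_right (hγ'.trans_le q2) hκ.le, hγ, q1, q2⟩

theorem eventually_mul_le (A : ℝ) {c : ℝ} (hc : 0 < c) :
    ∀ᶠ ρ : ℝ in nhdsWithin 0 (Ioi 0), A * ρ ≤ c := by
  have h : Tendsto (fun ρ : ℝ => A * ρ) (nhdsWithin 0 (Ioi 0)) (nhds (A * 0)) :=
    ((by fun_prop : Continuous fun ρ : ℝ => A * ρ).tendsto 0).mono_left nhdsWithin_le_nhds
  rw [mul_zero] at h
  exact (h.eventually (Iio_mem_nhds hc)).mono fun ρ h => le_of_lt h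

theorem Outer.mono {C : Set Vec} {P Q n : Vec} {x y k k' : ℝ} (h : Outer C P Q n x y k)
    (hx : 0 < x) (hy : 0 < y) (hk0 : 0 < k) (hk : k ≤ k') : Outer C P Q n x y k' := by
  intro α β γ hz hγ
  obtain ⟨h1, h2⟩ := h α β γ hz hγ
  have ha : 0 < α := pos_of_mul_pos_right ((mul_pos hx hγ).trans_le h1) hk0.le
  have hb : 0 < β := pos_of_mul_pos_right ((mul_pos hy hγ).trans_le h2) hk0.le
  exact ⟨h1.trans (by gcongr), h2.trans (by gcongr)⟩

/-- Short caps away from the base point of the chart, together with triangles over them of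
prescribed shape whose apex is an interior point. -/
theorem Chart.exists_caps (hC : IsBody C) (h : Chart C E e1 e2 r M b φ) {R T t0 κ δ : ℝ}
    (hR : 0 < R) (ht0 : 0 < t0) (hT : 0 < T) (hκ : 0 < κ) (hδ : 0 < δ) :
    ∃ B ρ a d : ℝ, 0 < a ∧ 0 < d ∧ a + d ≤ δ ∧ ρ < r ∧ ∀ c ∈ Ioc a (a + d),
      Chord C E e1 e2 r M b φ B ρ a c (slp φ a c) (icp φ a c) ∧
      Outer C (bpt E e1 e2 φ a) (bpt E e1 e2 φ c) (lineNormal E e1 e2 (slp φ a c) (icp φ a c)) 1 1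
        (κ * Real.sqrt ((-lor (bpt E e1 e2 φ a) (bpt E e1 e2 φ c)) ^ 2 - 1)) ∧
      ∀ x y t, |x| ≤ R → |y| ≤ R → |x + y - 1| ≤ 1 / 4 → t0 ≤ t → t ≤ T →
        x • bpt E e1 e2 φ a + y • bpt E e1 e2 φ c +
          (t * Real.sqrt ((-lor (bpt E e1 e2 φ a) (bpt E e1 e2 φ c)) ^ 2 - 1)) •
          (-lineNormal E e1 e2 (slp φ a c) (icp φ a c)) ∈ interior C := by
  have hM := h.M_pos
  obtain ⟨B, hB⟩ : ∃ B, B = M + 1 := ⟨_, rfl⟩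
  have hB0 : 0 < B := by linarith
  obtain ⟨K, hK⟩ : ∃ K, K = 2 * (R + T * (B + 1)) := ⟨_, rfl⟩
  have hK0 : 0 < K := by rw [hK]; positivity
  set κ' := min κ (1 / (2 * (B + 1))) with hκ'
  have hκ'0 : 0 < κ' := lt_min hκ (by positivity)
  have hκ'B : κ' * (B + 1) ≤ 1 / 2 := by
    calc κ' * (B + 1) ≤ 1 / (2 * (B + 1)) * (B + 1) := by gcongr; exact min_le_right _ _
      _ = 1 / 2 := by field_simp
  obtain ⟨ε, hε0, hε1, hε2, hε3⟩ : ∃ ε : ℝ, 0 < ε ∧ ε ≤ 1 ∧ ε ≤ κ' / 2 ∧ ε * K ≤ t0 / 2 := by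
    obtain ⟨ε, ⟨⟨h1, h2⟩, h3⟩, h4⟩ := ((((eventually_mul_le 1 one_pos).and
      (eventually_mul_le 1 (half_pos hκ'0))).and (eventually_mul_le K (half_pos ht0))).and
      self_mem_nhdsWithin).exists
    exact ⟨ε, h4, by linarith, by linarith, by linarith⟩
  obtain ⟨m, r', hr', hr'r, hm, hs⟩ := h.slopes hε0
  obtain ⟨ρ, hρ0, f1, f2, f3, f4, f5, f6, f7⟩ : ∃ ρ : ℝ, 0 < ρ ∧ ρ ≤ r' ∧ ρ ≤ δ ∧ 2 * ρ ≤ r ∧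
      ρ * (4 * B + 4) ≤ b ∧ ρ * (4 * B + 4) ≤ 1 / 10 ∧ R * ((1 + B ^ 2) * ρ ^ 2) ≤ 1 / 16 ∧
      T * ρ ≤ 1 := by
    obtain ⟨ρ, ⟨⟨⟨⟨⟨⟨⟨⟨h1, h2⟩, h3⟩, h4⟩, h5⟩, h6⟩, h7⟩, h8⟩, h9⟩⟩ := ((((((((eventually_mul_le 1
      hr').and (eventually_mul_le 1 hδ)).and (eventually_mul_le 2 h.r_pos)).and
      (eventually_mul_le (4 * B + 4) h.b_pos)).and (eventually_mul_le (4 * B + 4)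
      (by norm_num : (0:ℝ) < 1 / 10))).and (eventually_mul_le (R * (1 + B ^ 2))
      (by norm_num : (0:ℝ) < 1 / 16))).and (eventually_mul_le T one_pos)).and
      (eventually_mul_le 1 one_pos)).and self_mem_nhdsWithin |>.exists
    have h9 : 0 < ρ := h9
    refine ⟨ρ, h9, by linarith, by linarith, by linarith, by linarith, by linarith, ?_, by linarith⟩
    calc R * ((1 + B ^ 2) * ρ ^ 2) = R * (1 + B ^ 2) * ρ * ρ := by ring
      _ ≤ R * (1 + B ^ 2) * ρ * 1 := by gcongr; linarith
      _ ≤ 1 / 16 := by linarith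
  obtain ⟨d, hd0, g1, g2, g3⟩ : ∃ d : ℝ, 0 < d ∧ d ≤ ρ / 2 ∧ K * d ≤ ρ / 2 ∧
      (B * K + 2 * T * (1 + B ^ 2)) * d ≤ b / 2 := by
    obtain ⟨d, ⟨⟨h1, h2⟩, h3⟩, h4⟩ := ((((eventually_mul_le 1 (half_pos hρ0)).and
      (eventually_mul_le K (half_pos hρ0))).and (eventually_mul_le
      (B * K + 2 * T * (1 + B ^ 2)) (half_pos h.b_pos))).and self_mem_nhdsWithin).exists
    exact ⟨d, h4, by linarith, by linarith, by linarith⟩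
  refine ⟨B, ρ, ρ / 2, d, by linarith, hd0, by linarith, by linarith [h.r_pos], fun c hc => ?_⟩
  have hm' := abs_le.1 hm
  have hs0 : Slopes φ 0 ρ m (m + ε) := fun u v h1 h2 h3 => hs u v h1 h2 (h3.trans f1)
  have hs1 : Slopes φ (ρ / 2) c m (m + ε) := hs0.mono (by linarith) (by linarith [hc.2])
  have hch := h.mkChord hC hc.1 (abs_le.2 ⟨by linarith, by linarith⟩)
    (abs_le.2 ⟨by linarith [hc.1], by linarith [hc.2]⟩) (by linarith [h.r_pos] : ρ ≤ r)
    (by linarith : M ≤ B) f4 f5 hs1 (by linarith) (by linarith)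
  have hdc : c - ρ / 2 ≤ d := by linarith [hc.2]
  have hKd : K * (c - ρ / 2) ≤ K * d := by gcongr
  have hS : 0 < Real.sqrt ((-lor (bpt E e1 e2 φ (ρ / 2)) (bpt E e1 e2 φ c)) ^ 2 - 1) :=
    Real.sqrt_pos.2 (by nlinarith [hch.cframe.hs])
  refine ⟨hch, ?_, fun x y t hx hy hxy h1 h2 => ?_⟩
  · exact (hch.outer hκ'0 hκ'B hs1 (by linarith)).mono one_pos one_pos (by positivity)
      (by gcongr; exact min_le_left _ _)
  · refine hch.apex_int hx hy hxy ht0 h1 h2 f6 f7 hK hs0 hε0.le hε3 (by linarith) (by linarith)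
      (by linarith [hc.2]) (by linarith [h.r_pos]) (by linarith [h.r_pos]) (le_trans ?_ g3)
    gcongr

end

theorem cap_interior {C : Set Vec} {s κ : ℝ} {P Q n E : Vec} (hC : IsBody C)
    (h : CFrame s P Q n) (hPC : P ∈ Bd C) (hQC : Q ∈ Bd C) (hκ : 0 < κ)
    (hin : P + Q + κ • (-n) ∈ interior C) (hE : E ∈ Bd C) (hEn : 0 < lor E n) {α β γ : ℝ}
    (hα : 0 < α) (hβ : 0 < β) (hγ : 0 ≤ γ) (h1 : γ ≤ κ * α) (h2 : γ ≤ κ * β) :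
    α • P + β • Q + γ • (-n) ∈ interior C := by
  rcases hγ.eq_or_lt with rfl | hγ
  · obtain ⟨a, b, c, hEe⟩ := h.expand E
    have hc : 0 < c := by rw [hEe, h.lor_n] at hEn; exact hEn
    have hw : (κ * a + c) • P + (κ * b + c) • Q ∈ interior C := by
      have := hC.add_int (hC.smul κ hκ E hE.2.1) (hC.smul_int hc hin)
      convert this using 1
      rw [hEe]; module
    have hcr := nonneg_of_crossing h hC hPC hQC hE.2.1 hEn hin (by
        simp [h.hPn, h.hQn, h.hn]; exact hκ) (interior_subset hw)
    set p := κ * a + c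
    set q := κ * b + c
    obtain ⟨l, hl, l1, l2⟩ : ∃ l : ℝ, 0 < l ∧ l * p ≤ α ∧ l * q ≤ β := by
      obtain ⟨l, ⟨h1, h2⟩, h3⟩ := (((eventually_mul_le p hα).and (eventually_mul_le q hβ)).and
        self_mem_nhdsWithin).exists
      exact ⟨l, h3, by linarith, by linarith⟩
    have := hC.comb_int (a := α - l * p) (b := β - l * q) (by linarith) (by linarith) hl hPC.2.1
      hQC.2.1 hw
    convert this using 1
    module
  · have := hC.comb_int (a := α - γ / κ) (b := β - γ / κ) (c := γ / κ)
      (by rw [sub_nonneg, div_le_iff₀ hκ]; linarith) (by rw [sub_nonneg, div_le_iff₀ hκ]; linarith)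
      (by positivity) hPC.2.1 hQC.2.1 hin
    convert this using 1
    have hk' : γ / κ * κ = γ := by field_simp
    conv_lhs => rw [← hk']
    module

/-- A cap with a corner, glued to the complement of a planar cap, has no symmetries. -/
theorem corner_rigid {C D : Set Vec} {z w : ℝ → Vec} {p q a c x y k κ t1 t2 t3 : ℝ}
    {n v1 v2 v3 : Vec} (hc : Cap C z (-p) q n) (hp : 0 < p) (hq : 0 < q) (hd : Cap D w a c (-n))
    (hwa : w a = z (-p)) (hwc : w c = z q) (hk : 0 < k) (ho : Outer C (z (-p)) (z q) n x y k)
    (hapex : x • z (-p) + y • z q + k • n ∈ interior D) (hκ : 0 < κ)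
    (ho' : Outer D (z (-p)) (z q) (-n) 1 1 κ) (hin : z (-p) + z q + κ • (-n) ∈ interior C)
    (hcoord : ∀ u ∈ Ioo a c, ∃ α β γ : ℝ, w u = α • z (-p) + β • z q + γ • (-n) ∧ 0 < α ∧ 0 < β ∧
      0 ≤ γ ∧ γ ≤ κ * α ∧ γ ≤ κ * β)
    (honc : ∀ α β : ℝ, 0 < α → 0 < β → α • z (-p) + β • z q ∈ Bd D → ∃ u ∈ Ioo a c,
      α • z (-p) + β • z q = w u)
    (hup : ∀ u ∈ Ioo (-p) q, 0 < lor (z u) n) (hd1 : lor (z 0) (z (-p)) ≠ lor (z 0) (z q))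
    (hd2 : lor (z 0) (z (-p)) ≠ lor (z (-p)) (z q)) (hd3 : lor (z 0) (z q) ≠ lor (z (-p)) (z q))
    (hv1 : v1 ≠ 0) (hv2 : v2 ≠ 0) (hv3 : v3 ≠ 0) (h1 : ∀ u ∈ Ioo (-p) 0, lor (z u) v1 = t1)
    (h2 : ∀ u ∈ Ioo 0 q, lor (z u) v2 = t2) (h3 : ∀ u ∈ Icc a c, lor (w u) v3 = t3)
    (hPv : lor (z (-p)) v2 ≠ t2) (hQv : lor (z q) v1 ≠ t1)
    (hreg : ∀ u ∈ Ioo (-p) q, u ≠ 0 → Regular C (z u)) (hreg' : ∀ u ∈ Ioo a c, Regular D (w u))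
    (hirE : ¬ Regular C (z 0)) {A : Vec ≃ₗ[ℝ] Vec} (hA : IsLor A)
    (hAM : A '' (C ∩ D) = C ∩ D) : A = LinearEquiv.refl ℝ Vec := by
  have hC := hc.body
  have hD := hd.body
  have hac := hd.lt
  have h := hc.frame
  have hPC := hc.bd (-p) ⟨le_rfl, hc.lt.le⟩
  have hQC := hc.bd q ⟨hc.lt.le, le_rfl⟩
  have hPD : z (-p) ∈ Bd D := by rw [← hwa]; exact hd.bd a ⟨le_rfl, hd.lt.le⟩
  have hQD : z q ∈ Bd D := by rw [← hwc]; exact hd.bd c ⟨hd.lt.le, le_rfl⟩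
  have h0 : (0:ℝ) ∈ Ioo (-p) q := ⟨by linarith, hq⟩
  have hE := hc.bd 0 (Ioo_subset_Icc_self h0)
  have hEn := hup 0 h0
  have hzD : ∀ u ∈ Ioo (-p) q, z u ∈ Bd (C ∩ D) := fun u hu => by
    have hb := hc.bd u (Ioo_subset_Icc_self hu)
    exact (Bd_inter_iff (ho.mem_int h hD hPD.2.1 hQD.2.1 hk hapex hb.2.1 (hup u hu))).2 hb
  have hwC : ∀ u ∈ Ioo a c, w u ∈ Bd (C ∩ D) := fun u hu => by
    have hb := hd.bd u (Ioo_subset_Icc_self hu)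
    obtain ⟨α, β, γ, he, q1, q2, q3, q4, q5⟩ := hcoord u hu
    have := cap_interior hC h hPC hQC hκ hin hE hEn q1 q2 q3 q4 q5
    rw [← he] at this
    rw [inter_comm]
    exact (Bd_inter_iff this).2 hb
  have hirP : ¬ Regular (C ∩ D) (z (-p)) := fun hr => by
    have m1 : Meets v1 t1 (Bd (C ∩ D)) (z (-p)) := Meets.of_right (c := 0) (by linarith)
      ((hc.cont.continuousWithinAt (left_mem_Icc.2 hc.lt.le)).mono_of_mem_nhdsWithin
        (mem_of_superset (Ioo_mem_nhdsGT hc.lt) Ioo_subset_Icc_self))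
      (hc.inj.mono fun (u : ℝ) (hu : u ∈ Ioo (-p) 0) => show u ∈ Icc (-p) q from ⟨hu.1.le, by linarith [hu.2]⟩)
      (fun u hu => hzD u ⟨hu.1, by linarith [hu.2]⟩) h1
    have m2 : Meets v3 t3 (Bd (C ∩ D)) (w a) := Meets.of_right hac
      ((hd.cont.continuousWithinAt (left_mem_Icc.2 hac.le)).mono_of_mem_nhdsWithin
        (mem_of_superset (Ioo_mem_nhdsGT hac) Ioo_subset_Icc_self))
      (hd.inj.mono Ioo_subset_Icc_self) hwC (fun u hu => h3 u (Ioo_subset_Icc_self hu))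
    rw [hwa] at m2
    obtain ⟨e, he, rfl, rfl⟩ := hr.parallel hv1 hv3 m1 m2
    have := h3 c ⟨hac.le, le_rfl⟩
    rw [hwc, lor_smul_right] at this
    exact hQv (mul_left_cancel₀ he this)
  have hirQ : ¬ Regular (C ∩ D) (z q) := fun hr => by
    have m1 : Meets v2 t2 (Bd (C ∩ D)) (z q) := Meets.of_left (c := 0) hq
      ((hc.cont.continuousWithinAt (right_mem_Icc.2 hc.lt.le)).mono_of_mem_nhdsWithin
        (mem_of_superset (Ioo_mem_nhdsLT hc.lt) Ioo_subset_Icc_self))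
      (hc.inj.mono fun (u : ℝ) (hu : u ∈ Ioo 0 q) => show u ∈ Icc (-p) q from ⟨by linarith [hu.1], hu.2.le⟩)
      (fun u hu => hzD u ⟨by linarith [hu.1], hu.2⟩) h2
    have m2 : Meets v3 t3 (Bd (C ∩ D)) (w c) := Meets.of_left hac
      ((hd.cont.continuousWithinAt (right_mem_Icc.2 hac.le)).mono_of_mem_nhdsWithin
        (mem_of_superset (Ioo_mem_nhdsLT hac) Ioo_subset_Icc_self))
      (hd.inj.mono Ioo_subset_Icc_self) hwC (fun u hu => h3 u (Ioo_subset_Icc_self hu))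
    rw [hwc] at m2
    obtain ⟨e, he, rfl, rfl⟩ := hr.parallel hv2 hv3 m1 m2
    have := h3 a ⟨le_rfl, hac.le⟩
    rw [hwa, lor_smul_right] at this
    exact hPv (mul_left_cancel₀ he this)
  refine triangle_rigid hC hD h hPC hQC hPD hQD hk ho hapex hκ ho' hin hE hEn hd1 hd2 hd3 ?_ ?_ ?_
    hirE hirP hirQ hA hAM
  · intro y hy hyn
    obtain ⟨u, hu, rfl⟩ := hc.exhaust y hy hyn
    by_cases hu0 : u = 0
    · exact Or.inl (by rw [hu0])
    · exact Or.inr (hreg u hu hu0)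
  · intro y hy hyn
    obtain ⟨u, hu, rfl⟩ := hd.exhaust y hy (by rw [lor_neg_right]; linarith)
    exact hreg' u hu
  · intro α β hα hβ hb
    obtain ⟨u, hu, he⟩ := honc α β hα hβ hb
    rw [he]
    exact hreg' u hu

/-- A planar cap together with room for triangles glued along its chord. -/
structure FlatCap (D : Set Vec) (w : ℝ → Vec) (a c : ℝ) (n : Vec) (R t0 T κ : ℝ) (v : Vec) (t : ℝ) :
    Prop where
  cap : Cap D w a c n
  outer : Outer D (w a) (w c) n 1 1 κ
  coord : ∀ u ∈ Ioo a c, ∃ α β γ : ℝ, w u = α • w a + β • w c + γ • n ∧ 0 < α ∧ 0 < β ∧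
      0 ≤ γ ∧ γ ≤ κ * α ∧ γ ≤ κ * β
  on_chord : ∀ α β : ℝ, 0 < α → 0 < β → α • w a + β • w c ∈ Bd D → ∃ u ∈ Ioo a c,
      α • w a + β • w c = w u
  apex : ∀ x y k, |x| ≤ R → |y| ≤ R → |x + y - 1| ≤ 1 / 4 → t0 ≤ k → k ≤ T →
        x • w a + y • w c + k • (-n) ∈ interior D
  ne : v ≠ 0
  plane : ∀ u ∈ Icc a c, lor (w u) v = t
  reg : ∀ u ∈ Ioo a c, Regular D (w u)

namespace FlatCap

variable {D : Set Vec} {w : ℝ → Vec} {a c : ℝ} {n : Vec} {R t0 T κ : ℝ} {v : Vec} {t : ℝ}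

theorem image (h : FlatCap D w a c n R t0 T κ v t) {A : Vec ≃ₗ[ℝ] Vec} (hA : IsLor A) :
    FlatCap (A '' D) (fun u => A (w u)) a c (A n) R t0 T κ (A v) t where
  cap := h.cap.image hA
  outer := fun α β γ hz hγ => by
    obtain ⟨z, hz, he⟩ := hz
    have : z = α • w a + β • w c + γ • n := A.injective (by rw [he]; simp)
    exact h.outer α β γ (this ▸ hz) hγ
  coord := fun u hu => by
    obtain ⟨α, β, γ, he, h1⟩ := h.coord u hu
    exact ⟨α, β, γ, by simp [he], h1⟩
  on_chord := fun α β hα hβ hb => by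
    have e : α • A (w a) + β • A (w c) = A (α • w a + β • w c) := by simp
    rw [e, mem_Bd_image hA] at hb
    obtain ⟨u, hu, he⟩ := h.on_chord α β hα hβ hb
    exact ⟨u, hu, by rw [e, he]⟩
  apex := fun x y k h1 h2 h3 h4 h5 => by
    have e : x • A (w a) + y • A (w c) + k • (-A n) = A (x • w a + y • w c + k • (-n)) := by simp
    rw [e]
    exact mem_interior_image.2 (h.apex x y k h1 h2 h3 h4 h5)
  ne := by simpa using h.ne
  plane := fun u hu => by rw [hA.lor_map, h.plane u hu]
  reg := fun u hu => (h.reg u hu).image hA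

theorem rev (h : FlatCap D w a c n R t0 T κ v t) :
    FlatCap D (fun u => w (-u)) (-c) (-a) n R t0 T κ v t where
  cap := h.cap.rev
  outer := fun α β γ hz hγ => by
    simp only [neg_neg] at hz
    exact (h.outer β α γ (by rwa [add_comm (β • _)]) hγ).symm
  coord := fun u hu => by
    obtain ⟨α, β, γ, he, h1, h2, h3, h4, h5⟩ := h.coord (-u)
      ⟨by linarith [hu.2], by linarith [hu.1]⟩
    exact ⟨β, α, γ, by simp only [neg_neg]; rw [he, add_comm (α • _)], h2, h1, h3, h5, h4⟩
  on_chord := fun α β hα hβ hb => by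
    simp only [neg_neg] at hb ⊢
    rw [add_comm] at hb
    obtain ⟨u, hu, he⟩ := h.on_chord β α hβ hα hb
    exact ⟨-u, ⟨by linarith [hu.2], by linarith [hu.1]⟩, by rw [neg_neg, add_comm, he]⟩
  apex := fun x y k h1 h2 h3 h4 h5 => by
    simp only [neg_neg]
    have := h.apex y x k h2 h1 (by rwa [add_comm y]) h4 h5
    rwa [add_comm (y • _)] at this
  ne := h.ne
  plane := fun u hu => h.plane _ ⟨by linarith [hu.2], by linarith [hu.1]⟩
  reg := fun u hu => h.reg _ ⟨by linarith [hu.2], by linarith [hu.1]⟩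

end FlatCap

/-- A cap with a corner, with both sides planar. -/
structure CornerCap (C : Set Vec) (z : ℝ → Vec) (p q : ℝ) (n : Vec) (R t0 T κ : ℝ) : Prop where
  cap : Cap C z (-p) q n
  p_pos : 0 < p
  q_pos : 0 < q
  κ_pos : 0 < κ
  t0_pos : 0 < t0
  inner : z (-p) + z q + κ • (-n) ∈ interior C
  outer : ∃ x y k, |x| ≤ R ∧ |y| ≤ R ∧ |x + y - 1| ≤ 1 / 4 ∧ t0 ≤ k ∧ k ≤ T ∧
    Outer C (z (-p)) (z q) n x y k
  up : ∀ u ∈ Ioo (-p) q, 0 < lor (z u) n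
  hd1 : lor (z 0) (z (-p)) ≠ lor (z 0) (z q)
  hd2 : lor (z 0) (z (-p)) ≠ lor (z (-p)) (z q)
  hd3 : lor (z 0) (z q) ≠ lor (z (-p)) (z q)
  planes : ∃ v1 t1 v2 t2, v1 ≠ 0 ∧ v2 ≠ 0 ∧ (∀ u ∈ Ioo (-p) 0, lor (z u) v1 = t1) ∧
    (∀ u ∈ Ioo 0 q, lor (z u) v2 = t2) ∧ lor (z (-p)) v2 ≠ t2 ∧ lor (z q) v1 ≠ t1
  reg : ∀ u ∈ Ioo (-p) q, u ≠ 0 → Regular C (z u)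
  irr : ¬ Regular C (z 0)

theorem CornerCap.rigid {C D : Set Vec} {z w : ℝ → Vec} {p q a c R t0 T κ t3 : ℝ}
    {n v3 : Vec} (hc : CornerCap C z p q n R t0 T κ) (hd : FlatCap D w a c (-n) R t0 T κ v3 t3)
    (hwa : w a = z (-p)) (hwc : w c = z q) : (interior (C ∩ D)).Nonempty ∧
      ∀ A : Vec ≃ₗ[ℝ] Vec, IsLor A → A '' (C ∩ D) = C ∩ D → A = LinearEquiv.refl ℝ Vec := by
  obtain ⟨x, y, k, hx, hy, hxy, h1, h2, ho⟩ := hc.outer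
  obtain ⟨v1, t1, v2, t2, hv1, hv2, p1, p2, p3, p4⟩ := hc.planes
  have hk := hc.t0_pos.trans_le h1
  have hapex := hd.apex x y k hx hy hxy h1 h2
  rw [neg_neg, hwa, hwc] at hapex
  have h0 : (0:ℝ) ∈ Ioo (-p) q := ⟨by linarith [hc.p_pos], hc.q_pos⟩
  constructor
  · have hE := hc.cap.bd 0 (Ioo_subset_Icc_self h0)
    refine inter_int_nonempty hc.cap.body hE.2.1
      (ho.mem_int hc.cap.frame hd.cap.body ?_ ?_ hk hapex hE.2.1 (hc.up 0 h0))
    · rw [← hwa]; exact (hd.cap.bd a ⟨le_rfl, hd.cap.lt.le⟩).2.1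
    · rw [← hwc]; exact (hd.cap.bd c ⟨hd.cap.lt.le, le_rfl⟩).2.1
  · intro A hA hAM
    have k1 := hd.outer
    have k2 := hd.coord
    have k3 := hd.on_chord
    rw [hwa, hwc] at k1 k2 k3
    exact corner_rigid hc.cap hc.p_pos hc.q_pos hd.cap hwa hwc hk ho hapex hc.κ_pos k1 hc.inner k2
      k3 hc.up hc.hd1 hc.hd2 hc.hd3 hv1 hv2 hd.ne p1 p2 hd.plane p3 p4 hc.reg hd.reg hc.irr hA hAM

theorem CornerCap.absurd {C D : Set Vec} {z w : ℝ → Vec} {p q a c R t0 T κ t3 : ℝ}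
    {n n' v3 : Vec} (hc : CornerCap C z p q n R t0 T κ) (hd : FlatCap D w a c n' R t0 T κ v3 t3)
    (hs : lor (w a) (w c) = lor (z (-p)) (z q)) (hcd : LinCond C D) : False := by
  have hf := hd.cap.frame
  rw [hs] at hf
  obtain ⟨G, hG, hn, hPQ, hsym⟩ := hcd _ _ _ _ _ _ _ hc.cap.frame hf
  have h1 := hd.image hG
  rw [hn] at h1
  have key : (interior (C ∩ G '' D)).Nonempty ∧
      ∀ A : Vec ≃ₗ[ℝ] Vec, IsLor A → A '' (C ∩ G '' D) = C ∩ G '' D →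
        A = LinearEquiv.refl ℝ Vec := by
    rcases hPQ with ⟨hP, hQ⟩ | ⟨hP, hQ⟩
    · exact hc.rigid h1 hP hQ
    · exact hc.rigid h1.rev (by simpa using hQ) (by simpa using hP)
  obtain ⟨A, hA, hne, hAM⟩ := hsym key.1
  exact hne (key.2 A hA hAM)

section

variable {C : Set Vec} {E e1 e2 : Vec} {r M b : ℝ} {φ : ℝ → ℝ}

theorem bpt_neg (u : ℝ) : bpt E (-e1) e2 (fun u => φ (-u)) u = bpt E e1 e2 φ (-u) := by
  simp only [bpt, chart_neg]

theorem Chart.bpt_zero (h : Chart C E e1 e2 r M b φ) : bpt E e1 e2 φ 0 = E := by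
  have : BallChar.chart E e1 e2 0 (φ 0) = E := by simp [BallChar.chart, h.zero]
  rw [bpt, this]
  exact nrm_of_hyp h.frame.hE

/-- On a small interval the chart parametrizes boundary points. -/
theorem Chart.exists_small (hC : IsBody C) (h : Chart C E e1 e2 r M b φ) : ∃ ρ, 0 < ρ ∧ ρ < r ∧
    ∀ u, |u| ≤ ρ → φ u < b ∧ u ^ 2 + φ u ^ 2 < 1 ∧ bpt E e1 e2 φ u ∈ Bd C := by
  have hM := h.M_pos
  obtain ⟨ρ, ⟨⟨h1, h2⟩, h3⟩, h4⟩ := (((eventually_mul_le (4 * M + 4) h.b_pos).and (eventually_mul_le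
    (4 * M + 4) (by norm_num : (0:ℝ) < 1 / 10))).and (eventually_mul_le 2 h.r_pos)).and
    self_mem_nhdsWithin |>.exists
  have h4 : 0 < ρ := h4
  have hr : ρ ≤ r := by linarith
  refine ⟨ρ, h4, by linarith, fun u hu => ?_⟩
  have hb : φ u < b := by
    have := abs_le.1 (h.abs_bound le_rfl hr hu)
    nlinarith [this.2]
  have := h.small le_rfl hr (by linarith) hu
  exact ⟨hb, by linarith, h.bpt_mem_Bd hC (abs_le.1 (hu.trans hr)) hb.le⟩

/-- At a corner, the plane of the left arc does not contain points of the right arc. -/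
theorem Chart.corner_right (hC : IsBody C) (h : Chart C E e1 e2 r M b φ) {r1 r2 t1 t2 : ℝ}
    {v1 v2 : Vec} (hr1 : 0 < r1) (hr2 : 0 < r2) (hr1r : r1 ≤ r) (hr2r : r2 ≤ r) (hv1 : v1 ≠ 0)
    (hv2 : v2 ≠ 0)
    (h1 : ∀ u ∈ Icc (-r1) 0, lor (bpt E e1 e2 φ u) v1 = t1)
    (h2 : ∀ u ∈ Icc 0 r2, lor (bpt E e1 e2 φ u) v2 = t2) (hir : ¬ Regular C E) :
    ∃ ρ > 0, ∀ u ∈ Ioc 0 ρ, lor (bpt E e1 e2 φ u) v1 ≠ t1 := by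
  by_contra hcon
  push Not at hcon
  obtain ⟨ρ, hρ, hρr, hs⟩ := h.exists_small hC
  obtain ⟨u, hu, e1u⟩ := hcon (min ρ r2) (lt_min hρ hr2)
  obtain ⟨u', hu', e2u⟩ := hcon (u / 2) (by linarith [hu.1])
  have b1 : u ≤ ρ := hu.2.trans (min_le_left _ _)
  have b2 : u ≤ r2 := hu.2.trans (min_le_right _ _)
  have hlt : u' < u := by linarith [hu'.2, hu.1]
  have s0 := hs 0 (by simpa using hρ.le)
  have s1 := hs u (by rw [abs_of_pos hu.1]; exact b1)
  have s2 := hs u' (by rw [abs_of_pos hu'.1]; linarith)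
  obtain ⟨c, hc1, hc2⟩ := plane_unique (v' := v1) (t' := t1) s0.2.2.1 s2.2.2.1 s1.2.2.1
    (fun he => hu'.1.ne (h.frame.bpt_inj s0.2.1 s2.2.1 he))
    (fun he => hlt.ne (h.frame.bpt_inj s2.2.1 s1.2.1 he))
    (fun he => hu.1.ne (h.frame.bpt_inj s0.2.1 s1.2.1 he)) hv2
    (h2 0 ⟨le_rfl, hr2.le⟩) (h2 u' ⟨hu'.1.le, by linarith⟩) (h2 u ⟨hu.1.le, b2⟩)
    (h1 0 ⟨by linarith, le_rfl⟩) e2u e1u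
  have hc : c ≠ 0 := by rintro rfl; exact hv1 (by simpa using hc1)
  apply hir
  rw [← h.bpt_zero]
  refine h.regular hC (neg_le_neg hr1r) hr2r (neg_lt_zero.2 hr1) hr2 s0.1 s0.2.1 hv2 (t := t2)
    fun x hx => ?_
  rcases le_total x 0 with hx0 | hx0
  · have := h1 x ⟨hx.1.le, hx0⟩
    rw [hc1, hc2, lor_smul_right] at this
    exact mul_left_cancel₀ hc this
  · exact h2 x ⟨hx0, hx.2.le⟩

end

section

variable {C : Set Vec} {E e1 e2 : Vec} {r M b : ℝ} {φ : ℝ → ℝ}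

theorem Chart.exists_flatCap (hC : IsBody C) (h : Chart C E e1 e2 r M b φ) {R T t0 κ r3 t3 : ℝ}
    {v3 : Vec} (hR : 0 < R) (ht0 : 0 < t0) (hT : 0 < T) (hκ : 0 < κ) (hr3 : 0 < r3) (hr3r : r3 ≤ r)
    (hv3 : v3 ≠ 0) (h3 : ∀ u ∈ Icc 0 r3, lor (bpt E e1 e2 φ u) v3 = t3) :
    ∃ s1 > 1, ∀ s ∈ Ioc 1 s1, ∃ (a c : ℝ) (n : Vec), lor (bpt E e1 e2 φ a) (bpt E e1 e2 φ c) = -s ∧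
      FlatCap C (bpt E e1 e2 φ) a c n R (t0 * Real.sqrt (s ^ 2 - 1)) (T * Real.sqrt (s ^ 2 - 1))
        (κ * Real.sqrt (s ^ 2 - 1)) v3 t3 := by
  obtain ⟨B, ρ, a, d, ha, hd, had, hρ, H⟩ := h.exists_caps hC hR ht0 hT hκ (half_pos hr3)
  have hl := (H (a + d) ⟨by linarith, le_rfl⟩).1
  have hcap := hl.cap hρ
  refine ⟨_, hcap.frame.hs, fun s hs => ?_⟩
  have hself : -lor (bpt E e1 e2 φ a) (bpt E e1 e2 φ a) = 1 := by
    have := (hcap.bd a ⟨le_rfl, hcap.lt.le⟩).1.1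
    linarith
  have hcont : ContinuousOn (fun u => -lor (bpt E e1 e2 φ a) (bpt E e1 e2 φ u)) (Icc a (a + d)) :=
    (continuousOn_lor_comp continuousOn_const hcap.cont).neg
  obtain ⟨c, hc, hcs⟩ := intermediate_value_Icc (by linarith) hcont
    (show s ∈ Icc _ _ from ⟨by rw [hself]; exact hs.1.le, hs.2⟩)
  simp only at hcs
  have hac : a < c := by
    refine lt_of_le_of_ne hc.1 ?_
    rintro rfl
    rw [hself] at hcs
    exact hs.1.ne hcs
  obtain ⟨hch, ho, hap⟩ := H c ⟨hac, hc.2⟩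
  rw [hcs] at ho hap
  have hS : 0 < Real.sqrt (s ^ 2 - 1) := Real.sqrt_pos.2 (by nlinarith [hs.1])
  have hκS := mul_pos hκ hS
  refine ⟨a, c, _, by linarith, hch.cap hρ, ho, fun u hu => hch.arc_coords hρ hκS ho hu,
    fun α β hα hβ hb => hch.on_chord hα hβ hb, fun x y k hx hy hxy h1 h2 => ?_, hv3,
    fun u hu => h3 u ⟨by linarith [hu.1], by linarith [hu.2, hc.2]⟩, fun u hu => ?_⟩
  · have := hap x y (k / Real.sqrt (s ^ 2 - 1)) hx hy hxy (by rwa [le_div_iff₀ hS])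
      (by rwa [div_le_iff₀ hS])
    rwa [div_mul_cancel₀ _ hS.ne'] at this
  · have h0 : |u| ≤ ρ := abs_le.2 ⟨(abs_le.1 hch.abs1).1.trans hu.1.le,
      hu.2.le.trans (abs_le.1 hch.abs2).2⟩
    have h1 := abs_le.1 (h.abs_bound hch.MB hch.ρr h0)
    have h2 := h.small hch.MB hch.ρr hch.ρs h0
    refine h.regular hC (by linarith [h.r_pos] : -r ≤ 0) hr3r (by linarith [hu.1])
      (by linarith [hu.2, hc.2]) (by linarith [hch.Bρ.1, h.b_pos]) (by linarith) hv3
      fun x hx => h3 x (Ioo_subset_Icc_self hx)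

end

section

variable {C : Set Vec} {E e1 e2 : Vec} {r M b : ℝ} {φ : ℝ → ℝ}

theorem Chart.exists_slopes (h : Chart C E e1 e2 r M b φ) :
    ∃ r0 > 0, r0 ≤ r ∧ Slopes φ (-r0) r0 (-(M + 1)) (M + 1) := by
  obtain ⟨m, r', hr', hr'r, hm, H⟩ := h.slopes one_pos
  obtain ⟨m', r'', hr'', hr''r, hm', H'⟩ := h.neg.slopes one_pos
  have hm := abs_le.1 hm
  have hm' := abs_le.1 hm'
  have s1 : Slopes φ 0 r' m (m + 1) := H
  have s2 : Slopes φ (-r'') 0 (-(m' + 1)) (-m') := fun u v h1 h2 h3 => by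
    have := H' (-v) (-u) (by linarith) (by linarith) (by linarith)
    simp only [neg_neg] at this
    exact ⟨by linarith [this.2], by linarith [this.1]⟩
  have s1 := s1.weaken (lo' := -(M + 1)) (hi' := M + 1) (by linarith) (by linarith)
  have s2 := s2.weaken (lo' := -(M + 1)) (hi' := M + 1) (by linarith) (by linarith)
  exact ⟨min r' r'', lt_min hr' hr'', (min_le_left _ _).trans hr'r,
    (s2.join s1).mono (neg_le_neg (min_le_right _ _)) (min_le_left _ _)⟩

theorem hyp_smul_eq {P Q : Vec} {c : ℝ} (hP : P ∈ Hyp) (hQ : Q ∈ Hyp) (h : Q = c • P) : P = Q := by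
  have h1 := hP.1
  have h2 := hQ.1
  have h3 := hP.2
  have h4 := hQ.2
  rw [h] at h2 h4
  rw [lor_smul_left, lor_smul_right, h1] at h2
  have h5 : 0 < c := pos_of_mul_pos_left (by simpa using h4) h3.le
  have : c = 1 := by nlinarith
  rw [h, this, one_smul]

/-- Chords around the base point whose end points are at generic distances. -/
theorem Chart.exists_generic (h : Chart C E e1 e2 r M b φ) {ρ : ℝ} (hρ : 0 < ρ)
    (hρr : ρ < r) (hs : ∀ u, |u| ≤ ρ → φ u < b ∧ u ^ 2 + φ u ^ 2 < 1 ∧ bpt E e1 e2 φ u ∈ Bd C) :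
    ∃ p ∈ Ioc 0 ρ, ∃ q ∈ Ioc 0 ρ,
      lor (bpt E e1 e2 φ 0) (bpt E e1 e2 φ (-p)) ≠ lor (bpt E e1 e2 φ 0) (bpt E e1 e2 φ q) ∧
      lor (bpt E e1 e2 φ 0) (bpt E e1 e2 φ (-p)) ≠ lor (bpt E e1 e2 φ (-p)) (bpt E e1 e2 φ q) ∧
      lor (bpt E e1 e2 φ 0) (bpt E e1 e2 φ q) ≠ lor (bpt E e1 e2 φ (-p)) (bpt E e1 e2 φ q) := by
  have hinj : ∀ u v, |u| ≤ ρ → |v| ≤ ρ → u ≠ v → bpt E e1 e2 φ u ≠ bpt E e1 e2 φ v :=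
    fun u v hu hv hne he => hne (h.frame.bpt_inj (hs u hu).2.1 (hs v hv).2.1 he)
  have hH : ∀ u, |u| ≤ ρ → bpt E e1 e2 φ u ∈ Hyp := fun u hu => (hs u hu).2.2.1
  have h00 : |(0:ℝ)| ≤ ρ := by simpa using hρ.le
  have hcont : ContinuousOn (bpt E e1 e2 φ) (Icc (-ρ) ρ) :=
    h.continuousOn_bpt (fun u hu => ⟨by linarith [hu.1], by linarith [hu.2]⟩)
      fun u hu => (hs u (abs_le.2 hu)).2.1
  have hc0 : ContinuousAt (bpt E e1 e2 φ) 0 :=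
    hcont.continuousAt (Icc_mem_nhds (by linarith) hρ)
  have hneg : Tendsto (fun p : ℝ => -p) (nhdsWithin 0 (Ioi 0)) (nhds 0) := by
    have := (continuous_neg (G := ℝ)).tendsto 0
    rw [neg_zero] at this
    exact this.mono_left nhdsWithin_le_nhds
  have hP := hc0.tendsto.comp hneg
  have hlor : ∀ a b : Vec, Continuous (fun x : Vec => lor a x) := fun a b =>
    continuous_lor_comp continuous_const continuous_id
  have hsm : ∀ q, 0 < q → q ≤ ρ → ∀ᶠ p : ℝ in nhdsWithin 0 (Ioi 0), p ∈ Ioc 0 ρ ∧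
      lor (bpt E e1 e2 φ 0) (bpt E e1 e2 φ (-p)) ≠ lor (bpt E e1 e2 φ 0) (bpt E e1 e2 φ q) ∧
      lor (bpt E e1 e2 φ 0) (bpt E e1 e2 φ (-p)) ≠
        lor (bpt E e1 e2 φ (-p)) (bpt E e1 e2 φ q) := by
    intro q hq hqρ
    have hqa : |q| ≤ ρ := by rwa [abs_of_pos hq]
    have hne := hinj 0 q h00 hqa hq.ne
    have hEQ : lor (bpt E e1 e2 φ 0) (bpt E e1 e2 φ 0) ≠ lor (bpt E e1 e2 φ 0) (bpt E e1 e2 φ q) := by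
      rw [(hH 0 h00).1]
      exact fun he => hne (hyp_lor_eq (hH 0 h00) (hH q hqa) he.symm)
    have l1 : Tendsto (fun p => lor (bpt E e1 e2 φ 0) (bpt E e1 e2 φ (-p))) (nhdsWithin 0 (Ioi 0))
        (nhds (lor (bpt E e1 e2 φ 0) (bpt E e1 e2 φ 0))) :=
      ((hlor _ 0).tendsto _).comp hP
    have l2 : Tendsto (fun p => lor (bpt E e1 e2 φ (-p)) (bpt E e1 e2 φ q)) (nhdsWithin 0 (Ioi 0))
        (nhds (lor (bpt E e1 e2 φ 0) (bpt E e1 e2 φ q))) := by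
      simp only [lor_comm _ (bpt E e1 e2 φ q)]
      exact ((hlor _ 0).tendsto _).comp hP
    have k1 : ∀ᶠ p : ℝ in nhdsWithin 0 (Ioi 0), p ∈ Ioc 0 ρ :=
      mem_of_superset (Ioo_mem_nhdsGT hρ) Ioo_subset_Ioc_self
    have k2 := l1.eventually (isOpen_ne.mem_nhds hEQ)
    have k3 := (l1.sub l2).eventually (isOpen_ne.mem_nhds (sub_ne_zero.2 hEQ))
    filter_upwards [k1, k2, k3] with p p1 p2 p3
    exact ⟨p1, p2, sub_ne_zero.1 p3⟩
  have key : ∃ q, 0 < q ∧ q ≤ ρ ∧ ∃ᶠ p : ℝ in nhdsWithin 0 (Ioi 0),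
      lor (bpt E e1 e2 φ 0) (bpt E e1 e2 φ q) ≠ lor (bpt E e1 e2 φ (-p)) (bpt E e1 e2 φ q) := by
    by_contra hcon
    push Not at hcon
    have a1 := hcon (ρ / 2) (by linarith) (by linarith)
    have a2 := hcon ρ hρ le_rfl
    have k1 : ∀ ε > 0, ∀ᶠ p : ℝ in nhdsWithin 0 (Ioi 0), p ∈ Ioo 0 ε := fun ε hε =>
      Ioo_mem_nhdsGT hε
    obtain ⟨p, ⟨p1, p2⟩, p3⟩ := ((a1.and a2).and (k1 ρ hρ)).exists
    obtain ⟨p', ⟨p1', p2'⟩, p3'⟩ := ((a1.and a2).and (k1 p p3.1)).exists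
    have i1 : |-p| ≤ ρ := by rw [abs_neg, abs_of_pos p3.1]; exact p3.2.le
    have i2 : |-p'| ≤ ρ := by rw [abs_neg, abs_of_pos p3'.1]; linarith [p3.2, p3'.2]
    have i3 : |ρ / 2| ≤ ρ := by rw [abs_of_pos (by linarith)]; linarith
    have i4 : |ρ| ≤ ρ := by rw [abs_of_pos hρ]
    have hQ := hH _ i3
    obtain ⟨c, hc, -⟩ := plane_unique (hH 0 h00) (hH _ i2) (hH _ i1)
      (hinj _ _ h00 i2 (by linarith [p3'.1])) (hinj _ _ i2 i1 (by linarith [p3'.2]))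
      (hinj _ _ h00 i1 (by linarith [p3.1]))
      (by intro h0; have := hQ.2; rw [h0] at this; simp at this) rfl p1'.symm p1.symm rfl p2'.symm
      p2.symm
    exact hinj _ _ i3 i4 (by linarith) (hyp_smul_eq hQ (hH _ i4) hc)
  obtain ⟨q, hq, hqρ, hf⟩ := key
  obtain ⟨p, h1, h2, h3, h4⟩ := (hf.and_eventually (hsm q hq hqρ)).exists
  exact ⟨p, h2, q, ⟨hq, hqρ⟩, h3, h4, h1⟩

end

section

variable {C : Set Vec} {E e1 e2 : Vec} {r M b : ℝ} {φ : ℝ → ℝ}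

theorem Chart.exists_close (h : Chart C E e1 e2 r M b φ) {s1 : ℝ} (hs1 : 1 < s1) :
    ∃ ρ > 0, ∀ p ∈ Ioc 0 ρ, ∀ q ∈ Ioc 0 ρ,
      -lor (bpt E e1 e2 φ (-p)) (bpt E e1 e2 φ q) ≤ s1 := by
  obtain ⟨ρ, ⟨h1, h2⟩, h4⟩ := ((eventually_mul_le (4 * M + 4) (by norm_num : (0:ℝ) < 1 / 10)).and
    (eventually_mul_le 2 h.r_pos)).and self_mem_nhdsWithin |>.exists
  have h4 : 0 < ρ := h4
  have hr := h.r_pos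
  have hcont : ContinuousOn (bpt E e1 e2 φ) (Icc (-ρ) ρ) :=
    h.continuousOn_bpt (fun u hu => ⟨by linarith [hu.1], by linarith [hu.2]⟩)
      fun u hu => by
        linarith [h.small le_rfl (by linarith : ρ ≤ r) (by linarith) (abs_le.2 hu)]
  have hc0 : ContinuousAt (bpt E e1 e2 φ) 0 :=
    hcont.continuousAt (Icc_mem_nhds (by linarith) h4)
  have hc : Continuous fun x : Vec × Vec => -lor x.1 x.2 :=
    (continuous_lor_comp continuous_fst continuous_snd).neg
  have hE : -lor (bpt E e1 e2 φ 0) (bpt E e1 e2 φ 0) < s1 := by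
    rw [h.bpt_zero, h.frame.hE.1]; linarith
  have h5 : {x : Vec × Vec | -lor x.1 x.2 < s1} ∈ nhds (bpt E e1 e2 φ 0, bpt E e1 e2 φ 0) :=
    (isOpen_lt hc continuous_const).mem_nhds hE
  rw [nhds_prod_eq, mem_prod_same_iff] at h5
  obtain ⟨U, hU, h6⟩ := h5
  obtain ⟨ε, hε, h7⟩ := Metric.mem_nhds_iff.1 (hc0.preimage_mem_nhds hU)
  refine ⟨ε / 2, by positivity, fun p hp q hq => (h6 (mk_mem_prod (h7 ?_) (h7 ?_)) : _ < _).le⟩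
  · rw [Metric.mem_ball, Real.dist_eq, sub_zero, abs_neg, abs_of_pos hp.1]; linarith [hp.2]
  · rw [Metric.mem_ball, Real.dist_eq, sub_zero, abs_of_pos hq.1]; linarith [hq.2]

theorem Chord.up_of_irregular {B ρ u0 u1 u2 m k : ℝ} (h : Chord C E e1 e2 r M b φ B ρ u1 u2 m k)
    (h0 : u0 ∈ Ioo u1 u2) (hir : ¬ Regular C (bpt E e1 e2 φ u0)) {u : ℝ} (hu : u ∈ Ioo u1 u2) :
    0 < lor (bpt E e1 e2 φ u) (lineNormal E e1 e2 m k) := by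
  have hs : ∀ x ∈ Ioo u1 u2, |x| ≤ ρ := fun x hx => abs_le.2
    ⟨(abs_le.1 h.abs1).1.trans hx.1.le, hx.2.le.trans (abs_le.1 h.abs2).2⟩
  have hsm : ∀ x ∈ Ioo u1 u2, x ^ 2 + φ x ^ 2 < 1 := fun x hx => by
    linarith [h.chart.small h.MB h.ρr h.ρs (hs x hx)]
  have hlt : φ u0 < m * u0 + k := by
    by_contra hcon
    have hz : ∀ x ∈ Ioo u1 u2, lor (bpt E e1 e2 φ x) (lineNormal E e1 e2 m k) = 0 := fun x hx => by
      have : φ x = m * x + k := le_antisymm (h.le_line (Ioo_subset_Icc_self hx))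
        (not_lt.1 fun hc => hcon (h.lt_line hx h0 hc))
      rw [h.lor_bpt_normal, this, sub_self, zero_div, mul_zero]
    have hb := (abs_le.1 (h.chart.abs_bound h.MB h.ρr (hs u0 h0))).2
    refine hir (h.chart.regular h.body h.mem1.1 h.mem2.2 h0.1 h0.2
      (by linarith [h.Bρ.1, h.chart.b_pos]) (hsm u0 h0) ?_ hz)
    intro hn
    have := h.cframe.hn
    rw [hn] at this
    simp at this
  rw [h.lor_bpt_normal]
  have h1 := hgt_pos (hsm u hu)
  have h2 := h.W_pos
  have h3 := h.lt_line h0 hu hlt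
  have : 0 < m * u + k - φ u := by linarith
  positivity

theorem Chart.exists_cornerCap (hC : IsBody C) (h : Chart C E e1 e2 r M b φ) {r1 r2 t1 t2 s1 : ℝ}
    {v1 v2 : Vec} (hr1 : 0 < r1) (hr2 : 0 < r2) (hr1r : r1 ≤ r) (hr2r : r2 ≤ r) (hv1 : v1 ≠ 0)
    (hv2 : v2 ≠ 0) (h1 : ∀ u ∈ Icc (-r1) 0, lor (bpt E e1 e2 φ u) v1 = t1)
    (h2 : ∀ u ∈ Icc 0 r2, lor (bpt E e1 e2 φ u) v2 = t2) (hir : ¬ Regular C E) {B : ℝ}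
    (hB : B = M + 1) (hs1 : 1 < s1) :
    ∃ s ∈ Ioc 1 s1, ∃ (p q : ℝ) (n : Vec), lor (bpt E e1 e2 φ (-p)) (bpt E e1 e2 φ q) = -s ∧
      CornerCap C (bpt E e1 e2 φ) p q n (1 + 2 * B * (B + 1))
        (B / (2 * (1 + B ^ 2)) * Real.sqrt (s ^ 2 - 1)) (2 * B * Real.sqrt (s ^ 2 - 1))
        (1 / (2 * (B + 1)) * Real.sqrt (s ^ 2 - 1)) := by
  have hB0 : 0 < B := by linarith [h.M_pos]
  have hir0 : ¬ Regular C (bpt E e1 e2 φ 0) := by rwa [h.bpt_zero]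
  obtain ⟨ρa, hρa, hρar, ha⟩ := h.exists_small hC
  obtain ⟨ρb, hρb, hb⟩ := h.corner_right hC hr1 hr2 hr1r hr2r hv1 hv2 h1 h2 hir
  obtain ⟨ρc, hρc, hc⟩ := h.neg.corner_right hC hr2 hr1 hr2r hr1r hv2 hv1 (t1 := t2) (t2 := t1)
    (fun u hu => by rw [bpt_neg]; exact h2 _ ⟨by linarith [hu.2], by linarith [hu.1]⟩)
    (fun u hu => by rw [bpt_neg]; exact h1 _ ⟨by linarith [hu.2], by linarith [hu.1]⟩) hir
  obtain ⟨ρd, hρd, hd⟩ := h.exists_close hs1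
  obtain ⟨ρe, hρe, hρer, he⟩ := h.exists_slopes
  obtain ⟨ρ, hρ0, f1, f2, f3, f4, f5, f6, f7, f8, f9⟩ : ∃ ρ : ℝ, 0 < ρ ∧ ρ ≤ ρa ∧ ρ ≤ ρb ∧ ρ ≤ ρc ∧
      ρ ≤ ρd ∧ ρ ≤ ρe ∧ ρ ≤ r1 ∧ ρ ≤ r2 ∧ (ρ * (4 * B + 4) ≤ b ∧ ρ * (4 * B + 4) ≤ 1 / 10) ∧
      4 * ((1 + 2 * B * (B + 1)) * ((1 + B ^ 2) * ρ ^ 2)) ≤ 1 / 4 := by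
    obtain ⟨ρ, h1, h2, h3, h4, h5, h6, h7, h8, h9, h10, h11⟩ := ((eventually_mul_le 1 hρa).and
      ((eventually_mul_le 1 hρb).and ((eventually_mul_le 1 hρc).and ((eventually_mul_le 1 hρd).and
      ((eventually_mul_le 1 hρe).and ((eventually_mul_le 1 hr1).and ((eventually_mul_le 1 hr2).and
      ((eventually_mul_le (4 * B + 4) h.b_pos).and ((eventually_mul_le (4 * B + 4)
      (by norm_num : (0:ℝ) < 1 / 10)).and ((eventually_mul_le
      (4 * ((1 + 2 * B * (B + 1)) * (1 + B ^ 2))) (by norm_num : (0:ℝ) < 1 / 4)).and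
      self_mem_nhdsWithin)))))))))).exists
    have h11 : 0 < ρ := h11
    refine ⟨ρ, h11, by linarith, by linarith, by linarith, by linarith, by linarith, by linarith,
      by linarith, ⟨by linarith, by linarith⟩, ?_⟩
    have hρ1 : ρ ≤ 1 := by nlinarith
    calc 4 * ((1 + 2 * B * (B + 1)) * ((1 + B ^ 2) * ρ ^ 2))
        = 4 * ((1 + 2 * B * (B + 1)) * (1 + B ^ 2)) * ρ * ρ := by ring
      _ ≤ 4 * ((1 + 2 * B * (B + 1)) * (1 + B ^ 2)) * ρ * 1 := by gcongr
      _ ≤ 1 / 4 := by linarith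
  obtain ⟨p, hp, q, hq, d1, d2, d3⟩ := h.exists_generic hρ0 (f1.trans_lt hρar)
    fun u hu => ha u (hu.trans f1)
  have hsl : Slopes φ (-p) q (-B) B := by
    rw [hB]; exact he.mono (by linarith [hp.2]) (by linarith [hq.2])
  have hch := h.mkChord hC (by linarith [hp.1, hq.1] : -p < q)
    (by rw [abs_neg, abs_of_pos hp.1]; exact hp.2) (by rw [abs_of_pos hq.1]; exact hq.2)
    (by linarith) (by linarith : M ≤ B) f8.1 f8.2 hsl le_rfl le_rfl
  have hcap := hch.cap (f1.trans_lt hρar)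
  have hs : 1 < -lor (bpt E e1 e2 φ (-p)) (bpt E e1 e2 φ q) := hcap.frame.hs
  have hS : 0 < Real.sqrt ((-lor (bpt E e1 e2 φ (-p)) (bpt E e1 e2 φ q)) ^ 2 - 1) :=
    Real.sqrt_pos.2 (by nlinarith)
  refine ⟨_, ⟨hs, hd p ⟨hp.1, hp.2.trans f4⟩ q ⟨hq.1, hq.2.trans f4⟩⟩, p, q, _, by ring,
    hcap, hp.1, hq.1, by positivity, by positivity, hch.inner (by positivity) (by field_simp; rfl), ?_,
    fun u hu => hch.up_of_irregular (u0 := 0) ⟨by linarith [hp.1], hq.1⟩ hir0 hu, d1, d2, d3,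
    ⟨v1, t1, v2, t2, hv1, hv2, fun u hu => h1 u ⟨by linarith [hu.1, hp.2], hu.2.le⟩,
      fun u hu => h2 u ⟨hu.1.le, by linarith [hu.2, hq.2]⟩, ?_, hb q ⟨hq.1, hq.2.trans f2⟩⟩, ?_, hir0⟩
  · obtain ⟨x, y, t, hx, hy, hxy, k1, k2, ho⟩ := hch.outer_shape hsl f9
    exact ⟨x, y, _, hx, hy, hxy, mul_le_mul_of_nonneg_right k1 hS.le,
      mul_le_mul_of_nonneg_right k2 hS.le, ho⟩
  · have := hc p ⟨hp.1, hp.2.trans f3⟩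
    rwa [bpt_neg] at this
  · intro u hu hne
    have hau : |u| ≤ ρ := abs_le.2 ⟨by linarith [hu.1, hp.2], by linarith [hu.2, hq.2]⟩
    have hu' := ha u (hau.trans f1)
    rcases lt_or_gt_of_ne hne with hlt | hgt
    · exact h.regular hC (neg_le_neg hr1r) h.r_pos.le (by linarith [hu.1, hp.2]) hlt hu'.1 hu'.2.1 hv1
        fun x hx => h1 x (Ioo_subset_Icc_self hx)
    · exact h.regular hC (by linarith [h.r_pos]) hr2r hgt (by linarith [hu.2, hq.2]) hu'.1 hu'.2.1 hv2
        fun x hx => h2 x (Ioo_subset_Icc_self hx)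

end

/-- All boundary points are regular. -/
theorem all_regular {C D : Set Vec} (hC : IsBody C) (hD : IsBody D) (hCn : (Bd C).Nonempty)
    (hDn : (Bd D).Nonempty) (hcd : LinCond C D) (hdc : LinCond D C) :
    ∀ E ∈ Bd C, Regular C E := by
  intro E hE
  by_contra hir
  obtain ⟨e1, e2, r, M, b, φ, h⟩ := exists_Chart hC hE
  obtain ⟨r2, hr2, hr2r, v2, t2, hv2, h2⟩ := h.exists_planar hC hD hDn hcd
  obtain ⟨r1, hr1, hr1r, v1, t1, hv1, h1⟩ := h.neg.exists_planar hC hD hDn hcd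
  obtain ⟨E', hE'⟩ := hDn
  obtain ⟨e1', e2', r', M', b', φ', h'⟩ := exists_Chart hD hE'
  obtain ⟨r3, hr3, hr3r, v3, t3, hv3, h3⟩ := h'.exists_planar hD hC hCn hdc
  obtain ⟨B, hB⟩ : ∃ B, B = M + 1 := ⟨_, rfl⟩
  have hB0 : 0 < B := by linarith [h.M_pos]
  obtain ⟨s1, hs1, H⟩ := h'.exists_flatCap hD (R := 1 + 2 * B * (B + 1)) (T := 2 * B)
    (t0 := B / (2 * (1 + B ^ 2))) (κ := 1 / (2 * (B + 1))) (by positivity) (by positivity)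
    (by positivity) (by positivity) hr3 hr3r hv3 h3
  obtain ⟨s, hs, p, q, n, hpq, hcc⟩ := h.exists_cornerCap hC hr1 hr2 hr1r hr2r hv1 hv2 (t1 := t1)
    (fun u hu => by
      have := h1 (-u) ⟨by linarith [hu.2], by linarith [hu.1]⟩
      rwa [bpt_neg, neg_neg] at this) h2 hir hB hs1
  obtain ⟨a, c, n', hac, hfc⟩ := H s hs
  exact hcc.absurd hfc (by rw [hac, hpq]) hcd

/-! ### Bodies with everywhere regular boundary -/

theorem infinite_plane_unique {S : Set Vec} {v v' : Vec} {t t' : ℝ} (hS : S.Infinite)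
    (hSH : S ⊆ Hyp) (hv : v ≠ 0) (h : ∀ y ∈ S, lor y v = t) (h' : ∀ y ∈ S, lor y v' = t') :
    ∃ c : ℝ, v' = c • v ∧ t' = c * t := by
  obtain ⟨T, hTS, hT⟩ := hS.exists_subset_card_eq 3
  obtain ⟨x, y, w, hxy, hxw, hyw, rfl⟩ := Finset.card_eq_three.1 hT
  have hx : x ∈ S := hTS (by simp)
  have hy : y ∈ S := hTS (by simp)
  have hw : w ∈ S := hTS (by simp)
  exact plane_unique (hSH hx) (hSH hy) (hSH hw) hxy hyw hxw hv (h x hx) (h y hy) (h w hw)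
    (h' x hx) (h' y hy) (h' w hw)

theorem Bd_nhds_infinite {C U : Set Vec} {E : Vec} (hC : IsBody C) (hE : E ∈ Bd C)
    (hU : U ∈ nhds E) : (U ∩ Bd C).Infinite := by
  obtain ⟨e1, e2, r, M, b, φ, h⟩ := exists_Chart hC hE
  obtain ⟨ρ, hρ, hρr, hs⟩ := h.exists_small hC
  have hcont : ContinuousOn (bpt E e1 e2 φ) (Icc (-ρ) ρ) :=
    h.continuousOn_bpt (fun u hu => ⟨by linarith [hu.1], by linarith [hu.2]⟩)
      fun u hu => (hs u (abs_le.2 hu)).2.1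
  have hc0 : ContinuousAt (bpt E e1 e2 φ) 0 :=
    hcont.continuousAt (Icc_mem_nhds (by linarith) hρ)
  have hU' : bpt E e1 e2 φ ⁻¹' U ∈ nhds 0 := hc0 (by rwa [h.bpt_zero])
  obtain ⟨δ, hδ, hδU⟩ := Metric.mem_nhds_iff.1 hU'
  have hm : ∀ u ∈ Ioo 0 (min ρ δ), |u| ≤ ρ ∧ u ∈ ball (0:ℝ) δ := fun u hu => by
    rw [mem_ball, Real.dist_eq, sub_zero, abs_of_pos hu.1]
    exact ⟨hu.2.le.trans (min_le_left _ _), hu.2.trans_le (min_le_right _ _)⟩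
  refine ((Ioo_infinite (lt_min hρ hδ)).image (f := bpt E e1 e2 φ) ?_).mono ?_
  · intro u hu v hv he
    exact h.frame.bpt_inj (hs u (hm u hu).1).2.1 (hs v (hm v hv).1).2.1 he
  · rintro _ ⟨u, hu, rfl⟩
    exact ⟨hδU (hm u hu).2, (hs u (hm u hu).1).2.2⟩

theorem plane_unique_bd {C U : Set Vec} {E v v' : Vec} {t t' : ℝ} (hC : IsBody C) (hE : E ∈ Bd C)
    (hU : U ∈ nhds E) (hv : v ≠ 0) (h : ∀ y ∈ U, y ∈ Bd C → lor y v = t)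
    (h' : ∀ y ∈ U, y ∈ Bd C → lor y v' = t') : ∃ c : ℝ, v' = c • v ∧ t' = c * t :=
  infinite_plane_unique (Bd_nhds_infinite hC hE hU) (fun _ hy => hy.2.1) hv
    (fun y hy => h y hy.1 hy.2) fun y hy => h' y hy.1 hy.2

theorem planar_of_regular {C : Set Vec} (hC : IsBody C) (hconn : IsPreconnected (Bd C))
    (hne : (Bd C).Nonempty) (hreg : ∀ E ∈ Bd C, Regular C E) :
    ∃ v t, v ≠ 0 ∧ ∀ y ∈ Bd C, lor y v = t := by
  obtain ⟨E, hE⟩ := hne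
  obtain ⟨U, hU, v, t, hv, hUv⟩ := hreg E hE
  refine ⟨v, t, hv, ?_⟩
  set G := {y | ∃ U ∈ nhds y, ∀ x ∈ U, x ∈ Bd C → lor x v = t} with hG
  set G' := {y | ∃ U ∈ nhds y, ∀ x ∈ U, x ∈ Bd C → x ∉ G} with hG'
  have hGo : IsOpen G := by
    rw [isOpen_iff_mem_nhds]
    rintro y ⟨U, hU, h⟩
    filter_upwards [eventually_mem_nhds_iff.2 hU] with z hz using ⟨U, hz, h⟩
  have hG'o : IsOpen G' := by
    rw [isOpen_iff_mem_nhds]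
    rintro y ⟨U, hU, h⟩
    filter_upwards [eventually_mem_nhds_iff.2 hU] with z hz using ⟨U, hz, h⟩
  have hcov : Bd C ⊆ G ∪ G' := by
    intro y hy
    by_cases hyG : y ∈ G
    · exact Or.inl hyG
    · right
      obtain ⟨W, hW, v', t', hv', hWv⟩ := hreg y hy
      refine ⟨interior W, interior_mem_nhds.2 hW, fun x hx hxB hxG => hyG ?_⟩
      obtain ⟨V, hV, hVv⟩ := hxG
      obtain ⟨c, hc, hc'⟩ := plane_unique_bd hC hxB
        (inter_mem hV (mem_interior_iff_mem_nhds.1 hx)) hv'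
        (fun z hz hzB => hWv z hz.2 hzB) fun z hz hzB => hVv z hz.1 hzB
      exact ⟨W, hW, fun z hz hzB => by rw [hc, lor_smul_right, hWv z hz hzB, hc']⟩
  by_contra! hcon
  obtain ⟨y, hy, hyv⟩ := hcon
  have hyG : y ∉ G := fun ⟨V, hV, h⟩ => hyv (h y (mem_of_mem_nhds hV) hy)
  obtain ⟨z, hz, hzG, V, hV, hz'⟩ := hconn G G' hGo hG'o hcov ⟨E, hE, U, hU, hUv⟩
    ⟨y, hy, (hcov hy).resolve_left hyG⟩
  exact hz' z (mem_of_mem_nhds hV) hz hzG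

/-! ### Level sets of linear functionals on the hyperboloid -/

section frame

variable {E e1 e2 : Vec}

theorem OFrame.lor_comb (h : OFrame E e1 e2) (x y z x' y' z' : ℝ) :
    lor (x • E + y • e1 + z • e2) (x' • E + y' • e1 + z' • e2) = -(x * x') + y * y' + z * z' := by
  simp only [lor_add_left, lor_add_right, lor_smul_left, lor_smul_right, h.hE.1, h.h11,
    h.h22, h.h1, h.h2, h.h12, lor_comm e1 E, lor_comm e2 E, lor_comm e2 e1]
  ring

theorem OFrame.lor_comb_E (h : OFrame E e1 e2) (x y z : ℝ) :
    lor (x • E + y • e1 + z • e2) E = -x := by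
  simpa using h.lor_comb x y z 1 0 0

theorem OFrame.lor_comb_e1 (h : OFrame E e1 e2) (x y z : ℝ) :
    lor (x • E + y • e1 + z • e2) e1 = y := by
  simpa using h.lor_comb x y z 0 1 0

theorem OFrame.lor_comb_e2 (h : OFrame E e1 e2) (x y z : ℝ) :
    lor (x • E + y • e1 + z • e2) e2 = z := by
  simpa using h.lor_comb x y z 0 0 1

theorem OFrame.comb_mem_Hyp (h : OFrame E e1 e2) {x y z : ℝ} (hx : 0 < x)
    (he : x ^ 2 = 1 + y ^ 2 + z ^ 2) : x • E + y • e1 + z • e2 ∈ Hyp := by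
  refine mem_Hyp_of_lor_neg ?_ h.hE ?_
  · rw [h.lor_comb]; linarith
  · rw [h.lor_comb_E]; linarith

theorem OFrame.exists_comb (h : OFrame E e1 e2) {w : Vec} (hw : w ∈ Hyp) :
    ∃ x y z : ℝ, 0 < x ∧ x ^ 2 = 1 + y ^ 2 + z ^ 2 ∧ w = x • E + y • e1 + z • e2 := by
  have e := h.expand w
  refine ⟨_, _, _, ?_, ?_, e⟩
  · linarith [hyp_lor_le hw h.hE]
  · have := hw.1
    rw [e, h.lor_comb] at this
    linarith

theorem exists_oframe (hE : E ∈ Hyp) (h11 : lor e1 e1 = 1) (h1 : lor E e1 = 0) :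
    ∃ e2, OFrame E e1 e2 := by
  have hQ : Real.sqrt 2 • E + e1 ∈ Hyp := by
    refine mem_Hyp_of_lor_neg ?_ hE ?_
    · simp only [lor_add_left, lor_add_right, lor_smul_left, lor_smul_right, hE.1, h11, h1,
        lor_comm e1 E]
      linarith [Real.mul_self_sqrt (zero_le_two (α := ℝ))]
    · simp only [lor_add_left, lor_smul_left, hE.1, h1, lor_comm e1 E]
      linarith [Real.sqrt_pos.2 (zero_lt_two (α := ℝ))]
  have hlor : lor E (Real.sqrt 2 • E + e1) = -Real.sqrt 2 := by simp [hE.1, h1]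
  obtain ⟨n, hn⟩ := exists_cframe hE hQ fun he => by
    rw [← he, hE.1] at hlor
    have : Real.sqrt 2 = 1 := by linarith
    have h2 := Real.mul_self_sqrt (zero_le_two (α := ℝ))
    rw [this] at h2; norm_num at h2
  refine ⟨n, hE, h11, hn.hn, h1, hn.hPn, ?_⟩
  have := hn.hQn
  rw [lor_add_left, lor_smul_left, hn.hPn] at this
  linarith

theorem exists_oframe_of_unit {v : Vec} (hv : lor v v = 1) : ∃ E e2, OFrame E v e2 := by
  have hy : ((1, 0, 0) : Vec) ∈ Hyp := by simp [Hyp, lor]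
  set y : Vec := (1, 0, 0)
  set a := lor y v with ha
  have hs : 0 < Real.sqrt (1 + a ^ 2) := Real.sqrt_pos.2 (by positivity)
  have hs2 : Real.sqrt (1 + a ^ 2) ^ 2 = 1 + a ^ 2 := Real.sq_sqrt (by positivity)
  have hE : (Real.sqrt (1 + a ^ 2))⁻¹ • (y - a • v) ∈ Hyp := by
    refine mem_Hyp_of_lor_neg ?_ hy ?_
    · simp only [lor_sub_left, lor_sub_right, lor_smul_left, lor_smul_right, hy.1, hv,
        lor_comm v y, ← ha]
      field_simp
      rw [hs2]; ring
    · simp only [lor_sub_left, lor_smul_left, hy.1, lor_comm v y, ← ha]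
      have : -1 - a * a < 0 := by nlinarith
      exact mul_neg_of_pos_of_neg (inv_pos.2 hs) this
  have h1 : lor ((Real.sqrt (1 + a ^ 2))⁻¹ • (y - a • v)) v = 0 := by
    simp only [lor_sub_left, lor_smul_left, hv, ← ha]; ring
  obtain ⟨e2, h⟩ := exists_oframe hE hv h1
  exact ⟨_, e2, h⟩

end frame

/-- Coordinates on the hyperboloid whose first coordinate is the functional `lor · v`. -/
structure Level (v : Vec) (J : Set ℝ) (F : ℝ × ℝ → Vec) : Prop where
  ord : J.OrdConnected
  cont : ContinuousOn F (J ×ˢ univ)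
  mem : ∀ a ∈ J, ∀ b, F (a, b) ∈ Hyp
  lev : ∀ a ∈ J, ∀ b, lor (F (a, b)) v = a
  surj : ∀ y ∈ Hyp, lor y v ∈ J ∧ ∃ b, F (lor y v, b) = y

theorem OFrame.level_space {E e1 e2 : Vec} (h : OFrame E e1 e2) : ∃ F, Level e1 univ F := by
  have hs : ∀ a : ℝ, 0 < Real.sqrt (1 + a ^ 2) := fun a => Real.sqrt_pos.2 (by positivity)
  have hs2 : ∀ a : ℝ, Real.sqrt (1 + a ^ 2) ^ 2 = 1 + a ^ 2 := fun a => Real.sq_sqrt (by positivity)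
  refine ⟨fun p => (Real.sqrt (1 + p.1 ^ 2) * Real.cosh p.2) • E + p.1 • e1 +
    (Real.sqrt (1 + p.1 ^ 2) * Real.sinh p.2) • e2, ordConnected_univ, ?_, ?_, ?_, ?_⟩
  · exact Continuous.continuousOn (by fun_prop)
  · intro a _ b
    refine h.comb_mem_Hyp (mul_pos (hs a) (Real.cosh_pos b)) ?_
    rw [mul_pow, mul_pow, hs2, Real.cosh_sq]; ring
  · intro a _ b
    exact h.lor_comb_e1 _ _ _
  · intro w hw
    refine ⟨mem_univ _, ?_⟩
    obtain ⟨x, y, z, hx, he, rfl⟩ := h.exists_comb hw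
    rw [h.lor_comb_e1]
    refine ⟨Real.arsinh (z / Real.sqrt (1 + y ^ 2)), ?_⟩
    have h1 : Real.sqrt (1 + y ^ 2) * Real.cosh (Real.arsinh (z / Real.sqrt (1 + y ^ 2))) = x := by
      rw [← pow_left_inj₀ (mul_pos (hs y) (Real.cosh_pos _)).le hx.le two_ne_zero, mul_pow, hs2,
        Real.cosh_sq, Real.sinh_arsinh, div_pow, hs2, he]
      field_simp
      ring
    have h2 := (hs y).ne'
    simp only [h1, Real.sinh_arsinh]
    rw [mul_div_cancel₀ _ h2]

theorem exists_cos_sin {y z : ℝ} (h : y ^ 2 + z ^ 2 = 1) :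
    ∃ b, Real.cos b = y ∧ Real.sin b = z := by
  have hn : ‖(⟨y, z⟩ : ℂ)‖ = 1 := by
    rw [Complex.norm_def, Complex.normSq_mk, ← pow_two, ← pow_two, h, Real.sqrt_one]
  have h0 : (⟨y, z⟩ : ℂ) ≠ 0 := by rw [← norm_ne_zero_iff, hn]; norm_num
  refine ⟨Complex.arg ⟨y, z⟩, ?_, ?_⟩
  · rw [Complex.cos_arg h0, hn]; simp
  · rw [Complex.sin_arg, hn]; simp

theorem OFrame.level_time {E e1 e2 : Vec} (h : OFrame E e1 e2) : ∃ F, Level (-E) (Ici 1) F := by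
  have hs2 : ∀ a : ℝ, 1 ≤ a → Real.sqrt (a ^ 2 - 1) ^ 2 = a ^ 2 - 1 := fun a ha =>
    Real.sq_sqrt (by nlinarith)
  refine ⟨fun p => p.1 • E + (Real.sqrt (p.1 ^ 2 - 1) * Real.cos p.2) • e1 +
    (Real.sqrt (p.1 ^ 2 - 1) * Real.sin p.2) • e2, ordConnected_Ici, ?_, ?_, ?_, ?_⟩
  · exact Continuous.continuousOn (by fun_prop)
  · intro a ha b
    have ha : 1 ≤ a := ha
    refine h.comb_mem_Hyp (by linarith) ?_
    simp only [mul_pow, hs2 a ha]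
    linear_combination (1 - a ^ 2) * Real.sin_sq_add_cos_sq b
  · intro a _ b
    rw [lor_neg_right, h.lor_comb_E, neg_neg]
  · intro w hw
    obtain ⟨x, y, z, hx, he, rfl⟩ := h.exists_comb hw
    rw [lor_neg_right, h.lor_comb_E, neg_neg]
    have hx1 : 1 ≤ x := by nlinarith [sq_nonneg y, sq_nonneg z]
    refine ⟨hx1, ?_⟩
    rcases hx1.eq_or_lt with rfl | hx1
    · have hy : y = 0 := by nlinarith [sq_nonneg y, sq_nonneg z]
      have hz : z = 0 := by nlinarith [sq_nonneg y, sq_nonneg z]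
      exact ⟨0, by simp [hy, hz]⟩
    · have hs : 0 < Real.sqrt (x ^ 2 - 1) := Real.sqrt_pos.2 (by nlinarith)
      obtain ⟨b, hb1, hb2⟩ := exists_cos_sin (y := y / Real.sqrt (x ^ 2 - 1))
        (z := z / Real.sqrt (x ^ 2 - 1)) (by
          rw [div_pow, div_pow, hs2 x hx1.le, ← add_div, div_eq_one_iff_eq (by nlinarith)]
          linarith)
      refine ⟨b, ?_⟩
      simp only [hb1, hb2]
      rw [mul_div_cancel₀ _ hs.ne', mul_div_cancel₀ _ hs.ne']

theorem OFrame.level_null {E e1 e2 : Vec} (h : OFrame E e1 e2) :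
    ∃ F, Level (-(E + e1)) (Ioi 0) F := by
  refine ⟨fun p => ((1 + p.2 ^ 2) / (2 * p.1) + p.1 / 2) • E +
    ((1 + p.2 ^ 2) / (2 * p.1) - p.1 / 2) • e1 + p.2 • e2, ordConnected_Ioi, ?_, ?_, ?_, ?_⟩
  · have : ContinuousOn (fun p : ℝ × ℝ => (1 + p.2 ^ 2) / (2 * p.1)) (Ioi 0 ×ˢ univ) := by
      refine ContinuousOn.div (by fun_prop) (by fun_prop) fun p hp => ?_
      have : 0 < p.1 := hp.1
      positivity
    fun_prop
  · intro a ha b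
    have ha : 0 < a := ha
    refine h.comb_mem_Hyp (by positivity) ?_
    field_simp
    ring
  · intro a ha b
    rw [lor_neg_right, lor_add_right, h.lor_comb_E, h.lor_comb_e1]
    ring
  · intro w hw
    obtain ⟨x, y, z, hx, he, rfl⟩ := h.exists_comb hw
    rw [lor_neg_right, lor_add_right, h.lor_comb_E, h.lor_comb_e1]
    have hxy : 0 < x - y := by nlinarith [sq_nonneg y, sq_nonneg z]
    have e : -(-x + y) = x - y := by ring
    rw [e]
    refine ⟨hxy, z, ?_⟩
    have e1 : (1 + z ^ 2) / (2 * (x - y)) = (x + y) / 2 := by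
      rw [div_eq_div_iff (by positivity) two_ne_zero]
      linear_combination -2 * he
    simp only [e1]
    congr 3 <;> ring

/-! ### Bodies bounded by a plane section -/

section half

variable {C : Set Vec} {v : Vec} {J : Set ℝ} {F : ℝ × ℝ → Vec} {t : ℝ}

/-- A preconnected part of the hyperboloid off the boundary is inside or outside. -/
theorem IsBody.dich (hC : IsBody C) {S : Set Vec} (hS : IsPreconnected S) (hSH : S ⊆ Hyp)
    (hSB : ∀ y ∈ S, y ∉ Bd C) : S ⊆ interior C ∨ Disjoint S C := by
  have ho : IsOpen (Fut \ C) := by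
    have : Fut \ C = Fut ∩ (closure C)ᶜ := by
      ext y
      refine ⟨fun h => ⟨h.1, fun hy => h.2 (hC.closed y h.1 hy)⟩,
        fun h => ⟨h.1, fun hy => h.2 (subset_closure hy)⟩⟩
    rw [this]
    exact isOpen_Fut.inter isClosed_closure.isOpen_compl
  have hcov : S ⊆ interior C ∪ Fut \ C := by
    intro y hy
    by_cases hyC : y ∈ C
    · left
      by_contra hi
      exact hSB y hy ⟨hSH hy, hyC, hi⟩
    · exact Or.inr ⟨Hyp_subset_Fut (hSH hy), hyC⟩
  by_cases hne : (S ∩ C).Nonempty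
  · left
    obtain ⟨x, hx, hxC⟩ := hne
    intro y hy
    refine (hcov hy).resolve_right fun hyC => ?_
    obtain ⟨z, -, hz, hz'⟩ := hS _ _ isOpen_interior ho hcov
      ⟨x, hx, (hcov hx).resolve_right fun h => h.2 hxC⟩ ⟨y, hy, hyC⟩
    exact hz'.2 (interior_subset hz)
  · exact Or.inr (disjoint_iff_inter_eq_empty.2 (not_nonempty_iff_eq_empty.1 hne))

theorem Level.preconnected (h : Level v J F) {I : Set ℝ} (hI : I.OrdConnected) (hIJ : I ⊆ J) :
    IsPreconnected {y | y ∈ Hyp ∧ lor y v ∈ I} := by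
  have : {y | y ∈ Hyp ∧ lor y v ∈ I} = F '' (I ×ˢ univ) := by
    ext y
    constructor
    · rintro ⟨hy, hyI⟩
      obtain ⟨-, b, hb⟩ := h.surj y hy
      exact ⟨_, ⟨hyI, mem_univ _⟩, hb⟩
    · rintro ⟨⟨a, b⟩, ⟨ha, -⟩, rfl⟩
      exact ⟨h.mem a (hIJ ha) b, by rw [h.lev a (hIJ ha)]; exact ha⟩
  rw [this]
  exact (hI.isPreconnected.prod isPreconnected_univ).image _
    (h.cont.mono (prod_mono hIJ Subset.rfl))

theorem Level.mem_closure (h : Level v J F) {I : Set ℝ} (hIJ : I ⊆ J) {y : Vec} (hy : y ∈ Hyp)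
    (hyI : lor y v ∈ closure I) : y ∈ closure {y | y ∈ Hyp ∧ lor y v ∈ I} := by
  obtain ⟨hyJ, b, hb⟩ := h.surj y hy
  have hc : ContinuousOn (fun a => F (a, b)) J :=
    h.cont.comp (by fun_prop) fun a ha => ⟨ha, mem_univ _⟩
  have h1 : ContinuousWithinAt (fun a => F (a, b)) I (lor y v) := (hc _ hyJ).mono hIJ
  have h2 := h1.mem_closure_image hyI
  simp only [hb] at h2
  refine closure_mono ?_ h2
  rintro _ ⟨a, ha, rfl⟩
  exact ⟨h.mem a (hIJ ha) b, by rw [h.lev a (hIJ ha)]; exact ha⟩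

theorem IsBody.mem_of_closure (hC : IsBody C) {S : Set Vec} (hS : S ⊆ C) {y : Vec} (hy : y ∈ Hyp)
    (hyS : y ∈ closure S) : y ∈ C :=
  hC.closed y (Hyp_subset_Fut hy) (closure_mono hS hyS)

/-- Interior points and exterior points exist on the hyperboloid near a boundary point. -/
theorem exists_exterior (hE : (Bd C).Nonempty) (hC : IsBody C) : ∃ y ∈ Hyp, y ∉ C := by
  obtain ⟨E, hE⟩ := hE
  have hE2 := hE.2.2
  rw [mem_interior_iff_mem_nhds] at hE2
  by_contra! hcon
  refine hE2 (mem_of_superset (isOpen_Fut.mem_nhds (Hyp_subset_Fut hE.1)) fun v hv => ?_)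
  rw [← sqrt_smul_nrm hv]
  exact hC.smul _ (sqrt_lor_pos hv) _ (hcon _ (nrm_mem hv))

theorem IsBody.exists_int (hC : IsBody C) : ∃ y ∈ Hyp, y ∈ interior C := by
  obtain ⟨x, hx⟩ := hC.int
  have hxF := hC.fut (interior_subset hx)
  refine ⟨nrm x, nrm_mem hxF, ?_⟩
  rw [← sqrt_smul_nrm hxF, hC.smul_int_iff (sqrt_lor_pos hxF)] at hx
  exact hx

theorem Level.half (h : Level v J F) (hC : IsBody C) (hne : (Bd C).Nonempty)
    (hB : ∀ y ∈ Bd C, lor y v = t) (hlo : ∃ a ∈ J, a < t) (hhi : ∃ a ∈ J, t < a) (htJ : t ∈ J) :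
    (∀ y ∈ Hyp, y ∈ C ↔ lor y v ≤ t) ∨ (∀ y ∈ Hyp, y ∈ C ↔ t ≤ lor y v) := by
  obtain ⟨a, haJ, ha⟩ := hlo
  obtain ⟨a', haJ', ha'⟩ := hhi
  have hclo : t ∈ closure (J ∩ Iio t) := by
    have : Ico a t ⊆ J ∩ Iio t := fun x hx => ⟨h.ord.out haJ htJ ⟨hx.1, hx.2.le⟩, hx.2⟩
    refine closure_mono this ?_
    rw [closure_Ico ha.ne]
    exact ⟨ha.le, le_rfl⟩
  have hclo' : t ∈ closure (J ∩ Ioi t) := by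
    have : Ioc t a' ⊆ J ∩ Ioi t := fun x hx => ⟨h.ord.out htJ haJ' ⟨hx.1.le, hx.2⟩, hx.1⟩
    refine closure_mono this ?_
    rw [closure_Ioc ha'.ne]
    exact ⟨le_rfl, ha'.le⟩
  have m1 : ∀ y ∈ Hyp, lor y v < t → lor y v ∈ J ∩ Iio t := fun y hy hyt => ⟨(h.surj y hy).1, hyt⟩
  have m2 : ∀ y ∈ Hyp, t < lor y v → lor y v ∈ J ∩ Ioi t := fun y hy hyt => ⟨(h.surj y hy).1, hyt⟩
  have hd := hC.dich (h.preconnected (h.ord.inter ordConnected_Iio) inter_subset_left)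
    (fun y hy => hy.1) fun y hy hyB => (hy.2.2 : lor y v < t).ne (hB y hyB)
  have hd' := hC.dich (h.preconnected (h.ord.inter ordConnected_Ioi) inter_subset_left)
    (fun y hy => hy.1) fun y hy hyB => (hy.2.2 : t < lor y v).ne' (hB y hyB)
  rcases hd with hd | hd <;> rcases hd' with hd' | hd'
  · exfalso
    obtain ⟨y, hy, hyC⟩ := exists_exterior hne hC
    refine hyC ?_
    rcases lt_trichotomy (lor y v) t with hyt | hyt | hyt
    · exact interior_subset (hd ⟨hy, m1 y hy hyt⟩)
    · exact hC.mem_of_closure (hd.trans interior_subset) hy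
        (h.mem_closure inter_subset_left hy (by rwa [hyt]))
    · exact interior_subset (hd' ⟨hy, m2 y hy hyt⟩)
  · left
    intro y hy
    constructor
    · intro hyC
      by_contra! hyt
      exact disjoint_left.1 hd' ⟨hy, m2 y hy hyt⟩ hyC
    · intro hyt
      rcases hyt.eq_or_lt with hyt | hyt
      · exact hC.mem_of_closure (hd.trans interior_subset) hy
          (h.mem_closure inter_subset_left hy (by rwa [hyt]))
      · exact interior_subset (hd ⟨hy, m1 y hy hyt⟩)
  · right
    intro y hy
    constructor
    · intro hyC
      by_contra! hyt
      exact disjoint_left.1 hd ⟨hy, m1 y hy hyt⟩ hyC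
    · intro hyt
      rcases hyt.eq_or_lt with hyt | hyt
      · exact hC.mem_of_closure (hd'.trans interior_subset) hy
          (h.mem_closure inter_subset_left hy (by rwa [← hyt]))
      · exact interior_subset (hd' ⟨hy, m2 y hy hyt⟩)
  · exfalso
    obtain ⟨y, hy, hyC⟩ := hC.exists_int
    rcases lt_trichotomy (lor y v) t with hyt | hyt | hyt
    · exact disjoint_left.1 hd ⟨hy, m1 y hy hyt⟩ (interior_subset hyC)
    · obtain ⟨z, hz, hzS⟩ := mem_closure_iff.1 (h.mem_closure inter_subset_left hy
        (by rwa [hyt] : lor y v ∈ closure (J ∩ Iio t))) _ isOpen_interior hyC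
      exact disjoint_left.1 hd hzS (interior_subset hz)
    · exact disjoint_left.1 hd' ⟨hy, m2 y hy hyt⟩ (interior_subset hyC)

/-- The midpoint of two points of a level set lies strictly closer to the zero level. -/
theorem exists_mid {x y : Vec} (hx : x ∈ Hyp) (hy : y ∈ Hyp) (hxy : x ≠ y) (hxC : x ∈ C)
    (hyC : y ∈ C) (hC : IsBody C) (h1 : lor x v = t) (h2 : lor y v = t) :
    ∃ θ, 0 < θ ∧ θ < 1 ∧ ∃ m ∈ Hyp, m ∈ C ∧ lor m v = θ * t := by
  have hF := Fut_add (Hyp_subset_Fut hx) (Hyp_subset_Fut hy)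
  have hlt : lor x y < -1 := lt_of_le_of_ne (hyp_lor_le hx hy) fun h => hxy (hyp_lor_eq hx hy h)
  have e : -lor (x + y) (x + y) = 2 - 2 * lor x y := by
    simp only [lor_add_left, lor_add_right, hx.1, hy.1, lor_comm y x]; ring
  have hs : 2 < Real.sqrt (-lor (x + y) (x + y)) := by
    rw [Real.lt_sqrt (by norm_num), e]; linarith
  have hs0 : 0 < Real.sqrt (-lor (x + y) (x + y)) := by linarith
  refine ⟨2 / Real.sqrt (-lor (x + y) (x + y)), by positivity, by rwa [div_lt_one hs0], _,
    nrm_mem hF, hC.smul _ (inv_pos.2 hs0) _ (hC.add _ hxC _ hyC), ?_⟩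
  rw [nrm, lor_smul_left, lor_add_left x y v, h1, h2]
  ring

/-- A body whose boundary is nonempty and lies in a level set is a sublevel set, up to sign. -/
theorem Level.sublevel (h : Level v J F) (hC : IsBody C) (hne : (Bd C).Nonempty)
    (hB : ∀ y ∈ Bd C, lor y v = t) (hlo : ∃ a ∈ J, a < t) (hhi : ∃ a ∈ J, t < a) :
    (0 ≤ t ∧ ∀ y ∈ Hyp, y ∈ C ↔ lor y v ≤ t) ∨ (t ≤ 0 ∧ ∀ y ∈ Hyp, y ∈ C ↔ t ≤ lor y v) := by
  obtain ⟨E, hE⟩ := hne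
  have htJ : t ∈ J := by rw [← hB E hE]; exact (h.surj E hE.1).1
  obtain ⟨x, hx, y, hy, hxy⟩ := (Bd_nhds_infinite hC hE univ_mem).nontrivial
  obtain ⟨θ, h0, h1, m, hm, hmC, hmt⟩ := exists_mid (v := v) hx.2.1 hy.2.1 hxy hx.2.2.1 hy.2.2.1 hC
    (hB x hx.2) (hB y hy.2)
  rcases h.half hC ⟨E, hE⟩ hB hlo hhi htJ with hh | hh
  · refine Or.inl ⟨?_, hh⟩
    have := (hh m hm).1 hmC
    rw [hmt] at this
    nlinarith
  · refine Or.inr ⟨?_, hh⟩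
    have := (hh m hm).1 hmC
    rw [hmt] at this
    nlinarith

end half

theorem exists_oframe_of_hyp {E : Vec} (hE : E ∈ Hyp) : ∃ e1 e2, OFrame E e1 e2 := by
  set w : Vec := (0, 1, 0) + E.2.1 • E with hw
  have hs : 0 < Real.sqrt (1 + E.2.1 ^ 2) := Real.sqrt_pos.2 (by positivity)
  have hs2 : Real.sqrt (1 + E.2.1 ^ 2) ^ 2 = 1 + E.2.1 ^ 2 := Real.sq_sqrt (by positivity)
  have h1 : lor (0, 1, 0) E = E.2.1 := by simp [lor]
  have h2 : lor ((0, 1, 0) : Vec) (0, 1, 0) = 1 := by simp [lor]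
  have hww : lor w w = 1 + E.2.1 ^ 2 := by
    rw [hw]
    simp only [lor_add_left, lor_add_right, lor_smul_left, lor_smul_right, hE.1, h2, h1,
      lor_comm E (0, 1, 0)]
    ring
  have hEw : lor E w = 0 := by
    rw [hw, lor_add_right, lor_smul_right, hE.1, lor_comm, h1]; ring
  obtain ⟨e2, h⟩ := exists_oframe (e1 := (Real.sqrt (1 + E.2.1 ^ 2))⁻¹ • w) hE (by
    rw [lor_smul_left, lor_smul_right, hww]
    field_simp
    rw [hs2]) (by rw [lor_smul_right, hEw, mul_zero])
  exact ⟨_, e2, h⟩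

/-- The three normal forms of a body with planar boundary. -/
inductive Form (C : Set Vec) : Prop
  | time (E : Vec) (t : ℝ) (hE : E ∈ Hyp) (ht : 1 < t) (h : ∀ y ∈ Hyp, y ∈ C ↔ -lor y E ≤ t)
  | null (E e1 e2 : Vec) (hf : OFrame E e1 e2) (h : ∀ y ∈ Hyp, y ∈ C ↔ -lor y (E + e1) ≤ 1)
  | space (v : Vec) (t : ℝ) (hv : lor v v = 1) (ht : 0 ≤ t) (h : ∀ y ∈ Hyp, y ∈ C ↔ lor y v ≤ t)

theorem form_of_planar {C : Set Vec} {v : Vec} {t : ℝ} (hC : IsBody C) (hne : (Bd C).Nonempty)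
    (hv : v ≠ 0) (hB : ∀ y ∈ Bd C, lor y v = t) : Form C := by
  have hne' := hne
  obtain ⟨E, hE⟩ := hne'
  rcases lt_trichotomy (lor v v) 0 with hlt | heq | hgt
  · obtain ⟨E0, hE0, c, hc⟩ : ∃ E0 ∈ Hyp, ∃ c : ℝ, E0 = c • v := by
      have hs : 0 < Real.sqrt (-lor v v) := Real.sqrt_pos.2 (by linarith)
      have h1 : lor ((Real.sqrt (-lor v v))⁻¹ • v) ((Real.sqrt (-lor v v))⁻¹ • v) = -1 := by
        have := Real.sq_sqrt (by linarith : 0 ≤ -lor v v)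
        rw [lor_smul_left, lor_smul_right]
        field_simp
        rw [this, neg_neg]
      have h0 : lor v E ≠ 0 := fun h0 => by linarith [lor_orth_nonneg hE.1 h0]
      rcases h0.lt_or_gt with h0 | h0
      · refine ⟨_, mem_Hyp_of_lor_neg h1 hE.1 ?_, _, rfl⟩
        rw [lor_smul_left]
        exact mul_neg_of_pos_of_neg (inv_pos.2 hs) h0
      · refine ⟨-((Real.sqrt (-lor v v))⁻¹ • v), mem_Hyp_of_lor_neg (by simpa using h1) hE.1 ?_,
          -(Real.sqrt (-lor v v))⁻¹, by rw [neg_smul]⟩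
        rw [lor_neg_left, lor_smul_left, neg_lt_zero]
        exact mul_pos (inv_pos.2 hs) h0
    obtain ⟨e1, e2, hf⟩ := exists_oframe_of_hyp hE0
    obtain ⟨F, hF⟩ := hf.level_time
    have hB' : ∀ y ∈ Bd C, lor y (-E0) = -(c * t) := fun y hy => by
      rw [lor_neg_right, hc, lor_smul_right, hB y hy]
    obtain ⟨x, hx, y, hy, hxy⟩ := (Bd_nhds_infinite hC hE univ_mem).nontrivial
    have ht1 : 1 < -(c * t) := by
      by_contra! hle
      have key : ∀ z ∈ Bd C, z = E0 := fun z hz => by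
        refine hyp_lor_eq hz.1 hE0 ?_
        have h1 := hyp_lor_le hz.1 hE0
        have h2 := hB' z hz
        rw [lor_neg_right] at h2
        linarith
      exact hxy ((key x hx.2).trans (key y hy.2).symm)
    rcases hF.sublevel hC hne hB' ⟨1, mem_Ici.2 le_rfl, ht1⟩ ⟨-(c * t) + 1,
      mem_Ici.2 (by linarith), by linarith⟩ with ⟨-, h⟩ | ⟨h, -⟩
    · exact .time E0 _ hE0 ht1 fun y hy => by rw [h y hy, lor_neg_right]
    · linarith
  · have h0 : lor E v ≠ 0 := fun h0 => hv (lor_orth_eq_zero hE.1 (by rw [lor_comm, h0]) heq)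
    have ht : lor E v = t := hB E hE
    set e1 : Vec := -(t⁻¹) • v - E with he1
    have hn : E + e1 = -(t⁻¹) • v := by rw [he1]; abel
    have ht0 : t ≠ 0 := ht ▸ h0
    have h11 : lor e1 e1 = 1 := by
      rw [he1]
      simp only [lor_sub_left, lor_sub_right, lor_smul_left, lor_smul_right, heq, hE.1.1,
        lor_comm v E, ht]
      field_simp
      ring
    have hE1 : lor E e1 = 0 := by
      rw [he1]
      simp only [lor_sub_right, lor_smul_right, hE.1.1, ht]
      field_simp
      ring
    obtain ⟨e2, hf⟩ := exists_oframe hE.1 h11 hE1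
    obtain ⟨F, hF⟩ := hf.level_null
    have hB' : ∀ y ∈ Bd C, lor y (-(E + e1)) = 1 := fun y hy => by
      rw [hn, lor_neg_right, lor_smul_right, hB y hy]
      field_simp
    rcases hF.sublevel hC hne hB' ⟨1 / 2, by norm_num, by norm_num⟩ ⟨2, by norm_num, by norm_num⟩
      with ⟨-, h⟩ | ⟨h, -⟩
    · exact .null E e1 e2 hf fun y hy => by rw [h y hy, lor_neg_right]
    · linarith
  · have hs : 0 < Real.sqrt (lor v v) := Real.sqrt_pos.2 hgt
    have hs2 : Real.sqrt (lor v v) ^ 2 = lor v v := Real.sq_sqrt hgt.le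
    have h1 : lor ((Real.sqrt (lor v v))⁻¹ • v) ((Real.sqrt (lor v v))⁻¹ • v) = 1 := by
      rw [lor_smul_left, lor_smul_right]
      field_simp
      rw [hs2]
    obtain ⟨E0, e2, hf⟩ := exists_oframe_of_unit h1
    obtain ⟨F, hF⟩ := hf.level_space
    rcases hF.sublevel hC hne (t := (Real.sqrt (lor v v))⁻¹ * t)
      (fun y hy => by rw [lor_smul_right, hB y hy]) ⟨_, mem_univ _, sub_one_lt _⟩
      ⟨_, mem_univ _, lt_add_one _⟩ with ⟨ht, h⟩ | ⟨ht, h⟩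
    · exact .space _ _ h1 ht h
    · refine .space (-((Real.sqrt (lor v v))⁻¹ • v)) _ (by simpa using h1) (neg_nonneg.2 ht)
        fun y hy => ?_
      rw [h y hy, lor_neg_right, neg_le_neg_iff]

theorem form_of_regular {C : Set Vec} (hC : IsBody C) (hconn : IsConnected (Bd C))
    (hreg : ∀ E ∈ Bd C, Regular C E) : Form C := by
  obtain ⟨v, t, hv, hB⟩ := planar_of_regular hC hconn.isPreconnected hconn.nonempty hreg
  exact form_of_planar hC hconn.nonempty hv hB

/-! ### The hyperboloid model of a hyperbolic plane -/

/-- `p` identifies `X` with the hyperboloid, and `q` is its inverse extended to the future cone. -/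
structure Model (p : X → Vec) (q : Vec → X) : Prop where
  mem : ∀ x, p x ∈ Hyp
  pq : ∀ z ∈ Fut, p (q z) = nrm z
  cosh : ∀ x y, Real.cosh (dist x y) = -lor (p x) (p y)

theorem exists_model (hX : IsHyperbolicSpace X 2) : ∃ (p : X → Vec) (q : Vec → X), Model p q := by
  obtain ⟨e, -, hr, hd⟩ := hX
  have hl : ∀ u v : EuclideanSpace ℝ (Fin 2) × ℝ,
      mink 2 u v = lor (u.2, u.1 0, u.1 1) (v.2, v.1 0, v.1 1) := fun u v => by
    simp [mink, lor, PiLp.inner_apply, Fin.sum_univ_two]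
    ring
  have hmem : ∀ x, (((e x).2, (e x).1 0, (e x).1 1) : Vec) ∈ Hyp := fun x => by
    have h : e x ∈ range e := ⟨x, rfl⟩
    rw [hr] at h
    exact ⟨by rw [← hl]; exact h.1, h.2⟩
  have hsurj : ∀ z ∈ Hyp, ∃ x, (((e x).2, (e x).1 0, (e x).1 1) : Vec) = z := fun z hz => by
    have h : ((!₂[z.2.1, z.2.2], z.1) : EuclideanSpace ℝ (Fin 2) × ℝ) ∈ range e := by
      rw [hr]
      exact ⟨by rw [hl]; simpa using hz.1, hz.2⟩
    obtain ⟨x, hx⟩ := h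
    exact ⟨x, by simp [hx]⟩
  have : Nonempty X := ⟨(hsurj (1, 0, 0) (by simp [Hyp, lor])).choose⟩
  choose! g hg using hsurj
  refine ⟨fun x => ((e x).2, (e x).1 0, (e x).1 1), fun z => g (nrm z), hmem,
    fun z hz => hg _ (nrm_mem hz), fun x y => by rw [hd, hl]⟩

namespace Model

variable {p : X → Vec} {q : Vec → X}

theorem inj (h : Model p q) {x y : X} (he : p x = p y) : x = y := by
  have := h.cosh x y
  rw [he, (h.mem y).1, neg_neg] at this
  by_contra hne
  exact (Real.one_lt_cosh.2 (dist_pos.2 hne).ne').ne' this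

theorem fut (h : Model p q) (x : X) : p x ∈ Fut := Hyp_subset_Fut (h.mem x)

theorem qp_smul (h : Model p q) {a : ℝ} (ha : 0 < a) (x : X) : q (a • p x) = x :=
  h.inj (by rw [h.pq _ (Fut_smul (h.fut x) ha), nrm_smul_of_hyp (h.mem x) ha])

theorem qp (h : Model p q) (x : X) : q (p x) = x := by
  simpa using h.qp_smul one_pos x

theorem pq_hyp (h : Model p q) {z : Vec} (hz : z ∈ Hyp) : p (q z) = z := by
  rw [h.pq z (Hyp_subset_Fut hz), nrm_of_hyp hz]

theorem q_smul (h : Model p q) {a : ℝ} (ha : 0 < a) {z : Vec} (hz : z ∈ Fut) :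
    q (a • z) = q z := by
  rw [← sqrt_smul_nrm hz, smul_smul, ← h.pq z hz, h.qp_smul (mul_pos ha (sqrt_lor_pos hz)),
    h.qp_smul (sqrt_lor_pos hz)]

theorem continuous_p (h : Model p q) : Continuous p := by
  have key : ∀ w ∈ Hyp, Continuous fun x => lor (p x) w := fun w hw => by
    have : (fun x => lor (p x) w) = fun x => -Real.cosh (dist x (q w)) := by
      ext x; rw [h.cosh, h.pq_hyp hw, neg_neg]
    rw [this]
    exact (Real.continuous_cosh.comp (continuous_id.dist continuous_const)).neg
  have s2 := Real.mul_self_sqrt (zero_le_two (α := ℝ))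
  have s0 := Real.sqrt_pos.2 (zero_lt_two (α := ℝ))
  have h0 := key (1, 0, 0) (by simp [Hyp, lor])
  have h1 := key (Real.sqrt 2, 1, 0) (by simp [Hyp, lor]; norm_num)
  have h2 := key (Real.sqrt 2, 0, 1) (by simp [Hyp, lor]; norm_num)
  have c0 : Continuous fun x => (p x).1 := h0.neg.congr fun x => by simp [lor]
  have c1 : Continuous fun x => (p x).2.1 :=
    (h1.add (c0.mul (continuous_const (y := Real.sqrt 2)))).congr fun x => by simp [lor]
  have c2 : Continuous fun x => (p x).2.2 :=
    (h2.add (c0.mul (continuous_const (y := Real.sqrt 2)))).congr fun x => by simp [lor]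
  exact c0.prodMk (c1.prodMk c2)

theorem dist_eq (h : Model p q) (x y : X) : dist x y = Real.arcosh (-lor (p x) (p y)) := by
  rw [← h.cosh, Real.arcosh_cosh dist_nonneg]

theorem continuousOn_q (h : Model p q) : ContinuousOn q Fut := by
  intro z hz
  rw [ContinuousWithinAt, tendsto_iff_dist_tendsto_zero]
  have h1 : ∀ᶠ y in nhdsWithin z Fut,
      Real.arcosh (-lor (nrm y) (nrm z)) = dist (q y) (q z) := by
    filter_upwards [self_mem_nhdsWithin] with y hy
    rw [h.dist_eq, h.pq y hy, h.pq z hz]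
  refine Tendsto.congr' h1 ?_
  have h2 : ContinuousWithinAt (fun y => -lor (nrm y) (nrm z)) Fut z :=
    (continuousOn_lor_comp continuousOn_nrm continuousOn_const).neg z hz
  have h3 : ContinuousWithinAt Real.arcosh (Ici 1) (-lor (nrm z) (nrm z)) :=
    Real.continuousOn_arcosh _ (by rw [(nrm_mem hz).1, neg_neg]; exact mem_Ici.2 le_rfl)
  have h4 := ContinuousWithinAt.comp (g := Real.arcosh) (f := fun y => -lor (nrm y) (nrm z))
    (x := z) h3 h2 fun y hy => by
    have := hyp_lor_le (nrm_mem hy) (nrm_mem hz)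
    exact mem_Ici.2 (by linarith)
  have h5 := h4.tendsto
  simp only [Function.comp_def, (nrm_mem hz).1, neg_neg, Real.arcosh_zero] at h5
  exact h5

end Model

/-- The cone over a subset of the hyperbolic plane. -/
def body (q : Vec → X) (K : Set X) : Set Vec := {z | z ∈ Fut ∧ q z ∈ K}

section body

variable {p : X → Vec} {q : Vec → X} {K L : Set X}

theorem body_inter {Y : Type*} {q : Vec → Y} {K L : Set Y} : body q (K ∩ L) = body q K ∩ body q L := by
  ext z; simp only [body, mem_ofPred_eq, mem_inter_iff]; tauto

theorem Model.interior_body (h : Model p q) (K : Set X) :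
    interior (body q K) = body q (interior K) := by
  apply Subset.antisymm
  · intro z hz
    have hzF := (interior_subset hz).1
    refine ⟨hzF, mem_interior.2 ⟨{x | Real.sqrt (-lor z z) • p x ∈ interior (body q K)}, ?_,
      isOpen_interior.preimage (f := fun x => Real.sqrt (-lor z z) • p x)
        (by have := h.continuous_p; fun_prop), ?_⟩⟩
    · intro x hx
      have := (interior_subset hx).2
      rwa [h.qp_smul (sqrt_lor_pos hzF)] at this
    · rw [mem_ofPred_eq, h.pq z hzF, sqrt_smul_nrm hzF]
      exact hz
  · refine interior_maximal (fun z hz => ⟨hz.1, interior_subset hz.2⟩) ?_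
    exact h.continuousOn_q.isOpen_inter_preimage isOpen_Fut isOpen_interior

theorem Model.mem_body (h : Model p q) {x : X} : p x ∈ body q K ↔ x ∈ K := by
  simp only [body, mem_ofPred_eq, h.qp, h.fut, true_and]

theorem Model.body_nonempty (h : Model p q) : (body q K).Nonempty ↔ K.Nonempty :=
  ⟨fun ⟨_, hz⟩ => ⟨_, hz.2⟩, fun ⟨x, hx⟩ => ⟨p x, h.mem_body.2 hx⟩⟩

theorem Model.Bd_body (h : Model p q) (hK : IsClosed K) : Bd (body q K) = p '' frontier K := by
  rw [hK.frontier_eq]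
  ext z
  simp only [Bd, h.interior_body, mem_ofPred_eq]
  constructor
  · rintro ⟨hz, hzK, hzi⟩
    rw [← h.pq_hyp hz, h.mem_body] at hzK hzi
    exact ⟨q z, ⟨hzK, hzi⟩, h.pq_hyp hz⟩
  · rintro ⟨x, ⟨hx, hxi⟩, rfl⟩
    exact ⟨h.mem x, h.mem_body.2 hx, fun hh => hxi (h.mem_body.1 hh)⟩

/-- Points on a chord are unique between points. -/
theorem Model.uniqueBtw (h : Model p q) {v w : Vec} (hv : v ∈ Fut) (hw : w ∈ Fut) :
    UniqueBtwPt (q v) (q (v + w)) (q w) := by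
  set P := nrm v with hP
  set Q := nrm w with hQ
  set a := Real.sqrt (-lor v v) with ha
  set b := Real.sqrt (-lor w w) with hb
  have hPH : P ∈ Hyp := nrm_mem hv
  have hQH : Q ∈ Hyp := nrm_mem hw
  have ha0 : 0 < a := sqrt_lor_pos hv
  have hb0 : 0 < b := sqrt_lor_pos hw
  have hva : v = a • P := (sqrt_smul_nrm hv).symm
  have hwb : w = b • Q := (sqrt_smul_nrm hw).symm
  have hvw := Fut_add hv hw
  set N := Real.sqrt (-lor (v + w) (v + w)) with hN
  have hN0 : 0 < N := sqrt_lor_pos hvw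
  set c := -lor P Q with hc
  have hc1 : 1 ≤ c := by linarith [hyp_lor_le hPH hQH]
  have hPQ : lor P Q = -c := by rw [hc, neg_neg]
  have hN2 : N ^ 2 = a ^ 2 + b ^ 2 + 2 * a * b * c := by
    rw [hN, Real.sq_sqrt (by linarith [hvw.1]), hva, hwb]
    simp only [lor_add_left, lor_add_right, lor_smul_left, lor_smul_right, hPH.1, hQH.1,
      lor_comm Q P, hPQ]
    ring
  set Z := nrm (v + w) with hZ
  have hZH : Z ∈ Hyp := nrm_mem hvw
  have hZe : Z = N⁻¹ • (a • P + b • Q) := by rw [hZ, nrm, ← hva, ← hwb]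
  have hpv : p (q v) = P := h.pq v hv
  have hpw : p (q w) = Q := h.pq w hw
  have hpz : p (q (v + w)) = Z := h.pq _ hvw
  have hPZ : lor P Z = -((a + b * c) / N) := by
    rw [hZe, lor_smul_right, lor_add_right, lor_smul_right, lor_smul_right, hPH.1, hPQ]
    field_simp; ring
  have hZQ : lor Z Q = -((a * c + b) / N) := by
    rw [hZe, lor_smul_left, lor_add_left, lor_smul_left, lor_smul_left, hQH.1, hPQ]
    field_simp; ring
  have c1 := h.cosh (q v) (q (v + w))
  have c2 := h.cosh (q (v + w)) (q w)
  have c3 := h.cosh (q v) (q w)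
  rw [hpv, hpz, hPZ, neg_neg] at c1
  rw [hpw, hpz, hZQ, neg_neg] at c2
  rw [hpv, hpw, hPQ, neg_neg] at c3
  have hr0 : 0 ≤ Real.sqrt (c ^ 2 - 1) := Real.sqrt_nonneg _
  have hr2 : Real.sqrt (c ^ 2 - 1) ^ 2 = c ^ 2 - 1 := Real.sq_sqrt (by nlinarith)
  set r := Real.sqrt (c ^ 2 - 1)
  have s1 : Real.sinh (dist (q v) (q (v + w))) = b * r / N := by
    rw [← pow_left_inj₀ (Real.sinh_nonneg_iff.2 dist_nonneg) (by positivity) two_ne_zero,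
      Real.sinh_sq, c1, div_pow, div_pow, hN2, mul_pow, hr2]
    have : 0 < a ^ 2 + b ^ 2 + 2 * a * b * c := by rw [← hN2]; positivity
    field_simp
    ring
  have s2 : Real.sinh (dist (q (v + w)) (q w)) = a * r / N := by
    rw [← pow_left_inj₀ (Real.sinh_nonneg_iff.2 dist_nonneg) (by positivity) two_ne_zero,
      Real.sinh_sq, c2, div_pow, div_pow, hN2, mul_pow, hr2]
    have : 0 < a ^ 2 + b ^ 2 + 2 * a * b * c := by rw [← hN2]; positivity
    field_simp
    ring
  have hbtw : Btw (q v) (q (v + w)) (q w) := by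
    have : Real.cosh (dist (q v) (q (v + w)) + dist (q (v + w)) (q w)) =
        Real.cosh (dist (q v) (q w)) := by
      rw [Real.cosh_add, c1, c2, s1, s2, c3]
      field_simp
      rw [hN2]
      linear_combination a * b * hr2
    exact Real.cosh_injOn (mem_Ici.2 (by positivity)) (mem_Ici.2 dist_nonneg) this
  refine ⟨hbtw, fun u hu hud => h.inj (hyp_lor_eq (h.mem _) (h.mem _) ?_)⟩
  have e1 : lor (p u) P = lor Z P := by
    have g1 := h.cosh (q v) u
    rw [hud, h.cosh, hpv, hpz] at g1
    rw [lor_comm, lor_comm Z]; linarith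
  have e2 : lor (p u) Q = lor Z Q := by
    have g1 := h.cosh u (q w)
    have : dist u (q w) = dist (q (v + w)) (q w) := by
      have k1 : dist (q v) u + dist u (q w) = dist (q v) (q w) := hu
      have k2 : dist (q v) (q (v + w)) + dist (q (v + w)) (q w) = dist (q v) (q w) := hbtw
      linarith
    rw [this, h.cosh, hpw, hpz] at g1
    linarith
  have e3 : lor Z Z = -1 := hZH.1
  rw [hpz]
  rw [hZe, lor_smul_right, lor_add_right, lor_smul_right, lor_smul_right] at e3 ⊢
  rw [e1, e2, hZe, e3]

theorem Model.isBody (h : Model p q) (hKc : IsClosed K) (hK : GConvex K)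
    (hKi : (interior K).Nonempty) : IsBody (body q K) where
  fut := fun _ hz => hz.1
  add := fun v hv w hw => ⟨Fut_add hv.1 hw.1, hK _ hv.2 _ hw.2 _ (h.uniqueBtw hv.1 hw.1)⟩
  smul := fun a ha v hv => ⟨Fut_smul hv.1 ha, by rw [h.q_smul ha hv.1]; exact hv.2⟩
  closed := fun v hv hvc => by
    refine ⟨hv, ?_⟩
    by_contra hcon
    obtain ⟨z, hz, hzK⟩ := mem_closure_iff.1 hvc _
      (h.continuousOn_q.isOpen_inter_preimage isOpen_Fut hKc.isOpen_compl) ⟨hv, hcon⟩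
    exact hz.2 hzK.2
  int := by rw [h.interior_body, h.body_nonempty]; exact hKi

end body

/-! ### Isometries in the hyperboloid model -/

theorem exists_lor_reflection {w : Vec} (hw : lor w w = 1) :
    ∃ R : Vec ≃ₗ[ℝ] Vec, IsLor R ∧ ∀ u, R u = u - (2 * lor u w) • w := by
  let f : Vec →ₗ[ℝ] Vec :=
    { toFun := fun u => u - (2 * lor u w) • w
      map_add' := fun x y => by simp only [lor_add_left]; module
      map_smul' := fun a x => by simp only [lor_smul_left, RingHom.id_apply]; module }
  have hf : Function.Involutive f := fun u => by
    change (u - (2 * lor u w) • w) - (2 * lor (u - (2 * lor u w) • w) w) • w = u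
    rw [lor_sub_left, lor_smul_left, hw]
    module
  obtain ⟨E, e2, h⟩ := exists_oframe_of_unit hw
  have hR : ∀ u, LinearEquiv.ofInvolutive f hf u = u - (2 * lor u w) • w := fun u => rfl
  refine ⟨LinearEquiv.ofInvolutive f hf, isLor_of (P := E) ?_ h.hE ?_, hR⟩
  · intro x y
    rw [hR, hR]
    simp only [lor_sub_left, lor_sub_right, lor_smul_left, lor_smul_right, hw, lor_comm w y]
    ring
  · rw [hR, h.h1]
    simpa using h.hE

/-- The reflection exchanging two points of the hyperboloid. -/
theorem exists_swap {a b : Vec} (ha : a ∈ Hyp) (hb : b ∈ Hyp) (hab : a ≠ b) :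
    ∃ (w : Vec) (c : ℝ), lor w w = 1 ∧ w = c • (b - a) ∧ a - (2 * lor a w) • w = b := by
  have hp := hyp_sub_pos ha hb hab
  have hs := Real.sqrt_pos.2 hp
  have hs2 := Real.sq_sqrt hp.le
  refine ⟨_, (Real.sqrt (lor (b - a) (b - a)))⁻¹, ?_, rfl, ?_⟩
  · rw [lor_smul_left, lor_smul_right]
    field_simp
    rw [hs2]
  · rw [lor_smul_right, smul_smul]
    have : 2 * ((Real.sqrt (lor (b - a) (b - a)))⁻¹ * lor a (b - a)) *
        (Real.sqrt (lor (b - a) (b - a)))⁻¹ = -1 := by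
      field_simp
      rw [hs2]
      simp only [lor_sub_left, lor_sub_right, ha.1, hb.1, lor_comm b a]
      ring
    rw [this]
    module

/-- Being a product of reflections and induced by a Lorentz transformation. -/
def Folds (p : X → Vec) (f : X ≃ᵢ X) : Prop :=
  (∃ A, IsLor A ∧ ∀ x, p (f x) = A (p x)) ∧ ∃ l : List (X ≃ᵢ X), (∀ σ ∈ l, IsReflection σ) ∧
    f = l.foldr IsometryEquiv.trans (IsometryEquiv.refl X)

namespace Model

variable {p : X → Vec} {q : Vec → X}

theorem dist_eq_of_lor (h : Model p q) {x y x' y' : X} (he : lor (p x) (p y) = lor (p x') (p y')) :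
    dist x y = dist x' y' := by rw [h.dist_eq, h.dist_eq, he]

theorem lor_eq_of_dist (h : Model p q) {x y x' y' : X} (he : dist x y = dist x' y') :
    lor (p x) (p y) = lor (p x') (p y') := by
  have h1 := h.cosh x y
  have h2 := h.cosh x' y'
  rw [he] at h1
  linarith

theorem exists_isom (h : Model p q) {A : Vec ≃ₗ[ℝ] Vec} (hA : IsLor A) :
    ∃ f : X ≃ᵢ X, ∀ x, p (f x) = A (p x) := by
  refine ⟨IsometryEquiv.mk' (fun x => q (A (p x))) (fun x => q (A.symm (p x))) (fun x => ?_) ?_,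
    fun x => h.pq_hyp (hA.hyp_map _ (h.mem x))⟩
  · apply h.inj
    rw [h.pq_hyp (hA.hyp_map _ (h.mem _)), h.pq_hyp (hA.symm.hyp_map _ (h.mem _)),
      A.apply_symm_apply]
  · refine Isometry.of_dist_eq fun x y => h.dist_eq_of_lor ?_
    rw [h.pq_hyp (hA.hyp_map _ (h.mem _)), h.pq_hyp (hA.hyp_map _ (h.mem _)), hA.lor_map]

theorem exists_reflection (h : Model p q) {w : Vec} (hw : lor w w = 1) :
    ∃ σ : X ≃ᵢ X, IsReflection σ ∧ ∀ x, p (σ x) = p x - (2 * lor (p x) w) • w := by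
  obtain ⟨R, hR, hRw⟩ := exists_lor_reflection hw
  obtain ⟨σ, hσ⟩ := h.exists_isom hR
  have hσ' : ∀ x, p (σ x) = p x - (2 * lor (p x) w) • w := fun x => by rw [hσ, hRw]
  have hw0 : w ≠ 0 := by rintro rfl; simp at hw
  have hfix : ∀ x, σ x ≠ x ↔ lor (p x) w ≠ 0 := fun x => by
    refine not_congr ⟨fun he => ?_, fun he => h.inj (by rw [hσ', he]; simp)⟩
    have := hσ' x
    rw [he, eq_comm, sub_eq_self, smul_eq_zero] at this
    simpa using this.resolve_right hw0
  obtain ⟨E, e2, hf⟩ := exists_oframe_of_unit hw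
  have s2 := Real.mul_self_sqrt (zero_le_two (α := ℝ))
  have hpt : ∀ y : ℝ, y ^ 2 = 1 → ∃ x, lor (p x) w = y := fun y hy => by
    refine ⟨q (Real.sqrt 2 • E + y • w + (0 : ℝ) • e2), ?_⟩
    rw [h.pq_hyp (hf.comb_mem_Hyp (by positivity) (by rw [hy]; norm_num)), hf.lor_comb_e1]
  obtain ⟨x1, hx1⟩ := hpt 1 (by norm_num)
  obtain ⟨x2, hx2⟩ := hpt (-1) (by norm_num)
  refine ⟨σ, ⟨?_, ?_, ?_⟩, hσ'⟩
  · ext x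
    apply h.inj
    change p (σ (σ x)) = p x
    rw [hσ', hσ', lor_sub_left, lor_smul_left, hw]
    module
  · rintro rfl
    exact (hfix x1).2 (by rw [hx1]; norm_num) rfl
  · intro hpre
    have hc : Continuous fun x => lor (p x) w := by have := h.continuous_p; fun_prop
    obtain ⟨y, -, hy1, hy2⟩ := hpre {x | 0 < lor (p x) w} {x | lor (p x) w < 0}
      (isOpen_lt continuous_const hc) (isOpen_lt hc continuous_const)
      (fun x hx => by
        rcases ((hfix x).1 hx).lt_or_gt with h1 | h1
        · exact Or.inr h1
        · exact Or.inl h1)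
      ⟨x1, (hfix x1).2 (by rw [hx1]; norm_num), by rw [mem_ofPred_eq, hx1]; norm_num⟩
      ⟨x2, (hfix x2).2 (by rw [hx2]; norm_num), by rw [mem_ofPred_eq, hx2]; norm_num⟩
    exact lt_asymm (show 0 < lor (p y) w from hy1) hy2

theorem folds_step (h : Model p q) {f : X ≃ᵢ X} (a : X) (S : Set X) (hS : ∀ s ∈ S, f s = s)
    (hf : ∀ g : X ≃ᵢ X, (∀ s ∈ insert a S, g s = s) → Folds p g) : Folds p f := by
  by_cases hfa : f a = a
  · refine hf f fun s hs => ?_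
    rcases hs with rfl | hs
    exacts [hfa, hS s hs]
  have hne : p a ≠ p (f.symm a) := fun he => hfa (by
    have := h.inj he
    conv_lhs => rw [this, f.apply_symm_apply])
  obtain ⟨w, c, hw, hwc, hsw⟩ := exists_swap (h.mem a) (h.mem (f.symm a)) hne
  obtain ⟨σ, hσ, hσw⟩ := h.exists_reflection hw
  obtain ⟨R, hR, hRw⟩ := exists_lor_reflection hw
  have hσa : σ a = f.symm a := h.inj (by rw [hσw, hsw])
  have hσs : ∀ s ∈ S, σ s = s := fun s hs => h.inj (by
    have : lor (p s) w = 0 := by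
      rw [hwc, lor_smul_right, lor_sub_right]
      have : lor (p s) (p (f.symm a)) = lor (p s) (p a) := by
        refine h.lor_eq_of_dist ?_
        conv_rhs => rw [← f.symm.dist_eq, ← hS s hs, f.symm_apply_apply]
      rw [this, sub_self, mul_zero]
    rw [hσw, this]; simp)
  have hσσ : ∀ x, σ (σ x) = x := fun x => congrFun (congrArg DFunLike.coe hσ.1) x
  obtain ⟨⟨A, hA, hAp⟩, l, hl, hle⟩ := hf (σ.trans f) fun s hs => by
    change f (σ s) = s
    rcases hs with rfl | hs
    · rw [hσa, f.apply_symm_apply]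
    · rw [hσs s hs, hS s hs]
  have hfe : f = σ.trans (σ.trans f) := by
    ext x
    change f x = f (σ (σ x))
    rw [hσσ]
  refine ⟨⟨R.trans A, hR.trans hA, fun x => ?_⟩, σ :: l, ?_, ?_⟩
  · rw [LinearEquiv.trans_apply, hRw, ← hσw, ← hAp]
    change p (f x) = p (f (σ (σ x)))
    rw [hσσ]
  · intro τ hτ
    rcases List.mem_cons.1 hτ with rfl | hτ
    exacts [hσ, hl τ hτ]
  · rw [List.foldr_cons, ← hle]
    exact hfe

theorem folds (h : Model p q) (f : X ≃ᵢ X) : Folds p f := by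
  have s2 := Real.mul_self_sqrt (zero_le_two (α := ℝ))
  have m0 : ((1, 0, 0) : Vec) ∈ Hyp := by simp [Hyp, lor]
  have m1 : ((Real.sqrt 2, 1, 0) : Vec) ∈ Hyp := by simp [Hyp, lor]; norm_num
  have m2 : ((Real.sqrt 2, 0, 1) : Vec) ∈ Hyp := by simp [Hyp, lor]; norm_num
  refine h.folds_step (q (1, 0, 0)) ∅ (by simp) fun f hf => ?_
  refine h.folds_step (q (Real.sqrt 2, 1, 0)) _ hf fun f hf => ?_
  refine h.folds_step (q (Real.sqrt 2, 0, 1)) _ hf fun f hf => ?_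
  have hid : f = IsometryEquiv.refl X := by
    ext x
    apply h.inj
    change p (f x) = p x
    have key : ∀ z ∈ Hyp, f (q z) = q z → lor (p (f x)) z = lor (p x) z := fun z hz hfz => by
      have := h.lor_eq_of_dist (f.dist_eq x (q z))
      rwa [hfz, h.pq_hyp hz] at this
    have k0 := key _ m0 (hf _ (by simp))
    have k1 := key _ m1 (hf _ (by simp))
    have k2 := key _ m2 (hf _ (by simp))
    simp only [lor, mul_zero, zero_add, add_zero, mul_one, zero_sub, neg_inj] at k0 k1 k2
    rw [k0] at k1 k2
    exact vec_ext k0 (by linarith) (by linarith)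
  subst hid
  exact ⟨⟨LinearEquiv.refl ℝ Vec, IsLor.refl, fun x => rfl⟩, [], by simp, rfl⟩

theorem exists_op (h : Model p q) {G : Vec ≃ₗ[ℝ] Vec} (hG : IsLor G) {w : Vec} (hw : lor w w = 1) :
    ∃ (φ : X ≃ᵢ X) (H : Vec ≃ₗ[ℝ] Vec), OrientationPreserving φ ∧ IsLor H ∧
      (∀ x, p (φ x) = H (p x)) ∧ ((∀ u, H u = G u) ∨ ∀ u, H u = G (u - (2 * lor u w) • w)) := by
  obtain ⟨f, hf⟩ := h.exists_isom hG
  obtain ⟨-, l, hl, hle⟩ := h.folds f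
  rcases Nat.even_or_odd l.length with he | ho
  · exact ⟨f, G, ⟨l, hl, he, hle⟩, hG, hf, Or.inl fun _ => rfl⟩
  · obtain ⟨σ, hσ, hσw⟩ := h.exists_reflection hw
    obtain ⟨R, hR, hRw⟩ := exists_lor_reflection hw
    refine ⟨σ.trans f, R.trans G, ⟨σ :: l, ?_, ?_, ?_⟩, hR.trans hG, fun x => ?_,
      Or.inr fun u => ?_⟩
    · intro τ hτ
      rcases List.mem_cons.1 hτ with rfl | hτ
      exacts [hσ, hl τ hτ]
    · rw [List.length_cons]; exact ho.add_one
    · rw [List.foldr_cons, ← hle]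
    · change p (f (σ x)) = _
      rw [hf, hσw, LinearEquiv.trans_apply, hRw]
    · rw [LinearEquiv.trans_apply, hRw]

theorem body_image (h : Model p q) {f : X ≃ᵢ X} {A : Vec ≃ₗ[ℝ] Vec} (hA : IsLor A)
    (hf : ∀ x, p (f x) = A (p x)) (K : Set X) : body q (f '' K) = A '' body q K := by
  have hF : ∀ {B : Vec ≃ₗ[ℝ] Vec}, IsLor B → ∀ z ∈ Fut, B z ∈ Fut := fun {B} hB z hz => by
    rw [← sqrt_smul_nrm hz, map_smul]
    exact Fut_smul (Hyp_subset_Fut (hB.hyp_map _ (nrm_mem hz))) (sqrt_lor_pos hz)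
  have hq : ∀ z ∈ Fut, q (A z) = f (q z) := fun z hz => by
    apply h.inj
    rw [hf, h.pq z hz, h.pq _ (hF hA z hz), nrm, nrm, hA.lor_map, map_smul]
  ext z
  constructor
  · rintro ⟨hz, x, hx, hxz⟩
    refine ⟨A.symm z, ⟨hF hA.symm z hz, ?_⟩, A.apply_symm_apply z⟩
    have := hq _ (hF hA.symm z hz)
    rw [A.apply_symm_apply, ← hxz] at this
    rwa [← f.injective this]
  · rintro ⟨y, ⟨hy, hyK⟩, rfl⟩
    exact ⟨hF hA y hy, q y, hyK, (hq y hy).symm⟩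

/-- The congruence condition in the hyperboloid model, up to a reflection. -/
theorem exists_cond (h : Model p q) {K L : Set X} (hKL : T5Cond1 K L) {G : Vec ≃ₗ[ℝ] Vec}
    (hG : IsLor G) {w : Vec} (hw : lor w w = 1) :
    ∃ H : Vec ≃ₗ[ℝ] Vec, IsLor H ∧
      ((∀ u, H u = G u) ∨ ∀ u, H u = G (u - (2 * lor u w) • w)) ∧
      ((interior (body q K ∩ H '' body q L)).Nonempty → ∃ A : Vec ≃ₗ[ℝ] Vec, IsLor A ∧
        A ≠ LinearEquiv.refl ℝ Vec ∧
        A '' (body q K ∩ H '' body q L) = body q K ∩ H '' body q L) := by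
  obtain ⟨ψ, H, hψ, hG', hψp, hor⟩ := h.exists_op hG hw
  refine ⟨H, hG', hor, fun hne => ?_⟩
  have hrefl : ⇑(IsometryEquiv.refl X) '' K = K := by
    change id '' K = K
    rw [image_id]
  have e : body q (⇑(IsometryEquiv.refl X) '' K ∩ ψ '' L) = body q K ∩ H '' body q L := by
    rw [hrefl, body_inter, h.body_image hG' hψp]
  rw [← e, h.interior_body, h.body_nonempty] at hne
  obtain ⟨f, hf, hfM⟩ := hKL (IsometryEquiv.refl X) ψ ⟨[], by simp, by simp, rfl⟩ hψ hne
  obtain ⟨⟨A, hA, hfA⟩, -⟩ := h.folds f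
  refine ⟨A, hA, ?_, ?_⟩
  · rintro rfl
    exact hf (by ext x; exact h.inj (hfA x))
  · rw [← e, ← h.body_image hA hfA, hfM]

theorem linCond (h : Model p q) {K L : Set X} (hKL : T5Cond1 K L) :
    LinCond (body q K) (body q L) := by
  intro s P Q n P' Q' n' hc hc'
  obtain ⟨G, hG, hP, hQ, hn⟩ := hc'.exists_map hc.neg
  have hne : P' ≠ Q' := fun he => by
    have := hc'.hPQ
    rw [he, hc'.hQ.1] at this
    linarith [hc'.hs]
  obtain ⟨w, c, hw, hwc, hsw⟩ := exists_swap hc'.hP hc'.hQ hne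
  obtain ⟨R, hR, hRw⟩ := exists_lor_reflection hw
  have hRP : R P' = Q' := by rw [hRw, hsw]
  have hRQ : R Q' = P' := by
    rw [← hRP, hRw, hRw, lor_sub_left, lor_smul_left, hw]
    module
  have hRn : R n' = n' := by
    have : lor n' w = 0 := by
      rw [hwc, lor_smul_right, lor_sub_right, lor_comm, hc'.hQn, lor_comm, hc'.hPn]; ring
    rw [hRw, this]; simp
  obtain ⟨H, hG', hor, hcond⟩ := h.exists_cond hKL hG hw
  refine ⟨H, hG', ?_, ?_, hcond⟩
  · rcases hor with ho | ho
    · rw [ho, hn]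
    · rw [ho, ← hRw, hRn, hn]
  · rcases hor with ho | ho
    · left; rw [ho, ho]; exact ⟨hP, hQ⟩
    · right; rw [ho, ho, ← hRw, ← hRw, hRP, hRQ]; exact ⟨hQ, hP⟩

end Model

theorem T5Cond1.symm {K L : Set X} (h : T5Cond1 K L) : T5Cond1 L K := fun φ ψ hφ hψ hne => by
  rw [inter_comm] at hne ⊢
  exact h ψ φ hψ hφ hne

/-! ### Recognising discs, paraballs, hypercycle domains and half-planes -/

theorem exists_foot {w v : Vec} (hw : w ∈ Hyp) (hv : lor v v = 1) :
    ∃ f ∈ Hyp, lor f v = 0 ∧ w = Real.sqrt (1 + lor w v ^ 2) • f + lor w v • v := by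
  set a := lor w v with ha
  have hs : 0 < Real.sqrt (1 + a ^ 2) := Real.sqrt_pos.2 (by positivity)
  have hs2 : Real.sqrt (1 + a ^ 2) ^ 2 = 1 + a ^ 2 := Real.sq_sqrt (by positivity)
  refine ⟨(Real.sqrt (1 + a ^ 2))⁻¹ • (w - a • v), mem_Hyp_of_lor_neg ?_ hw ?_, ?_, ?_⟩
  · simp only [lor_sub_left, lor_sub_right, lor_smul_left, lor_smul_right, hw.1, hv,
      lor_comm v w, ← ha]
    field_simp
    rw [hs2]; ring
  · simp only [lor_sub_left, lor_smul_left, hw.1, lor_comm v w, ← ha]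
    have : -1 - a * a < 0 := by nlinarith
    exact mul_neg_of_pos_of_neg (inv_pos.2 hs) this
  · simp only [lor_sub_left, lor_smul_left, hv, ← ha]; ring
  · rw [smul_inv_smul₀ hs.ne', sub_add_cancel]

theorem OFrame.lor_ray_neg {E e1 e2 : Vec} (hf : OFrame E e1 e2) {a : ℝ} (ha : a ^ 2 ≤ 1) {y : Vec}
    (hy : y ∈ Hyp) : lor y (E + a • e1) < 0 := by
  obtain ⟨x, b, z, hx, he, rfl⟩ := hf.exists_comb hy
  rw [lor_add_right, lor_smul_right, hf.lor_comb_E, hf.lor_comb_e1]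
  nlinarith [sq_nonneg (x - a * b), sq_nonneg b, sq_nonneg z, mul_nonneg (sub_nonneg.2 ha)
    (sq_nonneg b)]

namespace Model

variable {p : X → Vec} {q : Vec → X} {K : Set X}

theorem isDisc (h : Model p q) {E : Vec} {t : ℝ} (hE : E ∈ Hyp) (ht : 1 < t)
    (hK : ∀ x, x ∈ K ↔ -lor (p x) E ≤ t) : IsDisc K := by
  refine ⟨q E, Real.arcosh t, Real.arcosh_pos ht, ?_⟩
  ext x
  rw [mem_closedBall, h.dist_eq, h.pq_hyp hE,
    Real.arcosh_le_arcosh (by linarith [hyp_lor_le (h.mem x) hE]) (by linarith), hK]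

theorem isParaball (h : Model p q) {E e1 e2 : Vec} (hf : OFrame E e1 e2)
    (hK : ∀ x, x ∈ K ↔ -lor (p x) (E + e1) ≤ 1) : IsParaball K := by
  have hm : ∀ s : ℝ, Real.cosh s • E + Real.sinh s • e1 + (0 : ℝ) • e2 ∈ Hyp := fun s =>
    hf.comb_mem_Hyp (Real.cosh_pos s) (by rw [Real.cosh_sq]; ring)
  have hlim : ∀ x, Tendsto
      (fun t => dist x (q (Real.cosh t • E + Real.sinh t • e1 + (0 : ℝ) • e2)) - t) atTop
      (nhds (Real.log (-lor (p x) (E + e1)))) := fun x => by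
    have hA := hf.lor_ray_neg (a := 1) (by norm_num) (h.mem x)
    rw [one_smul] at hA
    set A := -lor (p x) (E + e1) with hAd
    set B := -lor (p x) (E - e1) with hBd
    have h0 : Tendsto (fun t : ℝ => Real.exp (-t)) atTop (nhds 0) :=
      Real.tendsto_exp_neg_atTop_nhds_zero
    have hA0 : 0 < A := by linarith
    have e1' : A = (A + B * 0 ^ 2) / 2 + Real.sqrt (((A + B * 0 ^ 2) / 2) ^ 2 - 0 ^ 2) := by
      have : ((A + B * 0 ^ 2) / 2) ^ 2 - 0 ^ 2 = (A / 2) ^ 2 := by ring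
      rw [this, Real.sqrt_sq (by linarith)]; ring
    have hcl : Tendsto (fun t : ℝ => Real.log ((A + B * Real.exp (-t) ^ 2) / 2 +
        Real.sqrt (((A + B * Real.exp (-t) ^ 2) / 2) ^ 2 - Real.exp (-t) ^ 2))) atTop
        (nhds (Real.log A)) := by
      have hc : Continuous fun r : ℝ => (A + B * r ^ 2) / 2 +
        Real.sqrt (((A + B * r ^ 2) / 2) ^ 2 - r ^ 2) := by fun_prop
      have := (hc.tendsto 0).comp h0
      rw [← e1'] at this
      exact this.log hA0.ne'
    refine hcl.congr fun t => ?_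
    rw [h.dist_eq, h.pq_hyp (hm t)]
    set u := -lor (p x) (Real.cosh t • E + Real.sinh t • e1 + (0 : ℝ) • e2) with hu
    have hu1 : 1 ≤ u := by linarith [hyp_lor_le (h.mem x) (hm t)]
    have hr := Real.exp_pos (-t)
    have hrt : Real.exp (-t) * Real.exp t = 1 := by rw [← Real.exp_add]; simp
    have hv : (A + B * Real.exp (-t) ^ 2) / 2 = Real.exp (-t) * u := by
      simp only [hu, hAd, hBd, lor_add_right, lor_sub_right, lor_smul_right, Real.cosh_eq,
        Real.sinh_eq]
      linear_combination ((lor (p x) E + lor (p x) e1) / 2) * hrt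
    have hw : (Real.exp (-t) * u) ^ 2 - Real.exp (-t) ^ 2 = Real.exp (-t) ^ 2 * (u ^ 2 - 1) := by
      ring
    rw [hv, hw, Real.sqrt_mul (sq_nonneg _), Real.sqrt_sq hr.le, ← mul_add,
      Real.log_mul hr.ne' (by positivity), Real.log_exp, Real.arcosh]
    ring
  refine ⟨fun s => q (Real.cosh s • E + Real.sinh s • e1 + (0 : ℝ) • e2), ?_, ?_⟩
  · refine Isometry.of_dist_eq fun s t => ?_
    rw [h.dist_eq, h.pq_hyp (hm s), h.pq_hyp (hm t), hf.lor_comb, Real.dist_eq]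
    have : -(-(Real.cosh s * Real.cosh t) + Real.sinh s * Real.sinh t + 0 * 0) =
        Real.cosh |s - t| := by
      rw [Real.cosh_abs, Real.cosh_sub]; ring
    rw [this, Real.arcosh_cosh (abs_nonneg _)]
  · ext x
    have hA := hf.lor_ray_neg (a := 1) (by norm_num) (h.mem x)
    rw [one_smul] at hA
    rw [hK]
    constructor
    · intro hx
      exact ⟨_, Real.log_nonpos (by linarith) hx, hlim x⟩
    · rintro ⟨b, hb, hbt⟩
      rw [tendsto_nhds_unique hbt (hlim x)] at hb
      exact (Real.log_nonpos_iff (by linarith)).1 hb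

theorem isHalfspace (h : Model p q) {v : Vec} (hv : lor v v = 1)
    (hK : ∀ x, x ∈ K ↔ lor (p x) v ≤ 0) : IsHalfspace K := by
  obtain ⟨σ, hσ, hσv⟩ := h.exists_reflection hv
  have hl : ∀ x, lor (p (σ x)) v = -lor (p x) v := fun x => by
    rw [hσv, lor_sub_left, lor_smul_left, hv]; ring
  have hσσ : ∀ x, σ (σ x) = x := fun x => by
    have := congrArg (fun f : X ≃ᵢ X => f x) hσ.1
    exact this
  have him : ∀ x, x ∈ σ '' K ↔ 0 ≤ lor (p x) v := fun x => by
    constructor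
    · rintro ⟨y, hy, rfl⟩
      rw [hl]; linarith [(hK y).1 hy]
    · intro hx
      exact ⟨σ x, (hK _).2 (by rw [hl]; linarith), hσσ x⟩
  have hv0 : v ≠ 0 := by rintro rfl; simp at hv
  refine ⟨σ, hσ, ?_, ?_, ?_⟩
  · have : K = {x | lor (p x) v ≤ 0} := by ext x; exact hK x
    rw [this]
    have := h.continuous_p
    exact isClosed_le (by fun_prop) continuous_const
  · ext x
    rw [mem_union, hK, him]
    exact iff_true_intro (le_total _ _)
  · ext x
    rw [mem_inter_iff, hK, him, ← le_antisymm_iff]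
    refine ⟨fun hx => h.inj (by rw [hσv, hx]; simp), fun hx => ?_⟩
    have hx : σ x = x := hx
    have := hl x
    rw [hx] at this
    linarith

theorem isHypercycleDomain (h : Model p q) {v : Vec} {t : ℝ} (hv : lor v v = 1) (ht : 0 < t)
    (hK : ∀ x, x ∈ K ↔ lor (p x) v ≤ t) : IsHypercycleDomain K := by
  have hs : ∀ a : ℝ, 1 ≤ Real.sqrt (1 + a ^ 2) := fun a => by
    rw [Real.one_le_sqrt]; nlinarith
  have hpos : ∀ a : ℝ, 0 < Real.sqrt (1 + a ^ 2) := fun a => by linarith [hs a]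
  refine ⟨{x | lor (p x) v ≤ 0}, Real.arcosh (Real.sqrt (1 + t ^ 2)),
    h.isHalfspace hv fun x => Iff.rfl, Real.arcosh_pos ?_, ?_⟩
  · rw [Real.lt_sqrt one_pos.le]; nlinarith
  obtain ⟨E, e2, hf⟩ := exists_oframe_of_unit hv
  have hne : {x | lor (p x) v ≤ 0}.Nonempty :=
    ⟨q E, by rw [mem_ofPred_eq, h.pq_hyp hf.hE, hf.h1]⟩
  ext x
  rw [mem_ofPred_eq, hK]
  obtain ⟨f, hfH, hfv, hfx⟩ := exists_foot (h.mem x) hv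
  constructor
  · intro hx
    rcases le_or_gt (lor (p x) v) 0 with h0 | h0
    · rw [infDist_zero_of_mem (by exact h0)]
      exact Real.arcosh_nonneg (hs t)
    · refine (infDist_le_dist_of_mem (y := q f) ?_).trans ?_
      · rw [mem_ofPred_eq, h.pq_hyp hfH, hfv]
      · rw [h.dist_eq, h.pq_hyp hfH, Real.arcosh_le_arcosh
          (by linarith [hyp_lor_le (h.mem x) hfH]) (hpos t)]
        have : -lor (p x) f = Real.sqrt (1 + lor (p x) v ^ 2) := by
          conv_lhs => rw [hfx]
          rw [lor_add_left, lor_smul_left, lor_smul_left, hfH.1, lor_comm v f, hfv]; ring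
        rw [this]
        exact Real.sqrt_le_sqrt (by nlinarith)
  · intro hx
    by_contra! hlt
    have h1 : Real.arcosh (Real.sqrt (1 + lor (p x) v ^ 2)) ≤ infDist x {x | lor (p x) v ≤ 0} := by
      refine (le_infDist hne).2 fun y hy => ?_
      have hy : lor (p y) v ≤ 0 := hy
      rw [h.dist_eq, Real.arcosh_le_arcosh (hpos _)
        (by linarith [hyp_lor_le (h.mem x) (h.mem y)])]
      obtain ⟨g, hgH, hgv, hgy⟩ := exists_foot (h.mem y) hv
      have : lor (p x) (p y) = Real.sqrt (1 + lor (p x) v ^ 2) *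
          (Real.sqrt (1 + lor (p y) v ^ 2) * lor f g) + lor (p x) v * lor (p y) v := by
        conv_lhs => rw [hfx, hgy]
        simp only [lor_add_left, lor_add_right, lor_smul_left, lor_smul_right, hv, hfv,
          lor_comm v g, hgv]
        ring
      have h2 : 1 ≤ Real.sqrt (1 + lor (p y) v ^ 2) * -lor f g :=
        one_le_mul_of_one_le_of_one_le (hs _) (by linarith [hyp_lor_le hfH hgH])
      have h3 := mul_le_mul_of_nonneg_left h2 (hpos (lor (p x) v)).le
      have h4 := mul_nonneg (ht.trans hlt).le (neg_nonneg.2 hy)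
      rw [this]
      linarith
    refine (h1.trans hx).not_gt ((Real.arcosh_lt_arcosh (hpos _) (hpos _)).2 ?_)
    exact Real.sqrt_lt_sqrt (by positivity) (by nlinarith)

theorem caseABody (h : Model p q) (hC : Form (body q K)) : CaseABody K := by
  rcases hC with ⟨E, t, hE, ht, hh⟩ | ⟨E, e1, e2, hf, hh⟩ | ⟨v, t, hv, ht, hh⟩
  · exact Or.inl (h.isDisc hE ht fun x => by rw [← hh _ (h.mem x), h.mem_body])
  · exact Or.inr (Or.inl (h.isParaball hf fun x => by rw [← hh _ (h.mem x), h.mem_body]))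
  · have hK : ∀ x, x ∈ K ↔ lor (p x) v ≤ t := fun x => by rw [← hh _ (h.mem x), h.mem_body]
    rcases ht.eq_or_lt with rfl | ht
    · exact Or.inr (Or.inr (Or.inr (h.isHalfspace hv hK)))
    · exact Or.inr (Or.inr (Or.inl (h.isHypercycleDomain hv ht hK)))

/-- Two congruent copies of a disc or a paraball never cover the plane. -/
theorem not_cover (h : Model p q) {E e1 e2 : Vec} (hf : OFrame E e1 e2) {a t : ℝ} (ha : a ^ 2 ≤ 1)
    (hK : ∀ x, x ∈ K → -lor (p x) (E + a • e1) ≤ t) (f : X ≃ᵢ X) : K ∪ f '' K ≠ univ := by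
  intro hu
  obtain ⟨⟨A, hA, hfA⟩, -⟩ := h.folds f
  set m := A (E + a • e1) with hm
  have hf0 : lor E m < 0 := by
    have := hA.lor_map (A.symm E) (E + a • e1)
    rw [A.apply_symm_apply] at this
    rw [hm, this]
    exact hf.lor_ray_neg ha (hA.symm.hyp_map _ hf.hE)
  obtain ⟨z, hz, hz1, hz2⟩ : ∃ z : ℝ, t < |z| ∧ t < -lor E m * |z| ∧ 0 ≤ -(z * lor e2 m) := by
    have key : ∀ r : ℝ, |t| + 1 + (|t| + 1) / -lor E m = |r| → t < |r| ∧ t < -lor E m * |r| := by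
      intro r hr
      have h1 : 0 < (|t| + 1) / -lor E m := div_pos (by positivity) (by linarith)
      rw [← hr]
      refine ⟨by linarith [le_abs_self t], ?_⟩
      rw [mul_add, mul_div_cancel₀ _ (by linarith : -lor E m ≠ 0)]
      nlinarith [le_abs_self t, abs_nonneg t]
    have h0 : 0 ≤ |t| + 1 + (|t| + 1) / -lor E m :=
      add_nonneg (by positivity) (div_nonneg (by positivity) (by linarith))
    rcases le_total 0 (lor e2 m) with he | he
    · obtain ⟨k1, k2⟩ := key (-(|t| + 1 + (|t| + 1) / -lor E m)) (by
        rw [abs_neg, abs_of_nonneg h0])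
      exact ⟨_, k1, k2, by rw [neg_mul, neg_neg]; exact mul_nonneg h0 he⟩
    · obtain ⟨k1, k2⟩ := key (|t| + 1 + (|t| + 1) / -lor E m) (by rw [abs_of_nonneg h0])
      exact ⟨_, k1, k2, by rw [← mul_neg]; exact mul_nonneg h0 (by linarith)⟩
  have hy : Real.sqrt (1 + z ^ 2) • E + (0 : ℝ) • e1 + z • e2 ∈ Hyp :=
    hf.comb_mem_Hyp (Real.sqrt_pos.2 (by positivity)) (by rw [Real.sq_sqrt (by positivity)]; ring)
  have hsz : |z| ≤ Real.sqrt (1 + z ^ 2) := Real.abs_le_sqrt (by linarith)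
  set y := Real.sqrt (1 + z ^ 2) • E + (0 : ℝ) • e1 + z • e2 with hyd
  have hmem : q y ∈ K ∪ f '' K := hu ▸ mem_univ _
  rcases hmem with hyK | ⟨x, hx, hxy⟩
  · have := hK _ hyK
    rw [h.pq_hyp hy, lor_add_right, lor_smul_right, hf.lor_comb_E, hf.lor_comb_e1] at this
    linarith
  · have h1 := hK _ hx
    have h2 : p (f x) = y := by rw [hxy, h.pq_hyp hy]
    rw [← hA.lor_map, ← hfA, h2, ← hm, hyd] at h1
    simp only [lor_add_left, lor_smul_left] at h1
    nlinarith

theorem space_form (h : Model p q) (hC : Form (body q K))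
    (hK : IsHypercycleDomain K ∨ IsHalfspace K) :
    ∃ v t, lor v v = 1 ∧ 0 ≤ t ∧ ∀ y ∈ Hyp, y ∈ body q K ↔ lor y v ≤ t := by
  obtain ⟨σ, hσ⟩ : ∃ σ : X ≃ᵢ X, K ∪ σ '' K = univ := by
    rcases hK with ⟨P, l, ⟨σ, -, -, hP, -⟩, hl, rfl⟩ | ⟨σ, -, -, hP, -⟩
    · have hPK : P ⊆ {x | infDist x P ≤ l} := fun x hx => by
        rw [mem_ofPred_eq, infDist_zero_of_mem hx]; exact hl.le
      exact ⟨σ, univ_subset_iff.1 (hP ▸ union_subset_union hPK (image_mono hPK))⟩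
    · exact ⟨σ, hP⟩
  rcases hC with ⟨E, t, hE, ht, hh⟩ | ⟨E, e1, e2, hf, hh⟩ | ⟨v, t, hv, ht, hh⟩
  · obtain ⟨e1, e2, hf⟩ := exists_oframe_of_hyp hE
    refine absurd hσ (h.not_cover hf (a := 0) (t := t) (by norm_num) (fun x hx => ?_) σ)
    rw [zero_smul, add_zero]
    exact (hh _ (h.mem x)).1 (h.mem_body.2 hx)
  · refine absurd hσ (h.not_cover hf (a := 1) (t := 1) (by norm_num) (fun x hx => ?_) σ)
    rw [one_smul]
    exact (hh _ (h.mem x)).1 (h.mem_body.2 hx)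
  · exact ⟨v, t, hv, ht, hh⟩

end Model

/-! ### Rigid intersections of two sublevel sets -/

section rigid

variable {C D : Set Vec} {v v' : Vec} {t t' : ℝ}

theorem IsBody.mem_interior_of_lt (hC : IsBody C) (hh : ∀ y ∈ Hyp, y ∈ C ↔ lor y v ≤ t) {y : Vec}
    (hy : y ∈ Hyp) (hyt : lor y v < t) : y ∈ interior C := by
  have hc : ContinuousOn (fun z => lor (nrm z) v) Fut := by
    have := continuousOn_nrm
    exact continuousOn_lor_comp this continuousOn_const
  have ho : IsOpen (Fut ∩ (fun z => lor (nrm z) v) ⁻¹' Iio t) :=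
    hc.isOpen_inter_preimage isOpen_Fut isOpen_Iio
  refine interior_maximal (fun z hz => ?_) ho ⟨Hyp_subset_Fut hy, ?_⟩
  · rw [← sqrt_smul_nrm hz.1]
    exact hC.smul _ (sqrt_lor_pos hz.1) _ ((hh _ (nrm_mem hz.1)).2 (le_of_lt hz.2))
  · rw [mem_preimage, nrm_of_hyp hy]; exact hyt

theorem IsBody.lor_eq_of_Bd (hC : IsBody C) (hh : ∀ y ∈ Hyp, y ∈ C ↔ lor y v ≤ t) {y : Vec}
    (hy : y ∈ Bd C) : lor y v = t :=
  ((hh y hy.1).1 hy.2.1).antisymm (not_lt.1 fun h => hy.2.2 (hC.mem_interior_of_lt hh hy.1 h))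

theorem Level.mem_Bd {J : Set ℝ} {F : ℝ × ℝ → Vec} (h : Level v J F)
    (hh : ∀ y ∈ Hyp, y ∈ C ↔ lor y v ≤ t) (hJ : Ioi t ⊆ J) {y : Vec} (hy : y ∈ Hyp)
    (hyt : lor y v = t) : y ∈ Bd C := by
  refine ⟨hy, (hh y hy).2 hyt.le, fun hi => ?_⟩
  obtain ⟨z, hz, hzH, hzt⟩ := mem_closure_iff.1 (h.mem_closure hJ hy
    (by rw [hyt, closure_Ioi]; exact self_mem_Ici)) _ isOpen_interior hi
  exact (not_le.2 hzt) ((hh z hzH).1 (interior_subset hz))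

/-- A symmetry of an intersection of two sublevel sets fixes the first functional. -/
theorem symm_fixes (hC : IsBody C) (hD : IsBody D) (hCh : ∀ y ∈ Hyp, y ∈ C ↔ lor y v ≤ t)
    (hDh : ∀ y ∈ Hyp, y ∈ D ↔ lor y v' ≤ t') (hv : v ≠ 0) (ht : t ≠ 0 ∨ lor v v ≠ 0)
    (hns : ∀ c, lor v' v' = c ^ 2 * lor v v → t' ≠ c * t) {y1 y2 : Vec} (hy1 : y1 ∈ Bd C)
    (hy1D : y1 ∈ interior D) (hy2 : y2 ∈ Hyp) (hy2D : y2 ∈ D) (hy2C : lor y2 v < t)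
    {A : Vec ≃ₗ[ℝ] Vec} (hA : IsLor A) (hM : A '' (C ∩ D) = C ∩ D) : A.symm v = v := by
  have hAl : ∀ y u, lor (A y) u = lor y (A.symm u) := fun y u => by
    rw [← hA.lor_map y, A.apply_symm_apply]
  have hAn : ∀ u, lor (A.symm u) (A.symm u) = lor u u := fun u => hA.symm.lor_map u u
  set S := interior D ∩ Bd C with hS
  have hSinf : S.Infinite := Bd_nhds_infinite hC hy1 (isOpen_interior.mem_nhds hy1D)
  have hSv : ∀ y ∈ S, lor y v = t := fun y hy => hC.lor_eq_of_Bd hCh hy.2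
  have hcov : S ⊆ {y ∈ S | lor (A y) v = t} ∪ {y ∈ S | lor (A y) v' = t'} := by
    intro y hy
    have hyM : y ∈ Bd (C ∩ D) := (Bd_inter_iff hy.1).2 hy.2
    rw [← mem_Bd_image hA, hM] at hyM
    obtain ⟨hH, hyCD, hyi⟩ := hyM
    rw [interior_inter, mem_inter_iff, not_and_or] at hyi
    rcases hyi with hi | hi
    · exact Or.inl ⟨hy, hC.lor_eq_of_Bd hCh ⟨hH, hyCD.1, hi⟩⟩
    · exact Or.inr ⟨hy, hD.lor_eq_of_Bd hDh ⟨hH, hyCD.2, hi⟩⟩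
  rcases infinite_union.1 (hSinf.mono hcov) with hi | hi
  · obtain ⟨c, hc, hct⟩ := infinite_plane_unique hi (fun y hy => hy.1.2.1) hv
      (fun y hy => hSv y hy.1) (v' := A.symm v) (t' := t) fun y hy => by rw [← hAl]; exact hy.2
    have hAy2 : lor (A y2) v ≤ t := by
      have : A y2 ∈ C ∩ D := hM ▸ mem_image_of_mem A ⟨(hCh y2 hy2).2 hy2C.le, hy2D⟩
      exact (hCh _ (hA.hyp_map _ hy2)).1 this.1
    rw [hAl, hc, lor_smul_right] at hAy2
    rcases eq_or_ne t 0 with h0 | h0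
    · have h1 := hAn v
      rw [hc, lor_smul_left, lor_smul_right] at h1
      have h2 : c * c = 1 := mul_right_cancel₀ (ht.resolve_left (not_not.2 h0))
        (by rw [mul_assoc, h1, one_mul])
      have h3 : c = 1 := by
        rcases mul_self_eq_one_iff.1 h2 with h | h
        · exact h
        · rw [h] at hAy2; linarith
      rw [hc, h3, one_smul]
    · have : c = 1 := mul_right_cancel₀ h0 (by rw [← hct, one_mul])
      rw [hc, this, one_smul]
  · obtain ⟨c, hc, hct⟩ := infinite_plane_unique hi (fun y hy => hy.1.2.1) hv
      (fun y hy => hSv y hy.1) (v' := A.symm v') (t' := t') fun y hy => by rw [← hAl]; exact hy.2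
    refine absurd hct (hns c ?_)
    rw [← hAn, hc, lor_smul_left, lor_smul_right]; ring

/-- A Lorentz map fixing a degenerate plane is the identity. -/
theorem OFrame.eq_refl_of_fix {E e1 e2 : Vec} (hf : OFrame E e1 e2) {A : Vec ≃ₗ[ℝ] Vec}
    (hA : IsLor A) (h1 : A.symm e1 = e1) (h2 : A.symm (E + e2) = E + e2) :
    A = LinearEquiv.refl ℝ Vec := by
  have hH : ∀ y ∈ Hyp, A y = y := by
    intro y hy
    by_contra hne
    have hpos := hyp_sub_pos hy (hA.hyp_map y hy) (Ne.symm hne)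
    have hl : ∀ u, A.symm u = u → lor (A y - y) u = 0 := fun u hu => by
      rw [lor_sub_left, ← hA.symm.lor_map (A y) u, A.symm_apply_apply, hu, sub_self]
    have k1 := hl _ h1
    have k2 := hl _ h2
    have e := hf.expand (A y - y)
    rw [lor_add_right] at k2
    rw [k1, (by linarith : lor (A y - y) e2 = -lor (A y - y) E)] at e
    rw [e, hf.lor_comb] at hpos
    linarith
  have s2 := Real.mul_self_sqrt (zero_le_two (α := ℝ))
  have s0 : 0 < Real.sqrt 2 := Real.sqrt_pos.2 two_pos
  have hE := hH E hf.hE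
  have he1 := hH _ (hf.comb_mem_Hyp (y := 1) (z := 0) s0 (by rw [pow_two, s2]; norm_num))
  have he2 := hH _ (hf.comb_mem_Hyp (y := 0) (z := 1) s0 (by rw [pow_two, s2]; norm_num))
  simp only [map_add, map_smul, hE, one_smul, zero_smul, add_zero,
    add_left_cancel_iff] at he1 he2
  refine LinearEquiv.ext fun u => ?_
  rw [hf.expand u]
  simp only [map_add, map_smul, hE, he1, he2, LinearEquiv.refl_apply]

end rigid

theorem OFrame.swap {E e1 e2 : Vec} (hf : OFrame E e1 e2) : OFrame E e2 e1 :=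
  ⟨hf.hE, hf.h22, hf.h11, hf.h2, hf.h1, by rw [lor_comm]; exact hf.h12⟩

theorem image_form {D : Set Vec} {v : Vec} {t : ℝ} (hh : ∀ y ∈ Hyp, y ∈ D ↔ lor y v ≤ t)
    {G : Vec ≃ₗ[ℝ] Vec} (hG : IsLor G) : ∀ y ∈ Hyp, y ∈ G '' D ↔ lor y (G v) ≤ t := by
  intro y hy
  obtain ⟨z, rfl⟩ := G.surjective y
  rw [G.injective.mem_set_image, hG.lor_map]
  exact hh z (hG.mem_iff.1 hy)

namespace Model

variable {p : X → Vec} {q : Vec → X} {K L : Set X} {v v0 E e2 : Vec} {t t' : ℝ}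

/-- A suitable relative position of two sublevel sets contradicts the congruence condition. -/
theorem position_false (h : Model p q) (hKL : T5Cond1 K L) (hC : IsBody (body q K))
    (hD : IsBody (body q L)) (hf : OFrame E v e2) (hCh : ∀ y ∈ Hyp, y ∈ body q K ↔ lor y v ≤ t)
    (hDh : ∀ y ∈ Hyp, y ∈ body q L ↔ lor y v0 ≤ t') {G : Vec ≃ₗ[ℝ] Vec} (hG : IsLor G) {w v' : Vec}
    (hw : lor w w = 1) (hwv : lor v0 w = 0) (hv' : G v0 = v') {a b : ℝ}
    (hspan : E + e2 = a • v + b • v') {J : Set ℝ} {F : ℝ × ℝ → Vec} (hL : Level v' J F)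
    (hJ : Ioi t' ⊆ J) (ht' : t' ≠ 0 ∨ lor v' v' ≠ 0) (hv'0 : v' ≠ 0)
    (hns : ∀ c, lor v' v' = c ^ 2 → t' ≠ c * t) (hns' : ∀ c, 1 = c ^ 2 * lor v' v' → t ≠ c * t')
    {y1 y2 : Vec} (hy1 : y1 ∈ Hyp) (hy1v : lor y1 v = t) (hy1v' : lor y1 v' < t')
    (hy2 : y2 ∈ Hyp) (hy2v : lor y2 v < t) (hy2v' : lor y2 v' = t') : False := by
  obtain ⟨H, hG', hor, hcond⟩ := h.exists_cond hKL hG hw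
  have hGv : H v0 = v' := by
    rcases hor with ho | ho
    · rw [ho, hv']
    · rw [ho, hwv]; simpa using hv'
  have hD' : IsBody (H '' body q L) := hD.image hG'
  have hDh' := image_form hDh hG'
  rw [hGv] at hDh'
  have hv0 : v ≠ 0 := by rintro rfl; simpa using hf.h11
  obtain ⟨F', hF'⟩ := hf.level_space
  have b1 : y1 ∈ Bd (body q K) := hF'.mem_Bd hCh (subset_univ _) hy1 hy1v
  have b2 : y2 ∈ Bd (H '' body q L) := hL.mem_Bd hDh' hJ hy2 hy2v'
  have i1 := hD'.mem_interior_of_lt hDh' hy1 hy1v'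
  have i2 := hC.mem_interior_of_lt hCh hy2 hy2v
  obtain ⟨A, hA, hne, hM⟩ := hcond (inter_int_nonempty hC b1.2.1 i1)
  have f1 := symm_fixes hC hD' hCh hDh' hv0 (Or.inr (by rw [hf.h11]; exact one_ne_zero))
    (by simpa only [hf.h11, mul_one] using hns) b1 i1 hy2 b2.2.1 hy2v hA hM
  rw [inter_comm] at hM
  have f2 := symm_fixes hD' hC hDh' hCh hv'0 ht' (by rwa [hf.h11]) b2 i2 hy1 b1.2.1 hy1v' hA hM
  exact hne (hf.eq_refl_of_fix hA f1 (by rw [hspan, map_add, map_smul, map_smul, f1, f2]))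

theorem space_space (h : Model p q) (hKL : T5Cond1 K L) (hC : IsBody (body q K))
    (hD : IsBody (body q L)) (hv : lor v v = 1) (hv0 : lor v0 v0 = 1) (ht : 0 ≤ t) (ht' : 0 ≤ t')
    (hCh : ∀ y ∈ Hyp, y ∈ body q K ↔ lor y v ≤ t)
    (hDh : ∀ y ∈ Hyp, y ∈ body q L ↔ lor y v0 ≤ t') : t = t' := by
  by_contra hne
  obtain ⟨E, e2, hf⟩ := exists_oframe_of_unit hv
  obtain ⟨E0, w, hf0⟩ := exists_oframe_of_unit hv0
  have hn : ∀ y ∈ Hyp, lor y (E + e2) < 0 := fun y hy => by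
    simpa using hf.swap.lor_ray_neg (a := 1) (by norm_num) hy
  have hv' : lor (E + e2 - v) (E + e2 - v) = 1 := by
    simp only [lor_add_left, lor_add_right, lor_sub_left, lor_sub_right, hf.hE.1, hf.h11, hf.h22,
      hf.h1, hf.h2, hf.h12, lor_comm e2 E, lor_comm v E, lor_comm e2 v]
    ring
  obtain ⟨E', e', hf'⟩ := exists_oframe_of_unit hv'
  obtain ⟨G, hG, -, hGv, -⟩ := hf0.exists_map hf'
  obtain ⟨F, hF⟩ := hf.level_space
  obtain ⟨F', hF'⟩ := hf'.level_space
  have hns : ∀ c r s : ℝ, 0 ≤ r → 0 ≤ s → r ≠ s → 1 = c ^ 2 → r ≠ c * s := by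
    intro c r s hr hs hrs hc he
    rcases mul_self_eq_one_iff.1 ((pow_two c).symm.trans hc.symm) with h | h
    · exact hrs (by rw [he, h, one_mul])
    · rw [h] at he
      exact hrs (by linarith)
  have h1 := hn _ (hF.mem t (mem_univ _) 0)
  have h1' := hF.lev t (mem_univ _) 0
  have h2 := hn _ (hF'.mem t' (mem_univ _) 0)
  have h2' := hF'.lev t' (mem_univ _) 0
  refine h.position_false hKL hC hD hf hCh hDh hG hf0.h22 hf0.h12 hGv (a := 1) (b := 1)
    (by module) hF' (subset_univ _) (Or.inr (by rw [hv']; exact one_ne_zero))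
    (by rintro h0; rw [h0] at hv'; simp at hv')
    (fun c hc => hns c t' t ht' ht (Ne.symm hne) (by rw [← hc, hv']))
    (fun c hc => hns c t t' ht ht' hne (by rw [hv', mul_one] at hc; exact hc))
    (hF.mem t (mem_univ _) 0) h1' ?_ (hF'.mem t' (mem_univ _) 0) ?_ h2'
  · rw [lor_sub_right, h1']; linarith
  · rw [lor_sub_right] at h2'; linarith

theorem space_null (h : Model p q) (hKL : T5Cond1 K L) (hC : IsBody (body q K))
    (hD : IsBody (body q L)) (hv : lor v v = 1) {E0 e1 e2' : Vec} (hf0 : OFrame E0 e1 e2')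
    (hCh : ∀ y ∈ Hyp, y ∈ body q K ↔ lor y v ≤ t)
    (hDh : ∀ y ∈ Hyp, y ∈ body q L ↔ -lor y (E0 + e1) ≤ 1) : False := by
  obtain ⟨E, e2, hf⟩ := exists_oframe_of_unit hv
  obtain ⟨G, hG, hGE, hG1, -⟩ := hf0.exists_map hf.swap
  obtain ⟨F, hF⟩ := hf.swap.level_null
  have hl : ∀ x y z : ℝ, lor (x • E + y • v + z • e2) (-(E + e2)) = x - z := fun x y z => by
    rw [lor_neg_right, lor_add_right, hf.lor_comb_E, hf.lor_comb_e2]; ring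
  have h0 : lor (-(E + e2)) (-(E + e2)) = 0 := by
    simp only [lor_add_left, lor_add_right, lor_neg_left, lor_neg_right, hf.hE.1, hf.h22, hf.h2,
      lor_comm e2 E]
    ring
  refine h.position_false hKL hC hD hf hCh (v0 := -(E0 + e1)) (t' := 1)
    (by simpa only [lor_neg_right] using hDh) hG hf0.h22
    (by rw [lor_neg_left, lor_add_left, hf0.h2, hf0.h12]; simp) (v' := -(E + e2))
    (by rw [map_neg, map_add, hGE, hG1]) (a := 0) (b := -1) (by module) hF
    (Ioi_subset_Ioi zero_le_one) (Or.inl one_ne_zero) ?_ ?_ ?_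
    (hf.comb_mem_Hyp (x := t ^ 2 + 5 / 4) (y := t) (z := t ^ 2 + 3 / 4) (by positivity) (by ring))
    (hf.lor_comb_e1 _ _ _) ?_
    (hf.comb_mem_Hyp (x := (t - 1) ^ 2 / 2 + 1) (y := t - 1) (z := (t - 1) ^ 2 / 2) (by positivity)
      (by ring)) ?_ ?_
  · intro hz
    have := (hf.lor_comb_E 1 0 1)
    rw [one_smul, zero_smul, add_zero, one_smul, ← neg_neg (E + e2), hz] at this
    simp at this
  · intro c hc
    rw [h0, eq_comm, pow_eq_zero_iff two_ne_zero] at hc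
    simp [hc]
  · intro c hc
    rw [h0, mul_zero] at hc
    exact absurd hc one_ne_zero
  · rw [hl]; linarith
  · rw [hf.lor_comb_e1]; linarith
  · rw [hl]; ring

theorem isDisc_or_congruent (h : Model p q) (hKL : T5Cond1 K L) (hC : IsBody (body q K))
    (hD : IsBody (body q L)) (fC : Form (body q K)) (fD : Form (body q L))
    (hK : IsHypercycleDomain K ∨ IsHalfspace K) : IsDisc L ∨ Congruent K L := by
  obtain ⟨v, t, hv, ht, hCh⟩ := h.space_form fC hK
  rcases fD with ⟨E, t', hE, ht', hh⟩ | ⟨E, e1, e2, hf, hh⟩ | ⟨v', t', hv', ht', hh⟩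
  · exact Or.inl (h.isDisc hE ht' fun x => by rw [← hh _ (h.mem x), h.mem_body])
  · exact (h.space_null hKL hC hD hv hf hCh hh).elim
  · obtain rfl := h.space_space hKL hC hD hv hv' ht ht' hCh hh
    obtain ⟨E, e2, hf⟩ := exists_oframe_of_unit hv
    obtain ⟨E', e2', hf'⟩ := exists_oframe_of_unit hv'
    obtain ⟨A, hA, -, hAv, -⟩ := hf.exists_map hf'
    obtain ⟨f, hfA⟩ := h.exists_isom hA
    refine Or.inr ⟨f, ?_⟩
    have key : ∀ x, f x ∈ L ↔ x ∈ K := fun x => by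
      rw [← h.mem_body, hh _ (h.mem _), ← h.mem_body, hCh _ (h.mem _), hfA, ← hAv, hA.lor_map]
    ext y
    constructor
    · rintro ⟨x, hx, rfl⟩
      exact (key x).2 hx
    · intro hy
      obtain ⟨x, rfl⟩ := f.surjective y
      exact ⟨x, (key x).1 hy, rfl⟩

theorem form (h : Model p q) (hKL : T5Cond1 K L) (hC : IsBody (body q K))
    (hD : IsBody (body q L)) (hKc : IsClosed K) (hLc : IsClosed L)
    (hKn : IsConnected (frontier K)) (hLn : IsConnected (frontier L)) : Form (body q K) := by
  have bK := h.Bd_body hKc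
  have bL := h.Bd_body hLc
  refine form_of_regular hC (bK ▸ hKn.image _ h.continuous_p.continuousOn) ?_
  exact all_regular hC hD (bK ▸ hKn.nonempty.image _) (bL ▸ hLn.nonempty.image _)
    (h.linCond hKL) (h.linCond hKL.symm)

end Model

/-- **Lemma 5.3.** In the hyperbolic plane, if every intersection of congruent copies
of the proper closed convex sets `K`, `L` (with interior points, via orientation
preserving congruences, with nonempty interior) admits some non-trivial congruence,
and both boundaries are connected, then case (A) holds. -/
theorem lemma5_3
    (X : Type*) [MetricSpace X] (hX : IsHyperbolicSpace X 2)
    (K L : Set X)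
    (hKcl : IsClosed K) (hLcl : IsClosed L)
    (hKcv : GConvex K) (hLcv : GConvex L)
    (hKint : (interior K).Nonempty) (hLint : (interior L).Nonempty)
    (hKpr : K ≠ univ) (hLpr : L ≠ univ)
    (hcong : T5Cond1 K L)
    (hKconn : IsConnected (frontier K)) (hLconn : IsConnected (frontier L)) :
    CaseA K L := by
  obtain ⟨p, q, h⟩ := exists_model hX
  have hC := h.isBody hKcl hKcv hKint
  have hD := h.isBody hLcl hLcv hLint
  have fC := h.form hcong hC hD hKcl hLcl hKconn hLconn
  have fD := h.form hcong.symm hD hC hLcl hKcl hLconn hKconn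
  exact ⟨h.caseABody fC, h.caseABody fD, h.isDisc_or_congruent hcong hC hD fC fD,
    h.isDisc_or_congruent hcong.symm hD hC fD fC⟩

end BallChar
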